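/- For every A > 0 there is a constant C_A > 0 (depending also on the βⱼ and ηⱼ) such that for all B ≥ 3: |R(B) − J(B)·𝔖| ≤ C_A · B (log B)^{−A}, where R(B) = Σ (log p₁)(log p₂)(log p₃)(log p₄), the sum being over quadruples of primes (p₁,p₂,p₃,p₄) with pⱼ ∈ I_j and β₁p₁ + β₂p₂ + β₃p₃ + β₄p₄ = 0; J(B) is the number of integer quadruples (m₁,m₂,m₃,m₄) with mⱼ ∈ I_j and β₁m₁ + β₂m₂ + β₃m₃ + β₄m₄ = 0; and 𝔖 = ∏_p (1 + 1/(p−1)³), the product over all primes p. -/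

import Mathlib

/-- The interval `I = [ηB^{1/3} - B^{1/3}/log B, ηB^{1/3} + B^{1/3}/log B]`. -/
noncomputable def shortInterval (η B : ℝ) : Set ℝ :=
  Set.Icc (η * B ^ ((1 : ℝ) / 3) - B ^ ((1 : ℝ) / 3) / Real.log B)
          (η * B ^ ((1 : ℝ) / 3) + B ^ ((1 : ℝ) / 3) / Real.log B)

/-- Quadruples of primes `(p₁,p₂,p₃,p₄)` with `pⱼ ∈ I_j` and `β₁p₁+β₂p₂+β₃p₃+β₄p₄ = 0`. -/
def primeQuad (β : Fin 4 → ℤ) (η : Fin 4 → ℝ) (B : ℝ) : Set (Fin 4 → ℕ) :=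
  {p | (∀ j, (p j).Prime ∧ ((p j : ℝ) ∈ shortInterval (η j) B)) ∧
    β 0 * (p 0 : ℤ) + β 1 * (p 1 : ℤ) + β 2 * (p 2 : ℤ) + β 3 * (p 3 : ℤ) = 0}

/-- The weighted count `R(B) = Σ (log p₁)(log p₂)(log p₃)(log p₄)`. -/
noncomputable def RB (β : Fin 4 → ℤ) (η : Fin 4 → ℝ) (B : ℝ) : ℝ :=
  ∑ᶠ p ∈ primeQuad β η B,
    Real.log (p 0 : ℝ) * Real.log (p 1 : ℝ) * Real.log (p 2 : ℝ) * Real.log (p 3 : ℝ)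

/-- `J(B)`: the number of integer quadruples `(m₁,m₂,m₃,m₄)` with `mⱼ ∈ I_j` and
`β₁m₁+β₂m₂+β₃m₃+β₄m₄ = 0`. -/
noncomputable def JB (β : Fin 4 → ℤ) (η : Fin 4 → ℝ) (B : ℝ) : ℕ :=
  Set.ncard {m : Fin 4 → ℤ | (∀ j, ((m j : ℝ) ∈ shortInterval (η j) B)) ∧
    β 0 * m 0 + β 1 * m 1 + β 2 * m 2 + β 3 * m 3 = 0}

/-- The singular series `𝔖 = ∏_p (1 + 1/(p-1)³)`. -/
noncomputable def singSeries : ℝ := ∏' p : Nat.Primes, (1 + 1 / (((p : ℕ) : ℝ) - 1) ^ 3)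

section

namespace CM

open Complex Filter Topology MeasureTheory

/-- Mean value of a Dirichlet character. -/
noncomputable def kap {q : ℕ} (χ : DirichletCharacter ℂ q) : ℝ :=
  open Classical in if χ = 1 then (Nat.totient q : ℝ) / q else 0

lemma kap_nonneg {q : ℕ} (χ : DirichletCharacter ℂ q) : 0 ≤ kap χ := by
  unfold kap; split_ifs <;> positivity

lemma kap_le_one {q : ℕ} (χ : DirichletCharacter ℂ q) : kap χ ≤ 1 := by
  unfold kap; split_ifs
  · exact div_le_one_of_le₀ (by exact_mod_cast Nat.totient_le q) (by positivity)
  · norm_num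

lemma kap_ne_one {q : ℕ} {χ : DirichletCharacter ℂ q} (h : χ ≠ 1) : kap χ = 0 := by
  simp [kap, h]

lemma sum_range_char {q : ℕ} [NeZero q] (χ : DirichletCharacter ℂ q) :
    ∑ n ∈ Finset.range q, χ (n : ZMod q) = (kap χ : ℂ) * q := by
  have h1 : ∑ n ∈ Finset.range q, χ (n : ZMod q) = ∑ a : ZMod q, χ a := by
    refine Finset.sum_bij' (fun n _ => (n : ZMod q)) (fun a _ => a.val) ?_ ?_ ?_ ?_ ?_
    · intros; simp
    · intro a _; simpa using ZMod.val_lt a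
    · intro n hn; exact ZMod.val_cast_of_lt (by simpa using hn)
    · intro a _; simp
    · intros; rfl
  rw [h1]
  by_cases h : χ = 1
  · subst h
    have := MulChar.sum_one_eq_card_units (R := ZMod q) (R' := ℂ)
    rw [this, ZMod.card_units_eq_totient]
    have hq : (q : ℂ) ≠ 0 := by exact_mod_cast NeZero.ne q
    simp [kap]
  · rw [MulChar.sum_eq_zero_of_ne_one h, kap_ne_one h]; simp

lemma sum_range_periodic (q : ℕ) (g : ℕ → ℂ) (hp : ∀ n, g (q + n) = g n)
    (h0 : ∑ n ∈ Finset.range q, g n = 0) (k r : ℕ) :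
    ∑ n ∈ Finset.range (q * k + r), g n = ∑ n ∈ Finset.range r, g n := by
  induction k with
  | zero => simp
  | succ k ih =>
    have : q * (k + 1) + r = q + (q * k + r) := by ring
    rw [this, Finset.sum_range_add, h0, zero_add]
    simp only [hp]; exact ih

lemma norm_char_sub_kap {q : ℕ} (χ : DirichletCharacter ℂ q) (n : ℕ) :
    ‖χ (n : ZMod q) - kap χ‖ ≤ 2 := by
  refine (norm_sub_le _ _).trans ?_
  have := χ.norm_le_one (n : ZMod q)
  have h2 : ‖(kap χ : ℂ)‖ ≤ 1 := by
    rw [Complex.norm_real, Real.norm_of_nonneg (kap_nonneg χ)]; exact kap_le_one χ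
  linarith

lemma norm_sum_range_char {q : ℕ} [NeZero q] (χ : DirichletCharacter ℂ q) (N : ℕ) :
    ‖∑ n ∈ Finset.range N, (χ (n : ZMod q) - kap χ)‖ ≤ 2 * q := by
  have := sum_range_periodic q (fun n => χ (n : ZMod q) - kap χ) (by intro n; simp)
    (by rw [Finset.sum_sub_distrib, sum_range_char]; simp [mul_comm]) (N / q) (N % q)
  rw [Nat.div_add_mod] at this
  rw [this]
  refine (norm_sum_le _ _).trans ?_
  refine (Finset.sum_le_card_nsmul _ _ 2 (fun n _ => norm_char_sub_kap χ n)).trans ?_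
  have := (Nat.mod_lt N (Nat.pos_of_neZero q)).le
  have : ((N % q : ℕ) : ℝ) ≤ q := by exact_mod_cast this
  simp; linarith

/-- partial sum over `Ioc Y M`. -/
lemma norm_sum_Ioc_char {q : ℕ} [NeZero q] (χ : DirichletCharacter ℂ q) (Y M : ℕ) (h : Y ≤ M) :
    ‖∑ n ∈ Finset.Ioc Y M, χ (n : ZMod q) - kap χ * (M - Y)‖ ≤ 4 * q := by
  have h1 : ∑ n ∈ Finset.Ioc Y M, χ (n : ZMod q) - kap χ * (M - Y)
      = ∑ n ∈ Finset.Ioc Y M, (χ (n : ZMod q) - kap χ) := by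
    rw [Finset.sum_sub_distrib]; simp [Nat.cast_sub h, mul_comm]
  have h2 : Finset.Ioc Y M = Finset.Ico (Y + 1) (M + 1) := by ext; simp
  rw [h1, h2, Finset.sum_Ico_eq_sub _ (by omega)]
  refine (norm_sub_le _ _).trans ?_
  linarith [norm_sum_range_char χ (M + 1), norm_sum_range_char χ (Y + 1)]

/-- The oscillating part. -/
noncomputable def EY {q : ℕ} (χ : DirichletCharacter ℂ q) (Y : ℕ) (t : ℝ) : ℂ :=
  (Set.Ioi (Y : ℝ)).indicator
    (fun t => ∑ n ∈ Finset.Ioc Y ⌊t⌋₊, χ (n : ZMod q) - kap χ * (t - Y)) t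

lemma norm_EY {q : ℕ} [NeZero q] (χ : DirichletCharacter ℂ q) (Y : ℕ) (t : ℝ) :
    ‖EY χ Y t‖ ≤ 5 * q := by
  unfold EY
  rw [Set.indicator_apply]
  split_ifs with h
  · have h : (Y : ℝ) < t := h
    have ht : 0 ≤ t := by linarith [Y.cast_nonneg (α := ℝ)]
    have hY : Y ≤ ⌊t⌋₊ := Nat.le_floor h.le
    have h1 := norm_sum_Ioc_char χ Y _ hY
    have h2 : ∑ n ∈ Finset.Ioc Y ⌊t⌋₊, χ (n : ZMod q) - kap χ * (t - Y)
       = (∑ n ∈ Finset.Ioc Y ⌊t⌋₊, χ (n : ZMod q) - kap χ * ((⌊t⌋₊ : ℂ) - Y))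
        - ((kap χ * (t - ⌊t⌋₊) : ℝ) : ℂ) := by push_cast; ring
    rw [h2]
    refine (norm_sub_le _ _).trans ?_
    have h3 : ‖((kap χ * (t - ⌊t⌋₊) : ℝ) : ℂ)‖ ≤ 1 := by
      have a1 := Nat.floor_le ht
      have a2 := Nat.lt_floor_add_one t
      rw [Complex.norm_real, Real.norm_of_nonneg (mul_nonneg (kap_nonneg χ) (by linarith))]
      nlinarith [kap_nonneg χ, kap_le_one χ]
    have : (1 : ℝ) ≤ q := by exact_mod_cast Nat.pos_of_neZero q
    linarith
  · simp

lemma measurable_EY {q : ℕ} (χ : DirichletCharacter ℂ q) (Y : ℕ) : Measurable (EY χ Y) := by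
  unfold EY
  refine Measurable.indicator ?_ measurableSet_Ioi
  refine Measurable.sub ?_ (by fun_prop)
  exact (measurable_from_nat (f := fun m : ℕ => ∑ n ∈ Finset.Ioc Y m, χ (n : ZMod q))).comp
    Nat.measurable_floor

lemma locInt_EY {q : ℕ} [NeZero q] (χ : DirichletCharacter ℂ q) (Y : ℕ) :
    LocallyIntegrable (EY χ Y) := by
  have : LocallyIntegrable (fun _ : ℝ => (5 * q : ℝ)) := locallyIntegrable_const _
  refine this.mono (measurable_EY χ Y).aestronglyMeasurable ?_
  filter_upwards with t
  rw [Real.norm_of_nonneg (by positivity)]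
  exact norm_EY χ Y t

lemma EY_top {q : ℕ} [NeZero q] (χ : DirichletCharacter ℂ q) (Y : ℕ) :
    EY χ Y =O[atTop] (fun t : ℝ => t ^ (-(0:ℝ))) := by
  refine Asymptotics.IsBigO.of_bound (5 * q) ?_
  filter_upwards with t
  simpa using norm_EY χ Y t

lemma EY_bot {q : ℕ} (χ : DirichletCharacter ℂ q) (Y : ℕ) (hY : 1 ≤ Y) (b : ℝ) :
    EY χ Y =O[𝓝[>] 0] (fun t : ℝ => t ^ (-b)) := by
  have : EY χ Y =ᶠ[𝓝[>] 0] (fun _ => 0) := by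
    have : Set.Iio (1:ℝ) ∈ 𝓝[>] (0:ℝ) := mem_nhdsWithin_of_mem_nhds (Iio_mem_nhds one_pos)
    filter_upwards [this] with t ht
    have hY' : (1:ℝ) ≤ Y := by exact_mod_cast hY
    have ht : t < 1 := ht
    rw [EY, Set.indicator_of_notMem]
    simp; linarith
  exact this.trans_isBigO (Asymptotics.isBigO_zero _ _)

lemma mellin_EY_diff {q : ℕ} [NeZero q] (χ : DirichletCharacter ℂ q) (Y : ℕ) (hY : 1 ≤ Y)
    {s : ℂ} (hs : 0 < s.re) : DifferentiableAt ℂ (fun s => mellin (EY χ Y) (-s)) s := by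
  have := mellin_differentiableAt_of_isBigO_rpow (s := -s) (a := 0) (b := - s.re - 1)
    ((locInt_EY χ Y).locallyIntegrableOn _) (EY_top χ Y) (by simpa using hs)
    (EY_bot χ Y hY _) (by simp)
  exact this.comp s (by fun_prop : DifferentiableAt ℂ (fun s : ℂ => -s) s)

lemma mellin_EY_eq {q : ℕ} (χ : DirichletCharacter ℂ q) (Y : ℕ) (hY : 1 ≤ Y) (s : ℂ) :
    mellin (EY χ Y) (-s) = ∫ t in Set.Ioi (Y : ℝ), (t : ℂ) ^ (-(s+1)) *
      (∑ n ∈ Finset.Ioc Y ⌊t⌋₊, χ (n : ZMod q) - kap χ * (t - Y)) := by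
  unfold mellin
  have : ∀ t : ℝ, (t : ℂ) ^ (-s - 1) • EY χ Y t = (Set.Ioi (Y : ℝ)).indicator (fun t : ℝ =>
     (t : ℂ) ^ (-(s+1)) * (∑ n ∈ Finset.Ioc Y ⌊t⌋₊, χ (n : ZMod q) - kap χ * (t - Y))) t := by
    intro t
    unfold EY
    rw [Set.indicator_apply, Set.indicator_apply]
    split_ifs
    · rw [smul_eq_mul]; congr 2; ring
    · simp
  simp_rw [this]
  rw [setIntegral_indicator measurableSet_Ioi]
  congr 2
  ext t; simp only [Set.mem_inter_iff, Set.mem_Ioi, and_iff_right_iff_imp]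
  intro h; exact lt_of_le_of_lt (Nat.cast_nonneg Y) h

lemma norm_mellin_EY {q : ℕ} [NeZero q] (χ : DirichletCharacter ℂ q) (Y : ℕ) (hY : 1 ≤ Y) {s : ℂ}
    (hs : 0 < s.re) : ‖mellin (EY χ Y) (-s)‖ ≤ 5 * q * ((Y:ℝ) ^ (-s.re) / s.re) := by
  have hY0 : (0:ℝ) < Y := by exact_mod_cast hY
  rw [mellin_EY_eq χ Y hY]
  have h1 : ∀ t ∈ Set.Ioi (Y:ℝ), ‖(t : ℂ) ^ (-(s+1)) *
      (∑ n ∈ Finset.Ioc Y ⌊t⌋₊, χ (n : ZMod q) - kap χ * (t - Y))‖ ≤ 5 * q * t ^ (-s.re - 1) := by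
    intro t ht
    have ht0 : 0 < t := hY0.trans ht
    have := norm_EY χ Y t
    rw [EY, Set.indicator_of_mem ht] at this
    rw [norm_mul, Complex.norm_cpow_eq_rpow_re_of_pos ht0, mul_comm]
    have e : (-(s+1)).re = -s.re - 1 := by simp; ring
    rw [e]
    gcongr
  have hintg : IntegrableOn (fun t : ℝ => 5 * q * t ^ (-s.re - 1)) (Set.Ioi (Y:ℝ)) :=
    (integrableOn_Ioi_rpow_of_lt (by linarith) hY0).const_mul _
  refine (norm_integral_le_of_norm_le hintg ((ae_restrict_iff' measurableSet_Ioi).2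
    (Eventually.of_forall h1))).trans ?_
  rw [integral_const_mul, integral_Ioi_rpow_of_lt (by linarith) hY0]
  have : -s.re - 1 + 1 = -s.re := by ring
  rw [this, neg_div_neg_eq]

lemma integral_tail (Y : ℕ) (hY : 1 ≤ Y) {s : ℂ} (hs : 1 < s.re) :
    IntegrableOn (fun t : ℝ => (t : ℂ) ^ (-(s+1)) * (t - Y)) (Set.Ioi (Y : ℝ)) ∧
    s * ∫ t in Set.Ioi (Y : ℝ), (t : ℂ) ^ (-(s+1)) * (t - Y) = (Y : ℂ) ^ (1 - s) / (s - 1) := by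
  have hY0 : (0:ℝ) < Y := by exact_mod_cast hY
  have hs0 : s ≠ 0 := by intro h; rw [h] at hs; simp at hs; linarith
  have hs1 : s - 1 ≠ 0 := by
    intro h; have := congrArg Complex.re h; simp at this; linarith
  have e : Set.EqOn (fun t : ℝ => (t : ℂ) ^ (-(s+1)) * (t - Y))
      (fun t : ℝ => (t : ℂ) ^ (-s) - Y * (t : ℂ) ^ (-(s+1))) (Set.Ioi (Y : ℝ)) := by
    intro t ht
    have ht0 : (t : ℂ) ≠ 0 := by
      have : 0 < t := hY0.trans ht
      exact_mod_cast this.ne'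
    have : (t : ℂ) ^ (-s) = (t : ℂ) ^ (-(s+1)) * t := by
      rw [show -s = -(s+1) + 1 by ring, Complex.cpow_add _ _ ht0, Complex.cpow_one]
    simp only [this]; ring
  have i1 := integrableOn_Ioi_cpow_of_lt (a := -s) (by simpa using hs) hY0
  have i2 := (integrableOn_Ioi_cpow_of_lt (a := -(s+1)) (by simp; linarith) hY0).const_mul (Y:ℂ)
  refine ⟨(i1.sub i2).congr_fun e.symm measurableSet_Ioi, ?_⟩
  rw [setIntegral_congr_fun measurableSet_Ioi e, integral_sub i1 i2, integral_const_mul,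
    integral_Ioi_cpow_of_lt (by simpa using hs) hY0,
    integral_Ioi_cpow_of_lt (by simp; linarith) hY0]
  have hYc : (Y : ℂ) ≠ 0 := by exact_mod_cast hY0.ne'
  have e1 : -s + 1 = 1 - s := by ring
  have e2 : -(s+1) + 1 = -s := by ring
  have e3 : (((Y:ℝ):ℂ)) = (Y : ℂ) := by simp
  rw [e1, e2, e3]
  have e4 : (Y : ℂ) ^ (1 - s) = (Y : ℂ) ^ (-s) * Y := by
    rw [show 1 - s = -s + 1 by ring, Complex.cpow_add _ _ hYc, Complex.cpow_one]
  rw [e4]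
  have hs2 : (1 - s) ≠ 0 := by intro h; apply hs1; linear_combination -h
  field_simp
  ring

lemma LFun_formula_one {q : ℕ} [NeZero q] (χ : DirichletCharacter ℂ q) (Y : ℕ) (hY : 1 ≤ Y)
    {s : ℂ} (hs : 1 < s.re) :
    DirichletCharacter.LFunction χ s = ∑ n ∈ Finset.Icc 1 Y, χ (n : ZMod q) * (n : ℂ) ^ (-s)
      + kap χ * ((Y : ℂ) ^ (1 - s) / (s - 1)) + s * mellin (EY χ Y) (-s) := by
  have hs0 : s ≠ 0 := by intro h; rw [h] at hs; simp at hs; linarith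
  rw [DirichletCharacter.LFunction_eq_LSeries χ hs]
  set f : ℕ → ℂ := fun n => χ (n : ZMod q) with hf
  set g : ℕ → ℂ := fun n => if n ≤ Y then χ (n : ZMod q) else 0 with hg
  set h : ℕ → ℂ := fun n => if n ≤ Y then 0 else χ (n : ZMod q) with hh
  have hsum : LSeriesSummable f s := DirichletCharacter.LSeriesSummable_of_one_lt_re χ hs
  have hgs : LSeriesSummable g s := by
    refine (summable_of_ne_finset_zero (s := Finset.Icc 1 Y) ?_)
    intro n hn
    rcases Nat.eq_zero_or_pos n with h0 | h0
    · simp [h0]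
    · have : ¬ n ≤ Y := by
        intro hle; apply hn; simp; omega
      simp [LSeries.term, hg, this]
  have hfgh : f = g + h := by
    ext n; simp only [hf, hg, hh, Pi.add_apply]; split_ifs <;> simp
  have hhs : LSeriesSummable h s := by
    have : h = f - g := by rw [hfgh]; simp
    rw [this]; exact hsum.sub hgs
  have e1 : LSeries g s = ∑ n ∈ Finset.Icc 1 Y, χ (n : ZMod q) * (n : ℂ) ^ (-s) := by
    unfold LSeries
    rw [tsum_eq_sum (s := Finset.Icc 1 Y)]
    · refine Finset.sum_congr rfl ?_
      intro n hn
      simp only [Finset.mem_Icc] at hn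
      rw [LSeries.term_of_ne_zero (by omega)]
      simp only [hg, hn.2, if_true]
      rw [Complex.cpow_neg]; rfl
    · intro n hn
      rcases Nat.eq_zero_or_pos n with h0 | h0
      · simp [h0]
      · have : ¬ n ≤ Y := by
          intro hle; apply hn; simp; omega
        simp [LSeries.term, hg, this]
  have hpart : ∀ N : ℕ, ∑ k ∈ Finset.Icc 1 N, h k = ∑ n ∈ Finset.Ioc Y N, χ (n : ZMod q) := by
    intro N
    have : Finset.Ioc Y N = (Finset.Icc 1 N).filter (fun n => ¬ n ≤ Y) := by
      ext n; simp; omega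
    rw [this, Finset.sum_filter]
    refine Finset.sum_congr rfl ?_
    intro n _
    simp only [hh]
    split_ifs <;> simp_all
  have hO : (fun n ↦ ∑ k ∈ Finset.Icc 1 n, h k) =O[atTop] fun n ↦ (n : ℝ) ^ (1:ℝ) := by
    refine Asymptotics.IsBigO.of_bound 1 ?_
    filter_upwards with n
    refine (norm_sum_le _ _).trans ?_
    refine (Finset.sum_le_card_nsmul _ _ 1 ?_).trans ?_
    · intro k _
      simp only [hh]; split_ifs
      · simp
      · exact χ.norm_le_one _
    · simp
  have e2 : LSeries h s = kap χ * ((Y : ℂ) ^ (1 - s) / (s - 1)) + s * mellin (EY χ Y) (-s) := by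
    rw [LSeries_eq_mul_integral h zero_le_one hs hhs hO, mellin_EY_eq χ Y hY]
    simp_rw [hpart]
    have hind : ∫ t in Set.Ioi (1:ℝ), (∑ n ∈ Finset.Ioc Y ⌊t⌋₊, χ (n : ZMod q)) * (t:ℂ) ^ (-(s + 1))
      = ∫ t in Set.Ioi (Y:ℝ), (t:ℂ) ^ (-(s + 1)) * (∑ n ∈ Finset.Ioc Y ⌊t⌋₊, χ (n : ZMod q)) := by
      have hYr : (1:ℝ) ≤ Y := by exact_mod_cast hY
      rw [← integral_indicator measurableSet_Ioi, ← integral_indicator measurableSet_Ioi]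
      congr 1
      ext t
      simp only [Set.indicator_apply, Set.mem_Ioi]
      by_cases h1 : (Y:ℝ) < t
      · rw [if_pos (lt_of_le_of_lt hYr h1), if_pos h1, mul_comm]
      · rw [if_neg h1]
        split_ifs with h2
        · have : ⌊t⌋₊ ≤ Y := by
            have := Nat.floor_le_floor (not_lt.1 h1)
            simpa using this
          rw [Finset.Ioc_eq_empty (by omega)]; simp
        · rfl
    rw [hind]
    obtain ⟨hi, hv⟩ := integral_tail Y hY hs
    have hi2 : IntegrableOn (fun t : ℝ => (t : ℂ) ^ (-(s+1)) *
      (∑ n ∈ Finset.Ioc Y ⌊t⌋₊, χ (n : ZMod q) - kap χ * (t - Y))) (Set.Ioi (Y:ℝ)) := by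
      have hm := mellinConvergent_of_isBigO_rpow (s := -s) (a := 0) (b := - s.re - 1)
        ((locInt_EY χ Y).locallyIntegrableOn _) (EY_top χ Y) (by simp; linarith)
        (EY_bot χ Y hY _) (by simp)
      have hsub : Set.Ioi (Y:ℝ) ⊆ Set.Ioi 0 := Set.Ioi_subset_Ioi (Nat.cast_nonneg Y)
      refine (IntegrableOn.mono_set hm hsub).congr_fun ?_ measurableSet_Ioi
      intro t ht
      simp only [EY, Set.indicator_of_mem ht, smul_eq_mul]
      congr 2; ring
    have : ∀ t : ℝ, (t:ℂ) ^ (-(s + 1)) * (∑ n ∈ Finset.Ioc Y ⌊t⌋₊, χ (n : ZMod q))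
       = kap χ * ((t : ℂ) ^ (-(s+1)) * (t - Y)) + (t : ℂ) ^ (-(s+1)) *
      (∑ n ∈ Finset.Ioc Y ⌊t⌋₊, χ (n : ZMod q) - kap χ * (t - Y)) := by intro t; ring
    simp_rw [this]
    rw [integral_add (hi.const_mul _) hi2, integral_const_mul, mul_add, ← hv]
    ring
  rw [hfgh, LSeries_add hgs hhs, e1, e2]; ring

/-- `(s-1) L(s,χ)` as an entire function. -/
noncomputable def Lent {q : ℕ} [NeZero q] (χ : DirichletCharacter ℂ q) : ℂ → ℂ :=
  open Classical in if χ = 1 then DirichletCharacter.LFunctionTrivChar₁ q else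
    fun s => (s - 1) * DirichletCharacter.LFunction χ s

lemma Lent_diff {q : ℕ} [NeZero q] (χ : DirichletCharacter ℂ q) : Differentiable ℂ (Lent χ) := by
  unfold Lent; split_ifs with h
  · exact DirichletCharacter.differentiable_LFunctionTrivChar₁ q
  · have := DirichletCharacter.differentiable_LFunction h
    fun_prop

lemma Lent_eq {q : ℕ} [NeZero q] (χ : DirichletCharacter ℂ q) {s : ℂ} (hs : s ≠ 1) :
    Lent χ s = (s - 1) * DirichletCharacter.LFunction χ s := by
  unfold Lent; split_ifs with h
  · rw [DirichletCharacter.LFunctionTrivChar₁, Function.update_of_ne hs, h]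
  · rfl

lemma LFun_formula {q : ℕ} [NeZero q] (χ : DirichletCharacter ℂ q) (Y : ℕ) (hY : 1 ≤ Y)
    {s : ℂ} (hs : 0 < s.re) (hs1 : s ≠ 1) :
    DirichletCharacter.LFunction χ s = ∑ n ∈ Finset.Icc 1 Y, χ (n : ZMod q) * (n : ℂ) ^ (-s)
      + kap χ * ((Y : ℂ) ^ (1 - s) / (s - 1)) + s * mellin (EY χ Y) (-s) := by
  have hYc : (Y : ℂ) ≠ 0 := by exact_mod_cast (by omega : Y ≠ 0)
  set R : ℂ → ℂ := fun s => (s - 1) * (∑ n ∈ Finset.Icc 1 Y, χ (n : ZMod q) * (n : ℂ) ^ (-s))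
      + kap χ * (Y : ℂ) ^ (1 - s) + (s - 1) * (s * mellin (EY χ Y) (-s)) with hR
  have hopen : IsOpen {s : ℂ | 0 < s.re} := isOpen_lt continuous_const Complex.continuous_re
  have hRd : DifferentiableOn ℂ R {s : ℂ | 0 < s.re} := by
    intro z hz
    have hm := mellin_EY_diff χ Y hY (s := z) hz
    have hsm : DifferentiableAt ℂ
        (fun s : ℂ => ∑ n ∈ Finset.Icc 1 Y, χ (n : ZMod q) * (n : ℂ) ^ (-s)) z := by
      refine DifferentiableAt.fun_sum ?_
      intro n hn
      have hn0 : (n : ℂ) ≠ 0 := by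
        have := (Finset.mem_Icc.1 hn).1
        exact_mod_cast (by omega : n ≠ 0)
      exact ((differentiableAt_id.neg).const_cpow (Or.inl hn0)).const_mul _
    have hc : DifferentiableAt ℂ (fun s : ℂ => (Y : ℂ) ^ (1 - s)) z :=
      DifferentiableAt.const_cpow (by fun_prop) (Or.inl hYc)
    apply DifferentiableAt.differentiableWithinAt
    fun_prop
  have hconn : IsPreconnected {s : ℂ | 0 < s.re} :=
    (convex_halfSpace_re_gt 0).isPreconnected
  have key := AnalyticOnNhd.eqOn_of_preconnected_of_eventuallyEq
    ((Lent_diff χ).differentiableOn.analyticOnNhd hopen) (hRd.analyticOnNhd hopen) hconn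
    (z₀ := 2) (by simp) (by
      have : {s : ℂ | 1 < s.re} ∈ 𝓝 (2:ℂ) :=
        (isOpen_lt continuous_const Complex.continuous_re).mem_nhds (by simp)
      filter_upwards [this] with z hz
      have hz : 1 < z.re := hz
      have hz1 : z ≠ 1 := by intro h; rw [h] at hz; simp at hz
      rw [Lent_eq χ hz1, LFun_formula_one χ Y hY hz]
      have : z - 1 ≠ 0 := sub_ne_zero.2 hz1
      simp only [hR]
      field_simp)
  have := key (show s ∈ {s : ℂ | 0 < s.re} from hs)
  rw [Lent_eq χ hs1] at this
  have h1 : s - 1 ≠ 0 := sub_ne_zero.2 hs1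
  apply mul_left_cancel₀ h1
  rw [this]
  simp only [hR]
  field_simp

lemma norm_exp_sub_one_le' (z : ℂ) {r : ℝ} (hr : 0 ≤ r) (hz : z.re ≤ r) :
    ‖Complex.exp z - 1‖ ≤ Real.exp r * ‖z‖ := by
  have := Convex.norm_image_sub_le_of_norm_hasDerivWithin_le (f := Complex.exp) (f' := Complex.exp)
    (s := {w : ℂ | w.re ≤ r}) (x := 0) (y := z) (C := Real.exp r)
    (fun x _ => (Complex.hasDerivAt_exp x).hasDerivWithinAt)
    (fun x hx => by rw [Complex.norm_exp]; exact Real.exp_le_exp.2 hx)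
    (convex_halfSpace_re_le r) (by simpa using hr) hz
  simpa using this

/-- The conductor parameter. -/
noncomputable def TT (q : ℕ) (t : ℝ) : ℝ := q * (|t| + 2)

lemma two_le_TT (q : ℕ) [NeZero q] (t : ℝ) : 2 ≤ TT q t := by
  have : (1 : ℝ) ≤ q := by exact_mod_cast Nat.pos_of_neZero q
  unfold TT; nlinarith [abs_nonneg t]

/-- Lemma A. -/
lemma LFun_bound {δ : ℝ} (hδ : 0 < δ) (hδ2 : δ ≤ 1/2) {q : ℕ} [NeZero q]
    (χ : DirichletCharacter ℂ q) (s : ℂ) (h1 : 1 - δ ≤ s.re) (h4 : s.re ≤ 4) (hs1 : s ≠ 1) :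
    ‖DirichletCharacter.LFunction χ s - kap χ / (s - 1)‖ ≤ (4 / δ + 22) * TT q s.im ^ (2 * δ) := by
  set T := TT q s.im with hT
  have hT2 : 2 ≤ T := two_le_TT q s.im
  set Y : ℕ := ⌈T⌉₊ with hYdef
  have hYT : T ≤ Y := Nat.le_ceil T
  have hYT2 : (Y : ℝ) ≤ 2 * T := by
    have := (Nat.ceil_lt_add_one (by linarith : 0 ≤ T)).le
    linarith
  have hYr : (1:ℝ) ≤ Y := by linarith
  have hY : 1 ≤ Y := by exact_mod_cast hYr
  have hY0 : (0:ℝ) < Y := by linarith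
  have hσ : 1/2 ≤ s.re := by linarith
  have hs1' : s - 1 ≠ 0 := sub_ne_zero.2 hs1
  rw [LFun_formula χ Y hY (by linarith) hs1]
  have e : ∑ n ∈ Finset.Icc 1 Y, χ (n : ZMod q) * (n : ℂ) ^ (-s)
      + kap χ * ((Y : ℂ) ^ (1 - s) / (s - 1)) + s * mellin (EY χ Y) (-s) - kap χ / (s - 1)
      = ∑ n ∈ Finset.Icc 1 Y, χ (n : ZMod q) * (n : ℂ) ^ (-s)
      + kap χ * (((Y : ℂ) ^ (1 - s) - 1) / (s - 1)) + s * mellin (EY χ Y) (-s) := by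
    field_simp; ring
  rw [e]
  have hlog : Real.log Y ≤ (Y:ℝ) ^ δ / δ := Real.log_le_rpow_div hY0.le hδ
  have hYδ1 : 1 ≤ (Y:ℝ) ^ δ := Real.one_le_rpow hYr hδ.le
  have hYδ : (Y:ℝ) ^ δ * (Y:ℝ) ^ δ ≤ 2 * T ^ (2 * δ) := by
    rw [← Real.rpow_add hY0]
    calc (Y:ℝ) ^ (δ + δ) ≤ (2 * T) ^ (δ + δ) := by gcongr
      _ = 2 ^ (δ + δ) * T ^ (2 * δ) := by
        rw [Real.mul_rpow (by norm_num) (by linarith)]; ring_nf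
      _ ≤ 2 ^ (1:ℝ) * T ^ (2 * δ) := by gcongr; norm_num; linarith
      _ = _ := by simp
  have b1 : ‖∑ n ∈ Finset.Icc 1 Y, χ (n : ZMod q) * (n : ℂ) ^ (-s)‖
      ≤ (Y:ℝ) ^ δ * (1 + Real.log Y) := by
    refine (norm_sum_le _ _).trans ?_
    have hb : ∀ n ∈ Finset.Icc 1 Y, ‖χ (n : ZMod q) * (n : ℂ) ^ (-s)‖
        ≤ (Y:ℝ) ^ δ * (n:ℝ)⁻¹ := by
      intro n hn
      rw [Finset.mem_Icc] at hn
      have hn1 : (1:ℝ) ≤ n := by exact_mod_cast hn.1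
      have hn2 : (n:ℝ) ≤ Y := by exact_mod_cast hn.2
      rw [norm_mul, Complex.norm_natCast_cpow_of_pos (by omega)]
      have : (n:ℝ) ^ (-s).re ≤ (Y:ℝ) ^ δ * (n:ℝ)⁻¹ := by
        calc (n:ℝ) ^ (-s).re ≤ (n:ℝ) ^ (δ + -1) := by
              apply Real.rpow_le_rpow_of_exponent_le hn1; simp; linarith
          _ = (n:ℝ) ^ δ * (n:ℝ)⁻¹ := by
              rw [Real.rpow_add (by linarith), Real.rpow_neg_one]
          _ ≤ _ := by gcongr
      calc ‖χ (n : ZMod q)‖ * (n:ℝ) ^ (-s).re ≤ 1 * (n:ℝ) ^ (-s).re := by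
            gcongr; exact χ.norm_le_one _
        _ ≤ _ := by linarith
    refine (Finset.sum_le_sum hb).trans ?_
    rw [← Finset.mul_sum]
    gcongr
    have := harmonic_le_one_add_log Y
    rw [harmonic_eq_sum_Icc] at this
    push_cast at this
    exact this
  have b2 : ‖kap χ * (((Y : ℂ) ^ (1 - s) - 1) / (s - 1))‖ ≤ (Y:ℝ) ^ δ * Real.log Y := by
    have hl0 : 0 ≤ Real.log Y := Real.log_nonneg hYr
    have hYc : (Y : ℂ) ≠ 0 := by exact_mod_cast hY0.ne'
    have a1 : ‖(Y : ℂ) ^ (1 - s) - 1‖ ≤ (Y:ℝ) ^ δ * (Real.log Y * ‖s - 1‖) := by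
      rw [Complex.cpow_def_of_ne_zero hYc, Complex.natCast_log.symm]
      refine (norm_exp_sub_one_le' _ (r := Real.log Y * δ) (by positivity) ?_).trans ?_
      · rw [Complex.re_ofReal_mul]
        gcongr
        simp; linarith
      · rw [Real.rpow_def_of_pos hY0, norm_mul, Complex.norm_real, Real.norm_of_nonneg hl0,
          norm_sub_rev]
    rw [norm_mul, norm_div, Complex.norm_real, Real.norm_of_nonneg (kap_nonneg χ)]
    calc kap χ * (‖(Y : ℂ) ^ (1 - s) - 1‖ / ‖s - 1‖)
        ≤ 1 * (‖(Y : ℂ) ^ (1 - s) - 1‖ / ‖s - 1‖) := by gcongr; exact kap_le_one χ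
      _ ≤ _ := by
        rw [one_mul, div_le_iff₀ (norm_pos_iff.2 hs1')]
        linarith
  have b3 : ‖s * mellin (EY χ Y) (-s)‖ ≤ 20 * T ^ (2 * δ) := by
    rw [norm_mul]
    have m := norm_mellin_EY χ Y hY (s := s) (by linarith)
    have hns : ‖s‖ ≤ 2 * (|s.im| + 2) := by
      have := Complex.norm_le_abs_re_add_abs_im s
      rw [abs_of_nonneg (by linarith : 0 ≤ s.re)] at this
      linarith [abs_nonneg s.im]
    have hYs : (Y:ℝ) ^ (-s.re) ≤ T ^ (δ - 1) := by
      calc (Y:ℝ) ^ (-s.re) ≤ (Y:ℝ) ^ (δ - 1) := by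
            apply Real.rpow_le_rpow_of_exponent_le hYr; linarith
        _ ≤ T ^ (δ - 1) := Real.rpow_le_rpow_of_nonpos (by linarith) hYT (by linarith)
    have hdiv : (Y:ℝ) ^ (-s.re) / s.re ≤ 2 * T ^ (δ - 1) := by
      rw [div_le_iff₀ (by linarith)]
      have : 0 ≤ T ^ (δ - 1) := by positivity
      nlinarith
    have hq0 : (0:ℝ) ≤ q := Nat.cast_nonneg q
    calc ‖s‖ * ‖mellin (EY χ Y) (-s)‖
        ≤ (2 * (|s.im| + 2)) * (5 * q * (2 * T ^ (δ - 1))) := by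
          gcongr; exact m.trans (by gcongr)
      _ = 20 * (T ^ (δ - 1) * T ^ (1:ℝ)) := by rw [Real.rpow_one, hT, TT]; ring
      _ = 20 * T ^ δ := by rw [← Real.rpow_add (by linarith)]; ring_nf
      _ ≤ 20 * T ^ (2 * δ) := by gcongr <;> linarith
  have hfin : (Y:ℝ) ^ δ * (1 + Real.log Y) + (Y:ℝ) ^ δ * Real.log Y + 20 * T ^ (2 * δ)
      ≤ (4 / δ + 22) * T ^ (2 * δ) := by
    have c1 : (Y:ℝ) ^ δ * Real.log Y ≤ 2 * T ^ (2 * δ) / δ := by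
      calc (Y:ℝ) ^ δ * Real.log Y ≤ (Y:ℝ) ^ δ * ((Y:ℝ) ^ δ / δ) := by gcongr
        _ = ((Y:ℝ) ^ δ * (Y:ℝ) ^ δ) / δ := by ring
        _ ≤ _ := by gcongr
    have c2 : (Y:ℝ) ^ δ ≤ 2 * T ^ (2 * δ) := by nlinarith
    calc _ = (Y:ℝ) ^ δ + 2 * ((Y:ℝ) ^ δ * Real.log Y) + 20 * T ^ (2 * δ) := by ring
      _ ≤ 2 * T ^ (2 * δ) + 2 * (2 * T ^ (2 * δ) / δ) + 20 * T ^ (2 * δ) := by gcongr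
      _ = _ := by ring
  refine (norm_add_le _ _).trans (le_trans (add_le_add ((norm_add_le _ _).trans
    (add_le_add b1 b2)) b3) hfin)

end CM

end

section

namespace CM

open Complex Filter Topology MeasureTheory
open scoped ComplexOrder

lemma hasSum_congr' {E : Type*} [AddCommMonoid E] [TopologicalSpace E] {u v : ℕ → E} {x : E}
    (h : HasSum u x) (huv : ∀ n, u n = v n) : HasSum v x := by
  rw [← funext huv]; exact h

section Estermann

variable {a : ℕ → ℂ} {f : ℂ → ℂ}

lemma est_abscissa (hs : ∀ s : ℂ, 1 < s.re → LSeriesSummable a s) :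
    LSeries.abscissaOfAbsConv a ≤ 1 := by
  refine LSeries.abscissaOfAbsConv_le_of_forall_lt_LSeriesSummable' ?_
  intro y hy
  apply hs; simpa using (by exact_mod_cast hy : (1:ℝ) < y)

lemma est_nonneg (h0 : 0 ≤ a) (hs : ∀ s : ℂ, 1 < s.re → LSeriesSummable a s) (x : ℝ) (hx : 1 < x)
    (n : ℕ) : 0 ≤ (-1) ^ n * iteratedDeriv n (LSeries a) x :=
  LSeries.iteratedDeriv_alternating h0 ((est_abscissa hs).trans_lt (by exact_mod_cast hx)) n

lemma est_lambda (h0 : 0 ≤ a) (hs : ∀ s : ℂ, 1 < s.re → LSeriesSummable a s)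
    (hf : Differentiable ℂ f) (hL : ∀ s : ℂ, 1 < s.re → f s = (s - 1) * LSeries a s) :
    0 ≤ f 1 := by
  have hc : Continuous (fun x : ℝ => f x) := hf.continuous.comp Complex.continuous_ofReal
  have ht : Tendsto (fun x : ℝ => f x) (𝓝[>] 1) (𝓝 (f ((1:ℝ):ℂ))) :=
    (hc.tendsto 1).mono_left nhdsWithin_le_nhds
  rw [Complex.ofReal_one] at ht
  refine ge_of_tendsto ht ?_
  filter_upwards [self_mem_nhdsWithin] with x hx
  have hx : 1 < x := hx
  rw [hL x (by simpa using hx)]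
  refine mul_nonneg ?_ (by simpa using est_nonneg h0 hs x hx 0)
  have : (x : ℂ) - 1 = ((x - 1 : ℝ) : ℂ) := by push_cast; ring
  rw [this]; exact_mod_cast (by linarith : (0:ℝ) ≤ x - 1)

lemma iteratedDeriv_inv_sub_one (n : ℕ) :
    iteratedDeriv n (fun s : ℂ => (s - 1)⁻¹) 2 = (-1) ^ n * n.factorial := by
  have := congrFun (iter_deriv_inv_linear_sub (𝕜 := ℂ) n 1 1) 2
  rw [iteratedDeriv_eq_iterate]
  simp only [one_mul] at this
  rw [this]; norm_num

lemma est_deriv (h0 : 0 ≤ a) (hs : ∀ s : ℂ, 1 < s.re → LSeriesSummable a s)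
    (hf : Differentiable ℂ f) (hL : ∀ s : ℂ, 1 < s.re → f s = (s - 1) * LSeries a s) (n : ℕ) :
    ∃ A : ℂ, 0 ≤ A ∧ (n = 0 → A = LSeries a 2) ∧
      (n.factorial : ℂ)⁻¹ * (-1) ^ n * iteratedDeriv n (dslope f 1) 2 = A - f 1 := by
  refine ⟨(n.factorial : ℂ)⁻¹ * ((-1) ^ n * iteratedDeriv n (LSeries a) 2), ?_, ?_, ?_⟩
  · refine mul_nonneg (by positivity) ?_
    exact_mod_cast est_nonneg h0 hs 2 (by norm_num) n
  · rintro rfl; simp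
  · have hev : dslope f 1 =ᶠ[𝓝 2] (LSeries a - fun s => f 1 * (s - 1)⁻¹) := by
      have : {s : ℂ | 1 < s.re} ∈ 𝓝 (2:ℂ) :=
        (isOpen_lt continuous_const Complex.continuous_re).mem_nhds (by simp)
      filter_upwards [this] with z hz
      have hz : 1 < z.re := hz
      have hz1 : z ≠ 1 := by intro h; rw [h] at hz; simp at hz
      have : z - 1 ≠ 0 := sub_ne_zero.2 hz1
      rw [dslope_of_ne _ hz1, slope_def_field, hL z hz]
      simp only [Pi.sub_apply]
      field_simp
    rw [hev.iteratedDeriv_eq]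
    have hA : AnalyticAt ℂ (LSeries a) 2 := by
      refine (LSeries_analyticOnNhd a) 2 ?_
      refine (est_abscissa hs).trans_lt ?_
      norm_num
      exact_mod_cast (by norm_num : (1:ℝ) < 2)
    have hB : AnalyticAt ℂ (fun s : ℂ => f 1 * (s - 1)⁻¹) 2 := by
      have : AnalyticAt ℂ (fun s : ℂ => s - 1) 2 := by fun_prop
      exact analyticAt_const.mul (this.inv (by norm_num))
    rw [iteratedDeriv_sub hA.contDiffAt hB.contDiffAt, iteratedDeriv_const_mul_field,
      iteratedDeriv_inv_sub_one]
    have : (n.factorial : ℂ) ≠ 0 := by exact_mod_cast n.factorial_ne_zero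
    have h1 : ((-1:ℂ) ^ n) * (-1) ^ n = 1 := by rw [← mul_pow]; simp
    field_simp
    linear_combination (-(n.factorial : ℂ) * f 1) * h1

lemma est_hasSum (hf : Differentiable ℂ f) (z : ℂ) :
    HasSum (fun n : ℕ => ((n.factorial : ℂ)⁻¹ * (-1) ^ n * iteratedDeriv n (dslope f 1) 2)
      * (2 - z) ^ n) (dslope f 1 z) := by
  have hG : Differentiable ℂ (dslope f 1) := by
    have := (Complex.differentiableOn_dslope (f := f) (c := 1) (s := Set.univ) univ_mem).2
      hf.differentiableOn
    exact differentiableOn_univ.1 this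
  have := Complex.hasSum_taylorSeries_of_entire hG 2 z
  refine hasSum_congr' this ?_
  intro n
  have : (z - 2) ^ n = (-1) ^ n * (2 - z) ^ n := by rw [← mul_pow]; ring
  rw [this]; simp only [smul_eq_mul]; ring

lemma est_im (h0 : 0 ≤ a) (hs : ∀ s : ℂ, 1 < s.re → LSeriesSummable a s)
    (hf : Differentiable ℂ f) (hL : ∀ s : ℂ, 1 < s.re → f s = (s - 1) * LSeries a s) (x : ℝ) :
    (f x).im = 0 := by
  have hlam := est_lambda h0 hs hf hL
  have hlam0 : (f 1).im = 0 := (Complex.nonneg_iff.1 hlam).2.symm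
  have h1 : (dslope f 1 x).im = 0 := by
    have := (Complex.hasSum_im (est_hasSum hf x))
    refine this.unique ?_
    convert hasSum_zero with n
    obtain ⟨A, hA, -, hA2⟩ := est_deriv h0 hs hf hL n
    rw [hA2]
    have h3 : (2 - (x:ℂ)) ^ n = (((2 - x) ^ n : ℝ) : ℂ) := by push_cast; ring
    rw [h3, Complex.mul_im]
    have : A.im = 0 := (Complex.nonneg_iff.1 hA).2.symm
    rw [Complex.ofReal_im]
    simp [this, hlam0]
  have h2 := sub_smul_dslope f 1 (x:ℂ)
  have h3 : f x = f 1 + ((x - 1 : ℝ) : ℂ) * dslope f 1 x := by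
    rw [smul_eq_mul] at h2; push_cast; rw [h2]; ring
  rw [h3, Complex.add_im, Complex.im_ofReal_mul, h1, hlam0]; simp

lemma est_main (h0 : 0 ≤ a) (ha1 : 1 ≤ (LSeries a 2).re)
    (hs : ∀ s : ℂ, 1 < s.re → LSeriesSummable a s)
    (hf : Differentiable ℂ f) (hL : ∀ s : ℂ, 1 < s.re → f s = (s - 1) * LSeries a s)
    {M : ℝ} (hM : ∀ s ∈ Metric.sphere (2:ℂ) (3/2), ‖dslope f 1 s‖ ≤ M) (hM1 : 1 ≤ M)
    {b : ℝ} (hb : 7/8 ≤ b) (hb1 : b < 1) (hFb : 0 ≤ (f b).re) :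
    (1 - b) / 6 * (8 * M) ^ (-(4 * (1 - b))) ≤ (f 1).re := by
  have hG : Differentiable ℂ (dslope f 1) := by
    have := (Complex.differentiableOn_dslope (f := f) (c := 1) (s := Set.univ) univ_mem).2
      hf.differentiableOn
    exact differentiableOn_univ.1 this
  have hlam := est_lambda h0 hs hf hL
  set l := (f 1).re with hl
  have hl0 : 0 ≤ l := (Complex.nonneg_iff.1 hlam).1
  set B : ℕ → ℂ := fun n => (n.factorial : ℂ)⁻¹ * (-1) ^ n * iteratedDeriv n (dslope f 1) 2 with hB
  have hBn : ∀ n, ‖B n‖ ≤ M * (2/3) ^ n := by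
    intro n
    have := Complex.norm_iteratedDeriv_le_of_forall_mem_sphere_norm_le n (by norm_num : (0:ℝ) < 3/2)
      hG.diffContOnCl hM
    simp only [hB, norm_mul, norm_inv, norm_pow, norm_neg, norm_one, one_pow, mul_one,
      Complex.norm_natCast]
    have hn : (0:ℝ) < n.factorial := by exact_mod_cast n.factorial_pos
    rw [inv_mul_le_iff₀ hn]
    refine this.trans (le_of_eq ?_)
    rw [div_pow, div_pow]; field_simp
  have hsum := est_hasSum hf (b:ℂ)
  have hre := Complex.hasSum_re hsum
  have hy : ∀ n, (B n * (2 - (b:ℂ)) ^ n).re = (B n).re * (2 - b) ^ n := by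
    intro n
    have h3 : (2 - (b:ℂ)) ^ n = (((2 - b) ^ n : ℝ) : ℂ) := by push_cast; ring
    rw [h3, Complex.mul_re, Complex.ofReal_im, Complex.ofReal_re]; ring
  have hre : HasSum (fun n => (B n).re * (2 - b) ^ n) (dslope f 1 b).re := by
    have h := hre
    change HasSum (fun n => (B n * (2 - (b:ℂ)) ^ n).re) _ at h
    simpa only [hy] using h
  -- lower bound of coefficients
  have hlow : ∀ n, -l ≤ (B n).re := by
    intro n
    obtain ⟨A, hA, -, hA2⟩ := est_deriv h0 hs hf hL n
    have : (B n).re = A.re - l := by rw [hB]; simp only [hA2]; simp [hl]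
    rw [this]
    linarith [(Complex.nonneg_iff.1 hA).1]
  have hlow0 : 1 - l ≤ (B 0).re := by
    obtain ⟨A, hA, hA1, hA2⟩ := est_deriv h0 hs hf hL 0
    have : (B 0).re = A.re - l := by rw [hB]; simp only [hA2]; simp [hl]
    rw [this, hA1 rfl]; linarith
  -- the choice of N
  obtain ⟨N, hN1, hN2⟩ : ∃ N : ℕ, Real.log (8 * M) ≤ N * Real.log (4/3) ∧
      (N:ℝ) ≤ 4 * Real.log (8 * M) + 1 := by
    have hlog : (1:ℝ)/4 ≤ Real.log (4/3) := by
      have := Real.one_sub_inv_le_log_of_pos (by norm_num : (0:ℝ) < 4/3)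
      norm_num at this ⊢; linarith
    have hlM : 0 ≤ Real.log (8 * M) := Real.log_nonneg (by linarith)
    refine ⟨⌈4 * Real.log (8 * M)⌉₊, ?_, ?_⟩
    · have := Nat.le_ceil (4 * Real.log (8 * M))
      nlinarith
    · exact (Nat.ceil_lt_add_one (by positivity)).le
  have h8M : 0 < 8 * M := by linarith
  have hN3 : 4 * M * (3/4:ℝ) ^ N ≤ 1/2 := by
    have : 8 * M ≤ (4/3:ℝ) ^ N := by
      rw [← Real.log_le_log_iff h8M (by positivity), Real.log_pow]; exact hN1
    have h34 : (3/4:ℝ) ^ N * (4/3) ^ N = 1 := by rw [← mul_pow]; norm_num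
    have : (0:ℝ) < (3/4:ℝ) ^ N := by positivity
    nlinarith
  have hN0 : 1 ≤ N := by
    by_contra h
    have : N = 0 := by omega
    rw [this] at hN3; norm_num at hN3; linarith
  have hq1 : 1 < 2 - b := by linarith
  have hb8 : (2 - b) ≤ 9/8 := by linarith
  -- tail
  have htail : -(4 * M * (3/4:ℝ) ^ N) ≤
      (dslope f 1 b).re - ∑ n ∈ Finset.range N, (B n).re * (2 - b) ^ n := by
    have ht := (hasSum_nat_add_iff' N).2 hre
    have hg : HasSum (fun n : ℕ => -(M * (3/4:ℝ) ^ (n + N))) (-(4 * M * (3/4:ℝ) ^ N)) := by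
      have := ((hasSum_geometric_of_lt_one (by norm_num : (0:ℝ) ≤ 3/4) (by norm_num)).mul_left
        (M * (3/4:ℝ) ^ N)).neg
      rw [show -(M * (3/4:ℝ) ^ N * (1 - 3/4)⁻¹) = -(4 * M * (3/4:ℝ) ^ N) by
        rw [show (1 - 3/4 : ℝ)⁻¹ = 4 by norm_num]; ring] at this
      refine hasSum_congr' this ?_
      intro n; rw [pow_add]; ring
    refine hasSum_le ?_ hg ht
    intro n
    have h1 := hBn (n + N)
    have h2 : |(B (n+N)).re| ≤ M * (2/3) ^ (n+N) := (Complex.abs_re_le_norm _).trans h1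
    have h3 : |(B (n+N)).re * (2 - b) ^ (n+N)| ≤ M * (3/4) ^ (n+N) := by
      rw [abs_mul, abs_of_nonneg (by positivity : 0 ≤ (2-b) ^ (n+N))]
      calc |(B (n+N)).re| * (2 - b) ^ (n+N) ≤ (M * (2/3) ^ (n+N)) * (9/8) ^ (n+N) := by gcongr
        _ = M * (3/4) ^ (n+N) := by rw [mul_assoc, ← mul_pow]; norm_num
    exact (abs_le.1 h3).1
  -- head
  have hhead : 1 - l * (((2 - b) ^ N - 1) / (1 - b)) ≤
      ∑ n ∈ Finset.range N, (B n).re * (2 - b) ^ n := by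
    have hgeo : ∑ n ∈ Finset.range N, (2 - b) ^ n = ((2 - b) ^ N - 1) / (1 - b) := by
      rw [geom_sum_eq (by linarith)]; congr 1; ring
    rw [← hgeo, Finset.mul_sum]
    obtain ⟨K, rfl⟩ : ∃ K, N = K + 1 := ⟨N - 1, by omega⟩
    rw [Finset.sum_range_succ', Finset.sum_range_succ']
    have : ∑ n ∈ Finset.range K, -(l * (2 - b) ^ (n+1)) ≤
        ∑ n ∈ Finset.range K, (B (n+1)).re * (2 - b) ^ (n+1) := by
      refine Finset.sum_le_sum ?_
      intro n _
      have : 0 ≤ (2 - b) ^ (n+1) := by positivity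
      nlinarith [hlow (n+1)]
    rw [Finset.sum_neg_distrib] at this
    simp only [pow_zero, mul_one]
    linarith
  have hds : (dslope f 1 b).re = ((f b).re - l) / (b - 1) := by
    have h2 := sub_smul_dslope f 1 (b:ℂ)
    have h3 : ((b - 1 : ℝ) : ℂ) * dslope f 1 b = f b - f 1 := by
      rw [smul_eq_mul] at h2; push_cast; rw [h2]
    have h4 := congrArg Complex.re h3
    rw [Complex.re_ofReal_mul, Complex.sub_re] at h4
    rw [eq_div_iff (by linarith)]; linarith
  have hds2 : (dslope f 1 b).re ≤ l / (1 - b) := by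
    rw [hds, ← neg_div_neg_eq]
    have : -(b - 1) = 1 - b := by ring
    rw [this]
    have : 0 < 1 - b := by linarith
    gcongr; linarith
  have hmain : (1:ℝ)/2 ≤ l * ((2 - b) ^ N / (1 - b)) := by
    have : l / (1 - b) + l * (((2 - b) ^ N - 1) / (1 - b)) = l * ((2 - b) ^ N / (1 - b)) := by
      field_simp; ring
    linarith
  have hpow : (2 - b) ^ N ≤ 3 * (8 * M) ^ (4 * (1 - b)) := by
    have h1 : (2 - b) ≤ Real.exp (1 - b) := by linarith [Real.add_one_le_exp (1 - b)]
    calc (2 - b) ^ N ≤ Real.exp (1 - b) ^ N := by gcongr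
      _ = Real.exp (N * (1 - b)) := by rw [← Real.exp_nat_mul]
      _ ≤ Real.exp (1 + Real.log (8 * M) * (4 * (1 - b))) := by
        apply Real.exp_le_exp.2; nlinarith
      _ = Real.exp 1 * (8 * M) ^ (4 * (1 - b)) := by
        rw [Real.exp_add, Real.rpow_def_of_pos h8M]
      _ ≤ _ := by gcongr; linarith [Real.exp_one_lt_d9]
  rw [Real.rpow_neg h8M.le]
  have hP : 0 < (8 * M) ^ (4 * (1 - b)) := by positivity
  rw [← div_eq_mul_inv, div_le_iff₀ hP]
  have h1b : 0 < 1 - b := by linarith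
  have : (1 - b) / 2 ≤ l * (2 - b) ^ N := by
    have := mul_le_mul_of_nonneg_right hmain h1b.le
    have e : l * ((2 - b) ^ N / (1 - b)) * (1 - b) = l * (2 - b) ^ N := by field_simp
    linarith
  nlinarith [mul_le_mul_of_nonneg_left hpow hl0]

end Estermann

section Arith

/-- derivation by the logarithm -/
noncomputable def DD (a : ArithmeticFunction ℂ) : ArithmeticFunction ℂ :=
  ⟨fun n => (Real.log n : ℂ) * a n, by simp⟩

lemma DD_apply (a : ArithmeticFunction ℂ) (n : ℕ) : DD a n = (Real.log n : ℂ) * a n := rfl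

lemma DD_mul (a b : ArithmeticFunction ℂ) : DD (a * b) = DD a * b + a * DD b := by
  ext n
  rw [DD_apply, ArithmeticFunction.add_apply, ArithmeticFunction.mul_apply,
    ArithmeticFunction.mul_apply, ArithmeticFunction.mul_apply, Finset.mul_sum,
    ← Finset.sum_add_distrib]
  refine Finset.sum_congr rfl ?_
  rintro ⟨d, e⟩ hde
  rw [Nat.mem_divisorsAntidiagonal] at hde
  obtain ⟨hde, hn⟩ := hde
  have hd : d ≠ 0 := by rintro rfl; simp at hde; omega
  have he : e ≠ 0 := by rintro rfl; simp at hde; omega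
  simp only [DD_apply]
  rw [← hde]
  push_cast
  rw [Real.log_mul (by exact_mod_cast hd) (by exact_mod_cast he)]
  push_cast; ring

/-- A character as an arithmetic function. -/
noncomputable def cx {q : ℕ} (χ : DirichletCharacter ℂ q) : ArithmeticFunction ℂ :=
  toArithmeticFunction (fun n => χ (n : ZMod q))

/-- twisted von Mangoldt function -/
noncomputable def wx {q : ℕ} (χ : DirichletCharacter ℂ q) : ArithmeticFunction ℂ :=
  toArithmeticFunction (fun n => χ (n : ZMod q) * (ArithmeticFunction.vonMangoldt n : ℂ))

lemma cx_apply {q : ℕ} (χ : DirichletCharacter ℂ q) {n : ℕ} (hn : n ≠ 0) :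
    cx χ n = χ (n : ZMod q) := by simp [cx, toArithmeticFunction, hn]

lemma wx_apply {q : ℕ} (χ : DirichletCharacter ℂ q) (n : ℕ) :
    wx χ n = χ (n : ZMod q) * (ArithmeticFunction.vonMangoldt n : ℂ) := by
  by_cases hn : n = 0
  · simp [hn]
  · simp [wx, toArithmeticFunction, hn]

lemma DD_cx {q : ℕ} (χ : DirichletCharacter ℂ q) : DD (cx χ) = cx χ * wx χ := by
  have h := DirichletCharacter.convolution_twist_vonMangoldt χ
  ext n
  have h1 := congrFun h n
  by_cases hn : n = 0
  · simp [hn]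
  rw [DD_apply, cx_apply χ hn, mul_comm (cx χ)]
  have e : wx χ * cx χ = toArithmeticFunction ((fun n : ℕ => χ (n : ZMod q)) *
      fun n => (ArithmeticFunction.vonMangoldt n : ℂ)) * toArithmeticFunction (fun n : ℕ => χ (n : ZMod q)) := rfl
  rw [e]
  unfold LSeries.convolution at h1
  rw [h1]
  simp [mul_comm]

lemma DD_nonneg {a w : ArithmeticFunction ℂ} (h : DD a = a * w) (ha1 : a 1 = 1) (hw : ∀ n, 0 ≤ w n)
    (hw1 : w 1 = 0) : ∀ n, 0 ≤ a n := by
  intro n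
  induction n using Nat.strong_induction_on with
  | _ n ih =>
    rcases Nat.lt_or_ge n 2 with h2 | h2
    · interval_cases n
      · simp
      · simp [ha1]
    · have h1 := congrArg (fun f => f n) h
      simp only [DD_apply, ArithmeticFunction.mul_apply] at h1
      have hpos : 0 ≤ ∑ x ∈ n.divisorsAntidiagonal, a x.1 * w x.2 := by
        refine Finset.sum_nonneg ?_
        rintro ⟨d, e⟩ hde
        rw [Nat.mem_divisorsAntidiagonal] at hde
        obtain ⟨hde, hn⟩ := hde
        simp only at hde ⊢
        by_cases he : e = 1
        · simp [he, hw1]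
        · refine mul_nonneg (ih d ?_) (hw e)
          have : e ≠ 0 := by rintro rfl; simp at hde; omega
          have : d ≠ 0 := by rintro rfl; simp at hde; omega
          have : 2 ≤ e := by omega
          nlinarith [Nat.pos_of_ne_zero ‹d ≠ 0›]
      rw [← h1] at hpos
      have hl : 0 < Real.log n := Real.log_pos (by exact_mod_cast h2)
      have e : a n = ((Real.log n)⁻¹ : ℝ) * ((Real.log n : ℂ) * a n) := by
        rw [← mul_assoc, ← Complex.ofReal_mul, inv_mul_cancel₀ hl.ne']; simp
      rw [e]
      exact mul_nonneg (by exact_mod_cast (inv_pos.2 hl).le) hpos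

lemma cx_summable {q : ℕ} (χ : DirichletCharacter ℂ q) {s : ℂ} (hs : 1 < s.re) :
    LSeriesSummable (cx χ) s := by
  refine (LSeriesSummable_congr s ?_).1 (DirichletCharacter.LSeriesSummable_of_one_lt_re χ hs)
  intro n hn; exact (cx_apply χ hn).symm

lemma cx_LSeries {q : ℕ} [NeZero q] (χ : DirichletCharacter ℂ q) {s : ℂ} (hs : 1 < s.re) :
    LSeries (cx χ) s = DirichletCharacter.LFunction χ s := by
  rw [DirichletCharacter.LFunction_eq_LSeries χ hs]
  refine LSeries_congr ?_ s
  intro n hn; exact cx_apply χ hn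

lemma one_le_LSeries {a : ArithmeticFunction ℂ} (h0 : ∀ n, 0 ≤ a n) (ha1 : a 1 = 1)
    (hs : LSeriesSummable a 2) : 1 ≤ (LSeries a 2).re := by
  have ht : ∀ n, 0 ≤ LSeries.term a 2 n := by
    intro n
    rw [LSeries.term_def]
    split_ifs with h
    · exact le_rfl
    · exact div_nonneg (h0 n) (by exact_mod_cast (by positivity : (0:ℝ) ≤ (n:ℝ)^2))
  have h1 := (Complex.hasSum_re hs.hasSum)
  have h2 := h1.summable.le_tsum 1 (fun j _ => (Complex.nonneg_iff.1 (ht j)).1)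
  rw [h1.tsum_eq] at h2
  rw [LSeries.term_def] at h2
  simpa [ha1, LSeries] using h2

lemma quad_vals {q : ℕ} {χ : DirichletCharacter ℂ q} (h : χ ^ 2 = 1) (n : ZMod q) :
    0 ≤ 1 + χ n := by
  rcases MulChar.isQuadratic_iff_sq_eq_one.mpr h n with h | h | h <;> rw [h] <;> norm_num

/-- `ζ(s)(s-1)` -/
noncomputable def ZZ : ℂ → ℂ := Lent (1 : DirichletCharacter ℂ 1)

lemma ZZ_diff : Differentiable ℂ ZZ := Lent_diff _

lemma ZZ_eq {s : ℂ} (hs : s ≠ 1) : ZZ s = (s - 1) * riemannZeta s := by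
  rw [ZZ, Lent_eq _ hs, DirichletCharacter.LFunction_modOne_eq]

/-- trivial character mod one -/
noncomputable def z1 : DirichletCharacter ℂ 1 := 1

lemma z1_apply (n : ℕ) : z1 (n : ZMod 1) = 1 := MulChar.one_apply (isUnit_of_subsingleton _)

lemma z1_LSeries {s : ℂ} (hs : 1 < s.re) : LSeries (cx z1) s = riemannZeta s := by
  rw [cx_LSeries z1 hs, DirichletCharacter.LFunction_modOne_eq]

lemma ZZ_one : ZZ 1 = 1 := by
  simp [ZZ, Lent, DirichletCharacter.LFunctionTrivChar₁]

/-- Estermann for two characters. -/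
lemma est2 {q : ℕ} [NeZero q] {χ : DirichletCharacter ℂ q} (h2 : χ ^ 2 = 1) (h1 : χ ≠ 1) :
    ∃ a : ℕ → ℂ, 0 ≤ a ∧ 1 ≤ (LSeries a 2).re ∧ (∀ s : ℂ, 1 < s.re → LSeriesSummable a s) ∧
      Differentiable ℂ (fun s => ZZ s * DirichletCharacter.LFunction χ s) ∧
      ∀ s : ℂ, 1 < s.re → ZZ s * DirichletCharacter.LFunction χ s = (s - 1) * LSeries a s := by
  have hDD : DD (cx z1 * cx χ) = (cx z1 * cx χ) * (wx z1 + wx χ) := by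
    rw [DD_mul, DD_cx, DD_cx]; ring
  have ha1 : (cx z1 * cx χ) 1 = 1 := by
    rw [ArithmeticFunction.mul_apply]
    simp [cx_apply]
    simpa using z1_apply 0
  have hnn : ∀ n, 0 ≤ (cx z1 * cx χ) n := by
    refine DD_nonneg hDD ha1 ?_ ?_
    · intro n
      rw [ArithmeticFunction.add_apply, wx_apply, wx_apply, z1_apply, ← add_mul]
      exact mul_nonneg (quad_vals h2 _) (by exact_mod_cast ArithmeticFunction.vonMangoldt_nonneg)
    · rw [ArithmeticFunction.add_apply, wx_apply, wx_apply]; simp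
  have hsm : ∀ s : ℂ, 1 < s.re → LSeriesSummable (⇑(cx z1 * cx χ)) s := fun s hs =>
    ArithmeticFunction.LSeriesSummable_mul (cx_summable z1 hs) (cx_summable χ hs)
  refine ⟨⇑(cx z1 * cx χ), hnn, one_le_LSeries hnn ha1 (hsm 2 (by norm_num)), hsm,
    ZZ_diff.fun_mul (DirichletCharacter.differentiable_LFunction h1), ?_⟩
  intro s hs
  rw [ArithmeticFunction.LSeries_mul' (cx_summable z1 hs) (cx_summable χ hs), z1_LSeries hs,
    cx_LSeries χ hs]
  have hs1 : s ≠ 1 := by intro h; rw [h] at hs; simp at hs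
  rw [ZZ_eq hs1]; ring

/-- Estermann for four characters. -/
lemma est4 {q : ℕ} [NeZero q] {χ ψ : DirichletCharacter ℂ q} (h2 : χ ^ 2 = 1) (h1 : χ ≠ 1)
    (g2 : ψ ^ 2 = 1) (g1 : ψ ≠ 1) (hg : χ * ψ ≠ 1) :
    ∃ a : ℕ → ℂ, 0 ≤ a ∧ 1 ≤ (LSeries a 2).re ∧ (∀ s : ℂ, 1 < s.re → LSeriesSummable a s) ∧
      Differentiable ℂ (fun s => ZZ s * (DirichletCharacter.LFunction χ s *
        DirichletCharacter.LFunction ψ s * DirichletCharacter.LFunction (χ * ψ) s)) ∧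
      ∀ s : ℂ, 1 < s.re → ZZ s * (DirichletCharacter.LFunction χ s *
        DirichletCharacter.LFunction ψ s * DirichletCharacter.LFunction (χ * ψ) s)
          = (s - 1) * LSeries a s := by
  set u := (cx z1 * cx χ) * (cx ψ * cx (χ * ψ)) with hu
  have hDD : DD u = u * (wx z1 + wx χ + wx ψ + wx (χ * ψ)) := by
    rw [hu, DD_mul, DD_mul, DD_mul, DD_cx, DD_cx, DD_cx, DD_cx]; ring
  have ha1 : u 1 = 1 := by
    simp only [hu, ArithmeticFunction.mul_apply]
    simp [cx_apply]
    simpa using z1_apply 0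
  have hnn : ∀ n, 0 ≤ u n := by
    refine DD_nonneg hDD ha1 ?_ ?_
    · intro n
      simp only [ArithmeticFunction.add_apply, wx_apply, z1_apply]
      have : 1 * (ArithmeticFunction.vonMangoldt n : ℂ) + χ n * (ArithmeticFunction.vonMangoldt n : ℂ)
        + ψ n * (ArithmeticFunction.vonMangoldt n : ℂ)
        + (χ * ψ) n * (ArithmeticFunction.vonMangoldt n : ℂ)
        = (1 + χ n) * (1 + ψ n) * (ArithmeticFunction.vonMangoldt n : ℂ) := by
        rw [MulChar.mul_apply]; ring
      rw [this]
      exact mul_nonneg (mul_nonneg (quad_vals h2 _) (quad_vals g2 _))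
        (by exact_mod_cast ArithmeticFunction.vonMangoldt_nonneg)
    · simp only [ArithmeticFunction.add_apply, wx_apply]; simp
  have hsm1 : ∀ s : ℂ, 1 < s.re → LSeriesSummable (⇑(cx z1 * cx χ)) s := fun s hs =>
    ArithmeticFunction.LSeriesSummable_mul (cx_summable z1 hs) (cx_summable χ hs)
  have hsm2 : ∀ s : ℂ, 1 < s.re → LSeriesSummable (⇑(cx ψ * cx (χ * ψ))) s := fun s hs =>
    ArithmeticFunction.LSeriesSummable_mul (cx_summable ψ hs) (cx_summable _ hs)
  have hsm : ∀ s : ℂ, 1 < s.re → LSeriesSummable u s := fun s hs =>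
    ArithmeticFunction.LSeriesSummable_mul (hsm1 s hs) (hsm2 s hs)
  refine ⟨u, hnn, one_le_LSeries hnn ha1 (hsm 2 (by norm_num)), hsm,
    (ZZ_diff).fun_mul (((DirichletCharacter.differentiable_LFunction h1).fun_mul
      (DirichletCharacter.differentiable_LFunction g1)).fun_mul
      (DirichletCharacter.differentiable_LFunction hg)), ?_⟩
  intro s hs
  rw [hu, ArithmeticFunction.LSeries_mul' (hsm1 s hs) (hsm2 s hs),
    ArithmeticFunction.LSeries_mul' (cx_summable z1 hs) (cx_summable χ hs),
    ArithmeticFunction.LSeries_mul' (cx_summable ψ hs) (cx_summable _ hs),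
    z1_LSeries hs, cx_LSeries χ hs, cx_LSeries ψ hs, cx_LSeries _ hs]
  have hs1 : s ≠ 1 := by intro h; rw [h] at hs; simp at hs
  rw [ZZ_eq hs1]; ring

end Arith

section Siegel

lemma LFun_bound' {δ : ℝ} (hδ : 0 < δ) (hδ2 : δ ≤ 1/2) {q : ℕ} [NeZero q]
    {χ : DirichletCharacter ℂ q} (hχ : χ ≠ 1) (s : ℂ) (h1 : 1 - δ ≤ s.re) (h4 : s.re ≤ 4) :
    ‖DirichletCharacter.LFunction χ s‖ ≤ (4 / δ + 22) * TT q s.im ^ (2 * δ) := by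
  by_cases hs1 : s = 1
  · subst hs1
    have hc : Continuous (fun x : ℝ => ‖DirichletCharacter.LFunction χ (x:ℂ)‖) :=
      ((DirichletCharacter.differentiable_LFunction hχ).continuous.comp
        Complex.continuous_ofReal).norm
    have ht : Tendsto (fun x : ℝ => ‖DirichletCharacter.LFunction χ (x:ℂ)‖) (𝓝[>] 1)
      (𝓝 ‖DirichletCharacter.LFunction χ ((1:ℝ):ℂ)‖) :=
      (hc.tendsto 1).mono_left nhdsWithin_le_nhds
    rw [Complex.ofReal_one] at ht
    refine le_of_tendsto ht ?_
    have hmem : Set.Iio (4:ℝ) ∈ 𝓝[>] (1:ℝ) :=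
      mem_nhdsWithin_of_mem_nhds (Iio_mem_nhds (by norm_num))
    filter_upwards [self_mem_nhdsWithin, hmem] with x hx hx4
    have hx : 1 < x := hx
    have hx4 : x < 4 := hx4
    have := LFun_bound hδ hδ2 χ (x:ℂ) (by simp; linarith) (by simp; linarith)
      (by intro h; have : x = 1 := by exact_mod_cast h
          linarith)
    simpa [kap_ne_one hχ] using this
  · have := LFun_bound hδ hδ2 χ s h1 h4 hs1
    simpa [kap_ne_one hχ] using this

lemma sphere_facts {s : ℂ} (hs : s ∈ Metric.sphere (2:ℂ) (3/2)) :
    1/2 ≤ s.re ∧ s.re ≤ 4 ∧ |s.im| ≤ 3/2 ∧ 1/2 ≤ ‖s - 1‖ ∧ s ≠ 1 := by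
  rw [mem_sphere_iff_norm] at hs
  have h1 := Complex.abs_re_le_norm (s - 2)
  have h2 := Complex.abs_im_le_norm (s - 2)
  rw [hs] at h1 h2
  simp only [sub_re, sub_im, re_ofNat, im_ofNat, sub_zero] at h1 h2
  have h3 := abs_le.1 h1
  have h4 : 1/2 ≤ ‖s - 1‖ := by
    have : ‖s - 2‖ ≤ ‖s - 1‖ + ‖(1:ℂ)‖ := by
      have e : s - 2 = (s - 1) - 1 := by ring
      rw [e]; exact norm_sub_le _ _
    rw [hs, norm_one] at this; linarith
  refine ⟨by linarith, by linarith, h2, h4, ?_⟩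
  rintro rfl
  norm_num at h4

lemma LFun_sphere {q : ℕ} [NeZero q] {χ : DirichletCharacter ℂ q} (hχ : χ ≠ 1) {s : ℂ}
    (hs : s ∈ Metric.sphere (2:ℂ) (3/2) ∨ s = 1) : ‖DirichletCharacter.LFunction χ s‖ ≤ 105 * q := by
  have h : 1/2 ≤ s.re ∧ s.re ≤ 4 ∧ |s.im| ≤ 3/2 := by
    rcases hs with hs | rfl
    · obtain ⟨a, b, c, -⟩ := sphere_facts hs; exact ⟨a, b, c⟩
    · norm_num
  have := LFun_bound' (δ := 1/2) (by norm_num) le_rfl hχ s (by linarith) h.2.1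
  norm_num at this
  refine this.trans ?_
  have hq : (0:ℝ) ≤ q := Nat.cast_nonneg q
  unfold TT; nlinarith [h.2.2]

lemma dslope_sphere {H : ℂ → ℂ} {h : ℝ} (hH : ∀ s ∈ Metric.sphere (2:ℂ) (3/2), ‖H s‖ ≤ h)
    (hH1 : ‖H 1‖ ≤ h) {s : ℂ} (hs : s ∈ Metric.sphere (2:ℂ) (3/2)) :
    ‖dslope (fun s => ZZ s * H s) 1 s‖ ≤ 109 * h := by
  obtain ⟨a, b, c, d, e⟩ := sphere_facts hs
  have hs1 : s - 1 ≠ 0 := sub_ne_zero.2 e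
  have hz : ‖riemannZeta s‖ ≤ 107 := by
    have := LFun_bound (δ := 1/2) (by norm_num) le_rfl (1 : DirichletCharacter ℂ 1) s
      (by linarith) b e
    rw [DirichletCharacter.LFunction_modOne_eq] at this
    norm_num at this
    have hk : ‖((kap (1 : DirichletCharacter ℂ 1) : ℝ) : ℂ) / (s - 1)‖ ≤ 2 := by
      rw [norm_div, Complex.norm_real, Real.norm_of_nonneg (kap_nonneg _)]
      rw [div_le_iff₀ (by linarith)]
      linarith [kap_le_one (1 : DirichletCharacter ℂ 1)]
    have h3 : ‖riemannZeta s‖ ≤ ‖riemannZeta s - ((kap (1 : DirichletCharacter ℂ 1) : ℝ) : ℂ) / (s - 1)‖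
        + ‖((kap (1 : DirichletCharacter ℂ 1) : ℝ) : ℂ) / (s - 1)‖ := by
      have := norm_add_le (riemannZeta s - ((kap (1 : DirichletCharacter ℂ 1) : ℝ) : ℂ) / (s - 1))
        (((kap (1 : DirichletCharacter ℂ 1) : ℝ) : ℂ) / (s - 1))
      simpa using this
    have hT : TT 1 s.im ≤ 7/2 := by unfold TT; push_cast; linarith
    linarith
  rw [dslope_of_ne _ e, slope_def_field, ZZ_one, ZZ_eq e]
  have h0 : 0 ≤ h := (norm_nonneg _).trans hH1
  have : ((s - 1) * riemannZeta s * H s - 1 * H 1) / (s - 1)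
      = riemannZeta s * H s - H 1 / (s - 1) := by field_simp
  rw [this]
  have b1 : ‖riemannZeta s * H s‖ ≤ 107 * h := by
    rw [norm_mul]; exact mul_le_mul hz (hH s hs) (norm_nonneg _) (by norm_num)
  have b2 : ‖H 1 / (s - 1)‖ ≤ 2 * h := by
    rw [norm_div, div_le_iff₀ (by linarith)]; nlinarith
  linarith [norm_sub_le (riemannZeta s * H s) (H 1 / (s - 1))]

lemma siegel_F2 {q : ℕ} [NeZero q] {χ : DirichletCharacter ℂ q} (h2 : χ ^ 2 = 1) (h1 : χ ≠ 1)
    {b : ℝ} (hb : 7/8 ≤ b) (hb1 : b < 1)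
    (hF : 0 ≤ (ZZ b * DirichletCharacter.LFunction χ b).re) :
    (1 - b) / 6 * (8 * (11445 * q)) ^ (-(4 * (1 - b))) ≤ ‖DirichletCharacter.LFunction χ 1‖ := by
  obtain ⟨a, a0, a1, a2, a3, a4⟩ := est2 h2 h1
  have hq : (1:ℝ) ≤ q := by exact_mod_cast Nat.pos_of_neZero q
  have := est_main (M := 11445 * q) a0 a1 a2 a3 a4 (fun s hs => by
    refine (dslope_sphere (h := 105 * q) (fun s hs => LFun_sphere h1 (Or.inl hs))
      (LFun_sphere h1 (Or.inr rfl)) hs).trans (le_of_eq (by ring))) (by linarith) hb hb1 hF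
  refine this.trans ?_
  rw [ZZ_one, one_mul]
  exact Complex.re_le_norm _

lemma siegel_F4 {q : ℕ} [NeZero q] {χ ψ : DirichletCharacter ℂ q} (h2 : χ ^ 2 = 1) (h1 : χ ≠ 1)
    (g2 : ψ ^ 2 = 1) (g1 : ψ ≠ 1) (hg : χ * ψ ≠ 1)
    {b : ℝ} (hb : 7/8 ≤ b) (hb1 : b < 1)
    (hF : ZZ b * DirichletCharacter.LFunction χ b = 0) :
    (1 - b) / 6 * (8 * (109 * (105 * q) ^ 3)) ^ (-(4 * (1 - b))) ≤
      ‖DirichletCharacter.LFunction χ 1‖ * ‖DirichletCharacter.LFunction ψ 1‖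
        * ‖DirichletCharacter.LFunction (χ * ψ) 1‖ := by
  obtain ⟨a, a0, a1, a2, a3, a4⟩ := est4 h2 h1 g2 g1 hg
  have hq : (1:ℝ) ≤ q := by exact_mod_cast Nat.pos_of_neZero q
  have hH : ∀ s : ℂ, (s ∈ Metric.sphere (2:ℂ) (3/2) ∨ s = 1) →
      ‖DirichletCharacter.LFunction χ s * DirichletCharacter.LFunction ψ s
        * DirichletCharacter.LFunction (χ * ψ) s‖ ≤ (105 * q) ^ 3 := by
    intro s hs
    rw [norm_mul, norm_mul, pow_three']
    have := LFun_sphere h1 hs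
    have := LFun_sphere g1 hs
    have := LFun_sphere hg hs
    gcongr
  have hM1 : (1:ℝ) ≤ 109 * (105 * q) ^ 3 := by
    have : (1:ℝ) ≤ (105 * q) ^ 3 := one_le_pow₀ (by linarith)
    linarith
  have := est_main (M := 109 * (105 * q) ^ 3) a0 a1 a2 a3 a4 (fun s hs => by
    exact dslope_sphere (h := (105 * q) ^ 3) (fun s hs => hH s (Or.inl hs)) (hH 1 (Or.inr rfl)) hs)
    hM1 hb hb1 (by rw [← mul_assoc, ← mul_assoc, hF]; simp)
  refine this.trans ?_
  rw [ZZ_one, one_mul, ← norm_mul, ← norm_mul]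
  exact Complex.re_le_norm _

lemma exists_zero {q : ℕ} [NeZero q] {χ : DirichletCharacter ℂ q} (h2 : χ ^ 2 = 1) (h1 : χ ≠ 1)
    {b : ℝ} (hb1 : b < 1) (hF : (ZZ b * DirichletCharacter.LFunction χ b).re < 0) :
    ∃ b' : ℝ, b ≤ b' ∧ b' < 1 ∧ ZZ b' * DirichletCharacter.LFunction χ b' = 0 := by
  obtain ⟨a, a0, a1, a2, a3, a4⟩ := est2 h2 h1
  have hlam := est_lambda a0 a2 a3 a4
  simp only [ZZ_one, one_mul] at hlam
  have hpos : 0 < (DirichletCharacter.LFunction χ 1).re := by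
    have hn := DirichletCharacter.LFunction_apply_one_ne_zero h1
    obtain ⟨hr, hi⟩ := Complex.nonneg_iff.1 hlam
    refine lt_of_le_of_ne hr ?_
    intro h; apply hn; apply Complex.ext <;> simp [← h, ← hi]
  have hcont : Continuous (fun x : ℝ => (ZZ x * DirichletCharacter.LFunction χ x).re) :=
    Complex.continuous_re.comp (a3.continuous.comp Complex.continuous_ofReal)
  have hivt := intermediate_value_Icc hb1.le hcont.continuousOn
  have hm : (0:ℝ) ∈ Set.Icc ((ZZ (b:ℂ) * DirichletCharacter.LFunction χ (b:ℂ)).re)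
      ((ZZ ((1:ℝ):ℂ) * DirichletCharacter.LFunction χ ((1:ℝ):ℂ)).re) := by
    refine ⟨hF.le, ?_⟩
    rw [Complex.ofReal_one, ZZ_one, one_mul]; exact hpos.le
  obtain ⟨x, hx, hx0⟩ := hivt hm
  simp only at hx0
  refine ⟨x, hx.1, lt_of_le_of_ne hx.2 ?_, Complex.ext hx0 (est_im a0 a2 a3 a4 x)⟩
  rintro rfl
  rw [Complex.ofReal_one, ZZ_one, one_mul] at hx0
  linarith

lemma changeLevel_norm_le {q1 q2 : ℕ} [NeZero q1] [NeZero q2] (hd : q2 ∣ q1 * q2)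
    {χ : DirichletCharacter ℂ q2} (h1 : χ ≠ 1) :
    ‖DirichletCharacter.LFunction (DirichletCharacter.changeLevel hd χ) 1‖ ≤
      2 ^ q1 * ‖DirichletCharacter.LFunction χ 1‖ := by
  have : NeZero (q1 * q2) := inferInstance
  rw [DirichletCharacter.LFunction_changeLevel hd χ (Or.inl h1), norm_mul, mul_comm]
  gcongr
  rw [norm_prod, Nat.primeFactors_mul (NeZero.ne q1) (NeZero.ne q2)]
  have hone : ∀ p ∈ q2.primeFactors, χ (p : ZMod q2) = 0 := by
    intro p hp
    apply MulChar.map_nonunit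
    rw [ZMod.isUnit_iff_coprime]
    intro hc
    exact (Nat.prime_of_mem_primeFactors hp).one_lt.ne'
      (Nat.eq_one_of_dvd_coprimes hc dvd_rfl (Nat.dvd_of_mem_primeFactors hp))
  have hle : ∀ p ∈ q1.primeFactors ∪ q2.primeFactors, ‖1 - χ (p : ZMod q2) * (p:ℂ) ^ (-1:ℂ)‖ ≤ 2 := by
    intro p hp
    have hpp : p.Prime := by
      rcases Finset.mem_union.1 hp with h | h <;> exact Nat.prime_of_mem_primeFactors h
    refine (norm_sub_le _ _).trans ?_
    rw [norm_one, norm_mul, Complex.cpow_neg_one, norm_inv, Complex.norm_natCast]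
    have a1 := χ.norm_le_one (p : ZMod q2)
    have a2 : ((p:ℝ))⁻¹ ≤ 1 := inv_le_one_of_one_le₀ (by exact_mod_cast hpp.one_lt.le)
    have a3 : 0 ≤ ((p:ℝ))⁻¹ := by positivity
    nlinarith [norm_nonneg (χ (p : ZMod q2))]
  calc ∏ p ∈ q1.primeFactors ∪ q2.primeFactors, ‖1 - χ (p : ZMod q2) * (p:ℂ) ^ (-1:ℂ)‖
      = ∏ p ∈ (q1.primeFactors ∪ q2.primeFactors) \ q2.primeFactors,
          ‖1 - χ (p : ZMod q2) * (p:ℂ) ^ (-1:ℂ)‖ := by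
        symm
        apply Finset.prod_subset Finset.sdiff_subset
        intro p hp hp2
        have : p ∈ q2.primeFactors := by
          by_contra h; exact hp2 (Finset.mem_sdiff.2 ⟨hp, h⟩)
        rw [hone p this]; simp
    _ ≤ ∏ p ∈ (q1.primeFactors ∪ q2.primeFactors) \ q2.primeFactors, 2 := by
        refine Finset.prod_le_prod (fun _ _ => norm_nonneg _) ?_
        intro p hp; exact hle p (Finset.mem_sdiff.1 hp).1
    _ = 2 ^ ((q1.primeFactors ∪ q2.primeFactors) \ q2.primeFactors).card := by
        rw [Finset.prod_const]
    _ ≤ 2 ^ q1 := by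
        gcongr
        · norm_num
        · calc _ ≤ q1.primeFactors.card := Finset.card_le_card (by
                intro p hp; simp only [Finset.mem_sdiff, Finset.mem_union] at hp; tauto)
            _ ≤ (Finset.Icc 1 q1).card := Finset.card_le_card (by
                intro p hp
                rw [Finset.mem_Icc]
                exact ⟨(Nat.prime_of_mem_primeFactors hp).one_lt.le, Nat.le_of_mem_primeFactors hp⟩)
            _ = q1 := by simp

theorem siegel {ε : ℝ} (hε : 0 < ε) : ∃ c : ℝ, 0 < c ∧ ∀ (q : ℕ) [NeZero q]
    (χ : DirichletCharacter ℂ q), χ ^ 2 = 1 → χ ≠ 1 →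
      c * (q:ℝ) ^ (-ε) ≤ ‖DirichletCharacter.LFunction χ 1‖ := by
  obtain ⟨e, he, heε, he8⟩ : ∃ e : ℝ, 0 < e ∧ 16 * e ≤ ε ∧ e ≤ 1/8 :=
    ⟨min (ε/16) (1/8), by positivity, by linarith [min_le_left (ε/16) (1/8)], min_le_right _ _⟩
  by_cases hI : ∀ (q : ℕ) [NeZero q] (χ : DirichletCharacter ℂ q), χ ^ 2 = 1 → χ ≠ 1 →
      0 ≤ (ZZ ((1 - e : ℝ) : ℂ) * DirichletCharacter.LFunction χ ((1 - e : ℝ) : ℂ)).re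
  · refine ⟨e / 6 * (8 * 11445) ^ (-(4 * e)), by positivity, ?_⟩
    intro q _ χ h2 h1
    have hq : (1:ℝ) ≤ q := by exact_mod_cast Nat.pos_of_neZero q
    have := siegel_F2 h2 h1 (by linarith : 7/8 ≤ 1 - e) (by linarith) (hI q χ h2 h1)
    refine le_trans ?_ this
    have e1 : (8*(11445*(q:ℝ)))^(-(4*e)) = (8*11445)^(-(4*e)) * (q:ℝ)^(-(4*e)) := by
      rw [← mul_assoc, Real.mul_rpow (by norm_num) (by linarith)]
    have e2 : (q:ℝ)^(-ε) ≤ (q:ℝ)^(-(4*e)) := Real.rpow_le_rpow_of_exponent_le hq (by linarith)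
    rw [show 1 - (1 - e) = e by ring, e1, ← mul_assoc]
    exact mul_le_mul_of_nonneg_left e2 (by positivity)
  · push Not at hI
    obtain ⟨q1, hq1, χ1, h12, h11, hneg⟩ := hI
    obtain ⟨b, hb, hb1, hb0⟩ := exists_zero h12 h11 (by linarith : 1 - e < 1) hneg
    set D : ℝ := 8 * (109 * 105 ^ 3) with hD
    set K : ℝ := 4 / e + 22 with hK
    have hK1 : 1 ≤ K := by
      have : 0 < 4 / e := by positivity
      linarith
    have hb1' : 0 < 1 - b := by linarith
    have hq1r : (1:ℝ) ≤ q1 := by exact_mod_cast Nat.pos_of_neZero q1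
    refine ⟨(1 - b) / 6 * D ^ (-(4 * e)) * (q1:ℝ) ^ (-(16 * e)) / (2 ^ q1 * K ^ 2 * 2 ^ (4 * e)),
      by positivity, ?_⟩
    intro q2 _ χ2 h22 h21
    have hq2r : (1:ℝ) ≤ q2 := by exact_mod_cast Nat.pos_of_neZero q2
    set N : ℕ := q1 * q2 with hN
    have hNr : (N:ℝ) = q1 * q2 := by rw [hN]; push_cast; ring
    have hN1 : (1:ℝ) ≤ N := by rw [hNr]; nlinarith
    have hNz : NeZero N := ⟨by rw [hN]; exact mul_ne_zero (NeZero.ne q1) (NeZero.ne q2)⟩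
    have hd1 : q1 ∣ N := dvd_mul_right _ _
    have hd2 : q2 ∣ N := dvd_mul_left _ _
    set χ := DirichletCharacter.changeLevel hd1 χ1 with hχ
    set ψ := DirichletCharacter.changeLevel hd2 χ2 with hψ
    have a2 : χ ^ 2 = 1 := by rw [hχ, ← map_pow, h12, map_one]
    have a1 : χ ≠ 1 := fun h => h11 ((DirichletCharacter.changeLevel_eq_one_iff hd1).1 h)
    have b2 : ψ ^ 2 = 1 := by rw [hψ, ← map_pow, h22, map_one]
    have b1 : ψ ≠ 1 := fun h => h21 ((DirichletCharacter.changeLevel_eq_one_iff hd2).1 h)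
    have hz : ZZ b * DirichletCharacter.LFunction χ b = 0 := by
      rw [hχ, DirichletCharacter.LFunction_changeLevel hd1 χ1 (Or.inl h11), ← mul_assoc, hb0,
        zero_mul]
    have hψn : ‖DirichletCharacter.LFunction ψ 1‖ ≤ 2 ^ q1 * ‖DirichletCharacter.LFunction χ2 1‖ :=
      changeLevel_norm_le hd2 h21
    have hLb : ∀ φ : DirichletCharacter ℂ N, φ ≠ 1 →
        ‖DirichletCharacter.LFunction φ 1‖ ≤ K * (2 * N) ^ (2 * e) := by
      intro φ hφ
      have := LFun_bound' he (by linarith) hφ 1 (by simp; linarith) (by norm_num)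
      simpa [TT, mul_comm] using this
    have h2N : (1:ℝ) ≤ (2 * N) ^ (2 * e) := Real.one_le_rpow (by linarith) (by linarith)
    set P : ℝ := K * (2 * N) ^ (2 * e) with hP
    have hP1 : 1 ≤ P := by rw [hP]; nlinarith
    set l := ‖DirichletCharacter.LFunction χ2 1‖ with hl
    have hDN : ∀ x : ℝ, 1 ≤ x → x ≤ D * (N:ℝ) ^ 3 →
        (D * (N:ℝ) ^ 3) ^ (-(4 * e)) ≤ x ^ (-(4 * (1 - b))) := by
      intro x hx hx2
      calc (D * (N:ℝ) ^ 3) ^ (-(4 * e)) ≤ x ^ (-(4 * e)) :=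
            Real.rpow_le_rpow_of_nonpos (by linarith) hx2 (by linarith)
        _ ≤ _ := Real.rpow_le_rpow_of_exponent_le hx (by linarith)
    have hN3 : (N:ℝ) ≤ (N:ℝ) ^ 3 := le_self_pow₀ hN1 (by norm_num)
    have key : (1 - b) / 6 * (D * (N:ℝ) ^ 3) ^ (-(4 * e)) ≤ 2 ^ q1 * l * P ^ 2 := by
      by_cases hg : χ * ψ = 1
      · have hχψ : χ = ψ := by
          have h3 : χ * ψ = ψ * ψ := by rw [hg, ← pow_two, b2]
          exact mul_right_cancel h3
        have h3 := siegel_F2 b2 b1 (by linarith : 7/8 ≤ b) hb1 (by rw [← hχψ, hz]; simp)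
        have h4 := hDN (8 * (11445 * N)) (by linarith) (by rw [hD]; nlinarith)
        calc (1 - b) / 6 * (D * (N:ℝ) ^ 3) ^ (-(4 * e))
            ≤ (1 - b) / 6 * (8 * (11445 * N)) ^ (-(4 * (1 - b))) := by gcongr
          _ ≤ _ := h3
          _ ≤ 2 ^ q1 * l := hψn
          _ ≤ _ := le_mul_of_one_le_right (by positivity) (one_le_pow₀ hP1)
      · have h3 := siegel_F4 a2 a1 b2 b1 hg (by linarith : 7/8 ≤ b) hb1 hz
        have e1 : 8 * (109 * (105 * (N:ℝ)) ^ 3) = D * (N:ℝ) ^ 3 := by rw [hD]; ring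
        rw [e1] at h3
        have h4 := hDN (D * (N:ℝ) ^ 3) (by rw [hD]; nlinarith) le_rfl
        calc (1 - b) / 6 * (D * (N:ℝ) ^ 3) ^ (-(4 * e))
            ≤ (1 - b) / 6 * (D * (N:ℝ) ^ 3) ^ (-(4 * (1 - b))) := by gcongr
          _ ≤ _ := h3
          _ ≤ P * (2 ^ q1 * l) * P := by
            gcongr
            · exact hLb _ a1
            · exact hLb _ hg
          _ = _ := by ring
    have e2 : (D * (N:ℝ) ^ 3) ^ (-(4 * e)) = D ^ (-(4 * e)) * (N:ℝ) ^ (-(12 * e)) := by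
      rw [Real.mul_rpow (by positivity) (by positivity), ← Real.rpow_natCast,
        ← Real.rpow_mul (by linarith)]
      congr 2; push_cast; ring
    have e3 : P ^ 2 = K ^ 2 * 2 ^ (4 * e) * (N:ℝ) ^ (4 * e) := by
      rw [hP, mul_pow, ← Real.rpow_natCast ((2 * (N:ℝ)) ^ (2 * e)), ← Real.rpow_mul (by linarith),
        Real.mul_rpow (by norm_num) (by linarith)]
      push_cast
      rw [show 2 * e * 2 = 4 * e by ring]; ring
    rw [e2, e3] at key
    have e4 : (N:ℝ) ^ (-(16 * e)) * (N:ℝ) ^ (4 * e) = (N:ℝ) ^ (-(12 * e)) := by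
      rw [← Real.rpow_add (by linarith)]; congr 1; ring
    rw [← e4] at key
    have hNp : 0 < (N:ℝ) ^ (4 * e) := by positivity
    have key2 : (1 - b) / 6 * D ^ (-(4 * e)) * (N:ℝ) ^ (-(16 * e)) ≤
        l * (2 ^ q1 * K ^ 2 * 2 ^ (4 * e)) := by
      refine le_of_mul_le_mul_right ?_ hNp
      calc _ = (1 - b) / 6 * (D ^ (-(4 * e)) * ((N:ℝ) ^ (-(16 * e)) * (N:ℝ) ^ (4 * e))) := by ring
        _ ≤ _ := key
        _ = _ := by ring
    have e5 : ((q1:ℝ)*q2)^(-(16*e)) = (q1:ℝ)^(-(16*e)) * (q2:ℝ)^(-(16*e)) :=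
      Real.mul_rpow (by linarith) (by linarith)
    rw [hNr, e5] at key2
    have hq2e : (q2:ℝ) ^ (-ε) ≤ (q2:ℝ) ^ (-(16 * e)) :=
      Real.rpow_le_rpow_of_exponent_le hq2r (by linarith)
    rw [div_mul_eq_mul_div, div_le_iff₀ (by positivity)]
    calc _ ≤ (1 - b) / 6 * D ^ (-(4 * e)) * (q1:ℝ) ^ (-(16 * e)) * (q2:ℝ) ^ (-(16 * e)) := by gcongr
      _ = (1 - b) / 6 * D ^ (-(4 * e)) * ((q1:ℝ) ^ (-(16 * e)) * (q2:ℝ) ^ (-(16 * e))) := by ring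
      _ ≤ _ := key2

end Siegel

end CM

end

section

open Complex Filter Topology MeasureTheory
namespace CM

lemma TT_mono {q : ℕ} {t t' : ℝ} (h : |t| ≤ |t'|) : TT q t ≤ TT q t' := by
  unfold TT; gcongr

lemma TT_near {q : ℕ} {t t' : ℝ} (h : |t'| ≤ 2 * |t| + 1) : TT q t' ≤ 2 * TT q t := by
  unfold TT
  have : (0:ℝ) ≤ q := Nat.cast_nonneg q
  nlinarith

lemma LFun_bd {δ : ℝ} (hδ : 0 < δ) (hδ2 : δ ≤ 1/2) {q : ℕ} [NeZero q]
    (χ : DirichletCharacter ℂ q) (s : ℂ) (hs : χ ≠ 1 ∨ 1/2 ≤ ‖s - 1‖)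
    (h1 : 1 - δ ≤ s.re) (h4 : s.re ≤ 4) :
    ‖DirichletCharacter.LFunction χ s‖ ≤ (4 / δ + 24) * TT q s.im ^ (2 * δ) := by
  have hT : (1:ℝ) ≤ TT q s.im ^ (2 * δ) :=
    Real.one_le_rpow (by linarith [two_le_TT q s.im]) (by linarith)
  rcases hs with hs | hs
  · refine (LFun_bound' hδ hδ2 hs s h1 h4).trans ?_
    nlinarith
  · have hne : s ≠ 1 := by rintro rfl; norm_num at hs
    have := LFun_bound hδ hδ2 χ s h1 h4 hne
    have hk : ‖((kap χ : ℝ) : ℂ) / (s - 1)‖ ≤ 2 := by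
      rw [norm_div, Complex.norm_real, Real.norm_of_nonneg (kap_nonneg _)]
      rw [div_le_iff₀ (by linarith)]
      linarith [kap_le_one χ]
    have h3 := norm_add_le (DirichletCharacter.LFunction χ s - ((kap χ : ℝ) : ℂ) / (s - 1))
        (((kap χ : ℝ) : ℂ) / (s - 1))
    rw [sub_add_cancel] at h3
    nlinarith

lemma LFun_nhd {δ : ℝ} (hδ : 0 < δ) (hδ2 : δ ≤ 1/2) {q : ℕ} [NeZero q]
    (χ : DirichletCharacter ℂ q) (s : ℂ) (hs : χ ≠ 1 ∨ 1 ≤ ‖s - 1‖)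
    (h1 : 1 ≤ s.re) (h4 : s.re ≤ 3) {z : ℂ} (hz : ‖z - s‖ ≤ δ) :
    DifferentiableAt ℂ (DirichletCharacter.LFunction χ) z ∧
    ‖DirichletCharacter.LFunction χ z‖ ≤ (4 / δ + 24) * (2 * TT q s.im) ^ (2 * δ) := by
  have hre : |(z - s).re| ≤ δ := (Complex.abs_re_le_norm _).trans hz
  have him : |(z - s).im| ≤ δ := (Complex.abs_im_le_norm _).trans hz
  simp only [Complex.sub_re, Complex.sub_im, abs_le] at hre him
  have hs' : χ ≠ 1 ∨ 1/2 ≤ ‖z - 1‖ := by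
    refine hs.imp id fun h => ?_
    have := norm_sub_le_norm_sub_add_norm_sub s z 1
    rw [norm_sub_rev s z] at this
    linarith
  constructor
  · rcases hs' with h | h
    · exact (DirichletCharacter.differentiable_LFunction h) z
    · refine DirichletCharacter.differentiableAt_LFunction χ z (Or.inl ?_)
      rintro rfl; norm_num at h
  · refine (LFun_bd hδ hδ2 χ z hs' (by linarith) (by linarith)).trans ?_
    have : TT q z.im ≤ 2 * TT q s.im := by
      apply TT_near
      have := abs_sub_abs_le_abs_sub z.im s.im
      have : |z.im - s.im| ≤ δ := abs_le.2 him
      have := abs_nonneg s.im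
      linarith
    have h0 : 0 ≤ TT q z.im := by linarith [two_le_TT q z.im]
    gcongr

lemma LFun_deriv_bd {δ : ℝ} (hδ : 0 < δ) (hδ2 : δ ≤ 1/2) {q : ℕ} [NeZero q]
    (χ : DirichletCharacter ℂ q) (s : ℂ) (hs : χ ≠ 1 ∨ 1 ≤ ‖s - 1‖)
    (h1 : 1 ≤ s.re) (h4 : s.re ≤ 3) :
    ‖deriv (DirichletCharacter.LFunction χ) s‖ ≤
      (4 / δ + 24) * (2 * TT q s.im) ^ (2 * δ) / δ := by
  refine Complex.norm_deriv_le_of_forall_mem_sphere_norm_le hδ ?_ ?_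
  · refine DifferentiableOn.diffContOnCl fun z hz => ?_
    rw [closure_ball _ hδ.ne', Metric.mem_closedBall, dist_eq_norm] at hz
    exact (LFun_nhd hδ hδ2 χ s hs h1 h4 hz).1.differentiableWithinAt
  · intro z hz
    rw [mem_sphere_iff_norm] at hz
    exact (LFun_nhd hδ hδ2 χ s hs h1 h4 hz.le).2

/-- Horizontal mean value inequality. -/
lemma horiz {f : ℂ → ℂ} {s w : ℂ} {D : ℝ} (hf : ∀ z ∈ segment ℝ s w, DifferentiableAt ℂ f z)
    (hD : ∀ z ∈ segment ℝ s w, ‖deriv f z‖ ≤ D) : ‖f w‖ - D * ‖w - s‖ ≤ ‖f s‖ := by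
  have h1 := Convex.norm_image_sub_le_of_norm_deriv_le hf hD (convex_segment s w)
    (left_mem_segment ℝ s w) (right_mem_segment ℝ s w)
  have := norm_sub_norm_le (f w) (f s)
  linarith

lemma low_generic {q : ℕ} [NeZero q] (χ : DirichletCharacter ℂ q) {s : ℂ} {D P E : ℝ}
    (hD1 : 1 ≤ D) (hP1 : 1 ≤ P) (hE1 : 1 ≤ E) (hs1 : 1 < s.re) (hs2 : s.re ≤ 2)
    (hP : ∀ x : ℝ, s.re ≤ 1 + x → x ≤ 1 →
      ‖DirichletCharacter.LFunction (χ ^ 2) (1 + x + 2 * I * s.im)‖ ≤ P)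
    (hE : ∀ x : ℝ, 0 < x → x ≤ 1 →
      ‖DirichletCharacter.LFunction (1 : DirichletCharacter ℂ q) (1 + x)‖ ≤ E / x)
    (hd : ∀ z : ℂ, s.re ≤ z.re → z.re ≤ 2 → z.im = s.im →
      DifferentiableAt ℂ (DirichletCharacter.LFunction χ) z ∧
      ‖deriv (DirichletCharacter.LFunction χ) z‖ ≤ D) :
    1 / (16 * E ^ 3 * P * D ^ 3) ≤ ‖DirichletCharacter.LFunction χ s‖ := by
  have key : ∀ x : ℝ, s.re ≤ 1 + x → x ≤ 1 →
      x ^ 3 ≤ E ^ 3 * P * ‖DirichletCharacter.LFunction χ (1 + x + I * s.im)‖ ^ 4 := by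
    intro x hx hx1
    have hx0 : 0 < x := by linarith
    have h := χ.norm_LFunction_product_ge_one hx0 s.im
    rw [norm_mul, norm_mul, norm_pow, norm_pow] at h
    unfold DirichletCharacter.LFunctionTrivChar at h
    have h1 := hE x hx0 hx1
    have h2 := hP x hx hx1
    have h3 : 1 ≤ (E / x) ^ 3 * ‖DirichletCharacter.LFunction χ (1 + x + I * s.im)‖ ^ 4 * P := by
      refine h.le.trans ?_
      gcongr
    rw [div_pow, div_mul_eq_mul_div, div_mul_eq_mul_div, le_div_iff₀ (by positivity)] at h3
    linarith
  set ρ : ℝ := 1 / (16 * E ^ 3 * P * D ^ 4) with hρ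
  have hE3 : 1 ≤ E ^ 3 := one_le_pow₀ hE1
  have hD4 : 1 ≤ D ^ 4 := one_le_pow₀ hD1
  have hρ0 : 0 < ρ := by positivity
  have hρ1 : ρ ≤ 1 := by
    rw [hρ, div_le_one (by positivity)]
    have : 1 ≤ E ^ 3 * P := one_le_mul_of_one_le_of_one_le hE3 hP1
    have : 1 ≤ E ^ 3 * P * D ^ 4 := one_le_mul_of_one_le_of_one_le this hD4
    nlinarith
  have hgoal : 1 / (16 * E ^ 3 * P * D ^ 3) = ρ * D := by
    rw [hρ]; field_simp
  rw [hgoal]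
  have key2 : ∀ x : ℝ, s.re ≤ 1 + x → ρ ≤ x → x ≤ 1 →
      2 * ρ * D ≤ ‖DirichletCharacter.LFunction χ (1 + x + I * s.im)‖ := by
    intro x hx hxρ hx1
    have h := key x hx hx1
    have h4 : (2 * ρ * D) ^ 4 ≤ ‖DirichletCharacter.LFunction χ (1 + x + I * s.im)‖ ^ 4 := by
      have e1 : E ^ 3 * P * (2 * ρ * D) ^ 4 = ρ ^ 3 := by
        rw [hρ]; field_simp; norm_num
      have e2 : ρ ^ 3 ≤ x ^ 3 := by gcongr
      have e3 : 0 < E ^ 3 * P := by positivity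
      exact le_of_mul_le_mul_left (by linarith) e3
    exact le_of_pow_le_pow_left₀ (by norm_num) (norm_nonneg _) h4
  by_cases hc : ρ ≤ s.re - 1
  · have := key2 (s.re - 1) (by linarith) hc (by linarith)
    have e : (1 + ((s.re - 1 : ℝ) : ℂ) + I * s.im) = s := by
      apply Complex.ext <;> simp
    rw [e] at this
    have : 0 < ρ * D := by positivity
    linarith
  · push Not at hc
    have h2 := key2 ρ (by linarith) le_rfl hρ1
    set w : ℂ := 1 + ρ + I * s.im with hw
    have hwre : w.re = 1 + ρ := by simp [hw]
    have hwim : w.im = s.im := by simp [hw]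
    have hseg : ∀ z ∈ segment ℝ s w, s.re ≤ z.re ∧ z.re ≤ 2 ∧ z.im = s.im := by
      rintro z ⟨a, b, ha, hb, hab, rfl⟩
      simp only [Complex.add_re, Complex.add_im, Complex.real_smul, Complex.mul_re, Complex.mul_im,
        Complex.ofReal_re, Complex.ofReal_im, hwre, hwim]
      refine ⟨?_, ?_, ?_⟩
      · have : a = 1 - b := by linarith
        subst this; nlinarith
      · have : a = 1 - b := by linarith
        subst this; nlinarith
      · have : a = 1 - b := by linarith
        subst this; ring
    have h3 := horiz (f := DirichletCharacter.LFunction χ) (s := s) (w := w) (D := D)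
      (fun z hz => (hd z (hseg z hz).1 (hseg z hz).2.1 (hseg z hz).2.2).1)
      (fun z hz => (hd z (hseg z hz).1 (hseg z hz).2.1 (hseg z hz).2.2).2)
    have h4 : ‖w - s‖ ≤ ρ := by
      have : w - s = ((1 + ρ - s.re : ℝ) : ℂ) := by
        apply Complex.ext <;> simp [hwre, hwim]
      rw [this, Complex.norm_real, Real.norm_of_nonneg (by linarith)]
      linarith
    nlinarith

lemma two_mul_rpow_le {T δ : ℝ} (hT : 0 ≤ T) (hδ2 : δ ≤ 1/2) :
    (2 * T) ^ (2 * δ) ≤ 2 * T ^ (2 * δ) := by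
  rw [Real.mul_rpow (by norm_num) hT]
  have : (2:ℝ) ^ (2 * δ) ≤ 2 ^ (1:ℝ) := Real.rpow_le_rpow_of_exponent_le (by norm_num) (by linarith)
  rw [Real.rpow_one] at this
  gcongr

set_option maxHeartbeats 1000000 in
theorem LFun_low {ε : ℝ} (hε : 0 < ε) : ∃ c : ℝ, 0 < c ∧ ∀ (q : ℕ) [NeZero q]
    (χ : DirichletCharacter ℂ q) (s : ℂ), 1 < s.re → s.re ≤ 2 → (χ ≠ 1 ∨ 1 ≤ |s.im|) →
      c * TT q s.im ^ (-ε) ≤ ‖DirichletCharacter.LFunction χ s‖ := by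
  obtain ⟨δ, hδ, hδε, hδ2⟩ : ∃ e : ℝ, 0 < e ∧ 15 * e ≤ ε ∧ e ≤ 1/2 :=
    ⟨min (ε/15) (1/2), by positivity, by linarith [min_le_left (ε/15) (1/2)], min_le_right _ _⟩
  obtain ⟨c0, hc0, hsieg⟩ := siegel hδ
  set k : ℝ := 4 / δ + 24 with hk
  have hk1 : 24 ≤ k := by have : 0 < 4 / δ := by positivity
                          linarith
  set K : ℝ := k * 2 / δ with hK
  have hkK : 2 * k ≤ K := by rw [hK, le_div_iff₀ hδ]; nlinarith
  have hK1 : 1 ≤ K := by linarith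
  set K' : ℝ := K + 2 * K / c0 with hK'
  have hKK' : K ≤ K' := by have : 0 < 2 * K / c0 := by positivity
                           linarith
  refine ⟨min (1 / (16 * K ^ 6 * K')) (c0 / 2), by positivity, ?_⟩
  intro q _ χ s h1 h2 hs
  have hT2 := two_le_TT q s.im
  set T := TT q s.im with hT
  have hT0 : 0 < T := by linarith
  have h2T := two_mul_rpow_le hT0.le hδ2
  have hTp : ∀ {a b : ℝ}, a ≤ b → T ^ a ≤ T ^ b := fun h =>
    Real.rpow_le_rpow_of_exponent_le (by linarith) h
  have hTd1 : 1 ≤ T ^ (2 * δ) := Real.one_le_rpow (by linarith) (by linarith)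
  -- derivative bound
  have hder : ∀ z : ℂ, 1 ≤ z.re → z.re ≤ 2 → |z.im| ≤ |s.im| → (χ ≠ 1 ∨ 1 ≤ |z.im|) →
      DifferentiableAt ℂ (DirichletCharacter.LFunction χ) z ∧
      ‖deriv (DirichletCharacter.LFunction χ) z‖ ≤ K * T ^ (2 * δ) := by
    intro z hz1 hz2 him hz
    have hz' : χ ≠ 1 ∨ 1 ≤ ‖z - 1‖ := hz.imp id fun h => by
      have := Complex.abs_im_le_norm (z - 1)
      simp at this; linarith
    refine ⟨(LFun_nhd hδ hδ2 χ z hz' hz1 (by linarith) (z := z) (by simp [hδ.le])).1, ?_⟩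
    refine (LFun_deriv_bd hδ hδ2 χ z hz' hz1 (by linarith)).trans ?_
    have hTz : TT q z.im ≤ T := TT_mono him
    have hTz0 : 0 ≤ TT q z.im := by linarith [two_le_TT q z.im]
    have : (2 * TT q z.im) ^ (2 * δ) ≤ 2 * T ^ (2 * δ) := by
      refine le_trans ?_ h2T
      gcongr
    rw [hK]
    calc _ ≤ k * (2 * T ^ (2 * δ)) / δ := by gcongr
      _ = _ := by ring
  -- main dichotomy
  have hmain : (∀ x : ℝ, s.re ≤ 1 + x → x ≤ 1 →
      ‖DirichletCharacter.LFunction (χ ^ 2) (1 + x + 2 * I * s.im)‖ ≤ K' * T ^ (3 * δ)) →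
      1 / (16 * K ^ 6 * K') * T ^ (-ε) ≤ ‖DirichletCharacter.LFunction χ s‖ := by
    intro hP
    have := low_generic χ (s := s) (D := K * T ^ (2 * δ)) (P := K' * T ^ (3 * δ))
      (E := K * T ^ (2 * δ)) (by nlinarith)
      (one_le_mul_of_one_le_of_one_le (hK1.trans hKK') (Real.one_le_rpow (by linarith) (by linarith)))
      (by nlinarith) h1 h2 hP ?_ ?_
    · refine le_trans ?_ this
      have e1 : 16 * (K * T ^ (2 * δ)) ^ 3 * (K' * T ^ (3 * δ)) * (K * T ^ (2 * δ)) ^ 3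
          = 16 * K ^ 6 * K' * T ^ (15 * δ) := by
        have : T ^ (15 * δ) = (T ^ (2 * δ)) ^ 6 * T ^ (3 * δ) := by
          rw [← Real.rpow_mul_natCast hT0.le, ← Real.rpow_add hT0]
          congr 1; push_cast; ring
        rw [this]; ring
      have e2 : 1 / (16 * K ^ 6 * K' * T ^ (15 * δ)) = 1 / (16 * K ^ 6 * K') * T ^ (-(15 * δ)) := by
        rw [Real.rpow_neg hT0.le]; field_simp
      rw [e1, e2]
      have e3 : 0 ≤ 1 / (16 * K ^ 6 * K') := by positivity
      exact mul_le_mul_of_nonneg_left (hTp (by linarith)) e3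
    · intro x hx hx1
      have hb := LFun_bound hδ hδ2 (1 : DirichletCharacter ℂ q) (1 + x) (by simp; linarith)
        (by simp; linarith) (by simpa using hx.ne')
      have hk0 : ‖((kap (1 : DirichletCharacter ℂ q) : ℝ) : ℂ) / (1 + x - 1)‖ ≤ 1 / x := by
        rw [add_sub_cancel_left, norm_div, Complex.norm_real, Complex.norm_real,
          Real.norm_of_nonneg (kap_nonneg _), Real.norm_of_nonneg hx.le]
        have := kap_le_one (1 : DirichletCharacter ℂ q)
        gcongr
      have h3 := norm_add_le (DirichletCharacter.LFunction (1 : DirichletCharacter ℂ q) (1 + x)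
        - ((kap (1 : DirichletCharacter ℂ q) : ℝ) : ℂ) / (1 + x - 1))
        (((kap (1 : DirichletCharacter ℂ q) : ℝ) : ℂ) / (1 + x - 1))
      rw [sub_add_cancel] at h3
      have hT1 : TT q (1 + (x:ℂ)).im ^ (2 * δ) ≤ T ^ (2 * δ) := by
        have : TT q (1 + (x:ℂ)).im ≤ T := TT_mono (by simp)
        have := two_le_TT q (1 + (x:ℂ)).im
        gcongr
      have h5 : (4 / δ + 22) * T ^ (2 * δ) ≤ (4 / δ + 22) * T ^ (2 * δ) / x := by
        rw [le_div_iff₀ hx]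
        have : 0 < (4 / δ + 22) * T ^ (2 * δ) := by positivity
        nlinarith
      calc _ ≤ (4 / δ + 22) * TT q (1 + (x:ℂ)).im ^ (2 * δ) + 1 / x := by linarith
        _ ≤ (4 / δ + 22) * T ^ (2 * δ) + 1 / x := by gcongr
        _ ≤ (4 / δ + 22) * T ^ (2 * δ) / x + T ^ (2 * δ) / x := by
            refine add_le_add h5 ?_
            gcongr
        _ = ((k - 1) * T ^ (2 * δ)) / x := by rw [hk]; ring
        _ ≤ _ := by gcongr; linarith
    · intro z hz1 hz2 him
      exact hder z (by linarith) hz2 (by rw [him]) (by rw [him]; exact hs)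
  have hTneg : 0 < T ^ (-ε) := by positivity
  have hd23 : T ^ (2 * δ) ≤ T ^ (3 * δ) := hTp (by linarith)
  have hTT2 : ∀ x : ℝ, TT q ((1:ℂ) + x + 2 * I * s.im).im ^ (2 * δ) ≤ 2 * T ^ (2 * δ) := by
    intro x
    refine le_trans ?_ h2T
    have h1 : TT q ((1:ℂ) + x + 2 * I * s.im).im ≤ 2 * T := by
      apply TT_near
      simp [abs_mul]
    have := two_le_TT q ((1:ℂ) + x + 2 * I * s.im).im
    gcongr
  by_cases hA : χ ^ 2 ≠ 1 ∨ 1 ≤ |s.im|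
  · refine le_trans ?_ (hmain ?_)
    · gcongr; exact min_le_left _ _
    · intro x hx hx1
      refine (LFun_bd hδ hδ2 (χ ^ 2) _ ?_ (by simp; linarith) (by simp; linarith)).trans ?_
      · refine hA.imp id fun h => ?_
        have := Complex.abs_im_le_norm ((1:ℂ) + x + 2 * I * s.im - 1)
        simp [abs_mul] at this
        simp; linarith
      · calc _ ≤ k * (2 * T ^ (2 * δ)) := by rw [← hk]; gcongr; exact hTT2 x
          _ = (2 * k) * T ^ (2 * δ) := by ring
          _ ≤ K' * T ^ (3 * δ) := by gcongr; linarith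
  · push Not at hA
    obtain ⟨hχ2, hs1⟩ := hA
    have hχ : χ ≠ 1 := hs.resolve_right (by linarith)
    set τ : ℝ := c0 / (2 * K) * T ^ (-(3 * δ)) with hτ
    have hτ0 : 0 < τ := by positivity
    by_cases hB : ‖s - 1‖ ≤ τ
    · have hS := hsieg q χ hχ2 hχ
      have hqT : T ^ (-δ) ≤ (q:ℝ) ^ (-δ) := by
        have hq : (1:ℝ) ≤ q := by exact_mod_cast Nat.pos_of_neZero q
        refine Real.rpow_le_rpow_of_nonpos (by linarith) ?_ (by linarith)
        rw [hT]; unfold TT; nlinarith [abs_nonneg s.im]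
      have hseg : ∀ z ∈ segment ℝ s 1, 1 ≤ z.re ∧ z.re ≤ 2 ∧ |z.im| ≤ |s.im| := by
        rintro z ⟨a, b, ha, hb, hab, rfl⟩
        simp only [Complex.add_re, Complex.add_im, Complex.real_smul, Complex.mul_re,
          Complex.mul_im, Complex.ofReal_re, Complex.ofReal_im, Complex.one_re, Complex.one_im]
        have : b = 1 - a := by linarith
        subst this
        refine ⟨by nlinarith, by nlinarith, ?_⟩
        simp only [zero_mul, add_zero, mul_zero, abs_mul, abs_of_nonneg ha]
        have := abs_nonneg s.im
        nlinarith
      have h3 := horiz (f := DirichletCharacter.LFunction χ) (s := s) (w := 1)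
        (D := K * T ^ (2 * δ))
        (fun z hz => (hder z (hseg z hz).1 (hseg z hz).2.1 (hseg z hz).2.2 (Or.inl hχ)).1)
        (fun z hz => (hder z (hseg z hz).1 (hseg z hz).2.1 (hseg z hz).2.2 (Or.inl hχ)).2)
      rw [norm_sub_rev] at h3
      have h4 : K * T ^ (2 * δ) * ‖s - 1‖ ≤ c0 / 2 * T ^ (-δ) := by
        calc _ ≤ K * T ^ (2 * δ) * τ := by gcongr
          _ = c0 / 2 * (T ^ (2 * δ) * T ^ (-(3 * δ))) := by rw [hτ]; field_simp
          _ = _ := by rw [← Real.rpow_add hT0]; congr 2; ring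
      have h5 : T ^ (-ε) ≤ T ^ (-δ) := hTp (by linarith)
      have h6 : min (1 / (16 * K ^ 6 * K')) (c0 / 2) * T ^ (-ε) ≤ c0 / 2 * T ^ (-δ) := by
        gcongr; exact min_le_right _ _
      have h7 : c0 * T ^ (-δ) ≤ c0 * (q:ℝ) ^ (-δ) := by gcongr
      linarith
    · push Not at hB
      refine le_trans ?_ (hmain ?_)
      · gcongr; exact min_le_left _ _
      · intro x hx hx1
        have hx0 : 0 < x := by linarith
        set w : ℂ := 1 + x + 2 * I * s.im with hw
        have hwn : ‖s - 1‖ ≤ ‖w - 1‖ := by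
          refine abs_le_of_sq_le_sq' ?_ (norm_nonneg _) |>.2
          rw [← Complex.normSq_eq_norm_sq, ← Complex.normSq_eq_norm_sq, Complex.normSq_apply,
            Complex.normSq_apply]
          simp [hw]
          nlinarith [sq_nonneg s.im]
        have hb := LFun_bound hδ hδ2 (χ ^ 2) w (by simp [hw]; linarith)
          (by simp [hw]; linarith) (by
            intro h; rw [h] at hwn; simp at hwn
            rw [hwn] at hB; simp at hB; linarith)
        have hk' : ‖((kap (χ ^ 2) : ℝ) : ℂ) / (w - 1)‖ ≤ 1 / τ := by
          rw [norm_div, Complex.norm_real, Real.norm_of_nonneg (kap_nonneg _)]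
          have := kap_le_one (χ ^ 2)
          gcongr; linarith
        have h3 := norm_add_le (DirichletCharacter.LFunction (χ ^ 2) w
          - ((kap (χ ^ 2) : ℝ) : ℂ) / (w - 1)) (((kap (χ ^ 2) : ℝ) : ℂ) / (w - 1))
        rw [sub_add_cancel] at h3
        have h4 : 1 / τ = 2 * K / c0 * T ^ (3 * δ) := by
          rw [hτ, Real.rpow_neg hT0.le]; field_simp
        have h5 : (4 / δ + 22) * TT q w.im ^ (2 * δ) ≤ K * T ^ (3 * δ) := by
          calc _ ≤ k * (2 * T ^ (2 * δ)) := by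
                have := hTT2 x
                rw [← hw] at this
                have h9 := two_le_TT q w.im
                have h10 : (4 / δ + 22) ≤ k := by rw [hk]; linarith
                have h11 : 0 ≤ TT q w.im ^ (2 * δ) := Real.rpow_nonneg (by linarith) _
                exact mul_le_mul h10 this h11 (by linarith)
            _ = (2 * k) * T ^ (2 * δ) := by ring
            _ ≤ K * T ^ (3 * δ) := by gcongr
        rw [hK', add_mul]
        linarith

end CM

end

section

open Complex Filter Topology MeasureTheory
namespace CM

section LogDeriv

lemma logderiv_bound {f : ℂ → ℂ} {s : ℂ} {R M m : ℝ} (hR : 0 < R) (hm : 0 < m) (hmM : m ≤ M)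
    (hf : ∀ z, ‖z - s‖ ≤ R → DifferentiableAt ℂ f z) (hM : ∀ z, ‖z - s‖ ≤ R → ‖f z‖ ≤ M)
    (hs : m ≤ ‖f s‖) (k : ℕ) :
    ‖iteratedDeriv k (fun z => deriv f z / f z) s‖ ≤ k.factorial * (4 * M / (m * R)) ^ (k + 1) := by
  set r := m * R / (4 * M) with hr
  have hM0 : 0 < M := by linarith
  have hr0 : 0 < r := by positivity
  have hrR : r ≤ R / 4 := by
    rw [hr, div_le_iff₀ (by positivity)]; nlinarith
  have hd : ∀ z, ‖z - s‖ ≤ R / 2 → ‖deriv f z‖ ≤ 2 * M / R := by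
    intro z hz
    have : ‖deriv f z‖ ≤ M / (R / 2) := by
      refine Complex.norm_deriv_le_of_forall_mem_sphere_norm_le (by positivity) ?_ ?_
      · refine DifferentiableOn.diffContOnCl fun w hw => ?_
        rw [closure_ball _ (by positivity), Metric.mem_closedBall, dist_eq_norm] at hw
        have := norm_sub_le_norm_sub_add_norm_sub w z s
        exact (hf w (by linarith)).differentiableWithinAt
      · intro w hw
        rw [mem_sphere_iff_norm] at hw
        have := norm_sub_le_norm_sub_add_norm_sub w z s
        exact hM w (by linarith)
    refine this.trans (le_of_eq ?_)
    field_simp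
  have hlow : ∀ z, ‖z - s‖ ≤ r → m / 2 ≤ ‖f z‖ := by
    intro z hz
    have hseg : ∀ w ∈ segment ℝ z s, ‖w - s‖ ≤ r := by
      intro w hw
      have h1 : z ∈ Metric.closedBall s r := by rwa [mem_closedBall_iff_norm]
      have h2 : s ∈ Metric.closedBall s r := Metric.mem_closedBall_self hr0.le
      have := (convex_closedBall s r).segment_subset h1 h2 hw
      rwa [mem_closedBall_iff_norm] at this
    have := horiz (f := f) (s := z) (w := s) (D := 2 * M / R)
      (fun w hw => hf w (by linarith [hseg w hw])) (fun w hw => hd w (by linarith [hseg w hw]))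
    rw [norm_sub_rev] at this
    have h2 : 2 * M / R * ‖z - s‖ ≤ m / 2 := by
      calc _ ≤ 2 * M / R * r := by gcongr
        _ = m / 2 := by rw [hr]; field_simp; norm_num
    linarith
  have key := Complex.norm_iteratedDeriv_le_of_forall_mem_sphere_norm_le (c := s) (R := r)
    (C := 1 / r) (f := fun z => deriv f z / f z) k hr0 ?_ ?_
  · refine key.trans (le_of_eq ?_)
    have : 4 * M / (m * R) = 1 / r := by rw [hr]; field_simp
    rw [this, mul_div_assoc, one_div_pow, pow_succ]
    field_simp
  · refine DifferentiableOn.diffContOnCl fun w hw => ?_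
    rw [closure_ball _ hr0.ne', Metric.mem_closedBall, dist_eq_norm] at hw
    have h1 := hlow w hw
    have ho : IsOpen (Metric.ball s R) := Metric.isOpen_ball
    have hdo : DifferentiableOn ℂ f (Metric.ball s R) := fun z hz =>
      (hf z (by rw [mem_ball_iff_norm] at hz; exact hz.le)).differentiableWithinAt
    have hwm : w ∈ Metric.ball s R := by rw [mem_ball_iff_norm]; linarith
    have h2 : DifferentiableAt ℂ (deriv f) w :=
      (hdo.deriv ho).differentiableAt (ho.mem_nhds hwm)
    refine (h2.div (hf w (by linarith)) ?_).differentiableWithinAt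
    intro h; rw [h, norm_zero] at h1; linarith
  · intro z hz
    rw [mem_sphere_iff_norm] at hz
    rw [norm_div]
    have h1 := hlow z hz.le
    have h2 := hd z (by linarith)
    calc _ ≤ (2 * M / R) / (m / 2) := by gcongr
      _ = 1 / r := by rw [hr]; field_simp; norm_num

end LogDeriv

section Perron

noncomputable def pk (u : ℝ) : ℂ :=
  Set.indicator (Set.Ioc 0 1) (fun _ => 1 : ℝ → ℂ) u -
    Set.indicator (Set.Ioc 0 1) (fun t => (t:ℂ) ^ (1:ℂ) : ℝ → ℂ) u

lemma pk_eq {u : ℝ} (hu : 0 < u) : pk u = ((max (1 - u) 0 : ℝ) : ℂ) := by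
  unfold pk
  simp only [Set.indicator_apply, Set.mem_Ioc, hu, true_and]
  split_ifs with h
  · rw [max_eq_left (by linarith)]; simp
  · rw [max_eq_right (by linarith)]; simp

lemma pk_mellin {s : ℂ} (hs : 0 < s.re) : HasMellin pk s (1 / (s * (s + 1))) := by
  have h1 := hasMellin_one_Ioc hs
  have h2 := hasMellin_cpow_Ioc 1 (s := s) (by simp; linarith)
  have h3 := hasMellin_sub h1.1 h2.1
  rw [h1.2, h2.2] at h3
  have hs0 : s ≠ 0 := by intro h; simp [h] at hs
  have hs1 : s + 1 ≠ 0 := by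
    intro h; have := congrArg Complex.re h; simp at this; linarith
  have e : 1 / s - 1 / (s + 1) = 1 / (s * (s + 1)) := by field_simp; ring
  rw [e] at h3
  exact h3

lemma W_bound {σ : ℝ} (hσ : 1 ≤ σ) (t : ℝ) :
    ‖1 / (((σ:ℂ) + t * I) * ((σ:ℂ) + t * I + 1))‖ ≤ (1 + t ^ 2)⁻¹ := by
  rw [norm_div, norm_one, norm_mul, one_div]
  apply inv_anti₀ (by positivity)
  have h1 : ∀ x : ℝ, 1 ≤ x → √(1 + t ^ 2) ≤ ‖(x:ℂ) + t * I‖ := by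
    intro x hx
    rw [Complex.norm_add_mul_I]
    apply Real.sqrt_le_sqrt; nlinarith
  have h2 := h1 σ hσ
  have h3 := h1 (σ + 1) (by linarith)
  have e : ((σ + 1 : ℝ) : ℂ) + t * I = (σ:ℂ) + t * I + 1 := by push_cast; ring
  rw [e] at h3
  calc 1 + t ^ 2 = √(1 + t ^ 2) * √(1 + t ^ 2) := (Real.mul_self_sqrt (by positivity)).symm
    _ ≤ _ := by gcongr

lemma W_cont {σ : ℝ} (hσ : 1 ≤ σ) :
    Continuous fun t : ℝ => 1 / (((σ:ℂ) + t * I) * ((σ:ℂ) + t * I + 1)) := by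
  refine Continuous.div continuous_const (by fun_prop) ?_
  intro t
  refine mul_ne_zero ?_ ?_ <;>
  · intro h; have := congrArg Complex.re h; simp at this; linarith

lemma W_int {σ : ℝ} (hσ : 1 ≤ σ) :
    Integrable fun t : ℝ => 1 / (((σ:ℂ) + t * I) * ((σ:ℂ) + t * I + 1)) :=
  integrable_inv_one_add_sq.mono' (W_cont hσ).aestronglyMeasurable
    (Eventually.of_forall fun t => W_bound hσ t)

lemma pk_inv {σ : ℝ} (hσ : 1 ≤ σ) {u : ℝ} (hu : 0 < u) :
    ∫ t : ℝ, (u:ℂ) ^ (-((σ:ℂ) + t * I)) * (1 / (((σ:ℂ) + t * I) * ((σ:ℂ) + t * I + 1)))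
      = 2 * Real.pi * pk u := by
  have hm : ∀ t : ℝ, mellin pk ((σ:ℂ) + t * I) = 1 / (((σ:ℂ) + t * I) * ((σ:ℂ) + t * I + 1)) :=
    fun t => (pk_mellin (by simp; linarith)).2
  have h := mellinInv_mellin_eq σ pk hu (pk_mellin (by simp; linarith)).1 ?_ ?_
  · unfold mellinInv at h
    simp only [hm, smul_eq_mul] at h
    rw [← h, Complex.real_smul, ← mul_assoc]
    have : (2 * (Real.pi:ℂ)) * ((1 / (2 * Real.pi) : ℝ) : ℂ) = 1 := by
      have h0 : (Real.pi : ℂ) ≠ 0 := by exact_mod_cast Real.pi_ne_zero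
      push_cast; field_simp
    rw [this, one_mul]
  · unfold VerticalIntegrable
    simp only [hm]
    exact W_int hσ
  · have : (fun u : ℝ => ((max (1 - u) 0 : ℝ) : ℂ)) =ᶠ[𝓝 u] pk := by
      filter_upwards [lt_mem_nhds hu] with v hv using (pk_eq hv).symm
    refine ContinuousAt.congr ?_ this
    fun_prop

/-- weight integral constant -/
noncomputable def PC : ℝ := ∫ t : ℝ, 2 * ((1:ℝ) + ‖t‖ ^ 2) ^ (-(3/2 : ℝ) / 2)

lemma PC_int : Integrable fun t : ℝ => 2 * ((1:ℝ) + ‖t‖ ^ 2) ^ (-(3/2 : ℝ) / 2) :=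
  (integrable_rpow_neg_one_add_norm_sq (by norm_num)).const_mul 2

lemma PC_nonneg : 0 ≤ PC := integral_nonneg fun t => by positivity

lemma PC_weight (t : ℝ) : (|t| + 2) ^ (1/2 : ℝ) * (1 + t ^ 2)⁻¹ ≤
    2 * ((1:ℝ) + ‖t‖ ^ 2) ^ (-(3/2 : ℝ) / 2) := by
  rw [Real.norm_eq_abs, sq_abs]
  have h0 : (0:ℝ) < 1 + t ^ 2 := by positivity
  have h1 : (|t| + 2) ^ (1/2 : ℝ) ≤ 2 * (1 + t ^ 2) ^ (1/4 : ℝ) := by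
    have e : 2 * (1 + t ^ 2) ^ (1/4 : ℝ) = (16 * (1 + t ^ 2)) ^ (1/4 : ℝ) := by
      rw [Real.mul_rpow (by norm_num) h0.le]
      congr 1
      rw [show (16:ℝ) = 2 ^ (4:ℝ) by norm_num, ← Real.rpow_mul (by norm_num)]; norm_num
    have e2 : (|t| + 2) ^ (1/2 : ℝ) = ((|t| + 2) ^ 2) ^ (1/4 : ℝ) := by
      rw [← Real.rpow_natCast, ← Real.rpow_mul (by positivity)]; norm_num
    rw [e, e2]
    gcongr
    nlinarith [sq_abs t, sq_nonneg (|t| - 1), abs_nonneg t]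
  calc _ ≤ 2 * (1 + t ^ 2) ^ (1/4 : ℝ) * (1 + t ^ 2)⁻¹ := by gcongr
    _ = 2 * ((1 + t ^ 2) ^ (1/4 : ℝ) * (1 + t ^ 2) ^ (-1 : ℝ)) := by rw [Real.rpow_neg_one]; ring
    _ = _ := by rw [← Real.rpow_add h0]; norm_num

lemma perron {a : ℕ → ℂ} {σ K : ℝ} (hσ : 1 < σ) (hs : LSeriesSummable a σ)
    (hK : ∀ t : ℝ, ‖LSeries a ((σ:ℂ) + t * I)‖ ≤ K * (|t| + 2) ^ (1/2 : ℝ)) {N : ℕ} (hN : 0 < N) :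
    ‖∑ n ∈ Finset.Icc 1 N, a n * (1 - n / N)‖ ≤ PC * K * (N:ℝ) ^ σ := by
  have hN0 : (0:ℝ) < N := by exact_mod_cast hN
  have hNc : (N:ℂ) ≠ 0 := by exact_mod_cast hN.ne'
  set W : ℝ → ℂ := fun t => 1 / (((σ:ℂ) + t * I) * ((σ:ℂ) + t * I + 1)) with hW
  set F : ℕ → ℝ → ℂ := fun n t =>
    (N:ℂ) ^ ((σ:ℂ) + t * I) * LSeries.term a ((σ:ℂ) + t * I) n * W t with hF
  have hNn : ∀ t : ℝ, ‖(N:ℂ) ^ ((σ:ℂ) + t * I)‖ = (N:ℝ) ^ σ := by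
    intro t
    rw [Complex.norm_natCast_cpow_of_pos hN]; simp
  have htn : ∀ n (t : ℝ), ‖LSeries.term a ((σ:ℂ) + t * I) n‖ = ‖LSeries.term a σ n‖ := by
    intro n t
    rw [LSeries.norm_term_eq, LSeries.norm_term_eq]; simp
  have hFn : ∀ n t, ‖F n t‖ = (N:ℝ) ^ σ * ‖LSeries.term a σ n‖ * ‖W t‖ := by
    intro n t; rw [hF]; simp only [norm_mul, hNn, htn]
  have hWi : Integrable W := W_int hσ.le
  have hFc : ∀ n, Continuous (F n) := by
    intro n
    refine (Continuous.mul ?_ ?_).mul (W_cont hσ.le)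
    · exact Continuous.const_cpow (by fun_prop) (Or.inl hNc)
    · rcases Nat.eq_zero_or_pos n with rfl | h
      · simp [LSeries.term_zero, continuous_const]
      · have hn : (n:ℂ) ≠ 0 := by exact_mod_cast h.ne'
        simp only [LSeries.term_of_ne_zero h.ne']
        refine Continuous.div continuous_const
          (Continuous.const_cpow (by fun_prop) (Or.inl hn)) ?_
        intro t; simp [Complex.cpow_eq_zero_iff, hn]
  have hFi : ∀ n, Integrable (F n) := by
    intro n
    refine (hWi.norm.const_mul ((N:ℝ) ^ σ * ‖LSeries.term a σ n‖)).mono'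
      (hFc n).aestronglyMeasurable (Eventually.of_forall fun t => (hFn n t).le)
  have hsum := hasSum_integral_of_summable_integral_norm hFi (by
    simp only [hFn, integral_const_mul]
    exact (hs.norm.mul_left _).mul_right _)
  have hFI : ∀ n, ∫ t, F n t = if n = 0 then 0 else 2 * Real.pi * (a n * pk (n / N)) := by
    intro n
    split_ifs with h
    · simp [hF, h]
    · have hn0 : (0:ℝ) < n := by exact_mod_cast Nat.pos_of_ne_zero h
      have e : ∀ t, F n t = a n * (((n / N : ℝ) : ℂ) ^ (-((σ:ℂ) + t * I)) * W t) := by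
        intro t
        have hnc : (n:ℂ) ^ ((σ:ℂ) + t * I) ≠ 0 := by
          simp [Complex.cpow_eq_zero_iff, h]
        have : ((n / N : ℝ) : ℂ) ^ (-((σ:ℂ) + t * I))
            = (N:ℂ) ^ ((σ:ℂ) + t * I) / (n:ℂ) ^ ((σ:ℂ) + t * I) := by
          rw [Complex.cpow_neg, Complex.ofReal_div, Complex.div_cpow_ofReal_nonneg hn0.le hN0.le]
          simp
        rw [this, hF]
        simp only [LSeries.term_of_ne_zero h]
        field_simp
      simp_rw [e]
      rw [integral_const_mul, hW, pk_inv hσ.le (by positivity)]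
      ring
  simp only [hFI] at hsum
  have hfin : HasSum (fun n => if n = 0 then 0 else 2 * Real.pi * (a n * pk (n / N)))
      (∑ n ∈ Finset.Icc 1 N, 2 * (Real.pi : ℂ) * (a n * (1 - n / N))) := by
    have h1 := hasSum_sum_of_ne_finset_zero (L := SummationFilter.unconditional ℕ)
      (s := Finset.Icc 1 N)
      (f := fun n : ℕ => if n = 0 then (0:ℂ) else 2 * Real.pi * (a n * pk (n / N))) (by
        intro n hn
        split_ifs with h
        · rfl
        · have h2 : (N:ℝ) < n := by
            simp at hn; exact_mod_cast hn (Nat.pos_of_ne_zero h)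
          have hn0 : (0:ℝ) < n := by linarith
          rw [pk_eq (by positivity), max_eq_right]
          · simp
          · rw [sub_nonpos, le_div_iff₀ hN0]; linarith)
    have h2 : ∑ n ∈ Finset.Icc 1 N, 2 * (Real.pi : ℂ) * (a n * (1 - n / N)) =
      ∑ n ∈ Finset.Icc 1 N, (if n = 0 then (0:ℂ) else 2 * Real.pi * (a n * pk (n / N))) := by
      refine Finset.sum_congr rfl fun n hn => ?_
      rw [Finset.mem_Icc] at hn
      rw [if_neg (by omega)]
      have hn0 : (0:ℝ) < n := by exact_mod_cast hn.1
      rw [pk_eq (by positivity), max_eq_left]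
      · push_cast; ring
      · rw [sub_nonneg, div_le_one hN0]; exact_mod_cast hn.2
    rw [h2]; exact h1
  have heq := hfin.unique hsum
  rw [← Finset.mul_sum] at heq
  have hnorm : ‖∫ t, ∑' n, F n t‖ ≤ K * (N:ℝ) ^ σ * PC := by
    rw [PC, ← integral_const_mul]
    refine norm_integral_le_of_norm_le (PC_int.const_mul _) (Eventually.of_forall fun t => ?_)
    have e : ∑' n, F n t = (N:ℂ) ^ ((σ:ℂ) + t * I) * LSeries a ((σ:ℂ) + t * I) * W t := by
      simp only [hF]
      rw [tsum_mul_right, tsum_mul_left]; rfl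
    rw [e, norm_mul, norm_mul, hNn]
    have hK0 : 0 ≤ K := by
      have := (norm_nonneg _).trans (hK t)
      by_contra h
      have : 0 < (|t| + 2) ^ (1/2 : ℝ) := by positivity
      nlinarith
    calc _ ≤ (N:ℝ) ^ σ * (K * (|t| + 2) ^ (1/2 : ℝ)) * (1 + t ^ 2)⁻¹ := by
          gcongr
          · exact hK t
          · exact W_bound hσ.le t
      _ = K * (N:ℝ) ^ σ * ((|t| + 2) ^ (1/2 : ℝ) * (1 + t ^ 2)⁻¹) := by ring
      _ ≤ _ := by
          refine mul_le_mul_of_nonneg_left (PC_weight t) (by positivity)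
  rw [← heq, norm_mul] at hnorm
  have hpi : ‖2 * (Real.pi : ℂ)‖ = 2 * Real.pi := by
    rw [norm_mul, Complex.norm_real, Real.norm_of_nonneg Real.pi_pos.le]; simp
  rw [hpi] at hnorm
  have h6 : 1 ≤ 2 * Real.pi := by linarith [Real.pi_gt_three]
  have := norm_nonneg (∑ n ∈ Finset.Icc 1 N, a n * (1 - (n:ℂ) / N))
  nlinarith

end Perron

end CM

end

section

open Complex Filter Topology MeasureTheory
namespace CM

section Abel

lemma abel_id (u b : ℕ → ℂ) {M N : ℕ} (h : M ≤ N) :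
    ∑ n ∈ Finset.Ioc M N, u n * b n = u N * ∑ n ∈ Finset.Ioc M N, b n +
      ∑ n ∈ Finset.Ico (M + 1) N, (u n - u (n + 1)) * ∑ m ∈ Finset.Ioc M n, b m := by
  induction N, h using Nat.le_induction with
  | base => simp
  | succ N hN ih =>
    rw [← Finset.insert_Ioc_right_eq_Ioc_add_one hN, Finset.sum_insert (by simp),
      Finset.sum_insert (by simp), ih]
    rcases hN.eq_or_lt with rfl | hlt
    · simp
    · rw [Finset.sum_Ico_succ_top (by omega)]
      ring

lemma abel_bd (u b : ℕ → ℂ) {M N : ℕ} (h : M ≤ N) {P : ℝ}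
    (hP : ∀ n, M ≤ n → n ≤ N → ‖∑ m ∈ Finset.Ioc M n, b m‖ ≤ P) :
    ‖∑ n ∈ Finset.Ioc M N, u n * b n‖ ≤
      P * (‖u N‖ + ∑ n ∈ Finset.Ico (M + 1) N, ‖u n - u (n + 1)‖) := by
  rw [abel_id u b h, mul_add]
  refine (norm_add_le _ _).trans (add_le_add ?_ ?_)
  · rw [norm_mul, mul_comm]
    gcongr
    exact hP N h le_rfl
  · rw [Finset.mul_sum]
    refine (norm_sum_le _ _).trans (Finset.sum_le_sum fun n hn => ?_)
    rw [Finset.mem_Ico] at hn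
    rw [norm_mul, mul_comm]
    gcongr
    exact hP n (by omega) (by omega)

lemma abel_anti (g : ℕ → ℝ) (b : ℕ → ℂ) {M N : ℕ} (h : M < N) {P : ℝ}
    (hg : ∀ n, M < n → g (n + 1) ≤ g n) (hg0 : 0 ≤ g N)
    (hP : ∀ n, M ≤ n → n ≤ N → ‖∑ m ∈ Finset.Ioc M n, b m‖ ≤ P) :
    ‖∑ n ∈ Finset.Ioc M N, (g n : ℂ) * b n‖ ≤ P * g (M + 1) := by
  refine (abel_bd (fun n => (g n : ℂ)) b h.le hP).trans (le_of_eq ?_)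
  congr 1
  have : ∀ n ∈ Finset.Ico (M + 1) N, ‖(g n : ℂ) - (g (n + 1) : ℂ)‖ = g n - g (n + 1) := by
    intro n hn
    rw [Finset.mem_Ico] at hn
    rw [← Complex.ofReal_sub, Complex.norm_real, Real.norm_of_nonneg]
    linarith [hg n (by omega)]
  rw [Finset.sum_congr rfl this, Complex.norm_real, Real.norm_of_nonneg hg0]
  have := Finset.sum_Ico_sub g (show M + 1 ≤ N by omega)
  rw [Finset.sum_sub_distrib] at this ⊢
  linarith

end Abel

lemma Icc_one_eq (N : ℕ) : Finset.Icc 1 N = Finset.Ioc 0 N := rfl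

lemma sum_Icc_split {E : Type*} [AddCommMonoid E] (f : ℕ → E) {M N : ℕ} (h : M ≤ N) :
    ∑ n ∈ Finset.Icc 1 N, f n = ∑ n ∈ Finset.Icc 1 M, f n + ∑ n ∈ Finset.Ioc M N, f n := by
  rw [Icc_one_eq, Icc_one_eq]
  exact (Finset.sum_Ioc_consecutive f (Nat.zero_le M) h).symm

section Tauber

lemma one_le_log {N : ℕ} (hN : 3 ≤ N) : 1 ≤ Real.log N := by
  rw [Real.le_log_iff_exp_le (by positivity)]
  have : (3:ℝ) ≤ N := by exact_mod_cast hN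
  linarith [Real.exp_one_lt_d9]

lemma log_pow_le {x : ℝ} (hx : 1 ≤ x) (m : ℕ) : Real.log x ^ m ≤ m.factorial * x := by
  have h := Real.pow_div_factorial_le_exp (Real.log x) (Real.log_nonneg hx) m
  rw [Real.exp_log (by linarith), div_le_iff₀ (by positivity)] at h
  linarith

lemma log_pow_le_sqrt {x : ℝ} (hx : 1 ≤ x) (m : ℕ) :
    Real.log x ^ m ≤ 2 ^ m * m.factorial * √x := by
  have h := log_pow_le (Real.one_le_sqrt.2 hx) m
  rw [Real.log_sqrt (by linarith), div_pow, div_le_iff₀ (by positivity)] at h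
  linarith

lemma iter_logMul (a : ℕ → ℂ) (k n : ℕ) :
    (LSeries.logMul^[k] a) n = ((Real.log n ^ k : ℝ) : ℂ) * a n := by
  induction k with
  | zero => simp
  | succ k ih =>
    rw [Function.iterate_succ_apply', LSeries.logMul, ih, Complex.natCast_log.symm]
    push_cast; ring

variable {a : ℕ → ℂ} {K : ℝ} {k : ℕ}

lemma tauber1 (hs : ∀ s : ℂ, 1 < s.re → LSeriesSummable a s)
    (hK : ∀ σ t : ℝ, 1 < σ → σ ≤ 2 → ‖iteratedDeriv k (LSeries a) ((σ:ℂ) + t * I)‖ ≤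
      K * (|t| + 2) ^ (1/2 : ℝ)) {M : ℕ} (hM : 3 ≤ M) :
    ‖∑ n ∈ Finset.Icc 1 M, ((Real.log n ^ k : ℝ) : ℂ) * a n * (M - n)‖ ≤
      3 * PC * K * (M:ℝ) ^ 2 := by
  have hM0 : (0:ℝ) < M := by exact_mod_cast (by omega : 0 < M)
  have hMc : (M:ℂ) ≠ 0 := by exact_mod_cast (by omega : M ≠ 0)
  have hL := one_le_log hM
  set σ : ℝ := 1 + 1 / Real.log M with hσ
  have hσ1 : 1 < σ := by rw [hσ]; have : 0 < 1 / Real.log M := by positivity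
                         linarith
  have hσ2 : σ ≤ 2 := by
    have : 1 / Real.log M ≤ 1 := by rw [div_le_one (by linarith)]; exact hL
    linarith
  have hab := est_abscissa hs
  have hab' : LSeries.abscissaOfAbsConv (LSeries.logMul^[k] a) < (σ : ℂ).re := by
    rw [LSeries.absicssaOfAbsConv_logPowMul]
    exact hab.trans_lt (by simpa using! (by exact_mod_cast hσ1 : (1:EReal) < (σ:EReal)))
  have hp := perron (a := LSeries.logMul^[k] a) (K := K) hσ1
    (LSeriesSummable_of_abscissaOfAbsConv_lt_re hab') ?_ (N := M) (by omega)
  · have e : (M:ℝ) ^ σ = Real.exp 1 * M := by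
      rw [hσ, Real.rpow_add hM0, Real.rpow_one, Real.rpow_def_of_pos hM0]
      rw [mul_one_div_cancel (by linarith)]; ring
    rw [e] at hp
    have e2 : ∑ n ∈ Finset.Icc 1 M, ((Real.log n ^ k : ℝ) : ℂ) * a n * (M - n) =
        M * ∑ n ∈ Finset.Icc 1 M, (LSeries.logMul^[k] a) n * (1 - n / M) := by
      rw [Finset.mul_sum]
      refine Finset.sum_congr rfl fun n _ => ?_
      rw [iter_logMul]; field_simp
    rw [e2, norm_mul, Complex.norm_natCast]
    have hK0 : 0 ≤ K := by
      have := (norm_nonneg _).trans (hK 2 0 (by norm_num) le_rfl)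
      by_contra h
      have h2 : (0:ℝ) < (|0| + 2) ^ (1/2 : ℝ) := by positivity
      nlinarith
    have he : Real.exp 1 ≤ 3 := by linarith [Real.exp_one_lt_d9]
    have hPC := PC_nonneg
    calc _ ≤ (M:ℝ) * (PC * K * (3 * M)) := by
          gcongr; exact hp.trans (by gcongr)
      _ = _ := by ring
  · intro t
    have h := hK σ t hσ1 hσ2
    rw [LSeries_iteratedDeriv k (hab.trans_lt (by
      simpa using! (by exact_mod_cast hσ1 : (1:EReal) < (σ:EReal))))] at h
    simpa using h

lemma tauber2 (A : ℕ) : ∃ C : ℝ, 0 < C ∧ ∀ (a : ℕ → ℂ) (K : ℝ), 1 ≤ K →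
    (∀ n : ℕ, 1 ≤ n → ‖a n‖ ≤ Real.log n + 1) →
    (∀ s : ℂ, 1 < s.re → LSeriesSummable a s) →
    (∀ σ t : ℝ, 1 < σ → σ ≤ 2 → ‖iteratedDeriv (4 * A + 1) (LSeries a) ((σ:ℂ) + t * I)‖ ≤
      K * (|t| + 2) ^ (1/2 : ℝ)) → ∀ N : ℕ, 3 ≤ N →
    ‖∑ n ∈ Finset.Icc 1 N, ((Real.log n ^ (4 * A + 1) : ℝ) : ℂ) * a n‖ ≤
      C * K * N * Real.log N ^ (2 * A + 1) := by
  set m := 2 * A + 1 with hm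
  set k := 4 * A + 1 with hk
  set c : ℝ := (m.factorial : ℝ) with hc
  have hPC := PC_nonneg
  refine ⟨15 * PC + (1 + c) * (3 * 2 ^ k), by positivity, ?_⟩
  intro a K hK1 ha hs hK N hN
  have hL := one_le_log hN
  set L := Real.log N with hLdef
  have hN0 : (3:ℝ) ≤ N := by exact_mod_cast hN
  have hLm : 1 ≤ L ^ m := one_le_pow₀ hL
  set h : ℕ := ⌈(N:ℝ) / L ^ m⌉₊ with hh
  have hh0 : 0 < h := Nat.ceil_pos.2 (by positivity)
  have hh0r : (0:ℝ) < h := by exact_mod_cast hh0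
  have hhN : h ≤ N := by
    rw [hh, Nat.ceil_le]
    exact div_le_self (by linarith) hLm
  have hhNr : (h:ℝ) ≤ N := by exact_mod_cast hhN
  have hh1 : (N:ℝ) / L ^ m ≤ h := Nat.le_ceil _
  have hh2 : (h:ℝ) * L ^ m ≤ (1 + c) * N := by
    have h1 : (h:ℝ) < N / L ^ m + 1 := Nat.ceil_lt_add_one (by positivity)
    have h2 : L ^ m ≤ c * N := log_pow_le (by linarith) m
    calc (h:ℝ) * L ^ m ≤ (N / L ^ m + 1) * L ^ m := by gcongr
      _ = N + L ^ m := by field_simp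
      _ ≤ _ := by linarith
  set b : ℕ → ℂ := fun n => ((Real.log n ^ k : ℝ) : ℂ) * a n with hb
  have hI1 := tauber1 hs hK (M := N + h) (by omega)
  have hI0 := tauber1 hs hK hN
  rw [sum_Icc_split _ (show N ≤ N + h by omega)] at hI1
  have hlog2 : Real.log (2 * N) ≤ 2 * L := by
    rw [Real.log_mul (by norm_num) (by linarith)]
    have : Real.log 2 ≤ 1 := by linarith [Real.log_two_lt_d9]
    linarith
  have hrest : ‖∑ n ∈ Finset.Ioc N (N + h), b n * (((N + h : ℕ) : ℂ) - n)‖ ≤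
      h * (h * (3 * 2 ^ k * L ^ (k + 1))) := by
    refine (norm_sum_le _ _).trans ?_
    have : ∀ n ∈ Finset.Ioc N (N + h), ‖b n * (((N + h : ℕ) : ℂ) - n)‖ ≤
        h * (3 * 2 ^ k * L ^ (k + 1)) := by
      intro n hn
      rw [Finset.mem_Ioc] at hn
      have hn1 : (N:ℝ) < n := by exact_mod_cast hn.1
      have hn2 : (n:ℝ) ≤ N + h := by exact_mod_cast hn.2
      have hln : Real.log n ≤ 2 * L := by
        refine le_trans (Real.log_le_log (by linarith) ?_) hlog2
        linarith
      have hln0 : 0 ≤ Real.log n := Real.log_nonneg (by linarith)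
      have e : ‖((N + h : ℕ) : ℂ) - n‖ ≤ h := by
        rw [show ((N + h : ℕ) : ℂ) - n = ((N + h - n : ℝ) : ℂ) by push_cast; ring,
          Complex.norm_real, Real.norm_of_nonneg (by linarith)]
        linarith
      have e2 : ‖b n‖ ≤ 3 * 2 ^ k * L ^ (k + 1) := by
        rw [hb]; simp only []
        rw [norm_mul, Complex.norm_real, Real.norm_of_nonneg (by positivity)]
        calc _ ≤ (2 * L) ^ k * (3 * L) := by
              gcongr
              refine (ha n (by omega)).trans ?_
              linarith
          _ = _ := by ring
      rw [norm_mul, mul_comm]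
      gcongr
    refine (Finset.sum_le_card_nsmul _ _ _ this).trans ?_
    rw [Nat.card_Ioc, Nat.add_sub_cancel_left, nsmul_eq_mul]
  have hid : (h:ℂ) * ∑ n ∈ Finset.Icc 1 N, b n =
      (∑ n ∈ Finset.Icc 1 N, b n * (((N + h : ℕ) : ℂ) - n) +
        ∑ n ∈ Finset.Ioc N (N + h), b n * (((N + h : ℕ) : ℂ) - n)) -
      ∑ n ∈ Finset.Icc 1 N, b n * ((N:ℂ) - n) -
        ∑ n ∈ Finset.Ioc N (N + h), b n * (((N + h : ℕ) : ℂ) - n) := by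
    have : (h:ℂ) * ∑ n ∈ Finset.Icc 1 N, b n = ∑ n ∈ Finset.Icc 1 N, b n * (((N + h : ℕ) : ℂ) - n)
      - ∑ n ∈ Finset.Icc 1 N, b n * ((N:ℂ) - n) := by
      rw [Finset.mul_sum, ← Finset.sum_sub_distrib]
      refine Finset.sum_congr rfl fun n _ => ?_
      push_cast; ring
    rw [this]; ring
  have hmain : (h:ℝ) * ‖∑ n ∈ Finset.Icc 1 N, b n‖ ≤ 3 * PC * K * ((N + h : ℕ):ℝ) ^ 2 +
      3 * PC * K * (N:ℝ) ^ 2 + h * (h * (3 * 2 ^ k * L ^ (k + 1))) := by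
    have e : (h:ℝ) * ‖∑ n ∈ Finset.Icc 1 N, b n‖ = ‖(h:ℂ) * ∑ n ∈ Finset.Icc 1 N, b n‖ := by
      rw [norm_mul, Complex.norm_natCast]
    rw [e, hid]
    refine (norm_sub_le _ _).trans (add_le_add ?_ hrest)
    exact (norm_sub_le _ _).trans (add_le_add hI1 hI0)
  have hNh : (((N + h : ℕ):ℝ)) ^ 2 ≤ 4 * (N:ℝ) ^ 2 := by
    push_cast
    nlinarith
  have hNm : (N:ℝ) ≤ h * L ^ m := by rwa [div_le_iff₀ (by positivity)] at hh1
  have hkm : L ^ (k + 1) = L ^ m * L ^ m := by rw [← pow_add]; congr 1; omega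
  refine le_of_mul_le_mul_left (hmain.trans ?_) hh0r
  calc _ ≤ 3 * PC * K * (4 * (N:ℝ) ^ 2) + 3 * PC * K * (N:ℝ) ^ 2
        + h * (h * (3 * 2 ^ k * L ^ (k + 1))) := by gcongr
    _ = 15 * PC * K * N * N + h * (3 * 2 ^ k * L ^ m * (h * L ^ m)) := by rw [hkm]; ring
    _ ≤ 15 * PC * K * N * (h * L ^ m) + h * (3 * 2 ^ k * L ^ m * (((1 + c) * N) * K)) := by
        have h7 : (h:ℝ) * L ^ m ≤ ((1 + c) * N) * K :=
          hh2.trans (le_mul_of_one_le_right (by positivity) hK1)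
        refine add_le_add (mul_le_mul_of_nonneg_left hNm (by positivity)) ?_
        exact mul_le_mul_of_nonneg_left (mul_le_mul_of_nonneg_left h7 (by positivity))
          (by positivity)
    _ = _ := by ring

theorem tauber (A : ℕ) : ∃ C : ℝ, 0 < C ∧ ∀ (a : ℕ → ℂ) (K : ℝ), 1 ≤ K →
    (∀ n : ℕ, 1 ≤ n → ‖a n‖ ≤ Real.log n + 1) →
    (∀ s : ℂ, 1 < s.re → LSeriesSummable a s) →
    (∀ σ t : ℝ, 1 < σ → σ ≤ 2 → ‖iteratedDeriv (4 * A + 1) (LSeries a) ((σ:ℂ) + t * I)‖ ≤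
      K * (|t| + 2) ^ (1/2 : ℝ)) → ∀ N : ℕ, 3 ≤ N →
    ‖∑ n ∈ Finset.Icc 1 N, a n‖ ≤ C * K * N / Real.log N ^ (2 * A) := by
  obtain ⟨C, hC, h2⟩ := tauber2 A
  set k := 4 * A + 1 with hk
  set m := 2 * A + 1 with hm
  refine ⟨2 * (2 ^ m * m.factorial) + 2 ^ k * (2 * (C + 2)), by positivity, ?_⟩
  intro a K hK1 ha hs hK N hN
  have hB := h2 a K hK1 ha hs hK
  have hL := one_le_log hN
  have hN0 : (3:ℝ) ≤ N := by exact_mod_cast hN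
  set L := Real.log N with hLdef
  set M := Nat.sqrt N with hM
  have hM1 : 1 ≤ M := Nat.sqrt_pos.2 (by omega)
  have hMN : M < N := Nat.sqrt_lt_self (by omega)
  have hMr : (M:ℝ) ≤ √N := Real.nat_sqrt_le_real_sqrt
  have hMr2 : √N ≤ (M:ℝ) + 1 := Real.real_sqrt_le_nat_sqrt_succ
  have hlogM : L / 2 ≤ Real.log ((M:ℝ) + 1) := by
    rw [hLdef, ← Real.log_sqrt (by linarith)]
    exact Real.log_le_log (by positivity) hMr2
  rw [sum_Icc_split _ hMN.le]
  have hpart1 : ‖∑ n ∈ Finset.Icc 1 M, a n‖ ≤ 2 * (2 ^ m * m.factorial) * K * N / L ^ (2 * A) := by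
    have h1 : ‖∑ n ∈ Finset.Icc 1 M, a n‖ ≤ √N * (2 * L) := by
      refine (norm_sum_le _ _).trans ?_
      have : ∀ n ∈ Finset.Icc 1 M, ‖a n‖ ≤ 2 * L := by
        intro n hn
        rw [Finset.mem_Icc] at hn
        have hnN : (n:ℝ) ≤ N := by exact_mod_cast hn.2.trans hMN.le
        have : Real.log n ≤ L := Real.log_le_log (by exact_mod_cast hn.1) hnN
        linarith [ha n hn.1]
      refine (Finset.sum_le_card_nsmul _ _ _ this).trans ?_
      rw [Nat.card_Icc, nsmul_eq_mul, Nat.add_sub_cancel]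
      gcongr
    rw [le_div_iff₀ (by positivity)]
    have h3 := log_pow_le_sqrt (by linarith : (1:ℝ) ≤ N) m
    rw [← hLdef] at h3
    calc _ ≤ √N * (2 * L) * L ^ (2 * A) := by gcongr
      _ = 2 * √N * L ^ m := by rw [hm, pow_succ]; ring
      _ ≤ 2 * √N * (2 ^ m * m.factorial * √N) := by gcongr
      _ = 2 * (2 ^ m * m.factorial) * 1 * (√N * √N) := by ring
      _ = 2 * (2 ^ m * m.factorial) * 1 * N := by rw [Real.mul_self_sqrt (by linarith)]
      _ ≤ _ := by gcongr
  have hBall : ∀ n, 1 ≤ n → n ≤ N → ‖∑ i ∈ Finset.Icc 1 n, ((Real.log i ^ k : ℝ) : ℂ) * a i‖ ≤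
      (C + 2) * K * N * L ^ m := by
    intro n hn hnN
    have hnNr : (n:ℝ) ≤ N := by exact_mod_cast hnN
    have hLm : 1 ≤ L ^ m := one_le_pow₀ hL
    rcases Nat.lt_or_ge n 3 with h | h
    · have h2 : ‖∑ i ∈ Finset.Icc 1 n, ((Real.log i ^ k : ℝ) : ℂ) * a i‖ ≤ 2 := by
        have hk0 : k ≠ 0 := by omega
        interval_cases n
        · simp [hk0]
        · rw [show Finset.Icc 1 2 = {1, 2} from rfl, Finset.sum_pair (by norm_num)]
          have h3 := ha 2 (by norm_num)
          have hl0 : 0 ≤ Real.log 2 := Real.log_nonneg (by norm_num)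
          have hl1 : Real.log 2 ≤ 1 := by linarith [Real.log_two_lt_d9]
          have hlk : Real.log 2 ^ k ≤ 1 := pow_le_one₀ hl0 hl1
          simp only [Nat.cast_one, Real.log_one, ne_eq, hk0, not_false_eq_true, zero_pow,
            Complex.ofReal_zero, zero_mul, zero_add]
          push_cast at h3 ⊢
          rw [norm_mul, norm_pow, Complex.norm_real, Real.norm_of_nonneg hl0]
          have := norm_nonneg (a 2)
          nlinarith
      refine h2.trans ?_
      have : 1 ≤ (N:ℝ) * L ^ m := by nlinarith
      have : 1 ≤ K * ((N:ℝ) * L ^ m) := by nlinarith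
      nlinarith
    · refine (hB n h).trans ?_
      have : Real.log n ≤ L := Real.log_le_log (by positivity) hnNr
      have h0 : 0 ≤ Real.log n := Real.log_nonneg (by exact_mod_cast hn)
      gcongr
      linarith
  have hpart2 : ‖∑ n ∈ Finset.Ioc M N, a n‖ ≤ 2 ^ k * (2 * (C + 2)) * K * N / L ^ (2 * A) := by
    set g : ℕ → ℝ := fun n => (Real.log n ^ k)⁻¹ with hg
    have e : ∑ n ∈ Finset.Ioc M N, a n =
        ∑ n ∈ Finset.Ioc M N, (g n : ℂ) * (((Real.log n ^ k : ℝ) : ℂ) * a n) := by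
      refine Finset.sum_congr rfl fun n hn => ?_
      rw [Finset.mem_Ioc] at hn
      have : Real.log n ^ k ≠ 0 := by
        have : (1:ℝ) < n := by exact_mod_cast (by omega : 1 < n)
        have := Real.log_pos this
        positivity
      rw [hg, ← mul_assoc, ← Complex.ofReal_mul, inv_mul_cancel₀ this]; simp
    rw [e]
    have h := abel_anti g (fun n => ((Real.log n ^ k : ℝ) : ℂ) * a n) hMN
      (P := 2 * ((C + 2) * K * N * L ^ m)) ?_ (by positivity) ?_
    · refine h.trans ?_
      have hg1 : g (M + 1) ≤ (2 / L) ^ k := by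
        rw [hg]; simp only []
        rw [← inv_pow]; push_cast
        gcongr
        · rw [inv_nonneg]; exact Real.log_nonneg (by linarith [(Nat.cast_nonneg M : (0:ℝ) ≤ M)])
        rw [show 2 / L = (L / 2)⁻¹ by rw [inv_div]]
        gcongr
      have hk2 : L ^ k = L ^ m * L ^ (2 * A) := by rw [← pow_add]; congr 1; omega
      calc _ ≤ 2 * ((C + 2) * K * N * L ^ m) * (2 / L) ^ k := by gcongr
        _ = _ := by
          rw [div_pow, hk2]
          field_simp
    · intro n hn
      rw [hg]; simp only []
      have h1 : (1:ℝ) < n := by exact_mod_cast (by omega : 1 < n)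
      have := Real.log_pos h1
      push_cast
      gcongr
      linarith
    · intro n hn1 hn2
      have h1 := sum_Icc_split (fun n => ((Real.log n ^ k : ℝ) : ℂ) * a n) hn1
      rw [← sub_eq_iff_eq_add'] at h1
      rw [← h1]
      refine (norm_sub_le _ _).trans ?_
      have := hBall n (by omega) hn2
      have := hBall M hM1 hMN.le
      linarith
  refine (norm_add_le _ _).trans ((add_le_add hpart1 hpart2).trans (le_of_eq ?_))
  ring

end Tauber

end CM

end

section

open Complex Filter Topology MeasureTheory
namespace CM

lemma logderiv_L (k : ℕ) : ∃ C : ℝ, 1 ≤ C ∧ ∀ (q : ℕ) [NeZero q] (χ : DirichletCharacter ℂ q) (s : ℂ),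
    1 < s.re → s.re ≤ 2 → (χ ≠ 1 ∨ 1 ≤ |s.im|) →
    ‖iteratedDeriv k (fun z => deriv (DirichletCharacter.LFunction χ) z /
      DirichletCharacter.LFunction χ z) s‖ ≤ C * q * (|s.im| + 2) ^ (1/2 : ℝ) := by
  set δ : ℝ := 1 / (8 * (k + 1)) with hδd
  have hk0 : (0:ℝ) ≤ k := Nat.cast_nonneg k
  have hδ : 0 < δ := by positivity
  have hδ2 : δ ≤ 1/2 := by
    rw [hδd, div_le_div_iff₀ (by positivity) (by norm_num)]; linarith
  obtain ⟨c, hc, hlow⟩ := LFun_low (ε := 2 * δ) (by positivity)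
  set D : ℝ := 4 * ((4/δ + 24) * 2) / (c * δ) with hD
  have hD0 : 0 < D := by positivity
  refine ⟨max 1 (k.factorial * D ^ (k+1)), le_max_left _ _, ?_⟩
  intro q _ χ s h1 h2 hor
  set T := TT q s.im with hT
  have hT2 : 2 ≤ T := two_le_TT q s.im
  have hT0 : 0 < T := by linarith
  have hor' : χ ≠ 1 ∨ 1 ≤ ‖s - 1‖ := by
    rcases hor with h | h
    · exact Or.inl h
    · right
      calc (1:ℝ) ≤ |s.im| := h
        _ = |(s-1).im| := by simp
        _ ≤ _ := Complex.abs_im_le_norm _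
  have hn := fun z hz => LFun_nhd hδ hδ2 χ s hor' h1.le (by linarith) (z := z) hz
  have hl := hlow q χ s h1 h2 hor
  have hm0 : 0 < c * T ^ (-(2*δ)) := by positivity
  have hself := (hn s (by simpa using hδ.le)).2
  have := logderiv_bound hδ hm0 (hl.trans hself) (fun z hz => (hn z hz).1) (fun z hz => (hn z hz).2) hl k
  refine this.trans ?_
  have hb : 4 * ((4/δ+24) * (2 * T)^(2*δ)) / (c * T ^ (-(2*δ)) * δ) ≤ D * T ^ (4 * δ) := by
    have e1 : (2 * T)^(2*δ) ≤ 2 * T^(2*δ) := two_mul_rpow_le hT0.le hδ2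
    have e2 : T ^ (4 * δ) = T ^ (2*δ) * T ^ (2*δ) := by
      rw [← Real.rpow_add hT0]; ring_nf
    rw [Real.rpow_neg hT0.le, e2, hD]
    have hp : 0 < T ^ (2*δ) := by positivity
    rw [div_le_iff₀ (by positivity)]
    have : 4 * ((4 / δ + 24) * 2) / (c * δ) * (T ^ (2 * δ) * T ^ (2 * δ)) * (c * (T ^ (2 * δ))⁻¹ * δ)
        = 4 * ((4/δ+24) * (2 * T^(2*δ))) := by
      field_simp
    rw [this]
    gcongr
  have hpow : (T ^ (4*δ))^(k+1) = T ^ (1/2:ℝ) := by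
    rw [← Real.rpow_natCast, ← Real.rpow_mul hT0.le]
    congr 1
    rw [hδd]; push_cast; field_simp; norm_num
  have hq1 : (1:ℝ) ≤ q := by exact_mod_cast Nat.one_le_iff_ne_zero.mpr (NeZero.ne q)
  have hTq : T ^ (1/2:ℝ) ≤ q * (|s.im| + 2) ^ (1/2:ℝ) := by
    rw [hT, TT, Real.mul_rpow (by positivity) (by positivity)]
    gcongr
    calc (q:ℝ)^(1/2:ℝ) ≤ (q:ℝ)^(1:ℝ) := Real.rpow_le_rpow_of_exponent_le hq1 (by norm_num)
      _ = q := Real.rpow_one _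
  calc (k.factorial:ℝ) * (4 * ((4/δ+24) * (2 * T)^(2*δ)) / (c * T ^ (-(2*δ)) * δ))^(k+1)
      ≤ k.factorial * (D * T^(4*δ))^(k+1) := by gcongr
    _ = k.factorial * D^(k+1) * T^(1/2:ℝ) := by rw [mul_pow, hpow]; ring
    _ ≤ max 1 (k.factorial * D ^ (k+1)) * (q * (|s.im| + 2) ^ (1/2:ℝ)) := by
        gcongr
        exact le_max_right _ _
    _ = _ := by ring

lemma half_nhds {s : ℂ} (hs : 1 < s.re) : ∀ᶠ z in 𝓝 s, 1 < z.re :=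
  Complex.continuous_re.continuousAt.eventually (lt_mem_nhds hs)

open ArithmeticFunction in
theorem SW (A : ℕ) : ∃ C : ℝ, 0 < C ∧ ∀ (N q : ℕ), 3 ≤ N → 0 < q → (q:ℝ) ≤ Real.log N ^ A →
    ∀ χ : DirichletCharacter ℂ q, χ ≠ 1 →
    ‖∑ n ∈ Finset.Icc 1 N, χ (n : ZMod q) * (vonMangoldt n : ℂ)‖ ≤ C * N / Real.log N ^ A := by
  obtain ⟨C1, hC1, hd⟩ := logderiv_L (4*A+1)
  obtain ⟨C2, hC2, ht⟩ := tauber A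
  refine ⟨C2 * C1, by positivity, ?_⟩
  intro N q hN hq hqN χ hχ
  haveI : NeZero q := ⟨hq.ne'⟩
  have hq1 : (1:ℝ) ≤ q := by exact_mod_cast hq
  have key := ht (fun n => χ (n : ZMod q) * (vonMangoldt n : ℂ)) (C1 * q) (by nlinarith) ?_ ?_ ?_ N hN
  · refine key.trans ?_
    have hL : 0 < Real.log N := by linarith [one_le_log hN]
    rw [two_mul, pow_add, div_le_div_iff₀ (by positivity) (by positivity)]
    have : C2 * (C1 * q) * N * Real.log N ^ A ≤ C2 * (C1 * Real.log N ^ A) * N * Real.log N ^ A := by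
      gcongr
    calc _ ≤ _ := this
      _ = _ := by ring
  · intro n hn
    rw [norm_mul]
    calc ‖χ (n : ZMod q)‖ * ‖((vonMangoldt n : ℝ):ℂ)‖ ≤ 1 * vonMangoldt n := by
          gcongr
          · exact χ.norm_le_one _
          · rw [Complex.norm_real, Real.norm_of_nonneg vonMangoldt_nonneg]
      _ ≤ Real.log n + 1 := by
          linarith [vonMangoldt_le_log (n := n)]
  · intro s hs
    exact DirichletCharacter.LSeriesSummable_twist_vonMangoldt χ hs
  · intro σ t h1 h2
    have hs : 1 < ((σ:ℂ) + t * I).re := by simpa using h1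
    have h := hd q χ ((σ:ℂ) + t * I) hs (by simpa using h2) (Or.inl hχ)
    have hev : LSeries (fun n => χ (n : ZMod q) * (vonMangoldt n : ℂ)) =ᶠ[𝓝 ((σ:ℂ) + t * I)]
        fun z => -(deriv (DirichletCharacter.LFunction χ) z / DirichletCharacter.LFunction χ z) := by
      filter_upwards [half_nhds hs, (half_nhds hs).eventually_nhds] with z hz hz'
      have e1 := DirichletCharacter.LSeries_twist_vonMangoldt_eq χ hz
      have e2 : DirichletCharacter.LFunction χ =ᶠ[𝓝 z] LSeries (fun n => χ (n : ZMod q)) := by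
        filter_upwards [hz'] with w hw
        exact DirichletCharacter.LFunction_eq_LSeries χ hw
      rw [e2.deriv_eq, e2.eq_of_nhds, ← neg_div]
      exact e1
    rw [hev.iteratedDeriv_eq, iteratedDeriv_fun_neg, norm_neg]
    simpa using h

open ArithmeticFunction in
lemma zeta_near {k : ℕ} : ∃ C : ℝ, 0 ≤ C ∧ ∀ s : ℂ, 1 < s.re → s.re ≤ 2 → |s.im| ≤ 1 →
    ‖iteratedDeriv k (LSeries (fun n => (vonMangoldt n : ℂ) - 1)) s‖ ≤ C := by
  set G : ℂ → ℂ := fun z => -(deriv ZZ z / ZZ z) - dslope ZZ 1 z with hG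
  have hane : ∀ z : ℂ, 1 ≤ z.re → ZZ z ≠ 0 := by
    intro z hz
    by_cases h1 : z = 1
    · rw [h1, ZZ_one]; exact one_ne_zero
    · rw [ZZ_eq h1]
      exact mul_ne_zero (sub_ne_zero.mpr h1) (riemannZeta_ne_zero_of_one_le_re hz)
  have hds : Differentiable ℂ (dslope ZZ 1) := by
    rw [← differentiableOn_univ, Complex.differentiableOn_dslope Filter.univ_mem]
    exact ZZ_diff.differentiableOn
  have hGa : ∀ z : ℂ, 1 ≤ z.re → AnalyticAt ℂ G z := by
    intro z hz
    have hZ : AnalyticAt ℂ ZZ z := ZZ_diff.analyticAt z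
    exact ((hZ.deriv.div hZ (hane z hz)).neg).sub (hds.analyticAt z)
  set K : Set ℂ := Set.Icc (1:ℝ) 2 ×ℂ Set.Icc (-1:ℝ) 1 with hK
  have hKc : IsCompact K := isCompact_Icc.reProdIm isCompact_Icc
  have hcont : ContinuousOn (iteratedDeriv k G) K := by
    intro z hz
    have h1 : 1 ≤ z.re := (Complex.mem_reProdIm.mp hz).1.1
    have := (hGa z h1).iterated_deriv k
    rw [← iteratedDeriv_eq_iterate] at this
    exact this.continuousAt.continuousWithinAt
  obtain ⟨C, hC⟩ := hKc.exists_bound_of_continuousOn hcont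
  refine ⟨max C 0, le_max_right _ _, ?_⟩
  intro s h1 h2 h3
  have hev : LSeries (fun n => (vonMangoldt n : ℂ) - 1) =ᶠ[𝓝 s] G := by
    filter_upwards [half_nhds h1] with z hz
    have hz1 : z ≠ 1 := by rintro rfl; simp at hz
    have hz0 : z - 1 ≠ 0 := sub_ne_zero.mpr hz1
    have e0 : LSeries (fun n => (vonMangoldt n : ℂ) - 1) z
        = -deriv riemannZeta z / riemannZeta z - riemannZeta z := by
      have := LSeries_sub (LSeriesSummable_vonMangoldt hz) (LSeriesSummable_one_iff.mpr hz)
      rw [LSeries_vonMangoldt_eq_deriv_riemannZeta_div hz, LSeries_one_eq_riemannZeta hz] at this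
      exact this
    have hd : deriv ZZ z = riemannZeta z + (z - 1) * deriv riemannZeta z := by
      have : ZZ =ᶠ[𝓝 z] fun w => (w - 1) * riemannZeta w := by
        filter_upwards [isOpen_ne.mem_nhds hz1] with w hw
        exact ZZ_eq hw
      rw [this.deriv_eq, deriv_fun_mul (by fun_prop) (differentiableAt_riemannZeta hz1)]
      simp
    have hzne : riemannZeta z ≠ 0 := riemannZeta_ne_zero_of_one_le_re hz.le
    simp only [hG]
    rw [e0, hd, dslope_of_ne _ hz1, slope_def_field, ZZ_eq hz1, ZZ_one]
    field_simp
    ring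
  rw [hev.iteratedDeriv_eq]
  refine (hC s ?_).trans (le_max_left _ _)
  rw [hK, Complex.mem_reProdIm]
  exact ⟨⟨h1.le, h2⟩, abs_le.mp h3⟩

open ArithmeticFunction in
lemma zeta_far {k : ℕ} : ∃ C : ℝ, 0 ≤ C ∧ ∀ s : ℂ, 1 < s.re → s.re ≤ 2 → 1 ≤ |s.im| →
    ‖iteratedDeriv k (LSeries (fun n => (vonMangoldt n : ℂ) - 1)) s‖ ≤ C * (|s.im|+2)^(1/2:ℝ) := by
  obtain ⟨C1, hC1, hd⟩ := logderiv_L k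
  refine ⟨C1 + k.factorial * ((4/(1/4:ℝ) + 24) * 2) / (1/4)^k, by positivity, ?_⟩
  intro s h1 h2 h3
  have hs1 : s ≠ 1 := by rintro rfl; norm_num at h3
  have hs1' : 1 ≤ ‖s - 1‖ := by
    calc (1:ℝ) ≤ |s.im| := h3
        _ = |(s-1).im| := by simp
        _ ≤ _ := Complex.abs_im_le_norm _
  have hz1f : DirichletCharacter.LFunction (1 : DirichletCharacter ℂ 1) = riemannZeta :=
    DirichletCharacter.LFunction_modOne_eq
  have hA := hd 1 (1 : DirichletCharacter ℂ 1) s h1 h2 (Or.inr h3)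
  have hn := fun z hz => LFun_nhd (δ := 1/4) (by norm_num) (by norm_num) (1 : DirichletCharacter ℂ 1)
    s (Or.inr hs1') h1.le (by linarith) (z := z) hz
  rw [hz1f] at hA hn
  have hzan : AnalyticAt ℂ riemannZeta s := by
    refine DifferentiableOn.analyticAt (s := {1}ᶜ) (fun z hz =>
      (differentiableAt_riemannZeta hz).differentiableWithinAt) (isOpen_compl_singleton.mem_nhds hs1)
  have hzne : riemannZeta s ≠ 0 := riemannZeta_ne_zero_of_one_le_re h1.le
  have hev : LSeries (fun n => (vonMangoldt n : ℂ) - 1) =ᶠ[𝓝 s]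
      fun z => -(deriv riemannZeta z / riemannZeta z) - riemannZeta z := by
    filter_upwards [half_nhds h1] with z hz
    have := LSeries_sub (LSeriesSummable_vonMangoldt hz) (LSeriesSummable_one_iff.mpr hz)
    rw [LSeries_vonMangoldt_eq_deriv_riemannZeta_div hz, LSeries_one_eq_riemannZeta hz] at this
    rw [← neg_div]
    exact this
  have hquot : AnalyticAt ℂ (fun z => -(deriv riemannZeta z / riemannZeta z)) s :=
    (hzan.deriv.div hzan hzne).neg
  rw [hev.iteratedDeriv_eq, iteratedDeriv_fun_sub hquot.contDiffAt hzan.contDiffAt, iteratedDeriv_fun_neg]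
  have hB : ‖iteratedDeriv k riemannZeta s‖ ≤
      k.factorial * ((4/(1/4:ℝ) + 24) * (2 * TT 1 s.im) ^ (2 * (1/4:ℝ))) / (1/4)^k := by
    refine Complex.norm_iteratedDeriv_le_of_forall_mem_sphere_norm_le k (by norm_num) ?_ ?_
    · refine DifferentiableOn.diffContOnCl ?_
      rw [closure_ball _ (by norm_num)]
      intro z hz
      exact (hn z (by simpa [dist_eq_norm] using hz)).1.differentiableWithinAt
    · intro z hz
      exact (hn z (by simpa [dist_eq_norm] using (le_of_eq hz))).2
  have e1 : (2 * TT 1 s.im)^(2*(1/4:ℝ)) ≤ 2 * (|s.im|+2)^(1/2:ℝ) := by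
    have := two_mul_rpow_le (T := TT 1 s.im) (δ := 1/4) (by linarith [two_le_TT 1 s.im]) (by norm_num)
    refine this.trans (le_of_eq ?_)
    rw [TT]; norm_num
  refine (norm_sub_le _ _).trans ?_
  rw [norm_neg, add_mul]
  refine add_le_add (by simpa using hA) (hB.trans ?_)
  calc k.factorial * ((4/(1/4:ℝ) + 24) * (2 * TT 1 s.im) ^ (2 * (1/4:ℝ))) / (1/4)^k
      ≤ k.factorial * ((4/(1/4:ℝ) + 24) * (2 * (|s.im|+2)^(1/2:ℝ))) / (1/4)^k := by gcongr
    _ = _ := by ring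

open ArithmeticFunction in
theorem PNT (A : ℕ) : ∃ C : ℝ, 0 < C ∧ ∀ (N : ℕ), 3 ≤ N →
    ‖∑ n ∈ Finset.Icc 1 N, ((vonMangoldt n : ℂ) - 1)‖ ≤ C * N / Real.log N ^ A := by
  obtain ⟨C1, hC1, hn⟩ := zeta_near (k := 4*A+1)
  obtain ⟨C3, hC3, hf⟩ := zeta_far (k := 4*A+1)
  obtain ⟨C2, hC2, ht⟩ := tauber A
  refine ⟨C2 * (1 + C1 + C3), by positivity, ?_⟩
  intro N hN
  have key := ht (fun n => (vonMangoldt n : ℂ) - 1) (1 + C1 + C3) (by linarith) ?_ ?_ ?_ N hN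
  · refine key.trans ?_
    have hL := one_le_log hN
    have : Real.log N ^ A ≤ Real.log N ^ (2*A) := pow_le_pow_right₀ hL (by omega)
    gcongr
  · intro n hn
    refine (norm_sub_le _ _).trans ?_
    rw [Complex.norm_real, Real.norm_of_nonneg vonMangoldt_nonneg, norm_one]
    linarith [vonMangoldt_le_log (n := n)]
  · intro s hs
    exact (LSeriesSummable_vonMangoldt hs).sub (LSeriesSummable_one_iff.mpr hs)
  · intro σ t h1 h2
    have hs : 1 < ((σ:ℂ) + t * I).re := by simpa using h1
    have hs2 : ((σ:ℂ) + t * I).re ≤ 2 := by simpa using h2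
    have him : ((σ:ℂ) + t * I).im = t := by simp
    have hone : (1:ℝ) ≤ (|t|+2)^(1/2:ℝ) := Real.one_le_rpow (by linarith [abs_nonneg t]) (by norm_num)
    rcases le_total |t| 1 with h | h
    · refine (hn _ hs hs2 (by rw [him]; exact h)).trans ?_
      nlinarith
    · refine (hf _ hs hs2 (by rw [him]; exact h)).trans ?_
      rw [him]
      nlinarith
end CM

end

section

open Complex Filter Topology MeasureTheory
namespace CM

/-- The additive character `e(x) = exp(2πix)`. -/
noncomputable def ee (x : ℝ) : ℂ := Complex.exp (2 * Real.pi * I * x)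

lemma ee_add (x y : ℝ) : ee (x + y) = ee x * ee y := by
  rw [ee, ee, ee, ← Complex.exp_add]; congr 1; push_cast; ring

lemma ee_zero : ee 0 = 1 := by simp [ee]

lemma ee_int (n : ℤ) : ee n = 1 := by
  rw [ee, Complex.exp_eq_one_iff]
  exact ⟨n, by push_cast; ring⟩

lemma norm_ee (x : ℝ) : ‖ee x‖ = 1 := by
  rw [ee, show (2 * Real.pi * I * x : ℂ) = ((2 * Real.pi * x : ℝ) : ℂ) * I by push_cast; ring]
  exact Complex.norm_exp_ofReal_mul_I _

lemma ee_nat_mul (n : ℕ) (x : ℝ) : ee (n * x) = ee x ^ n := by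
  rw [ee, ee, ← Complex.exp_nat_mul]; congr 1; push_cast; ring

lemma ee_ne_zero (x : ℝ) : ee x ≠ 0 := Complex.exp_ne_zero _

lemma ee_neg (x : ℝ) : ee (-x) = (ee x)⁻¹ := by
  refine eq_inv_of_mul_eq_one_left ?_
  rw [← ee_add]; simp [ee_zero]

lemma ee_primitive {a : ℤ} {q : ℕ} (hq : 0 < q) (h : IsCoprime a q) :
    IsPrimitiveRoot (ee (a / q)) q := by
  have := Complex.isPrimitiveRoot_exp_of_isCoprime a q hq.ne' h
  rw [ee]; push_cast; exact this

open ArithmeticFunction in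
lemma ramanujan {ζ : ℂ} {q : ℕ} (hq : 0 < q) (h : IsPrimitiveRoot ζ q) :
    ∑ b ∈ (Finset.range q).filter (fun b => Nat.Coprime b q), ζ ^ b = (moebius q : ℂ) := by
  rw [Finset.sum_filter]
  have e1 : ∀ b ∈ Finset.range q, (if Nat.Coprime b q then ζ ^ b else 0) =
      ∑ d ∈ q.divisors, if d ∣ b then (moebius d : ℂ) * ζ ^ b else 0 := by
    intro b _
    have h1 : ∑ d ∈ (Nat.gcd b q).divisors, (moebius d : ℂ) = if Nat.gcd b q = 1 then 1 else 0 := by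
      have := coe_mul_zeta_apply (f := (moebius : ArithmeticFunction ℤ)) (x := Nat.gcd b q)
      rw [moebius_mul_coe_zeta, one_apply] at this
      have h2 := congrArg (fun z : ℤ => (z : ℂ)) this
      push_cast at h2
      rw [← h2]
    have h3 : (Nat.gcd b q).divisors = q.divisors.filter (fun d => d ∣ b) := by
      ext d
      have : Nat.gcd b q ≠ 0 := Nat.gcd_ne_zero_right hq.ne'
      simp [Nat.dvd_gcd_iff, hq.ne', this]
      tauto
    rw [← Finset.sum_filter, ← Finset.sum_mul, ← h3, h1]
    simp only [Nat.Coprime]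
    split_ifs <;> simp
  rw [Finset.sum_congr rfl e1, Finset.sum_comm]
  have e2 : ∀ d ∈ q.divisors, (∑ b ∈ Finset.range q, if d ∣ b then (moebius d : ℂ) * ζ ^ b else 0) =
      if d = q then (moebius q : ℂ) else 0 := by
    intro d hd
    obtain ⟨c, rfl⟩ := (Nat.mem_divisors.mp hd).1
    have hd0 : 0 < d := Nat.pos_of_mul_pos_right hq
    have hc0 : 0 < c := Nat.pos_of_mul_pos_left hq
    rw [← Finset.sum_filter]
    have : (Finset.range (d * c)).filter (fun b => d ∣ b) = (Finset.range c).image (fun x => d * x) := by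
      ext b
      simp only [Finset.mem_filter, Finset.mem_range, Finset.mem_image]
      constructor
      · rintro ⟨hb, x, rfl⟩
        exact ⟨x, lt_of_mul_lt_mul_left hb hd0.le, rfl⟩
      · rintro ⟨x, hx, rfl⟩
        exact ⟨Nat.mul_lt_mul_of_pos_left hx hd0, dvd_mul_right _ _⟩
    rw [this, Finset.sum_image (by intro x _ y _ hxy; exact Nat.eq_of_mul_eq_mul_left hd0 hxy)]
    simp_rw [pow_mul]
    rw [← Finset.mul_sum]
    have hp : IsPrimitiveRoot (ζ ^ d) c := h.pow hq rfl
    rcases Nat.lt_or_ge 1 c with h1 | h1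
    · rw [hp.geom_sum_eq_zero h1, if_neg (by nlinarith)]; simp
    · have : c = 1 := by omega
      subst this
      simp
  rw [Finset.sum_congr rfl e2]
  simp [hq.ne']

open ArithmeticFunction in
/-- contribution of `n` not coprime to `q`. -/
lemma noncop {N q : ℕ} (hN : 3 ≤ N) (hq : 0 < q) :
    ∑ n ∈ (Finset.Icc 1 N).filter (fun n => ¬ Nat.Coprime n q), vonMangoldt n ≤
      6 * q * Real.log N ^ 2 := by
  have hL := one_le_log hN
  set S := ((Finset.Icc 1 q) ×ˢ (Finset.Icc 0 (Nat.log 2 N))).image (fun x : ℕ × ℕ => x.1 ^ x.2) with hS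
  have hcard : (S.card : ℝ) ≤ q * (3 * Real.log N) := by
    have h1 : S.card ≤ q * (Nat.log 2 N + 1) := by
      refine Finset.card_image_le.trans ?_
      rw [Finset.card_product]; simp
    have h2 : ((Nat.log 2 N : ℕ) : ℝ) ≤ 2 * Real.log N := by
      have h3 : (2:ℝ) ^ (Nat.log 2 N) ≤ N := by exact_mod_cast Nat.pow_log_le_self 2 (by omega)
      have h4 := Real.log_le_log (by positivity) h3
      rw [Real.log_pow] at h4
      have h5 : (0.5:ℝ) ≤ Real.log 2 := by linarith [Real.log_two_gt_d9]
      have h6 : (0:ℝ) ≤ (Nat.log 2 N : ℕ) := Nat.cast_nonneg _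
      nlinarith
    calc (S.card : ℝ) ≤ ((q * (Nat.log 2 N + 1) : ℕ) : ℝ) := by exact_mod_cast h1
      _ = q * ((Nat.log 2 N : ℕ) + 1) := by push_cast; ring
      _ ≤ _ := by gcongr; linarith
  have hsub : ∀ n ∈ (Finset.Icc 1 N).filter (fun n => ¬ Nat.Coprime n q), n ∉ S → vonMangoldt n = 0 := by
    intro n hn hnS
    by_contra hne
    obtain ⟨p, k, hp, hk, rfl⟩ := vonMangoldt_ne_zero_iff.mp hne
    have hp' : p.Prime := hp.nat_prime
    simp only [Finset.mem_filter, Finset.mem_Icc] at hn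
    apply hnS
    rw [hS, Finset.mem_image]
    refine ⟨(p, k), ?_, rfl⟩
    simp only [Finset.mem_product, Finset.mem_Icc]
    have hpq : p ∣ q := by
      by_contra h
      exact hn.2 (Nat.Coprime.pow_left k ((Nat.Prime.coprime_iff_not_dvd hp').mpr h))
    refine ⟨⟨hp'.one_lt.le, Nat.le_of_dvd hq hpq⟩, Nat.zero_le _, ?_⟩
    exact Nat.le_log_of_pow_le (by norm_num) ((Nat.pow_le_pow_left hp'.two_le k).trans hn.1.2)
  have hle : ∀ n ∈ (Finset.Icc 1 N).filter (fun n => ¬ Nat.Coprime n q), vonMangoldt n ≤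
      if n ∈ S then Real.log N else 0 := by
    intro n hn
    split_ifs with h
    · have h1 := (Finset.mem_Icc.mp (Finset.mem_filter.mp hn).1)
      exact vonMangoldt_le_log.trans (Real.log_le_log (by exact_mod_cast h1.1) (by exact_mod_cast h1.2))
    · exact (hsub n hn h).le
  refine (Finset.sum_le_sum hle).trans ?_
  rw [← Finset.sum_filter, Finset.sum_const, nsmul_eq_mul]
  have : ((((Finset.Icc 1 N).filter (fun n => ¬ Nat.Coprime n q)).filter (fun n => n ∈ S)).card : ℝ) ≤ S.card := by
    exact_mod_cast Finset.card_le_card (fun x hx => (Finset.mem_filter.mp hx).2)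
  have hq0 : (0:ℝ) < q := by exact_mod_cast hq
  calc _ ≤ (q * (3 * Real.log N)) * Real.log N := by gcongr; exact this.trans hcard
    _ ≤ _ := by nlinarith [mul_pos hq0 (show (0:ℝ) < Real.log N ^ 2 by positivity)]

lemma log_q_bound (A : ℕ) {N q : ℕ} (hN : 3 ≤ N) (hqN : (q:ℝ) ≤ Real.log N ^ A) :
    6 * q * Real.log N ^ 2 ≤ (6 * (2*A+2).factorial) * N / Real.log N ^ A := by
  have hL := one_le_log hN
  rw [le_div_iff₀ (by positivity)]
  have h := log_pow_le (x := N) (by exact_mod_cast (by omega : 1 ≤ N)) (2*A+2)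
  calc 6 * q * Real.log N ^ 2 * Real.log N ^ A ≤ 6 * Real.log N ^ A * Real.log N ^ 2 * Real.log N ^ A := by
        gcongr
    _ = 6 * Real.log N ^ (2*A+2) := by ring
    _ ≤ _ := by linarith

open ArithmeticFunction Classical in
lemma psiAll (A : ℕ) : ∃ C : ℝ, 0 < C ∧ ∀ (N q : ℕ), 3 ≤ N → 0 < q → (q:ℝ) ≤ Real.log N ^ A →
    ∀ χ : DirichletCharacter ℂ q,
    ‖∑ n ∈ Finset.Icc 1 N, χ (n : ZMod q) * (vonMangoldt n : ℂ) - (if χ = 1 then (N:ℂ) else 0)‖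
      ≤ C * N / Real.log N ^ A := by
  obtain ⟨C1, hC1, h1⟩ := SW A
  obtain ⟨C2, hC2, h2⟩ := PNT A
  refine ⟨C1 + (C2 + 6 * (2*A+2).factorial), by positivity, ?_⟩
  intro N q hN hq hqN χ
  have hL := one_le_log hN
  split_ifs with hχ
  · subst hχ
    have e1 : ∑ n ∈ Finset.Icc 1 N, (1 : DirichletCharacter ℂ q) (n : ZMod q) * (vonMangoldt n : ℂ) - N =
        ∑ n ∈ Finset.Icc 1 N, ((vonMangoldt n : ℂ) - 1) -
        ((∑ n ∈ (Finset.Icc 1 N).filter (fun n => ¬ Nat.Coprime n q), vonMangoldt n : ℝ) : ℂ) := by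
      rw [Finset.sum_sub_distrib, Finset.sum_filter]
      push_cast
      simp only [Finset.sum_const, Nat.card_Icc, Nat.add_sub_cancel, nsmul_eq_mul, mul_one]
      rw [sub_right_comm, ← Finset.sum_sub_distrib]
      congr 1
      refine Finset.sum_congr rfl fun n _ => ?_
      by_cases h : Nat.Coprime n q
      · rw [MulChar.one_apply ((ZMod.isUnit_iff_coprime n q).mpr h)]; simp [h]
      · rw [MulChar.map_nonunit _ (fun hu => h ((ZMod.isUnit_iff_coprime n q).mp hu))]; simp [h]
    rw [e1]
    refine (norm_sub_le _ _).trans ?_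
    rw [Complex.norm_real, Real.norm_of_nonneg (Finset.sum_nonneg fun n _ => vonMangoldt_nonneg)]
    have h3 := (noncop hN hq).trans (log_q_bound A hN hqN)
    calc _ ≤ C2 * N / Real.log N ^ A + (6 * (2*A+2).factorial) * N / Real.log N ^ A := add_le_add (h2 N hN) h3
      _ = (C2 + 6 * (2*A+2).factorial) * N / Real.log N ^ A := by ring
      _ ≤ _ := by
        have : C2 + 6 * ((2*A+2).factorial:ℝ) ≤ C1 + (C2 + 6 * (2*A+2).factorial) := by linarith
        gcongr
  · rw [sub_zero]
    refine (h1 N q hN hq hqN χ hχ).trans ?_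
    gcongr
    linarith [(by positivity : (0:ℝ) ≤ C2 + 6 * (2*A+2).factorial)]

open ArithmeticFunction Classical in
theorem expF (A : ℕ) : ∃ C : ℝ, 0 < C ∧ ∀ (N q : ℕ), 3 ≤ N → 0 < q → (q:ℝ) ≤ Real.log N ^ A →
    ∀ ζ : ℂ, IsPrimitiveRoot ζ q →
    ‖∑ n ∈ Finset.Icc 1 N, (vonMangoldt n : ℂ) * ζ ^ n - (moebius q : ℂ) / (q.totient : ℂ) * N‖
      ≤ C * N / Real.log N ^ A := by
  obtain ⟨C1, hC1, h1⟩ := psiAll (2 * A)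
  refine ⟨C1 + 6 * (2*A+2).factorial, by positivity, ?_⟩
  intro N q hN hq hqN ζ hζ
  haveI : NeZero q := ⟨hq.ne'⟩
  have hL := one_le_log hN
  have hqN2 : (q:ℝ) ≤ Real.log N ^ (2 * A) := hqN.trans (pow_le_pow_right₀ hL (by omega))
  have hζn : ‖ζ‖ = 1 := hζ.norm'_eq_one hq.ne'
  have hφ : 0 < q.totient := Nat.totient_pos.mpr hq
  have hφC : (q.totient : ℂ) ≠ 0 := by exact_mod_cast hφ.ne'
  set Cq := (Finset.range q).filter (fun b => Nat.Coprime b q) with hCq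
  have hCcard : (Cq.card : ℝ) = q.totient := by
    rw [Nat.totient_eq_card_coprime, hCq]
    congr 2
    ext b; simp [Nat.coprime_comm]
  have hperiod : ∀ n : ℕ, ζ ^ n = ζ ^ (n % q) := by
    intro n
    conv_lhs => rw [← Nat.div_add_mod n q, pow_add, pow_mul, hζ.pow_eq_one, one_pow, one_mul]
  -- the coprime part through characters
  have hchar : ∀ n : ℕ, (if Nat.Coprime n q then ζ ^ n else 0) =
      (q.totient : ℂ)⁻¹ * ∑ χ : DirichletCharacter ℂ q, (∑ b ∈ Cq, χ ((b : ZMod q)⁻¹) * ζ ^ b) * χ (n : ZMod q) := by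
    intro n
    have : ∑ χ : DirichletCharacter ℂ q, (∑ b ∈ Cq, χ ((b : ZMod q)⁻¹) * ζ ^ b) * χ (n : ZMod q)
        = ∑ b ∈ Cq, ζ ^ b * (if (b : ZMod q) = n then (q.totient : ℂ) else 0) := by
      simp_rw [Finset.sum_mul]
      rw [Finset.sum_comm]
      refine Finset.sum_congr rfl fun b hb => ?_
      rw [← DirichletCharacter.sum_char_inv_mul_char_eq ℂ
        ((ZMod.isUnit_iff_coprime b q).mpr (Finset.mem_filter.mp hb).2), Finset.mul_sum]
      refine Finset.sum_congr rfl fun χ _ => by ring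
    rw [this]
    split_ifs with hn
    · have hmem : n % q ∈ Cq := by
        rw [hCq, Finset.mem_filter, Finset.mem_range]
        refine ⟨Nat.mod_lt _ hq, ?_⟩
        rw [Nat.Coprime, ← Nat.gcd_rec, Nat.gcd_comm]; exact hn
      rw [Finset.sum_eq_single_of_mem _ hmem]
      · rw [if_pos (by simp), ← hperiod]; field_simp
      · intro b hb hne
        rw [if_neg, mul_zero]
        intro h
        apply hne
        have := (ZMod.natCast_eq_natCast_iff' b n q).mp h
        rw [Nat.mod_eq_of_lt (Finset.mem_range.mp (Finset.mem_filter.mp hb).1)] at this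
        exact this
    · rw [Finset.sum_eq_zero, mul_zero]
      intro b hb
      rw [if_neg, mul_zero]
      intro h
      apply hn
      rw [← ZMod.isUnit_iff_coprime, ← h, ZMod.isUnit_iff_coprime]
      exact (Finset.mem_filter.mp hb).2
  set P : DirichletCharacter ℂ q → ℂ := fun χ => ∑ n ∈ Finset.Icc 1 N, χ (n : ZMod q) * (vonMangoldt n : ℂ) with hP
  set G : DirichletCharacter ℂ q → ℂ := fun χ => ∑ b ∈ Cq, χ ((b : ZMod q)⁻¹) * ζ ^ b with hG
  have hGle : ∀ χ, ‖G χ‖ ≤ q.totient := by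
    intro χ
    refine (norm_sum_le _ _).trans ?_
    rw [← hCcard, ← nsmul_one, ← Finset.sum_const]
    refine Finset.sum_le_sum fun b _ => ?_
    rw [norm_mul, norm_pow, hζn, one_pow, mul_one]
    exact χ.norm_le_one _
  have hG1 : G 1 = (moebius q : ℂ) := by
    rw [← ramanujan hq hζ, hG]
    refine Finset.sum_congr rfl fun b hb => ?_
    have hb : IsUnit ((b : ZMod q)) := (ZMod.isUnit_iff_coprime b q).mpr (Finset.mem_filter.mp hb).2
    rw [MulChar.one_apply, one_mul]
    obtain ⟨u, hu⟩ := hb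
    rw [← hu, ZMod.inv_coe_unit]
    exact (u⁻¹).isUnit
  have hcop : ∑ n ∈ Finset.Icc 1 N, (vonMangoldt n : ℂ) * (if Nat.Coprime n q then ζ ^ n else 0) =
      (q.totient : ℂ)⁻¹ * ∑ χ : DirichletCharacter ℂ q, G χ * P χ := by
    simp_rw [hchar, hP, Finset.mul_sum]
    rw [Finset.sum_comm]
    refine Finset.sum_congr rfl fun χ _ => Finset.sum_congr rfl fun n _ => by ring
  have hmain : (q.totient : ℂ)⁻¹ * ∑ χ : DirichletCharacter ℂ q, G χ * (if χ = 1 then (N:ℂ) else 0) =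
      (moebius q : ℂ) / (q.totient : ℂ) * N := by
    simp [hG1]; ring
  have hsplit : ∑ n ∈ Finset.Icc 1 N, (vonMangoldt n : ℂ) * ζ ^ n - (moebius q : ℂ) / (q.totient : ℂ) * N =
      (q.totient : ℂ)⁻¹ * ∑ χ : DirichletCharacter ℂ q, G χ * (P χ - (if χ = 1 then (N:ℂ) else 0)) +
      ∑ n ∈ (Finset.Icc 1 N).filter (fun n => ¬ Nat.Coprime n q), (vonMangoldt n : ℂ) * ζ ^ n := by
    simp_rw [mul_sub, Finset.sum_sub_distrib, mul_sub]
    rw [hmain, ← hcop, Finset.sum_filter, sub_add_eq_add_sub, ← Finset.sum_add_distrib]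
    congr 1
    refine Finset.sum_congr rfl fun n _ => ?_
    by_cases h : Nat.Coprime n q <;> simp [h]
  rw [hsplit]
  refine (norm_add_le _ _).trans ?_
  have b1 : ‖(q.totient : ℂ)⁻¹ * ∑ χ : DirichletCharacter ℂ q, G χ * (P χ - (if χ = 1 then (N:ℂ) else 0))‖ ≤
      C1 * N / Real.log N ^ A := by
    have hcardχ : ((Finset.univ : Finset (DirichletCharacter ℂ q)).card : ℝ) = q.totient := by
      rw [Finset.card_univ, ← Nat.card_eq_fintype_card, DirichletCharacter.card_eq_totient_of_hasEnoughRootsOfUnity]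
    have hs : ‖∑ χ : DirichletCharacter ℂ q, G χ * (P χ - (if χ = 1 then (N:ℂ) else 0))‖ ≤
        q.totient * (q.totient * (C1 * N / Real.log N ^ (2*A))) := by
      refine (norm_sum_le _ _).trans ?_
      rw [← hcardχ, ← nsmul_eq_mul, ← Finset.sum_const, hcardχ]
      refine Finset.sum_le_sum fun χ _ => ?_
      rw [norm_mul]
      refine mul_le_mul (hGle χ) ?_ (norm_nonneg _) (by positivity)
      have := h1 N q hN hq hqN2 χ
      by_cases h : χ = 1
      · rw [if_pos h] at this ⊢; exact this
      · rw [if_neg h] at this ⊢; exact this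
    rw [norm_mul, norm_inv, Complex.norm_natCast]
    have hφR : (0:ℝ) < q.totient := by exact_mod_cast hφ
    have hφq : (q.totient:ℝ) ≤ Real.log N ^ A := le_trans (by exact_mod_cast Nat.totient_le q) hqN
    calc (q.totient:ℝ)⁻¹ * _ ≤ (q.totient:ℝ)⁻¹ * (q.totient * (q.totient * (C1 * N / Real.log N ^ (2*A)))) := by
          gcongr
      _ = q.totient * (C1 * N / Real.log N ^ (2*A)) := by field_simp
      _ ≤ Real.log N ^ A * (C1 * N / Real.log N ^ (2*A)) := by gcongr
      _ = C1 * N / Real.log N ^ A := by rw [two_mul, pow_add]; field_simp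
  have b2 : ‖∑ n ∈ (Finset.Icc 1 N).filter (fun n => ¬ Nat.Coprime n q), (vonMangoldt n : ℂ) * ζ ^ n‖ ≤
      (6 * (2*A+2).factorial) * N / Real.log N ^ A := by
    refine le_trans ?_ ((noncop hN hq).trans (log_q_bound A hN hqN))
    refine (norm_sum_le _ _).trans (Finset.sum_le_sum fun n _ => ?_)
    rw [norm_mul, norm_pow, hζn, one_pow, mul_one, Complex.norm_real,
      Real.norm_of_nonneg vonMangoldt_nonneg]
  calc _ ≤ _ := add_le_add b1 b2
    _ = _ := by ring

lemma log_pow_le_sqrt' (m : ℕ) : ∃ C : ℝ, 0 < C ∧ ∀ x : ℝ, 1 ≤ x → Real.log x ^ m ≤ C * Real.sqrt x :=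
  by
  refine ⟨2 ^ m * m.factorial, by positivity, fun x hx => ?_⟩
  have h := log_pow_le (x := Real.sqrt x) (Real.one_le_sqrt.mpr hx) m
  rw [Real.log_sqrt (by linarith), div_pow, div_le_iff₀ (by positivity)] at h
  linarith

open ArithmeticFunction in
/-- Uniform exponential sums at rationals, all prefixes. -/
theorem expG (m A : ℕ) : ∃ C : ℝ, 0 < C ∧ ∀ (X N q : ℕ), 3 ≤ X → N ≤ X → 0 < q → (q:ℝ) ≤ Real.log X ^ m →
    ∀ ζ : ℂ, IsPrimitiveRoot ζ q →
    ‖∑ n ∈ Finset.Icc 1 N, ((vonMangoldt n : ℂ) * ζ ^ n - (moebius q : ℂ) / (q.totient : ℂ))‖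
      ≤ C * X / Real.log X ^ A := by
  obtain ⟨C1, hC1, h1⟩ := expF (2 * m + A)
  obtain ⟨C2, hC2, h2⟩ := log_pow_le_sqrt' (A + 1)
  refine ⟨C1 * 2 ^ A + 16 * C2, by positivity, ?_⟩
  intro X N q hX hNX hq hqX ζ hζ
  have hL := one_le_log hX
  have hX1 : (1:ℝ) ≤ X := by exact_mod_cast (by omega : 1 ≤ X)
  have hζn : ‖ζ‖ = 1 := hζ.norm'_eq_one hq.ne'
  have hφ : (1:ℝ) ≤ q.totient := by exact_mod_cast Nat.totient_pos.mpr hq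
  have hμ : ‖(moebius q : ℂ)‖ ≤ 1 := by
    rw [Complex.norm_intCast]
    exact_mod_cast abs_moebius_le_one (n := q)
  have hN0 : (0:ℝ) ≤ N := Nat.cast_nonneg _
  have hs1 := Real.one_le_sqrt.mpr hX1
  rcases le_or_gt (N:ℝ) (8 * Real.sqrt X) with hs | hs
  · have : ‖∑ n ∈ Finset.Icc 1 N, ((vonMangoldt n : ℂ) * ζ ^ n - (moebius q : ℂ) / (q.totient : ℂ))‖ ≤
        N * (2 * Real.log X) := by
      refine (norm_sum_le _ _).trans ?_
      have hc : ((Finset.Icc 1 N).card : ℝ) = N := by simp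
      rw [← hc, ← nsmul_eq_mul, ← Finset.sum_const]
      refine Finset.sum_le_sum fun n hn => (norm_sub_le _ _).trans ?_
      have hn' := Finset.mem_Icc.mp hn
      rw [norm_mul, norm_pow, hζn, one_pow, mul_one, Complex.norm_real,
        Real.norm_of_nonneg vonMangoldt_nonneg, norm_div, Complex.norm_natCast, two_mul]
      refine add_le_add (vonMangoldt_le_log.trans (Real.log_le_log (by exact_mod_cast hn'.1)
        (by exact_mod_cast hn'.2.trans hNX))) ?_
      rw [div_le_iff₀ (by linarith)]
      nlinarith
    refine this.trans ?_
    rw [le_div_iff₀ (by positivity)]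
    have h3 := h2 X hX1
    calc (N:ℝ) * (2 * Real.log X) * Real.log X ^ A = 2 * N * Real.log X ^ (A+1) := by ring
      _ ≤ 2 * (8 * Real.sqrt X) * (C2 * Real.sqrt X) := by gcongr
      _ = 16 * C2 * (Real.sqrt X * Real.sqrt X) := by ring
      _ = 16 * C2 * X := by rw [Real.mul_self_sqrt (by linarith)]
      _ ≤ _ := by
        have : 0 ≤ C1 * 2 ^ A * X := by positivity
        linarith
  · have hN8 : 8 < N := by
      have : (8:ℝ) < N := by linarith
      exact_mod_cast this
    have hlog : Real.log X ≤ 2 * Real.log N := by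
      have : Real.log (Real.sqrt X) ≤ Real.log N := Real.log_le_log (by linarith) (by linarith)
      rw [Real.log_sqrt (by linarith)] at this
      linarith
    have hlog2 : 2 ≤ Real.log N := by
      have h9 : Real.log 8 ≤ Real.log N := Real.log_le_log (by norm_num) (by exact_mod_cast hN8.le)
      rw [show (8:ℝ) = 2 ^ 3 by norm_num, Real.log_pow] at h9
      have := Real.log_two_gt_d9
      push_cast at h9
      linarith
    have hqN : (q:ℝ) ≤ Real.log N ^ (2*m+A) := by
      calc (q:ℝ) ≤ Real.log X ^ m := hqX
        _ ≤ (2 * Real.log N)^m := by gcongr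
        _ ≤ (Real.log N * Real.log N)^m := by gcongr
        _ = Real.log N ^ (2*m) := by rw [← pow_two, ← pow_mul]
        _ ≤ _ := pow_le_pow_right₀ (by linarith) (by omega)
    have := h1 N q (by omega) hq hqN ζ hζ
    rw [Finset.sum_sub_distrib]
    simp only [Finset.sum_const, Nat.card_Icc, Nat.add_sub_cancel, nsmul_eq_mul]
    rw [mul_comm (N:ℂ)]
    refine this.trans ?_
    have hNX' : (N:ℝ) ≤ X := by exact_mod_cast hNX
    rw [div_le_div_iff₀ (by positivity) (by positivity)]
    calc C1 * N * Real.log X ^ A ≤ C1 * X * (2 * Real.log N)^A := by gcongr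
      _ = C1 * 2^A * X * Real.log N ^ A := by rw [mul_pow]; ring
      _ ≤ (C1 * 2^A + 16 * C2) * X * Real.log N ^ (2*m+A) := by
        gcongr
        · linarith
        · linarith
        · omega
end CM

end

section

open Complex Filter Topology MeasureTheory
namespace CM

/-- distance to the nearest integer -/
noncomputable def nd (x : ℝ) : ℝ := |x - round x|

lemma nd_eq (x : ℝ) : nd x = min (Int.fract x) (1 - Int.fract x) := abs_sub_round_eq_min x

lemma nd_nonneg (x : ℝ) : 0 ≤ nd x := abs_nonneg _

lemma nd_neg (x : ℝ) : nd (-x) = nd x := by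
  have h := norm_neg (x : UnitAddCircle)
  rw [← AddCircle.coe_neg, UnitAddCircle.norm_eq, UnitAddCircle.norm_eq] at h
  exact h

lemma nd_le_abs_sub (x : ℝ) (n : ℤ) : nd x ≤ |x - n| := round_le x n

lemma nd_sub_le (x y : ℝ) : nd x - |x - y| ≤ nd y := by
  have h1 := nd_le_abs_sub x (round y)
  have h2 := abs_sub_le x y (round y)
  have : nd y = |y - round y| := rfl
  linarith

lemma nd_add_int (x : ℝ) (n : ℤ) : nd (x + n) = nd x := by
  rw [nd_eq, nd_eq, Int.fract_add_intCast]

/-- if `x = a/q` is not an integer then `nd x ≥ 1/q` -/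
lemma nd_rat {a : ℤ} {q : ℕ} (hq : 0 < q) (h : ¬ (q:ℤ) ∣ a) : 1 / (q:ℝ) ≤ nd ((a:ℝ) / q) := by
  have hq0 : (0:ℝ) < q := by exact_mod_cast hq
  rw [nd, div_le_iff₀ hq0]
  have : |(a:ℝ)/q - round ((a:ℝ)/q)| * q = |((a - round ((a:ℝ)/q) * q : ℤ) : ℝ)| := by
    push_cast
    rw [← abs_of_pos hq0, ← abs_mul, abs_of_pos hq0]
    congr 1; field_simp
  rw [this]
  have hne : a - round ((a:ℝ)/q) * q ≠ 0 := by
    intro h0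
    exact h ⟨round ((a:ℝ)/q), by linarith⟩
  exact_mod_cast Int.one_le_abs hne

lemma ee_sub_one_ge (x : ℝ) : 4 * nd x ≤ ‖ee x - 1‖ := by
  set d := x - round x with hd
  have h1 : ee x = ee d := by
    have : x = d + (round x : ℤ) := by rw [hd]; ring
    conv_lhs => rw [this, ee_add, ee_int, mul_one]
  have h2 : ‖ee d - 1‖ = ‖2 * Real.sin (2 * Real.pi * d / 2)‖ := by
    rw [← Complex.norm_exp_I_mul_ofReal_sub_one, ee]
    congr 3; push_cast; ring
  have h3 : |d| ≤ 1/2 := abs_sub_round x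
  have h4 := Real.mul_abs_le_abs_sin (x := Real.pi * d) (by
    rw [abs_mul, abs_of_pos Real.pi_pos]; nlinarith [Real.pi_pos])
  rw [h1, h2, norm_mul, Real.norm_eq_abs, Real.norm_eq_abs, show 2 * Real.pi * d / 2 = Real.pi * d by ring]
  rw [abs_mul, abs_of_pos Real.pi_pos] at h4
  have : 2 / Real.pi * (Real.pi * |d|) = 2 * |d| := by field_simp
  rw [this] at h4
  simp only [nd, abs_two]
  linarith

/-- bound for geometric sums -/
noncomputable def gb (M x : ℝ) : ℝ := if nd x = 0 then M else min M (1 / nd x)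

lemma gb_le {M x : ℝ} : gb M x ≤ M := by
  rw [gb]; split_ifs
  · exact le_rfl
  · exact min_le_left _ _

lemma gb_nonneg {M x : ℝ} (hM : 0 ≤ M) : 0 ≤ gb M x := by
  rw [gb]; split_ifs
  · exact hM
  · exact le_min hM (div_nonneg zero_le_one (nd_nonneg x))

lemma gb_mul {M x : ℝ} : gb M x * nd x ≤ 1 := by
  rw [gb]; split_ifs with h
  · rw [h]; simp
  · have : 0 < nd x := lt_of_le_of_ne (nd_nonneg x) (Ne.symm h)
    calc _ ≤ 1 / nd x * nd x := by gcongr; exact min_le_right _ _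
      _ = 1 := by field_simp

lemma le_gb {M x y : ℝ} (h1 : y ≤ M) (h2 : y * nd x ≤ 1) : y ≤ gb M x := by
  rw [gb]; split_ifs with h
  · exact h1
  · have : 0 < nd x := lt_of_le_of_ne (nd_nonneg x) (Ne.symm h)
    exact le_min h1 (by rwa [le_div_iff₀ this])

lemma gb_mono {M M' x : ℝ} (h : M ≤ M') : gb M x ≤ gb M' x := le_gb (gb_le.trans h) gb_mul

lemma gb_neg (M x : ℝ) : gb M (-x) = gb M x := by simp only [gb, nd_neg]

lemma gb_le_gb {M M' x : ℝ} (h : gb M x ≤ M') : gb M x ≤ gb M' x := le_gb h gb_mul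

lemma geom_bd {M : ℝ} {a b : ℕ} (hab : (b:ℝ) - a ≤ M) (hM : 0 ≤ M) (x : ℝ) :
    ‖∑ m ∈ Finset.Ioc a b, ee (m * x)‖ ≤ gb M x := by
  apply le_gb
  · refine (norm_sum_le _ _).trans ?_
    simp only [norm_ee, Finset.sum_const, Nat.card_Ioc, nsmul_eq_mul, mul_one]
    rcases le_total a b with h | h
    · rw [Nat.cast_sub h]; exact hab
    · rw [Nat.sub_eq_zero_of_le h]; simpa using hM
  · have key : ‖(∑ m ∈ Finset.Ioc a b, ee (m * x)) * (ee x - 1)‖ ≤ 2 := by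
      rcases le_total a b with h | h
      · have : (∑ m ∈ Finset.Ioc a b, ee (m * x)) * (ee x - 1) = ee ((b+1:ℕ) * x) - ee ((a+1:ℕ)*x) := by
          rw [Finset.sum_mul]
          have h2 : Finset.Ioc a b = Finset.Ico (a+1) (b+1) := by ext; simp
          rw [h2, ← Finset.sum_Ico_sub (fun m : ℕ => ee (m * x)) (by omega : a + 1 ≤ b + 1)]
          refine Finset.sum_congr rfl fun m _ => ?_
          push_cast
          rw [add_mul, one_mul, ee_add]; ring
        rw [this]
        refine (norm_sub_le _ _).trans ?_
        rw [norm_ee, norm_ee]; norm_num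
      · rw [Finset.Ioc_eq_empty (by omega)]; simp
    rw [norm_mul] at key
    have h4 := ee_sub_one_ge x
    have h5 := norm_nonneg (∑ m ∈ Finset.Ioc a b, ee (m * x))
    nlinarith [nd_nonneg x]

/-- Number of points in a block whose fractional parts fall in the same cell. -/
lemma fiber_card {α : ℝ} {a : ℤ} {q : ℕ} (hq : 0 < q) (hc : IsCoprime a q)
    (hα : |α - a / q| ≤ 1 / (q:ℝ)^2) (k0 s : ℕ) :
    ((Finset.Ioc k0 (k0 + q)).filter (fun k : ℕ => ⌊(q:ℝ) * Int.fract (k * α)⌋₊ = s)).card ≤ 3 := by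
  classical
  set F := (Finset.Ioc k0 (k0 + q)).filter (fun k : ℕ => ⌊(q:ℝ) * Int.fract (k * α)⌋₊ = s) with hF
  rcases F.eq_empty_or_nonempty with h | ⟨k, hk⟩
  · rw [h]; simp
  haveI : NeZero q := ⟨hq.ne'⟩
  have hq0 : (0:ℝ) < q := by exact_mod_cast hq
  have hcard : F.card ≤ ({-1, 0, 1} : Finset (ZMod q)).card := by
    refine Finset.card_le_card_of_injOn (fun k' : ℕ => (((k':ℤ) - k) * a : ℤ)) ?_ ?_
    · intro k' hk'
      have hk' : k' ∈ F := hk'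
      rw [hF, Finset.mem_filter, Finset.mem_Ioc] at hk hk'
      have f1 := Nat.floor_le (a := (q:ℝ) * Int.fract (k * α)) (mul_nonneg hq0.le (Int.fract_nonneg _))
      have f2 := Nat.lt_floor_add_one ((q:ℝ) * Int.fract (k * α))
      have f3 := Nat.floor_le (a := (q:ℝ) * Int.fract (k' * α)) (mul_nonneg hq0.le (Int.fract_nonneg _))
      have f4 := Nat.lt_floor_add_one ((q:ℝ) * Int.fract (k' * α))
      rw [hk.2] at f1 f2
      rw [hk'.2] at f3 f4
      set M : ℤ := ⌊(k':ℝ) * α⌋ - ⌊(k:ℝ) * α⌋ with hM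
      have hdiff : |(q:ℝ) * (((k':ℝ) - k) * α - M)| < 1 := by
        have : (q:ℝ) * (((k':ℝ) - k) * α - M) = q * Int.fract (k' * α) - q * Int.fract (k * α) := by
          rw [Int.fract, Int.fract, hM]; push_cast; ring
        rw [this, abs_lt]; constructor <;> linarith
      have hkk : |(k':ℝ) - k| < q := by
        have h1 : (k':ℝ) ≤ k0 + q := by exact_mod_cast hk'.1.2
        have h2 : (k:ℝ) ≤ k0 + q := by exact_mod_cast hk.1.2
        have h3 : (k0:ℝ) < k' := by exact_mod_cast hk'.1.1
        have h4 : (k0:ℝ) < k := by exact_mod_cast hk.1.1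
        rw [abs_lt]; constructor <;> linarith
      have hβ : |(q:ℝ) * (((k':ℝ) - k) * (α - a / q))| ≤ 1 := by
        rw [abs_mul, abs_mul, abs_of_pos hq0]
        calc (q:ℝ) * (|(k':ℝ) - k| * |α - a/q|) ≤ q * (q * (1 / (q:ℝ)^2)) := by gcongr
          _ = 1 := by field_simp
      have hz : |((((k':ℤ) - k) * a - q * M : ℤ) : ℝ)| < 2 := by
        have : ((((k':ℤ) - k) * a - q * M : ℤ) : ℝ) = (q:ℝ) * (((k':ℝ) - k) * α - M) -
            (q:ℝ) * (((k':ℝ) - k) * (α - a / q)) := by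
          push_cast; field_simp; ring
        rw [this]
        have h7 := abs_lt.mp hdiff
        have h8 := abs_le.mp hβ
        rw [abs_lt]; constructor <;> linarith
      have hz' : |((k':ℤ) - k) * a - q * M| < 2 := by exact_mod_cast hz
      have hcast : (((((k':ℤ) - k) * a : ℤ)) : ZMod q) = ((((k':ℤ) - k) * a - q * M : ℤ) : ZMod q) := by
        push_cast; simp
      show (((((k':ℤ) - k) * a : ℤ)) : ZMod q) ∈ _
      rw [hcast]
      rw [abs_lt] at hz'
      generalize ((k':ℤ) - k) * a - q * M = z at hz' ⊢
      obtain ⟨h1, h2⟩ := hz'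
      have : z = -1 ∨ z = 0 ∨ z = 1 := by omega
      rcases this with rfl | rfl | rfl <;> simp
    · intro x hx y hy hxy
      have hx : x ∈ F := hx
      have hy : y ∈ F := hy
      rw [hF, Finset.mem_filter, Finset.mem_Ioc] at hx hy
      have h1 : (((((x:ℤ) - k) * a : ℤ)) : ZMod q) = ((((y:ℤ) - k) * a : ℤ) : ZMod q) := hxy
      rw [ZMod.intCast_eq_intCast_iff_dvd_sub] at h1
      have h2 : ((y:ℤ) - k) * a - ((x:ℤ) - k) * a = ((y:ℤ) - x) * a := by ring
      rw [h2] at h1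
      have h3 : (q:ℤ) ∣ (y:ℤ) - x := hc.symm.dvd_of_dvd_mul_right h1
      have h4 : |(y:ℤ) - x| < q := by rw [abs_lt]; constructor <;> omega
      have := Int.eq_zero_of_abs_lt_dvd h3 h4
      omega
  exact hcard.trans Finset.card_le_three

lemma harm_le (n : ℕ) : ∑ s ∈ Finset.Icc 1 n, (1:ℝ) / s ≤ 1 + Real.log n := by
  have := harmonic_le_one_add_log n
  rw [harmonic_eq_sum_Icc] at this
  push_cast at this
  simpa using this

/-- block lemma -/
lemma block {α : ℝ} {a : ℤ} {q : ℕ} (hq : 0 < q) (hc : IsCoprime a q)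
    (hα : |α - a / q| ≤ 1 / (q:ℝ)^2) {M : ℝ} (hM : 0 ≤ M) (k0 : ℕ) :
    ∑ k ∈ Finset.Ioc k0 (k0 + q), gb M (k * α) ≤ 6 * (M + q * (1 + Real.log q)) := by
  have hq0 : (0:ℝ) < q := by exact_mod_cast hq
  set w : ℕ → ℝ := fun s => (if s = 0 then M else q / s) +
    (if q - 1 - s = 0 then M else q / ((q - 1 - s : ℕ):ℝ)) with hw
  have hw0 : ∀ s, 0 ≤ w s := by
    intro s
    simp only [hw]
    split_ifs <;> positivity
  have hle : ∀ k : ℕ, gb M (k * α) ≤ w ⌊(q:ℝ) * Int.fract (k * α)⌋₊ := by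
    intro k
    set x := (k:ℝ) * α
    set s := ⌊(q:ℝ) * Int.fract x⌋₊ with hs
    have hx0 := Int.fract_nonneg x
    have hx1 := Int.fract_lt_one x
    have f1 := Nat.floor_le (a := (q:ℝ) * Int.fract x) (mul_nonneg hq0.le hx0)
    have f2 := Nat.lt_floor_add_one ((q:ℝ) * Int.fract x)
    rw [← hs] at f1 f2
    have hg0 := gb_nonneg (M := M) (x := x) hM
    have hg1 := gb_mul (M := M) (x := x)
    have hgM := gb_le (M := M) (x := x)
    rw [nd_eq] at hg1
    rcases le_total (Int.fract x) (1 - Int.fract x) with h | h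
    · rw [min_eq_left h] at hg1
      have : gb M x ≤ if s = 0 then M else (q:ℝ) / s := by
        split_ifs with h0
        · exact hgM
        · have hs0 : (0:ℝ) < s := by exact_mod_cast Nat.pos_of_ne_zero h0
          rw [le_div_iff₀ hs0]
          nlinarith
      simp only [hw]
      have : 0 ≤ (if q - 1 - s = 0 then M else (q:ℝ) / ((q - 1 - s : ℕ):ℝ)) := by split_ifs <;> positivity
      linarith
    · rw [min_eq_right h] at hg1
      have : gb M x ≤ if q - 1 - s = 0 then M else (q:ℝ) / ((q - 1 - s : ℕ):ℝ) := by
        split_ifs with h0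
        · exact hgM
        · have hs0 : (0:ℝ) < ((q - 1 - s : ℕ):ℝ) := by exact_mod_cast Nat.pos_of_ne_zero h0
          rw [le_div_iff₀ hs0]
          have : ((q - 1 - s : ℕ):ℝ) = q - 1 - s := by
            rw [Nat.cast_sub (by omega), Nat.cast_sub (by omega)]; simp
          rw [this]
          nlinarith
      simp only [hw]
      have : 0 ≤ (if s = 0 then M else (q:ℝ) / s) := by split_ifs <;> positivity
      linarith
  have hmaps : ∀ k ∈ Finset.Ioc k0 (k0 + q), ⌊(q:ℝ) * Int.fract ((k:ℕ) * α)⌋₊ ∈ Finset.range q := by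
    intro k _
    rw [Finset.mem_range, Nat.floor_lt (mul_nonneg hq0.le (Int.fract_nonneg _))]
    nlinarith [Int.fract_lt_one ((k:ℝ) * α)]
  calc ∑ k ∈ Finset.Ioc k0 (k0 + q), gb M (k * α)
      ≤ ∑ k ∈ Finset.Ioc k0 (k0 + q), w ⌊(q:ℝ) * Int.fract (k * α)⌋₊ := Finset.sum_le_sum fun k _ => hle k
    _ = ∑ s ∈ Finset.range q, ∑ k ∈ (Finset.Ioc k0 (k0 + q)).filter
          (fun k : ℕ => ⌊(q:ℝ) * Int.fract (k * α)⌋₊ = s), w ⌊(q:ℝ) * Int.fract (k * α)⌋₊ :=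
        (Finset.sum_fiberwise_of_maps_to hmaps _).symm
    _ ≤ ∑ s ∈ Finset.range q, 3 * w s := by
        refine Finset.sum_le_sum fun s _ => ?_
        rw [Finset.sum_congr rfl (fun k hk => by rw [(Finset.mem_filter.mp hk).2]), Finset.sum_const, nsmul_eq_mul]
        have := fiber_card hq hc hα k0 s
        have h3 : (((Finset.Ioc k0 (k0 + q)).filter (fun k : ℕ => ⌊(q:ℝ) * Int.fract (k * α)⌋₊ = s)).card : ℝ) ≤ 3 := by
          exact_mod_cast this
        exact mul_le_mul_of_nonneg_right h3 (hw0 s)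
    _ = 3 * (2 * ∑ s ∈ Finset.range q, (if s = 0 then M else (q:ℝ) / s)) := by
        rw [← Finset.mul_sum, hw, Finset.sum_add_distrib,
          Finset.sum_range_reflect (fun s : ℕ => if s = 0 then M else (q:ℝ) / (s:ℝ)) q, two_mul]
    _ ≤ 3 * (2 * (M + q * (1 + Real.log q))) := by
        obtain ⟨r, rfl⟩ : ∃ r, q = r + 1 := ⟨q - 1, by omega⟩
        rw [Finset.sum_range_succ', if_pos rfl]
        have h5 : ∑ s ∈ Finset.range r, (if s + 1 = 0 then M else ((r+1:ℕ):ℝ) / ((s+1:ℕ):ℝ)) ≤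
            ((r+1:ℕ):ℝ) * (1 + Real.log (r+1:ℕ)) := by
          have h6 : ∑ s ∈ Finset.range r, (if s + 1 = 0 then M else ((r+1:ℕ):ℝ) / ((s+1:ℕ):ℝ)) =
             ((r+1:ℕ):ℝ) * ∑ s ∈ Finset.Icc 1 r, (1:ℝ)/s := by
            rw [Finset.mul_sum, Finset.range_eq_Ico, Finset.sum_Ico_add' (fun s : ℕ =>
              if s = 0 then M else ((r+1:ℕ):ℝ) / (s:ℝ)) 0 r 1]
            refine Finset.sum_congr rfl fun s hs => ?_
            rw [if_neg (by have := (Finset.mem_Ico.mp hs).1; omega)]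
            ring
          rw [h6]
          refine mul_le_mul_of_nonneg_left ((harm_le r).trans ?_) (by positivity)
          rcases Nat.eq_zero_or_pos r with h | h
          · subst h; simp
          · have := Real.log_le_log (x := (r:ℝ)) (y := ((r+1:ℕ):ℝ)) (by exact_mod_cast h) (by push_cast; linarith)
            linarith
        linarith
    _ = _ := by ring

lemma sum_blocks (f : ℕ → ℝ) (q J : ℕ) :
    ∑ k ∈ Finset.Ioc 0 (J * q), f k = ∑ j ∈ Finset.range J, ∑ k ∈ Finset.Ioc (j * q) (j * q + q), f k := by
  induction J with
  | zero => simp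
  | succ J ih =>
    rw [Finset.sum_range_succ, ← ih, add_mul, one_mul,
      Finset.sum_Ioc_consecutive _ (Nat.zero_le _) (Nat.le_add_right _ _)]

lemma log_q_nonneg (q : ℕ) : 0 ≤ Real.log q := Real.log_natCast_nonneg q

/-- sums over an initial segment -/
lemma hsum {α : ℝ} {a : ℤ} {q : ℕ} (hq : 0 < q) (hc : IsCoprime a q)
    (hα : |α - a / q| ≤ 1 / (q:ℝ)^2) {M : ℝ} (hM : 0 ≤ M) (H : ℕ) :
    ∑ h ∈ Finset.range H, gb M (h * α) ≤ 7 * ((H:ℝ) / q + 1) * (M + q * (1 + Real.log q)) := by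
  have hq0 : (0:ℝ) < q := by exact_mod_cast hq
  have hlq := log_q_nonneg q
  set J := H / q + 1 with hJ
  have hsub : Finset.range H ⊆ insert 0 (Finset.Ioc 0 (J * q)) := by
    intro h hh
    rw [Finset.mem_range] at hh
    rw [Finset.mem_insert, Finset.mem_Ioc]
    have : H < J * q := by
      rw [hJ, mul_comm]; exact Nat.lt_mul_div_succ H hq
    omega
  have hJr : (J:ℝ) ≤ H / q + 1 := by
    rw [hJ]; push_cast; gcongr; exact Nat.cast_div_le
  have hR : 0 ≤ M + q * (1 + Real.log q) := by positivity
  calc ∑ h ∈ Finset.range H, gb M (h * α) ≤ ∑ h ∈ insert 0 (Finset.Ioc 0 (J * q)), gb M (h * α) :=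
        Finset.sum_le_sum_of_subset_of_nonneg hsub (fun _ _ _ => gb_nonneg hM)
    _ = gb M ((0:ℕ) * α) + ∑ h ∈ Finset.Ioc 0 (J * q), gb M (h * α) := Finset.sum_insert (by simp)
    _ ≤ M + ∑ j ∈ Finset.range J, 6 * (M + q * (1 + Real.log q)) := by
        rw [sum_blocks]
        exact add_le_add gb_le (Finset.sum_le_sum fun j _ => block hq hc hα hM _)
    _ = M + J * (6 * (M + q * (1 + Real.log q))) := by simp
    _ ≤ 1 * (M + q * (1 + Real.log q)) + ((H:ℝ) / q + 1) * (6 * (M + q * (1 + Real.log q))) := by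
        refine add_le_add ?_ (mul_le_mul_of_nonneg_right hJr (by positivity))
        have : 0 ≤ q * (1 + Real.log q) := by positivity
        linarith
    _ ≤ ((H:ℝ) / q + 1) * (M + q * (1 + Real.log q)) + ((H:ℝ) / q + 1) * (6 * (M + q * (1 + Real.log q))) := by
        have : 0 ≤ (H:ℝ) / q := by positivity
        gcongr
        linarith
    _ = _ := by ring

lemma type_one {α : ℝ} {a : ℤ} {q : ℕ} (hq : 0 < q) (hc : IsCoprime a q)
    (hα : |α - a / q| ≤ 1 / (q:ℝ)^2) {N : ℝ} (hN : 0 ≤ N) {K : ℕ} (hK : 0 < K) :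
    ∑ k ∈ Finset.Icc 1 K, gb (N / k) (k * α) ≤
      24 * (N / q + K + q) * (2 + Real.log q + Real.log K) := by
  have hq0 : (0:ℝ) < q := by exact_mod_cast hq
  have hlq := log_q_nonneg q
  have hlK := log_q_nonneg K
  set J := K / q with hJ
  have hsub : Finset.Icc 1 K ⊆ Finset.Ioc 0 ((J + 1) * q) := by
    intro h hh
    rw [Finset.mem_Icc] at hh
    rw [Finset.mem_Ioc]
    have : K < (J + 1) * q := by
      rw [hJ, mul_comm]; exact Nat.lt_mul_div_succ K hq
    omega
  have hJr : (J:ℝ) * q ≤ K := by exact_mod_cast Nat.div_mul_le_self K q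
  have h0 : ∑ k ∈ Finset.Ioc (0 * q) (0 * q + q), gb (N / k) (k * α) ≤
      6 * (2 * q + q * (1 + Real.log q)) + 6 * (2 * N / q + q * (1 + Real.log q)) := by
    have hpt : ∀ k ∈ Finset.Ioc (0 * q) (0 * q + q), gb (N / k) (k * α) ≤ gb (2 * q) (k * α) + gb (2 * N / q) (k * α) := by
      intro k hk
      rw [Finset.mem_Ioc] at hk
      have hk0 : (0:ℝ) < k := by exact_mod_cast (by omega : 0 < k)
      rcases Nat.lt_or_ge q (2 * k) with h | h
      · have h' : (q:ℝ) ≤ 2 * k := by exact_mod_cast h.le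
        have : gb (N / k) (k * α) ≤ gb (2 * N / q) (k * α) := by
          apply gb_mono
          rw [div_le_div_iff₀ hk0 hq0]
          nlinarith
        have := gb_nonneg (M := 2 * (q:ℝ)) (x := k * α) (by positivity)
        linarith
      · have h' : 2 * (k:ℝ) ≤ q := by exact_mod_cast h
        have hnd : ¬ (q:ℤ) ∣ (k:ℤ) * a := by
          intro hd
          have h3 : (q:ℤ) ∣ (k:ℤ) := hc.symm.dvd_of_dvd_mul_right hd
          have h4 := Int.le_of_dvd (by omega) h3
          omega
        have h5 := nd_rat hq hnd
        have h6 := nd_sub_le (((k * a : ℤ):ℝ) / q) (k * α)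
        have h7 : |((k * a : ℤ):ℝ) / q - k * α| ≤ 1 / (2 * q) := by
          have : ((k * a : ℤ):ℝ) / q - k * α = -(k * (α - a / q)) := by push_cast; ring
          rw [this, abs_neg, abs_mul, abs_of_pos hk0]
          calc (k:ℝ) * |α - a/q| ≤ (q/2) * (1 / (q:ℝ)^2) := by
                apply mul_le_mul (by linarith) hα (abs_nonneg _) (by positivity)
            _ = _ := by field_simp
        have h8 : 1 / (2 * (q:ℝ)) ≤ nd (k * α) := by
          have : 1 / (q:ℝ) - 1 / (2 * q) = 1 / (2 * q) := by field_simp; norm_num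
          linarith
        have h9 : gb (N / k) (k * α) ≤ 2 * q := by
          have h10 := gb_mul (M := N / k) (x := k * α)
          have h11 := gb_nonneg (M := N / k) (x := k * α) (by positivity)
          have h12 : gb (N / k) (k * α) * (1 / (2 * (q:ℝ))) ≤ 1 :=
            (mul_le_mul_of_nonneg_left h8 h11).trans h10
          rw [mul_one_div, div_le_one (by positivity)] at h12
          exact h12
        have := gb_le_gb h9
        have := gb_nonneg (M := 2 * N / (q:ℝ)) (x := k * α) (by positivity)
        linarith
    refine (Finset.sum_le_sum hpt).trans ?_
    rw [Finset.sum_add_distrib]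
    exact add_le_add (block hq hc hα (by positivity) _) (block hq hc hα (by positivity) _)
  have hj : ∀ j : ℕ, ∑ k ∈ Finset.Ioc ((j+1) * q) ((j+1) * q + q), gb (N / k) (k * α) ≤
      6 * (N / q * (1 / ((j+1:ℕ):ℝ)) + q * (1 + Real.log q)) := by
    intro j
    have : N / q * (1 / ((j+1:ℕ):ℝ)) = N / (((j+1:ℕ):ℝ) * q) := by field_simp
    rw [this]
    refine le_trans (Finset.sum_le_sum fun k hk => ?_) (block hq hc hα (M := N / (((j+1:ℕ):ℝ) * q)) (by positivity) ((j+1)*q))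
    apply gb_mono
    have hk' : (((j+1:ℕ):ℝ) * q) ≤ k := by exact_mod_cast (Finset.mem_Ioc.mp hk).1.le
    exact div_le_div_of_nonneg_left hN (by positivity) hk'
  have hharm : ∑ j ∈ Finset.range J, (1 / ((j+1:ℕ):ℝ)) ≤ 1 + Real.log K := by
    have h1 : ∑ j ∈ Finset.range J, (1 / ((j+1:ℕ):ℝ)) = ∑ s ∈ Finset.Icc 1 J, (1:ℝ) / s := by
      rw [Finset.range_eq_Ico, Finset.sum_Ico_add' (fun s : ℕ => 1 / (s:ℝ)) 0 J 1]
      rfl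
    rw [h1]
    refine (harm_le J).trans ?_
    rcases Nat.eq_zero_or_pos J with h | h
    · rw [h]; simpa using hlK
    · have := Real.log_le_log (x := (J:ℝ)) (y := K) (by exact_mod_cast h) (by exact_mod_cast Nat.div_le_self K q)
      linarith
  have hNq : 0 ≤ N / q := by positivity
  calc ∑ k ∈ Finset.Icc 1 K, gb (N / k) (k * α)
      ≤ ∑ k ∈ Finset.Ioc 0 ((J + 1) * q), gb (N / k) (k * α) :=
        Finset.sum_le_sum_of_subset_of_nonneg hsub (fun _ _ _ => gb_nonneg (by positivity))
    _ = ∑ j ∈ Finset.range J, ∑ k ∈ Finset.Ioc ((j+1) * q) ((j+1) * q + q), gb (N / k) (k * α) +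
        ∑ k ∈ Finset.Ioc (0 * q) (0 * q + q), gb (N / k) (k * α) := by
        rw [sum_blocks, Finset.sum_range_succ']
    _ ≤ ∑ j ∈ Finset.range J, 6 * (N / q * (1 / ((j+1:ℕ):ℝ)) + q * (1 + Real.log q)) +
        (6 * (2 * q + q * (1 + Real.log q)) + 6 * (2 * N / q + q * (1 + Real.log q))) :=
        add_le_add (Finset.sum_le_sum fun j _ => hj j) h0
    _ = 6 * (N / q * ∑ j ∈ Finset.range J, (1 / ((j+1:ℕ):ℝ)) + (J * q) * (1 + Real.log q)) +
        (6 * (2 * q + q * (1 + Real.log q)) + 6 * (2 * N / q + q * (1 + Real.log q))) := by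
        rw [← Finset.mul_sum, Finset.sum_add_distrib, ← Finset.mul_sum, Finset.sum_const, Finset.card_range, nsmul_eq_mul]
        ring
    _ ≤ 6 * (N / q * (1 + Real.log K) + K * (1 + Real.log q)) +
        (6 * (2 * q + q * (1 + Real.log q)) + 6 * (2 * (N / q) + q * (1 + Real.log q))) := by
        rw [mul_div_assoc]
        gcongr
    _ ≤ _ := by
        have hKr : (0:ℝ) ≤ K := Nat.cast_nonneg _
        have p1 := mul_nonneg hNq hlK
        have p2 := mul_nonneg hNq hlq
        have p3 := mul_nonneg hq0.le hlq
        have p4 := mul_nonneg hq0.le hlK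
        have p5 := mul_nonneg hKr hlq
        have p6 := mul_nonneg hKr hlK
        nlinarith
end CM

end

section

open Complex Filter Topology MeasureTheory
namespace CM

lemma abel_mono (g : ℕ → ℝ) (b : ℕ → ℂ) {M N : ℕ} {P : ℝ} (hP0 : 0 ≤ P)
    (hg : ∀ n, M < n → g n ≤ g (n + 1)) (hg0 : ∀ n, 0 ≤ g n)
    (hP : ∀ n, M ≤ n → n ≤ N → ‖∑ m ∈ Finset.Ioc M n, b m‖ ≤ P) :
    ‖∑ n ∈ Finset.Ioc M N, (g n : ℂ) * b n‖ ≤ 2 * P * g N := by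
  rcases Nat.lt_or_ge M N with h | h
  · refine (abel_bd (fun n => (g n : ℂ)) b h.le hP).trans ?_
    have : ∀ n ∈ Finset.Ico (M + 1) N, ‖(g n : ℂ) - (g (n + 1) : ℂ)‖ = g (n + 1) - g n := by
      intro n hn
      rw [Finset.mem_Ico] at hn
      rw [← Complex.ofReal_sub, Complex.norm_real, Real.norm_eq_abs, abs_sub_comm,
        abs_of_nonneg (sub_nonneg.mpr (hg n (by omega)))]
    rw [Finset.sum_congr rfl this, Finset.sum_Ico_sub _ (by omega), Complex.norm_real,
      Real.norm_of_nonneg (hg0 N)]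
    nlinarith [hg0 (M+1)]
  · rw [Finset.Ioc_eq_empty (by omega)]
    simp only [Finset.sum_empty, norm_zero]
    have := hg0 N
    positivity

lemma dsum (f g : ArithmeticFunction ℝ) (F : ℕ → ℂ) (N : ℕ) :
    ∑ n ∈ Finset.Ioc 0 N, ((⇑(f * g) n : ℝ) : ℂ) * F n =
      ∑ k ∈ Finset.Ioc 0 N, (f k : ℂ) * ∑ m ∈ Finset.Ioc 0 (N / k), (g m : ℂ) * F (k * m) := by
  have h1 : ∑ n ∈ Finset.Ioc 0 N, ((⇑(f * g) n : ℝ) : ℂ) * F n =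
      ∑ n ∈ Finset.Ioc 0 N, ∑ x ∈ (Finset.Ioc 0 N ×ˢ Finset.Ioc 0 N).filter (fun x => x.1 * x.2 = n),
        (f x.1 : ℂ) * ((g x.2 : ℂ) * F (x.1 * x.2)) := by
    refine Finset.sum_congr rfl fun n hn => ?_
    simp only [Finset.mem_Ioc] at hn
    rw [ArithmeticFunction.mul_apply, ← Nat.divisorsAntidiagonal_eq_prod_filter_of_le hn.1.ne' hn.2]
    push_cast
    rw [Finset.sum_mul]
    refine Finset.sum_congr rfl fun x hx => ?_
    rw [(Nat.mem_divisorsAntidiagonal.mp hx).1]; ring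
  rw [h1]
  simp_rw [Finset.sum_filter]
  rw [Finset.sum_comm, Finset.sum_product]
  refine Finset.sum_congr rfl fun k hk => ?_
  rw [Finset.mem_Ioc] at hk
  rw [Finset.mul_sum, ← Finset.sum_subset (s₁ := Finset.Ioc 0 (N / k)) (s₂ := Finset.Ioc 0 N)]
  · refine Finset.sum_congr rfl fun m hm => ?_
    rw [Finset.mem_Ioc] at hm
    rw [Finset.sum_ite_eq, if_pos]
    rw [Finset.mem_Ioc]
    refine ⟨Nat.mul_pos hk.1 hm.1, ?_⟩
    calc k * m ≤ k * (N / k) := Nat.mul_le_mul_left _ hm.2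
      _ ≤ N := Nat.mul_div_le _ _
  · intro m hm
    rw [Finset.mem_Ioc] at hm ⊢
    exact ⟨hm.1, hm.2.trans (Nat.div_le_self _ _)⟩
  · intro m hm hm'
    rw [Finset.mem_Ioc] at hm hm'
    rw [Finset.sum_ite_eq, if_neg]
    rw [Finset.mem_Ioc]
    rintro ⟨_, h⟩
    apply hm'
    refine ⟨hm.1, ?_⟩
    rw [Nat.le_div_iff_mul_le hk.1, mul_comm]; exact h

/-- low truncation -/
noncomputable def lo (u : ℕ) (f : ArithmeticFunction ℝ) : ArithmeticFunction ℝ :=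
  ⟨fun n => if n ≤ u then f n else 0, by simp⟩

lemma lo_apply (u : ℕ) (f : ArithmeticFunction ℝ) (n : ℕ) : lo u f n = if n ≤ u then f n else 0 := rfl

lemma hi_apply (u : ℕ) (f : ArithmeticFunction ℝ) (n : ℕ) : (f - lo u f) n = if n ≤ u then 0 else f n := by
  have : (f - lo u f) n = f n - lo u f n := by
    rw [sub_eq_add_neg, ArithmeticFunction.add_apply, sub_eq_add_neg]; rfl
  rw [this, lo_apply]
  split_ifs <;> simp

open ArithmeticFunction in
lemma vaughan_id (u : ℕ) :
    vonMangoldt = lo u vonMangoldt + lo u ((moebius : ArithmeticFunction ℤ) : ArithmeticFunction ℝ) * ArithmeticFunction.log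
      - (lo u vonMangoldt * lo u ((moebius : ArithmeticFunction ℤ) : ArithmeticFunction ℝ)) * (zeta : ArithmeticFunction ℝ)
      + (((moebius : ArithmeticFunction ℤ) : ArithmeticFunction ℝ) - lo u ((moebius : ArithmeticFunction ℤ) : ArithmeticFunction ℝ)) *
       ((vonMangoldt - lo u vonMangoldt) * (zeta : ArithmeticFunction ℝ)) := by
  have h1 : (vonMangoldt : ArithmeticFunction ℝ) * (zeta : ArithmeticFunction ℝ) = ArithmeticFunction.log := vonMangoldt_mul_zeta
  have h2 : ((moebius : ArithmeticFunction ℤ) : ArithmeticFunction ℝ) * (zeta : ArithmeticFunction ℝ) = 1 := coe_moebius_mul_coe_zeta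
  generalize ((moebius : ArithmeticFunction ℤ) : ArithmeticFunction ℝ) = m at *
  generalize (zeta : ArithmeticFunction ℝ) = z at *
  rw [← h1]
  linear_combination (lo u vonMangoldt - vonMangoldt) * h2

lemma supp_sum {f B : ℕ → ℝ} {c : ℝ} {K N : ℕ} (hc0 : 0 ≤ c)
    (hc : ∀ k, 0 < k → k ≤ N → |f k| ≤ c) (h0 : ∀ k, K < k → f k = 0)
    (hB : ∀ k, 0 ≤ B k) :
    ∑ k ∈ Finset.Ioc 0 N, |f k| * B k ≤ c * ∑ k ∈ Finset.Icc 1 K, B k := by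
  calc ∑ k ∈ Finset.Ioc 0 N, |f k| * B k ≤ ∑ k ∈ Finset.Ioc 0 N, if k ∈ Finset.Icc 1 K then c * B k else 0 := by
        refine Finset.sum_le_sum fun k hk => ?_
        rw [Finset.mem_Ioc] at hk
        split_ifs with h
        · exact mul_le_mul_of_nonneg_right (hc k hk.1 hk.2) (hB k)
        · rw [Finset.mem_Icc] at h
          rw [h0 k (by omega)]; simp
    _ = ∑ k ∈ (Finset.Ioc 0 N).filter (fun k => k ∈ Finset.Icc 1 K), c * B k := by rw [Finset.sum_filter]
    _ ≤ ∑ k ∈ Finset.Icc 1 K, c * B k := by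
        refine Finset.sum_le_sum_of_subset_of_nonneg (fun k hk => (Finset.mem_filter.mp hk).2) ?_
        intro k _ _
        exact mul_nonneg hc0 (hB k)
    _ = _ := by rw [Finset.mul_sum]

/-- Type I sums -/
lemma type_one' {α : ℝ} {a : ℤ} {q N : ℕ} (hq : 0 < q) (hqN : q ≤ N) (hc : IsCoprime a q)
    (hα : |α - a / q| ≤ 1 / (q:ℝ)^2) {K : ℕ} (hK : 0 < K) (hKN : K ≤ N) (f g : ArithmeticFunction ℝ)
    {c : ℝ} (hc0 : 0 ≤ c) (hcf : ∀ k, 0 < k → k ≤ N → |f k| ≤ c) (h0 : ∀ k, K < k → f k = 0)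
    {d : ℝ} (hd0 : 0 ≤ d)
    (hg : ∀ n, 0 < n → g n ≤ g (n+1)) (hg0 : ∀ n, 0 ≤ g n) (hgd : ∀ n, n ≤ N → g n ≤ d) :
    ‖∑ n ∈ Finset.Ioc 0 N, ((⇑(f * g) n : ℝ) : ℂ) * ee (n * α)‖ ≤
      c * d * (96 * (1 + Real.log N) * ((N:ℝ) / q + K + q)) := by
  rw [dsum f g (fun n => ee (n * α))]
  have hN0 : 0 < N := by omega
  have hinner : ∀ k : ℕ, ‖∑ m ∈ Finset.Ioc 0 (N / k), (g m : ℂ) * ee ((k * m : ℕ) * α)‖ ≤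
      2 * gb ((N:ℝ) / k) (k * α) * d := by
    intro k
    have e : ∀ m : ℕ, ee ((k * m : ℕ) * α) = ee (m * (k * α)) := by
      intro m; congr 1; push_cast; ring
    simp_rw [e]
    have hgb0 : 0 ≤ gb ((N:ℝ) / k) (k * α) := gb_nonneg (by positivity)
    refine (abel_mono (fun n => g n) (fun m => ee (m * (k * α))) hgb0 hg hg0 ?_).trans ?_
    · intro n _ hn
      refine geom_bd ?_ (by positivity) _
      have : (n:ℝ) ≤ ((N / k : ℕ):ℝ) := by exact_mod_cast hn
      have h2 : ((N / k : ℕ):ℝ) ≤ (N:ℝ) / k := Nat.cast_div_le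
      push_cast; linarith
    · refine mul_le_mul_of_nonneg_left (hgd _ (Nat.div_le_self _ _)) (by positivity)
  calc _ ≤ ∑ k ∈ Finset.Ioc 0 N, |f k| * (2 * gb ((N:ℝ) / k) (k * α) * d) := by
        refine (norm_sum_le _ _).trans (Finset.sum_le_sum fun k _ => ?_)
        rw [norm_mul, Complex.norm_real, Real.norm_eq_abs]
        exact mul_le_mul_of_nonneg_left (hinner k) (abs_nonneg _)
    _ ≤ c * ∑ k ∈ Finset.Icc 1 K, (2 * gb ((N:ℝ) / k) (k * α) * d) := by
        refine supp_sum hc0 hcf h0 fun k => ?_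
        have hgb0 : 0 ≤ gb ((N:ℝ) / k) (k * α) := gb_nonneg (by positivity)
        positivity
    _ = c * d * (2 * ∑ k ∈ Finset.Icc 1 K, gb ((N:ℝ) / k) (k * α)) := by
        rw [← Finset.sum_mul, ← Finset.mul_sum]; ring
    _ ≤ c * d * (2 * (24 * ((N:ℝ) / q + K + q) * (2 + Real.log q + Real.log K))) := by
        have := type_one hq hc hα (N := N) (by positivity) hK
        gcongr
    _ ≤ c * d * (2 * (24 * ((N:ℝ) / q + K + q) * (2 * (1 + Real.log N)))) := by
        have h1 : Real.log q ≤ Real.log N := Real.log_le_log (by exact_mod_cast hq) (by exact_mod_cast hqN)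
        have h2 : Real.log K ≤ Real.log N := Real.log_le_log (by exact_mod_cast hK) (by exact_mod_cast hKN)
        have : 2 + Real.log q + Real.log K ≤ 2 * (1 + Real.log N) := by linarith
        gcongr
    _ = _ := by ring

lemma bil_inner {N u m1 m2 : ℕ} (h2 : 0 < m2) (h12 : m1 ≤ m2) (α : ℝ) :
    ‖∑ k ∈ (Finset.Ioc u N).filter (fun k => k * m1 ≤ N ∧ k * m2 ≤ N), ((k:ℝ):ℂ) * ee (k * (((m1:ℝ) - m2) * α))‖ ≤
      2 * gb ((N:ℝ) / m2) (((m2 - m1 : ℕ):ℝ) * α) * ((N:ℝ) / m2) := by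
  have e : (Finset.Ioc u N).filter (fun k => k * m1 ≤ N ∧ k * m2 ≤ N) = Finset.Ioc u (N / m2) := by
    ext k
    simp only [Finset.mem_filter, Finset.mem_Ioc]
    rw [Nat.le_div_iff_mul_le h2]
    constructor
    · rintro ⟨⟨h, _⟩, _, h'⟩; exact ⟨h, h'⟩
    · rintro ⟨h, h'⟩
      refine ⟨⟨h, ?_⟩, ?_, h'⟩
      · exact (Nat.le_mul_of_pos_right _ h2).trans h'
      · exact (Nat.mul_le_mul_left _ h12).trans h'
  rw [e]
  have hgb0 : 0 ≤ gb ((N:ℝ) / m2) (((m2 - m1 : ℕ):ℝ) * α) := gb_nonneg (by positivity)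
  have hcast : ((N / m2 : ℕ):ℝ) ≤ (N:ℝ) / m2 := Nat.cast_div_le
  refine (abel_mono (fun n => (n:ℝ)) (fun k => ee (k * (((m1:ℝ) - m2) * α))) hgb0
    (fun n _ => by push_cast; linarith) (fun n => by positivity) ?_).trans ?_
  · intro n _ hn
    rw [Nat.cast_sub h12, ← gb_neg]
    have : -(((m2:ℝ) - m1) * α) = ((m1:ℝ) - m2) * α := by ring
    rw [this]
    refine geom_bd ?_ (by positivity) _
    have : (n:ℝ) ≤ ((N / m2 : ℕ):ℝ) := by exact_mod_cast hn
    have h0 : (0:ℝ) ≤ u := by positivity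
    linarith
  · exact mul_le_mul_of_nonneg_left hcast (by positivity)

lemma bil_inner' {N u m1 m2 : ℕ} (h1 : 0 < m1) (h2 : 0 < m2) (α : ℝ) :
    ‖∑ k ∈ (Finset.Ioc u N).filter (fun k => k * m1 ≤ N ∧ k * m2 ≤ N), ((k:ℝ):ℂ) * ee (k * (((m1:ℝ) - m2) * α))‖ ≤
      (if m1 ≤ m2 then 2 * gb ((N:ℝ) / m2) (((m2 - m1 : ℕ):ℝ) * α) * ((N:ℝ) / m2) else 0) +
      (if m2 ≤ m1 then 2 * gb ((N:ℝ) / m1) (((m1 - m2 : ℕ):ℝ) * α) * ((N:ℝ) / m1) else 0) := by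
  have p1 : 0 ≤ (if m1 ≤ m2 then 2 * gb ((N:ℝ) / m2) (((m2 - m1 : ℕ):ℝ) * α) * ((N:ℝ) / m2) else 0) := by
    have : 0 ≤ gb ((N:ℝ) / m2) (((m2 - m1 : ℕ):ℝ) * α) := gb_nonneg (by positivity)
    split_ifs <;> positivity
  have p2 : 0 ≤ (if m2 ≤ m1 then 2 * gb ((N:ℝ) / m1) (((m1 - m2 : ℕ):ℝ) * α) * ((N:ℝ) / m1) else 0) := by
    have : 0 ≤ gb ((N:ℝ) / m1) (((m1 - m2 : ℕ):ℝ) * α) := gb_nonneg (by positivity)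
    split_ifs <;> positivity
  rcases le_total m1 m2 with h | h
  · have := bil_inner (N := N) (u := u) h2 h α
    rw [if_pos h]
    rw [if_pos h] at p1
    linarith
  · have := bil_inner (N := N) (u := u) h1 h (-α)
    rw [if_pos h]
    rw [if_pos h] at p2
    have e1 : (Finset.Ioc u N).filter (fun k => k * m2 ≤ N ∧ k * m1 ≤ N) =
      (Finset.Ioc u N).filter (fun k => k * m1 ≤ N ∧ k * m2 ≤ N) := by
      congr 1; ext k; exact and_comm
    have e2 : ∀ k : ℕ, (k:ℝ) * (((m2:ℝ) - m1) * -α) = k * (((m1:ℝ) - m2) * α) := fun k => by ring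
    rw [e1] at this
    simp_rw [e2] at this
    rw [mul_neg, gb_neg] at this
    linarith

lemma tri_sum (F : ℕ → ℝ) (u m V : ℕ) (hF : ∀ h, 0 ≤ F h) :
    ∑ m1 ∈ Finset.Ioc u V, (if m1 ≤ m then F (m - m1) else 0) ≤ ∑ h ∈ Finset.range m, F h := by
  rw [← Finset.sum_filter]
  rw [← Finset.sum_image (f := F) (g := fun m1 => m - m1)]
  · refine Finset.sum_le_sum_of_subset_of_nonneg ?_ (fun h _ _ => hF h)
    intro x hx
    rw [Finset.mem_image] at hx
    obtain ⟨y, hy, rfl⟩ := hx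
    rw [Finset.mem_filter, Finset.mem_Ioc] at hy
    rw [Finset.mem_range]; omega
  · intro x hx y hy hxy
    simp only [Finset.coe_filter, Finset.mem_Ioc, Set.mem_setOf_eq] at hx hy
    simp only at hxy
    omega

lemma bil_double {α : ℝ} {a : ℤ} {q N u : ℕ} (hq : 0 < q) (hqN : q ≤ N) (hc : IsCoprime a q)
    (hα : |α - a / q| ≤ 1 / (q:ℝ)^2) (hu : 0 < u) :
    ∑ m1 ∈ Finset.Ioc u (N / u), ∑ m2 ∈ Finset.Ioc u (N / u),
     ‖∑ k ∈ (Finset.Ioc u N).filter (fun k => k * m1 ≤ N ∧ k * m2 ≤ N), ((k:ℝ):ℂ) * ee (k * (((m1:ℝ) - m2) * α))‖ ≤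
      56 * (1 + Real.log N) ^ 2 * ((N:ℝ)^2 / q + (N:ℝ)^2 / u + N * q) := by
  set V := N / u with hV
  have hN0 : 0 < N := by omega
  have hNr : (0:ℝ) < N := by exact_mod_cast hN0
  have hqr : (0:ℝ) < q := by exact_mod_cast hq
  have hur : (0:ℝ) < u := by exact_mod_cast hu
  set L := 1 + Real.log N with hL
  have hlogN : 0 ≤ Real.log N := log_q_nonneg N
  have hL1 : 1 ≤ L := by linarith
  have hVN : V ≤ N := Nat.div_le_self _ _
  have hVr : (V:ℝ) ≤ N / u := Nat.cast_div_le
  set T : ℕ → ℕ → ℝ := fun m1 m2 => if m1 ≤ m2 then 2 * gb ((N:ℝ) / m2) (((m2 - m1 : ℕ):ℝ) * α) * ((N:ℝ) / m2) else 0 with hT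
  have hl : 1 + Real.log q ≤ L := by
    have h1 : Real.log q ≤ Real.log N := Real.log_le_log (by exact_mod_cast hq) (by exact_mod_cast hqN)
    linarith
  have hone : ∀ m ∈ Finset.Ioc u V, ∑ m1 ∈ Finset.Ioc u V, T m1 m ≤
      14 * ((N:ℝ)^2 / q * (1 / m) + N * L + N^2 / u * (1 / m) + N * q * L * (1/m)) := by
    intro m hm
    rw [Finset.mem_Ioc] at hm
    have hm0 : (0:ℝ) < m := by exact_mod_cast (show 0 < m by omega)
    have hum : (u:ℝ) ≤ m := by exact_mod_cast hm.1.le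
    have t1 := tri_sum (fun h => 2 * gb ((N:ℝ) / m) ((h:ℝ) * α) * ((N:ℝ) / m)) u m V (fun h => by
      have : 0 ≤ gb ((N:ℝ) / m) ((h:ℝ) * α) := gb_nonneg (by positivity)
      positivity)
    have t2 : ∑ h ∈ Finset.range m, 2 * gb ((N:ℝ) / m) ((h:ℝ) * α) * ((N:ℝ) / m) =
      2 * ((N:ℝ)/m) * ∑ h ∈ Finset.range m, gb ((N:ℝ) / m) ((h:ℝ) * α) := by
      rw [Finset.mul_sum]; refine Finset.sum_congr rfl fun h _ => by ring
    have t3 := hsum hq hc hα (M := (N:ℝ)/m) (by positivity) m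
    calc _ ≤ _ := t1
      _ = _ := t2
      _ ≤ 2 * ((N:ℝ)/m) * (7 * ((m:ℝ) / q + 1) * ((N:ℝ)/m + q * (1 + Real.log q))) := by
          exact mul_le_mul_of_nonneg_left t3 (by positivity)
      _ ≤ 2 * ((N:ℝ)/m) * (7 * ((m:ℝ) / q + 1) * ((N:ℝ)/m + q * L)) := by gcongr
      _ = 14 * ((N:ℝ)^2 / q * (1 / m) + N * L + N^2 / m * (1 / m) + N * q * L * (1/m)) := by
          field_simp; ring
      _ ≤ _ := by gcongr
  have hharm : ∑ m ∈ Finset.Ioc u V, (1:ℝ) / m ≤ L := by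
    calc _ ≤ ∑ m ∈ Finset.Icc 1 N, (1:ℝ) / m := by
          refine Finset.sum_le_sum_of_subset_of_nonneg ?_ (fun h _ _ => by positivity)
          intro x hx
          rw [Finset.mem_Ioc] at hx; rw [Finset.mem_Icc]; omega
      _ ≤ _ := harm_le N
  have htot : ∑ m ∈ Finset.Ioc u V, ∑ m1 ∈ Finset.Ioc u V, T m1 m ≤
      28 * L ^ 2 * ((N:ℝ)^2 / q + (N:ℝ)^2 / u + N * q) := by
    calc _ ≤ ∑ m ∈ Finset.Ioc u V, 14 * ((N:ℝ)^2 / q * (1 / m) + N * L + N^2 / u * (1 / m) + N * q * L * (1/m)) :=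
          Finset.sum_le_sum hone
      _ = 14 * (((N:ℝ)^2 / q + N^2 / u + N * q * L) * (∑ m ∈ Finset.Ioc u V, (1:ℝ)/m) + (Finset.Ioc u V).card * (N * L)) := by
          rw [← Finset.mul_sum]
          simp only [Finset.sum_add_distrib, ← Finset.mul_sum, Finset.sum_const, nsmul_eq_mul]
          ring
      _ ≤ 14 * (((N:ℝ)^2 / q + N^2 / u + N * q * L) * L + (N / u) * (N * L)) := by
          have hcard : ((Finset.Ioc u V).card : ℝ) ≤ N / u := by
            rw [Nat.card_Ioc]
            refine le_trans ?_ hVr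
            exact_mod_cast Nat.sub_le _ _
          gcongr
      _ ≤ 14 * (((N:ℝ)^2 / q + N^2 / u + N * q) * L * L + (N^2 / u) * (L * L)) := by
          have e : ((N:ℝ)^2 / q + N^2 / u + N * q * L) ≤ ((N:ℝ)^2 / q + N^2 / u + N * q) * L := by
            have : (N:ℝ)^2 / q + N^2 / u ≤ ((N:ℝ)^2 / q + N^2 / u) * L := le_mul_of_one_le_right (by positivity) hL1
            nlinarith
          have e2 : (N / u : ℝ) * (N * L) ≤ (N^2 / u) * (L * L) := by
            have : L ≤ L * L := le_mul_of_one_le_right (by positivity) hL1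
            calc (N / u : ℝ) * (N * L) = (N^2/u) * L := by field_simp
              _ ≤ _ := by gcongr
          have e3 := mul_le_mul_of_nonneg_right e (by linarith : 0 ≤ L)
          linarith
      _ ≤ _ := by
          have : 0 ≤ (N:ℝ)^2 / q * (L * L) := by positivity
          have : 0 ≤ (N:ℝ) * q * (L * L) := by positivity
          nlinarith
  calc _ ≤ ∑ m1 ∈ Finset.Ioc u V, ∑ m2 ∈ Finset.Ioc u V, (T m1 m2 + T m2 m1) := by
        refine Finset.sum_le_sum fun m1 h1 => Finset.sum_le_sum fun m2 h2 => ?_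
        rw [Finset.mem_Ioc] at h1 h2
        exact bil_inner' (by omega) (by omega) α
    _ = (∑ m ∈ Finset.Ioc u V, ∑ m1 ∈ Finset.Ioc u V, T m1 m) + ∑ m ∈ Finset.Ioc u V, ∑ m1 ∈ Finset.Ioc u V, T m1 m := by
        simp only [Finset.sum_add_distrib]
        congr 1
        exact Finset.sum_comm
    _ ≤ _ := by linarith

lemma ee_conj (x : ℝ) : (starRingEnd ℂ) (ee x) = ee (-x) := by
  rw [ee_neg, ← Complex.inv_eq_conj (norm_ee x)]

lemma type_two {α : ℝ} {a : ℤ} {q N u : ℕ} (hq : 0 < q) (hqN : q ≤ N) (hc : IsCoprime a q)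
    (hα : |α - a / q| ≤ 1 / (q:ℝ)^2) (hu : 0 < u) (h f : ℕ → ℝ)
    (hh : ∀ k, |h k| ≤ 1) (hh0 : ∀ k, k ≤ u → h k = 0)
    (hf : ∀ m, 0 < m → m ≤ N → |f m| ≤ Real.log N) (hf0 : ∀ m, m ≤ u → f m = 0) :
    ‖∑ k ∈ Finset.Ioc 0 N, (h k : ℂ) * ∑ m ∈ Finset.Ioc 0 (N / k), (f m : ℂ) * ee ((k * m : ℕ) * α)‖ ^ 2 ≤
      56 * (1 + Real.log N) ^ 5 * ((N:ℝ)^2 / q + (N:ℝ)^2 / u + N * q) := by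
  set V := N / u with hV
  set A : ℕ → ℂ := fun k => ∑ m ∈ Finset.Ioc u V, if k * m ≤ N then (f m : ℂ) * ee ((k * m : ℕ) * α) else 0 with hA
  have hN0 : 0 < N := by omega
  set L := 1 + Real.log N with hL
  have hlogN : 0 ≤ Real.log N := log_q_nonneg N
  have hAk : ∀ k, u < k → ∑ m ∈ Finset.Ioc 0 (N / k), (f m : ℂ) * ee ((k * m : ℕ) * α) = A k := by
    intro k hk
    rw [hA]
    simp only
    rw [← Finset.sum_filter]
    symm
    refine Finset.sum_subset ?_ ?_
    · intro m hm
      rw [Finset.mem_filter, Finset.mem_Ioc] at hm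
      rw [Finset.mem_Ioc, Nat.le_div_iff_mul_le (by omega), mul_comm]
      exact ⟨by omega, hm.2⟩
    · intro m hm hm'
      rw [Finset.mem_Ioc] at hm
      rw [Finset.mem_filter, Finset.mem_Ioc] at hm'
      have h1 : k * m ≤ N := by
        have := hm.2; rw [Nat.le_div_iff_mul_le (by omega), mul_comm] at this; exact this
      have h2 : m ≤ V := by
        refine hm.2.trans ?_
        exact Nat.div_le_div_left hk.le hu
      rw [hf0 m (by by_contra h3; exact hm' ⟨⟨by omega, h2⟩, h1⟩)]
      simp
  have hbd : ‖∑ k ∈ Finset.Ioc 0 N, (h k : ℂ) * ∑ m ∈ Finset.Ioc 0 (N / k), (f m : ℂ) * ee ((k * m : ℕ) * α)‖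
      ≤ ∑ k ∈ Finset.Ioc u N, ‖A k‖ := by
    have : ∑ k ∈ Finset.Ioc 0 N, (h k : ℂ) * ∑ m ∈ Finset.Ioc 0 (N / k), (f m : ℂ) * ee ((k * m : ℕ) * α) =
        ∑ k ∈ Finset.Ioc u N, (h k : ℂ) * A k := by
      symm
      rw [← Finset.sum_subset (s₁ := Finset.Ioc u N) (s₂ := Finset.Ioc 0 N)]
      · refine Finset.sum_congr rfl fun k hk => ?_
        rw [Finset.mem_Ioc] at hk
        rw [hAk k hk.1]
      · exact Finset.Ioc_subset_Ioc_left (Nat.zero_le _)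
      · intro k hk hk'
        rw [Finset.mem_Ioc] at hk hk'
        rw [hh0 k (by omega)]; simp
    rw [this]
    refine (norm_sum_le _ _).trans (Finset.sum_le_sum fun k _ => ?_)
    rw [norm_mul, Complex.norm_real, Real.norm_eq_abs]
    exact mul_le_of_le_one_left (norm_nonneg _) (hh k)
  have hcs : (∑ k ∈ Finset.Ioc u N, ‖A k‖) ^ 2 ≤ (∑ k ∈ Finset.Ioc u N, (1:ℝ) / k) * ∑ k ∈ Finset.Ioc u N, (k:ℝ) * ‖A k‖ ^ 2 := by
    refine Finset.sum_sq_le_sum_mul_sum_of_sq_eq_mul _ (fun k _ => by positivity) (fun k _ => by positivity) ?_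
    intro k hk
    rw [Finset.mem_Ioc] at hk
    have : (0:ℝ) < k := by exact_mod_cast (show 0 < k by omega)
    field_simp
  have hharm : ∑ m ∈ Finset.Ioc u N, (1:ℝ) / m ≤ L := by
    calc _ ≤ ∑ m ∈ Finset.Icc 1 N, (1:ℝ) / m := by
          refine Finset.sum_le_sum_of_subset_of_nonneg ?_ (fun h _ _ => by positivity)
          intro x hx
          rw [Finset.mem_Ioc] at hx; rw [Finset.mem_Icc]; omega
      _ ≤ _ := harm_le N
  have hexp : (((∑ k ∈ Finset.Ioc u N, (k:ℝ) * ‖A k‖ ^ 2 : ℝ)) : ℂ) =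
      ∑ m1 ∈ Finset.Ioc u V, ∑ m2 ∈ Finset.Ioc u V, ((f m1 : ℂ) * (f m2 : ℂ)) *
       ∑ k ∈ (Finset.Ioc u N).filter (fun k => k * m1 ≤ N ∧ k * m2 ≤ N), ((k:ℝ):ℂ) * ee (k * (((m1:ℝ) - m2) * α)) := by
    have h1 : ∀ k : ℕ, (((k:ℝ) * ‖A k‖ ^ 2 : ℝ) : ℂ) = ∑ m1 ∈ Finset.Ioc u V, ∑ m2 ∈ Finset.Ioc u V,
        if (k * m1 ≤ N ∧ k * m2 ≤ N) then ((f m1 : ℂ) * (f m2 : ℂ)) * (((k:ℝ):ℂ) * ee (k * (((m1:ℝ) - m2) * α))) else 0 := by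
      intro k
      rw [Complex.ofReal_mul, Complex.ofReal_pow, ← Complex.mul_conj']
      have hAc : (starRingEnd ℂ) (A k) = ∑ m ∈ Finset.Ioc u V, if k * m ≤ N then (f m : ℂ) * ee (-((k * m : ℕ) * α)) else 0 := by
        rw [hA]
        simp only
        rw [map_sum]
        refine Finset.sum_congr rfl fun m _ => ?_
        split_ifs
        · rw [map_mul, Complex.conj_ofReal, ee_conj]
        · simp
      rw [hAc]
      simp only [hA]
      rw [Finset.sum_mul_sum, Finset.mul_sum]
      refine Finset.sum_congr rfl fun m1 _ => ?_
      rw [Finset.mul_sum]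
      refine Finset.sum_congr rfl fun m2 _ => ?_
      by_cases c1 : k * m1 ≤ N
      · by_cases c2 : k * m2 ≤ N
        · rw [if_pos c1, if_pos c2, if_pos ⟨c1, c2⟩]
          have : (k:ℝ) * (((m1:ℝ) - m2) * α) = ((k * m1 : ℕ):ℝ) * α + -(((k * m2 : ℕ):ℝ) * α) := by push_cast; ring
          rw [this, ee_add]; ring
        · rw [if_neg c2, if_neg (fun h : k * m1 ≤ N ∧ k * m2 ≤ N => c2 h.2)]; simp
      · rw [if_neg c1, if_neg (fun h : k * m1 ≤ N ∧ k * m2 ≤ N => c1 h.1)]; simp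
    push_cast
    have h1' : ∀ k : ℕ, (k:ℂ) * (‖A k‖:ℂ) ^ 2 = (((k:ℝ) * ‖A k‖ ^ 2 : ℝ) : ℂ) := by intro k; push_cast; rfl
    simp_rw [h1', h1]
    rw [Finset.sum_comm]
    refine Finset.sum_congr rfl fun m1 _ => ?_
    rw [Finset.sum_comm]
    refine Finset.sum_congr rfl fun m2 _ => ?_
    rw [Finset.mul_sum, Finset.sum_filter]
    simp
  have hQ : ∑ k ∈ Finset.Ioc u N, (k:ℝ) * ‖A k‖ ^ 2 ≤ L ^ 2 * (56 * L ^ 2 * ((N:ℝ)^2 / q + (N:ℝ)^2 / u + N * q)) := by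
    have h0 : 0 ≤ ∑ k ∈ Finset.Ioc u N, (k:ℝ) * ‖A k‖ ^ 2 := Finset.sum_nonneg fun k _ => by positivity
    rw [← abs_of_nonneg h0, ← Real.norm_eq_abs, ← Complex.norm_real, hexp]
    refine le_trans ?_ (mul_le_mul_of_nonneg_left (bil_double hq hqN hc hα hu) (by positivity))
    rw [Finset.mul_sum]
    refine (norm_sum_le _ _).trans (Finset.sum_le_sum fun m1 h1 => ?_)
    rw [Finset.mul_sum]
    refine (norm_sum_le _ _).trans (Finset.sum_le_sum fun m2 h2 => ?_)
    rw [norm_mul, norm_mul, Complex.norm_real, Complex.norm_real, Real.norm_eq_abs, Real.norm_eq_abs]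
    refine mul_le_mul_of_nonneg_right ?_ (norm_nonneg _)
    rw [Finset.mem_Ioc] at h1 h2
    have hVN : V ≤ N := Nat.div_le_self _ _
    have b1 := hf m1 (by omega) (by omega)
    have b2 := hf m2 (by omega) (by omega)
    calc |f m1| * |f m2| ≤ Real.log N * Real.log N := by gcongr
      _ ≤ L ^ 2 := by rw [sq]; gcongr <;> linarith
  calc _ ≤ (∑ k ∈ Finset.Ioc u N, ‖A k‖) ^ 2 := by gcongr
    _ ≤ _ := hcs
    _ ≤ L * (L ^ 2 * (56 * L ^ 2 * ((N:ℝ)^2 / q + (N:ℝ)^2 / u + N * q))) := by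
        refine mul_le_mul hharm hQ (Finset.sum_nonneg fun k _ => by positivity) (by positivity)
    _ = _ := by ring

lemma abs_moeb (n : ℕ) : |((ArithmeticFunction.moebius n : ℤ) : ℝ)| ≤ 1 := by
  rw [← Int.cast_abs]
  exact_mod_cast ArithmeticFunction.abs_moebius_le_one

set_option maxHeartbeats 1000000 in
open ArithmeticFunction in
theorem vaughan {α : ℝ} {a : ℤ} {q N u : ℕ} (hq : 0 < q) (hqN : q ≤ N) (hc : IsCoprime a q)
    (hα : |α - a / q| ≤ 1 / (q:ℝ)^2) (hu : 0 < u) (huN : u ^ 2 ≤ N) :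
    ‖∑ n ∈ Finset.Icc 1 N, (vonMangoldt n : ℂ) * ee (n * α)‖ ≤
      200 * (1 + Real.log N) ^ 3 * ((N:ℝ) / √q + N / √u + √(N * q) + u ^ 2) := by
  have hN0 : 0 < N := by omega
  have hNr : (0:ℝ) < N := by exact_mod_cast hN0
  have hqr : (0:ℝ) < q := by exact_mod_cast hq
  have hur : (0:ℝ) < u := by exact_mod_cast hu
  have hq1 : (1:ℝ) ≤ q := by exact_mod_cast hq
  have hu1 : (1:ℝ) ≤ u := by exact_mod_cast hu
  have huN' : u ≤ N := (Nat.le_self_pow two_ne_zero u).trans huN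
  have hlogN : 0 ≤ Real.log N := log_q_nonneg N
  set L := 1 + Real.log N with hL
  have hL1 : 1 ≤ L := by linarith
  have hlogle : ∀ n : ℕ, 0 < n → n ≤ N → Real.log n ≤ Real.log N := fun n h1 h2 =>
    Real.log_le_log (by exact_mod_cast h1) (by exact_mod_cast h2)
  set mu : ArithmeticFunction ℝ := ((moebius : ArithmeticFunction ℤ) : ArithmeticFunction ℝ) with hmu
  set ze : ArithmeticFunction ℝ := (zeta : ArithmeticFunction ℝ) with hze
  have hmu1 : ∀ n, |mu n| ≤ 1 := fun n => abs_moeb n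
  set f0 := lo u vonMangoldt with hf0
  set m0 := lo u mu with hm0
  have hm01 : ∀ n, |m0 n| ≤ 1 := by
    intro n; rw [hm0, lo_apply]; split_ifs
    · exact hmu1 n
    · simp
  have hf00 : ∀ n, 0 ≤ f0 n := by
    intro n; rw [hf0, lo_apply]; split_ifs
    · exact vonMangoldt_nonneg
    · simp
  have hf0le : ∀ n, f0 n ≤ vonMangoldt n := by
    intro n; rw [hf0, lo_apply]; split_ifs
    · exact le_rfl
    · exact vonMangoldt_nonneg
  set E : ℕ → ℂ := fun n => ee (n * α) with hE
  have hid : ∑ n ∈ Finset.Icc 1 N, (vonMangoldt n : ℂ) * ee (n * α) =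
      ∑ n ∈ Finset.Ioc 0 N, (f0 n : ℂ) * E n + ∑ n ∈ Finset.Ioc 0 N, ((⇑(m0 * ArithmeticFunction.log) n : ℝ) : ℂ) * E n
      - ∑ n ∈ Finset.Ioc 0 N, ((⇑((f0 * m0) * ze) n : ℝ) : ℂ) * E n
      + ∑ n ∈ Finset.Ioc 0 N, ((⇑((mu - m0) * ((vonMangoldt - f0) * ze)) n : ℝ) : ℂ) * E n := by
    rw [Icc_one_eq, ← Finset.sum_add_distrib, ← Finset.sum_sub_distrib, ← Finset.sum_add_distrib]
    refine Finset.sum_congr rfl fun n _ => ?_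
    have hv : vonMangoldt n = f0 n + (m0 * ArithmeticFunction.log) n - ((f0 * m0) * ze) n + ((mu - m0) * ((vonMangoldt - f0) * ze)) n := by
      conv_lhs => rw [vaughan_id u]
      rw [sub_eq_add_neg, ArithmeticFunction.add_apply, ArithmeticFunction.add_apply, ArithmeticFunction.add_apply, sub_eq_add_neg]; rfl
    rw [hv]; push_cast; ring
  have b0 : ‖∑ n ∈ Finset.Ioc 0 N, (f0 n : ℂ) * E n‖ ≤ u * Real.log N := by
    have : ∑ n ∈ Finset.Ioc 0 N, (f0 n : ℂ) * E n = ∑ n ∈ Finset.Ioc 0 u, (f0 n : ℂ) * E n := by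
      symm
      refine Finset.sum_subset (Finset.Ioc_subset_Ioc_right huN') ?_
      intro n hn hn'
      rw [Finset.mem_Ioc] at hn hn'
      rw [hf0, lo_apply, if_neg (by omega)]; simp
    rw [this]
    refine (norm_sum_le _ _).trans ?_
    refine (Finset.sum_le_card_nsmul _ _ (Real.log N) ?_).trans ?_
    · intro n hn
      rw [Finset.mem_Ioc] at hn
      rw [norm_mul, Complex.norm_real, Real.norm_eq_abs, hE]
      simp only
      rw [norm_ee, mul_one, abs_of_nonneg (hf00 n)]
      exact (hf0le n).trans (vonMangoldt_le_log.trans (hlogle n hn.1 (by omega)))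
    · simp
  have b1 : ‖∑ n ∈ Finset.Ioc 0 N, ((⇑(m0 * ArithmeticFunction.log) n : ℝ) : ℂ) * E n‖ ≤
      1 * Real.log N * (96 * (1 + Real.log N) * ((N:ℝ) / q + u + q)) := by
    refine type_one' hq hqN hc hα hu huN' m0 ArithmeticFunction.log zero_le_one (fun k _ _ => hm01 k) ?_ hlogN ?_ ?_ ?_
    · intro k hk
      rw [hm0, lo_apply, if_neg (by omega)]
    · intro n hn
      rw [log_apply, log_apply]
      exact Real.log_le_log (by exact_mod_cast hn) (by push_cast; linarith)
    · intro n; rw [log_apply]; exact log_q_nonneg n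
    · intro n hn
      rw [log_apply]
      rcases Nat.eq_zero_or_pos n with rfl | h
      · simpa using hlogN
      · exact hlogle n h hn
  have b2 : ‖∑ n ∈ Finset.Ioc 0 N, ((⇑((f0 * m0) * ze) n : ℝ) : ℂ) * E n‖ ≤
      Real.log N * 1 * (96 * (1 + Real.log N) * ((N:ℝ) / q + (u ^ 2 : ℕ) + q)) := by
    refine type_one' hq hqN hc hα (pow_pos hu 2) huN (f0 * m0) ze hlogN ?_ ?_ zero_le_one ?_ ?_ ?_
    · intro k hk hkN
      rw [mul_apply]
      calc _ ≤ ∑ x ∈ k.divisorsAntidiagonal, |f0 x.1 * m0 x.2| := Finset.abs_sum_le_sum_abs _ _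
        _ ≤ ∑ x ∈ k.divisorsAntidiagonal, vonMangoldt x.1 := by
            refine Finset.sum_le_sum fun x _ => ?_
            rw [abs_mul, abs_of_nonneg (hf00 _)]
            calc f0 x.1 * |m0 x.2| ≤ f0 x.1 * 1 := mul_le_mul_of_nonneg_left (hm01 _) (hf00 _)
              _ ≤ _ := by rw [mul_one]; exact hf0le _
        _ = ∑ i ∈ k.divisors, vonMangoldt i := Nat.sum_divisorsAntidiagonal (fun i _ => vonMangoldt i)
        _ = Real.log k := vonMangoldt_sum
        _ ≤ _ := hlogle k hk hkN
    · intro k hk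
      rw [mul_apply]
      refine Finset.sum_eq_zero fun x hx => ?_
      have hx1 := (Nat.mem_divisorsAntidiagonal.mp hx).1
      by_cases h1 : x.1 ≤ u
      · have h2 : ¬ x.2 ≤ u := by
          intro h2
          have := Nat.mul_le_mul h1 h2
          rw [hx1, ← sq] at this; omega
        rw [hm0, lo_apply u mu x.2, if_neg h2, mul_zero]
      · rw [hf0, lo_apply, if_neg h1, zero_mul]
    · intro n hn
      rw [hze, natCoe_apply, natCoe_apply, zeta_apply_ne (by omega), zeta_apply_ne (by omega)]
    · intro n
      rw [hze, natCoe_apply]; positivity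
    · intro n _
      rw [hze, natCoe_apply, zeta_apply]
      split_ifs <;> simp
  have b3 : ‖∑ n ∈ Finset.Ioc 0 N, ((⇑((mu - m0) * ((vonMangoldt - f0) * ze)) n : ℝ) : ℂ) * E n‖ ^ 2 ≤
      56 * L ^ 5 * ((N:ℝ)^2 / q + (N:ℝ)^2 / u + N * q) := by
    rw [dsum]
    refine type_two hq hqN hc hα hu (fun k => (mu - m0) k) (fun m => ((vonMangoldt - f0) * ze) m) ?_ ?_ ?_ ?_
    · intro k
      rw [hm0, hi_apply]; split_ifs
      · simp
      · exact hmu1 k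
    · intro k hk
      rw [hm0, hi_apply, if_pos hk]
    · intro m hm hmN
      rw [hze, coe_mul_zeta_apply]
      have hb : ∀ i, 0 ≤ (vonMangoldt - f0) i ∧ (vonMangoldt - f0) i ≤ vonMangoldt i := by
        intro i; rw [hf0, hi_apply]; split_ifs
        · exact ⟨le_rfl, vonMangoldt_nonneg⟩
        · exact ⟨vonMangoldt_nonneg, le_rfl⟩
      rw [abs_of_nonneg (Finset.sum_nonneg fun i _ => (hb i).1)]
      calc _ ≤ ∑ i ∈ m.divisors, vonMangoldt i := Finset.sum_le_sum fun i _ => (hb i).2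
        _ = Real.log m := vonMangoldt_sum
        _ ≤ _ := hlogle m hm hmN
    · intro m hm
      rw [hze, coe_mul_zeta_apply]
      refine Finset.sum_eq_zero fun i hi => ?_
      have := Nat.divisor_le hi
      rw [hf0, hi_apply, if_pos (by omega)]
  have b3' : ‖∑ n ∈ Finset.Ioc 0 N, ((⇑((mu - m0) * ((vonMangoldt - f0) * ze)) n : ℝ) : ℂ) * E n‖ ≤
      8 * L ^ 3 * ((N:ℝ) / √q + N / √u + √(N * q)) := by
    refine le_of_sq_le_sq (b3.trans ?_) (by positivity)
    have s1 : ((N:ℝ) / √q)^2 = (N:ℝ)^2/q := by rw [div_pow, Real.sq_sqrt hqr.le]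
    have s2 : ((N:ℝ) / √u)^2 = (N:ℝ)^2/u := by rw [div_pow, Real.sq_sqrt hur.le]
    have s3 : (√(N * q:ℝ))^2 = N * q := Real.sq_sqrt (by positivity)
    have s4 : 56 * L ^ 5 * ((N:ℝ)^2 / q + (N:ℝ)^2 / u + N * q) =
      56 * L ^ 5 * (((N:ℝ) / √q)^2 + ((N:ℝ) / √u)^2 + (√(N * q:ℝ))^2) := by rw [s1, s2, s3]
    rw [s4]
    clear s1 s2 s3 s4
    have p1 : 0 ≤ (N:ℝ) / √q := by positivity
    have p2 : 0 ≤ (N:ℝ) / √u := by positivity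
    have p3 : 0 ≤ √(N * q:ℝ) := by positivity
    generalize (N:ℝ) / √q = x at *
    generalize (N:ℝ) / √u = y at *
    generalize √(N * q:ℝ) = z at *
    calc 56 * L ^ 5 * (x^2+y^2+z^2) ≤ 64 * L ^ 6 * (x+y+z)^2 := by
          have i1 : L ^ 5 ≤ L ^ 6 := pow_le_pow_right₀ hL1 (by norm_num)
          have i2 : x^2+y^2+z^2 ≤ (x+y+z)^2 := by nlinarith [mul_nonneg p1 p2, mul_nonneg p1 p3, mul_nonneg p2 p3]
          gcongr
          norm_num
      _ = _ := by ring
  rw [hid]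
  have tri : ∀ w x y z : ℂ, ‖w + x - y + z‖ ≤ ‖w‖ + ‖x‖ + ‖y‖ + ‖z‖ := by
    intro w x y z
    refine (norm_add_le _ _).trans ?_
    gcongr
    refine (norm_sub_le _ _).trans ?_
    gcongr
    exact norm_add_le _ _
  refine (tri _ _ _ _).trans ?_
  have hsq : √(q:ℝ) ≤ q := by
    rw [Real.sqrt_le_left hqr.le]; nlinarith
  have c1 : (N:ℝ) / q ≤ N / √q := by gcongr
  have c2 : (q:ℝ) ≤ √(N * q) := by
    apply Real.le_sqrt_of_sq_le
    have : (q:ℝ) ≤ N := by exact_mod_cast hqN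
    nlinarith
  have c3 : (u:ℝ) ≤ u ^ 2 := by nlinarith
  have p2 : 0 ≤ (N:ℝ) / √u := by positivity
  have hLL : Real.log N * L ≤ L ^ 3 := by
    calc Real.log N * L ≤ L * L := by gcongr; linarith
      _ = L ^ 2 := by ring
      _ ≤ _ := pow_le_pow_right₀ hL1 (by norm_num)
  have hLL' : Real.log N ≤ L ^ 3 := by
    calc Real.log N ≤ L := by linarith
      _ = L ^ 1 := by ring
      _ ≤ _ := pow_le_pow_right₀ hL1 (by norm_num)
  have b1' : 1 * Real.log N * (96 * (1 + Real.log N) * ((N:ℝ) / q + u + q)) ≤ 96 * (L ^ 3 * (N / √q + u ^ 2 + √(N * q))) := by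
    calc _ = 96 * (Real.log N * L * ((N:ℝ) / q + u + q)) := by rw [hL]; ring
      _ ≤ _ := by gcongr
  have b2' : Real.log N * 1 * (96 * (1 + Real.log N) * ((N:ℝ) / q + (u ^ 2 : ℕ) + q)) ≤ 96 * (L ^ 3 * (N / √q + u ^ 2 + √(N * q))) := by
    calc _ = 96 * (Real.log N * L * ((N:ℝ) / q + u ^ 2 + q)) := by rw [hL]; push_cast; ring
      _ ≤ _ := by gcongr
  have b0' : u * Real.log N ≤ L ^ 3 * u ^ 2 := by
    rw [mul_comm]; gcongr
  have r1 : 0 ≤ L ^ 3 * (N / √u) := by positivity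
  have r2 : 0 ≤ L ^ 3 * (u:ℝ) ^ 2 := by positivity
  have e : 200 * L ^ 3 * ((N:ℝ) / √q + N / √u + √(N * q) + u ^ 2) = 200 * (L ^ 3 * (N / √q + u ^ 2 + √(N * q))) + 200 * (L ^ 3 * (N / √u)) := by ring
  have e2 : 8 * L ^ 3 * ((N:ℝ) / √q + N / √u + √(N * q)) = 8 * (L ^ 3 * (N / √q + u ^ 2 + √(N * q))) + 8 * (L ^ 3 * (N / √u)) - 8 * (L ^ 3 * u ^ 2) := by ring
  rw [e]
  rw [e2] at b3'
  linarith
end CM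

end

section

open Complex Filter Topology MeasureTheory
namespace CM

/-- reduced fractions with denominators at most `Q` -/
def fr (Q : ℕ) : Finset (ℕ × ℕ) :=
  ((Finset.Icc 1 Q) ×ˢ (Finset.range Q)).filter (fun x => x.2 < x.1 ∧ Nat.Coprime x.2 x.1)

noncomputable def th (x : ℕ × ℕ) : ℝ := (x.2 : ℝ) / x.1

noncomputable def cf (x : ℕ × ℕ) : ℝ := (ArithmeticFunction.moebius x.1 : ℝ) / (x.1.totient : ℝ)

noncomputable def LQ (Q n : ℕ) : ℂ := ∑ x ∈ fr Q, (cf x : ℂ) * ee (n * th x)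

lemma mem_fr {Q : ℕ} {x : ℕ × ℕ} : x ∈ fr Q ↔ 1 ≤ x.1 ∧ x.1 ≤ Q ∧ x.2 < x.1 ∧ Nat.Coprime x.2 x.1 := by
  simp only [fr, Finset.mem_filter, Finset.mem_product, Finset.mem_Icc, Finset.mem_range]
  constructor
  · rintro ⟨⟨⟨h1, h2⟩, h3⟩, h4, h5⟩; exact ⟨h1, h2, h4, h5⟩
  · rintro ⟨h1, h2, h4, h5⟩; exact ⟨⟨⟨h1, h2⟩, by omega⟩, h4, h5⟩

lemma card_fr (Q : ℕ) : (fr Q).card ≤ Q ^ 2 := by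
  refine (Finset.card_filter_le _ _).trans ?_
  rw [Finset.card_product]; simp [sq]

lemma abs_cf (x : ℕ × ℕ) : |cf x| ≤ 1 := by
  rw [cf, abs_div]
  have h := abs_moeb x.1
  rcases Nat.eq_zero_or_pos x.1.totient with h0 | h0
  · rw [h0]; simp
  · have : (1:ℝ) ≤ |(x.1.totient:ℝ)| := by rw [Nat.abs_cast]; exact_mod_cast h0
    rw [div_le_one (by linarith)]
    linarith

lemma fr_sep {Q : ℕ} {x y : ℕ × ℕ} (hx : x ∈ fr Q) (hy : y ∈ fr Q) (hxy : x ≠ y) :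
    1 / (Q:ℝ) ^ 2 ≤ nd (th x - th y) := by
  rw [mem_fr] at hx hy
  obtain ⟨x1, x2, x3, x4⟩ := hx
  obtain ⟨y1, y2, y3, y4⟩ := hy
  have hx0 : (0:ℝ) < x.1 := by exact_mod_cast x1
  have hy0 : (0:ℝ) < y.1 := by exact_mod_cast y1
  have e : th x - th y = (((x.2 : ℤ) * y.1 - y.2 * x.1 : ℤ) : ℝ) / ((x.1 * y.1 : ℕ) : ℝ) := by
    rw [th, th]; push_cast; field_simp
  rw [e]
  refine le_trans ?_ (nd_rat (Nat.mul_pos x1 y1) ?_)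
  · rw [sq]; push_cast
    have : (x.1:ℝ) ≤ Q := by exact_mod_cast x2
    have : (y.1:ℝ) ≤ Q := by exact_mod_cast y2
    gcongr
  · intro hd
    have hlt : |(x.2 : ℤ) * y.1 - y.2 * x.1| < ((x.1 * y.1 : ℕ) : ℤ) := by
      have a1 : (x.2 : ℤ) * y.1 < x.1 * y.1 := by
        have : (x.2:ℤ) < x.1 := by exact_mod_cast x3
        have : (0:ℤ) < y.1 := by exact_mod_cast y1
        nlinarith
      have a2 : (y.2 : ℤ) * x.1 < x.1 * y.1 := by
        have : (y.2:ℤ) < y.1 := by exact_mod_cast y3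
        have : (0:ℤ) < x.1 := by exact_mod_cast x1
        nlinarith
      have a3 : (0:ℤ) ≤ (x.2 : ℤ) * y.1 := by positivity
      have a4 : (0:ℤ) ≤ (y.2 : ℤ) * x.1 := by positivity
      push_cast
      rw [abs_lt]; constructor <;> linarith
    have h0 := Int.eq_zero_of_abs_lt_dvd hd hlt
    have h1 : x.2 * y.1 = y.2 * x.1 := by
      have : (x.2 : ℤ) * y.1 = y.2 * x.1 := by linarith
      exact_mod_cast this
    have d1 : x.1 ∣ y.1 := by
      have : x.1 ∣ x.2 * y.1 := by rw [h1]; exact Dvd.intro_left _ rfl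
      exact (x4.symm).dvd_of_dvd_mul_left this
    have d2 : y.1 ∣ x.1 := by
      have : y.1 ∣ y.2 * x.1 := by rw [← h1]; exact Dvd.intro_left _ rfl
      exact (y4.symm).dvd_of_dvd_mul_left this
    have e1 : x.1 = y.1 := Nat.dvd_antisymm d1 d2
    rw [← e1] at h1
    have e2 : x.2 = y.2 := Nat.eq_of_mul_eq_mul_right x1 h1
    exact hxy (Prod.ext e1 e2)

lemma geom_nd {x δ : ℝ} (hδ : 0 < δ) (h : δ ≤ nd x) (a N : ℕ) :
    ‖∑ n ∈ Finset.Ioc a N, ee (n * x)‖ ≤ 1 / δ := by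
  rcases Nat.lt_or_ge a N with haN | haN
  · have haN' : (a:ℝ) ≤ N := by exact_mod_cast haN.le
    refine (geom_bd (M := (N:ℝ) - a) le_rfl (by linarith) x).trans ?_
    rw [le_div_iff₀ hδ]
    refine le_trans ?_ (gb_mul (M := (N:ℝ) - a) (x := x))
    exact mul_le_mul_of_nonneg_left h (gb_nonneg (by linarith))
  · rw [Finset.Ioc_eq_empty (by omega)]
    simp; positivity

/-- sum of exponential sums over fractions that are separated from `-α`. -/
lemma LQ_sep {Q N : ℕ} {α δ : ℝ} (hδ : 0 < δ) (s : Finset (ℕ × ℕ)) (hs : s ⊆ fr Q)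
    (h : ∀ x ∈ s, δ ≤ nd (α + th x)) :
    ‖∑ n ∈ Finset.Icc 1 N, (∑ x ∈ s, (cf x : ℂ) * ee (n * th x)) * ee (n * α)‖ ≤ (Q:ℝ) ^ 2 * (1 / δ) := by
  have e : ∑ n ∈ Finset.Icc 1 N, (∑ x ∈ s, (cf x : ℂ) * ee (n * th x)) * ee (n * α) =
      ∑ x ∈ s, (cf x : ℂ) * ∑ n ∈ Finset.Icc 1 N, ee (n * (α + th x)) := by
    simp_rw [Finset.sum_mul, Finset.mul_sum]
    rw [Finset.sum_comm]
    refine Finset.sum_congr rfl fun x _ => Finset.sum_congr rfl fun n _ => ?_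
    rw [mul_add, ee_add]; ring
  rw [e]
  refine (norm_sum_le _ _).trans ?_
  have : ∀ x ∈ s, ‖(cf x : ℂ) * ∑ n ∈ Finset.Icc 1 N, ee (n * (α + th x))‖ ≤ 1 / δ := by
    intro x hx
    rw [norm_mul, Complex.norm_real, Real.norm_eq_abs]
    have := geom_nd hδ (h x hx) 0 N
    rw [Icc_one_eq]
    calc _ ≤ 1 * (1 / δ) := mul_le_mul (abs_cf x) this (norm_nonneg _) zero_le_one
      _ = _ := one_mul _
  refine (Finset.sum_le_card_nsmul _ _ _ this).trans ?_
  rw [nsmul_eq_mul]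
  refine mul_le_mul_of_nonneg_right ?_ (by positivity)
  exact_mod_cast (Finset.card_le_card hs).trans (card_fr Q)

lemma sep_large {Q q X : ℕ} {a : ℤ} {α : ℝ} (hQ : 0 < Q) (hqQ : Q < q) (hc : IsCoprime a q)
    (hX : 2 * Q ^ 5 ≤ X) (hα : |α - a / q| ≤ (Q:ℝ)^4 / (X * q)) {x : ℕ × ℕ} (hx : x ∈ fr Q) :
    1 / (2 * (q:ℝ) * Q) ≤ nd (α + th x) := by
  rw [mem_fr] at hx
  obtain ⟨x1, x2, x3, x4⟩ := hx
  have hQ0 : (0:ℝ) < Q := by exact_mod_cast hQ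
  have hq0 : (0:ℝ) < q := by exact_mod_cast (by omega : 0 < q)
  have hx0 : (0:ℝ) < x.1 := by exact_mod_cast x1
  have hXr : 2 * (Q:ℝ)^5 ≤ X := by exact_mod_cast hX
  have hX0 : (0:ℝ) < X := lt_of_lt_of_le (by positivity) hXr
  have e : (a:ℝ) / q + th x = ((a * x.1 + x.2 * q : ℤ) : ℝ) / ((q * x.1 : ℕ) : ℝ) := by
    rw [th]; push_cast; field_simp
  have h1 : 1 / ((q * x.1 : ℕ) : ℝ) ≤ nd ((a:ℝ) / q + th x) := by
    rw [e]
    refine nd_rat (Nat.mul_pos (by omega) x1) ?_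
    intro hd
    have h2 : (q:ℤ) ∣ a * x.1 + x.2 * q := by
      refine dvd_trans ?_ hd
      push_cast; exact Dvd.intro _ rfl
    have h3 : (q:ℤ) ∣ a * x.1 := (Int.dvd_add_left (Dvd.intro_left _ rfl)).mp h2
    have h4 : (q:ℤ) ∣ x.1 := hc.symm.dvd_of_dvd_mul_left h3
    have h5 : q ∣ x.1 := by exact_mod_cast h4
    have := Nat.le_of_dvd x1 h5
    omega
  have h2 := nd_sub_le ((a:ℝ) / q + th x) (α + th x)
  have h3 : |(a:ℝ) / q + th x - (α + th x)| ≤ (Q:ℝ)^4 / (X * q) := by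
    rw [← abs_neg]; convert hα using 2; ring
  have h4 : 1 / ((q:ℝ) * Q) ≤ 1 / ((q * x.1 : ℕ) : ℝ) := by
    push_cast
    have : (x.1:ℝ) ≤ Q := by exact_mod_cast x2
    gcongr
  have h5 : (Q:ℝ)^4 / (X * q) ≤ 1 / (2 * (q:ℝ) * Q) := by
    rw [div_le_div_iff₀ (by positivity) (by positivity)]
    nlinarith
  have h6 : 1 / ((q:ℝ) * Q) = 2 * (1 / (2 * (q:ℝ) * Q)) := by field_simp
  linarith

/-- minor arcs -/
lemma minor_bd {Q q X N : ℕ} {a : ℤ} {α : ℝ} (hQ : 0 < Q) (hqQ : Q < q) (hc : IsCoprime a q)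
    (hX : 2 * Q ^ 6 ≤ X) (hqX : q * Q ^ 4 ≤ X) (hα : |α - a / q| ≤ (Q:ℝ)^4 / (X * q)) (hN : N ≤ X) :
    ‖∑ n ∈ Finset.Icc 1 N, ((ArithmeticFunction.vonMangoldt n : ℂ) - LQ Q n) * ee (n * α)‖ ≤
      810 * (1 + Real.log X) ^ 3 * (X / √Q) := by
  have hQ0 : (0:ℝ) < Q := by exact_mod_cast hQ
  have hQ1 : (1:ℝ) ≤ Q := by exact_mod_cast hQ
  have hq0 : (0:ℝ) < q := by exact_mod_cast (by omega : 0 < q)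
  have hXr : 2 * (Q:ℝ)^6 ≤ X := by exact_mod_cast hX
  have hX0 : (0:ℝ) < X := lt_of_lt_of_le (by positivity) hXr
  have hqXr : (q:ℝ) * Q^4 ≤ X := by exact_mod_cast hqX
  have hNr : (N:ℝ) ≤ X := by exact_mod_cast hN
  have hsQ : 1 ≤ √(Q:ℝ) := Real.one_le_sqrt.mpr hQ1
  have hsQQ : √(Q:ℝ) ≤ Q := by rw [Real.sqrt_le_left hQ0.le]; nlinarith
  set L := 1 + Real.log X with hL
  have hlogX := log_q_nonneg X
  have hL1 : 1 ≤ L := by linarith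
  have hL3 : 1 ≤ L ^ 3 := one_le_pow₀ hL1
  have hlogNX : Real.log N ≤ Real.log X := by
    rcases Nat.eq_zero_or_pos N with rfl | h
    · simpa using hlogX
    · exact Real.log_le_log (by exact_mod_cast h) hNr
  have hb : ‖∑ n ∈ Finset.Icc 1 N, LQ Q n * ee (n * α)‖ ≤ 2 * (X / √Q) := by
    have h5 : 2 * Q ^ 5 ≤ X := le_trans (Nat.mul_le_mul_left 2 (Nat.pow_le_pow_right hQ (by norm_num))) hX
    refine (LQ_sep (Q := Q) (δ := 1 / (2 * (q:ℝ) * Q)) (by positivity) (fr Q) (Finset.Subset.refl _)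
      (fun x hx => sep_large hQ hqQ hc h5 hα hx)).trans ?_
    rw [one_div_one_div]
    have : (X:ℝ) / Q ≤ X / √Q := by gcongr
    refine le_trans ?_ (mul_le_mul_of_nonneg_left this (by norm_num))
    rw [mul_div_assoc', le_div_iff₀ hQ0]
    nlinarith
  have ha : ‖∑ n ∈ Finset.Icc 1 N, (ArithmeticFunction.vonMangoldt n : ℂ) * ee (n * α)‖ ≤
      800 * L ^ 3 * (X / √Q) := by
    rcases lt_or_ge ((X:ℝ)) (N * √Q) with hbig | hsmall
    · have hX2 : (q:ℝ) ≤ N := by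
        have : (q:ℝ) * Q ≤ N * Q := by
          calc (q:ℝ) * Q ≤ q * Q^4 := by
                have : (Q:ℝ)^1 ≤ Q^4 := pow_le_pow_right₀ hQ1 (by norm_num)
                rw [pow_one] at this; gcongr
            _ ≤ X := hqXr
            _ ≤ N * √Q := hbig.le
            _ ≤ N * Q := by gcongr
        exact le_of_mul_le_mul_right this hQ0
      have hX3 : q ≤ N := by exact_mod_cast hX2
      have hQ2 : Q ^ 2 ≤ N := by
        have : (Q:ℝ)^2 * Q ≤ N * Q := by
          calc (Q:ℝ)^2 * Q = (Q:ℝ)^3 := by ring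
            _ ≤ (Q:ℝ) ^ 6 := pow_le_pow_right₀ hQ1 (by norm_num)
            _ ≤ 2 * (Q:ℝ) ^ 6 := by linarith [pow_pos hQ0 6]
            _ ≤ X := hXr
            _ ≤ N * √Q := hbig.le
            _ ≤ N * Q := by gcongr
        exact_mod_cast le_of_mul_le_mul_right this hQ0
      have hα' : |α - a / q| ≤ 1 / (q:ℝ)^2 := by
        refine hα.trans ?_
        rw [div_le_div_iff₀ (by positivity) (by positivity)]
        nlinarith
      refine (vaughan (by omega) hX3 hc hα' hQ hQ2).trans ?_
      have i1 : (N:ℝ) / √q ≤ X / √Q := by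
        have : (Q:ℝ) ≤ q := by exact_mod_cast hqQ.le
        have := Real.sqrt_le_sqrt this
        gcongr
      have i2 : (N:ℝ) / √Q ≤ X / √Q := by gcongr
      have i3 : √((N:ℝ) * q) ≤ X / √Q := by
        rw [le_div_iff₀ (by positivity), ← Real.sqrt_mul (by positivity)]
        apply Real.sqrt_le_left hX0.le |>.mpr
        have : (q:ℝ) * Q ≤ X := by
          refine le_trans ?_ hqXr
          have : (Q:ℝ)^1 ≤ Q^4 := pow_le_pow_right₀ hQ1 (by norm_num)
          rw [pow_one] at this; gcongr
        calc (N:ℝ) * q * Q = N * (q * Q) := by ring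
          _ ≤ X * X := by gcongr
          _ = _ := by ring
      have i4 : (Q:ℝ)^2 ≤ X / √Q := by
        rw [le_div_iff₀ (by positivity)]
        calc (Q:ℝ)^2 * √Q ≤ (Q:ℝ)^2 * Q := by gcongr
          _ = (Q:ℝ)^3 := by ring
          _ ≤ (Q:ℝ) ^ 6 := pow_le_pow_right₀ hQ1 (by norm_num)
          _ ≤ 2 * (Q:ℝ) ^ 6 := by linarith [pow_pos hQ0 6]
          _ ≤ X := hXr
      calc _ ≤ 200 * L ^ 3 * (X / √Q + X / √Q + X / √Q + X / √Q) := by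
            have := log_q_nonneg N
            have hLN : 1 + Real.log N ≤ L := by linarith
            gcongr
        _ = _ := by ring
    · refine (norm_sum_le _ _).trans ?_
      refine (Finset.sum_le_card_nsmul _ _ (Real.log X) ?_).trans ?_
      · intro n hn
        rw [Finset.mem_Icc] at hn
        rw [norm_mul, Complex.norm_real, Real.norm_eq_abs, norm_ee, mul_one,
          abs_of_nonneg ArithmeticFunction.vonMangoldt_nonneg]
        refine ArithmeticFunction.vonMangoldt_le_log.trans (Real.log_le_log (by exact_mod_cast hn.1) ?_)
        exact_mod_cast hn.2.trans hN
      · rw [nsmul_eq_mul, Nat.card_Icc, Nat.add_sub_cancel]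
        have i1 : (N:ℝ) ≤ X / √Q := by rw [le_div_iff₀ (by positivity)]; exact hsmall
        have i2 : Real.log X ≤ 800 * L ^ 3 := by
          have : L ^ 1 ≤ L ^ 3 := pow_le_pow_right₀ hL1 (by norm_num)
          linarith
        rw [mul_comm]
        gcongr
  simp_rw [sub_mul]
  rw [Finset.sum_sub_distrib]
  refine (norm_sub_le _ _).trans ?_
  have : 0 ≤ (X:ℝ) / √Q := by positivity
  nlinarith


lemma norm_ee_sub (x y : ℝ) : ‖ee x - ee y‖ ≤ 7 * |x - y| := by
  have e : ee x - ee y = ee y * (ee (x - y) - 1) := by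
    rw [mul_sub, ← ee_add]; congr 1
    · congr 1; ring
    · ring
  rw [e, norm_mul, norm_ee, one_mul, ee]
  have h := Real.norm_exp_I_mul_ofReal_sub_one_le (x := 2 * Real.pi * (x - y))
  have e2 : Complex.exp (2 * Real.pi * I * ((x - y : ℝ) : ℂ)) = Complex.exp (I * ((2 * Real.pi * (x - y) : ℝ) : ℂ)) := by
    congr 1; push_cast; ring
  rw [e2]
  refine h.trans ?_
  rw [Real.norm_eq_abs, abs_mul, abs_of_pos (by positivity)]
  have := Real.pi_lt_d2
  refine mul_le_mul_of_nonneg_right ?_ (abs_nonneg _)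
  linarith

/-- major arcs -/
lemma major_bd {Q q X N : ℕ} {a : ℤ} {α P : ℝ} (hq : 0 < q) (hqQ : q ≤ Q) (hc : IsCoprime a q)
    (hX : 2 * Q ^ 6 ≤ X) (hα : |α - a / q| ≤ (Q:ℝ)^4 / (X * q)) (hN : N ≤ X)
    (hP : ∀ ζ : ℂ, IsPrimitiveRoot ζ q → ∀ n ≤ X,
      ‖∑ n ∈ Finset.Icc 1 n, ((ArithmeticFunction.vonMangoldt n : ℂ) * ζ ^ n - (ArithmeticFunction.moebius q : ℂ) / (q.totient : ℂ))‖ ≤ P) :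
    ‖∑ n ∈ Finset.Icc 1 N, ((ArithmeticFunction.vonMangoldt n : ℂ) - LQ Q n) * ee (n * α)‖ ≤
      P * (1 + 7 * (Q:ℝ)^4) + 2 * (Q:ℝ)^4 := by
  have hQ : 0 < Q := by omega
  have hQ0 : (0:ℝ) < Q := by exact_mod_cast hQ
  have hq0 : (0:ℝ) < q := by exact_mod_cast hq
  have hq1 : (1:ℝ) ≤ q := by exact_mod_cast hq
  have hXr : 2 * (Q:ℝ)^6 ≤ X := by exact_mod_cast hX
  have hX0 : (0:ℝ) < X := lt_of_lt_of_le (by positivity) hXr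
  have hNr : (N:ℝ) ≤ X := by exact_mod_cast hN
  have hP0 : 0 ≤ P := (norm_nonneg _).trans (hP _ (ee_primitive hq hc) 0 (Nat.zero_le _))
  set b := ((-a) % (q:ℤ)).toNat with hb
  have hqz : (0:ℤ) < q := by exact_mod_cast hq
  have hbz : (b:ℤ) = (-a) % (q:ℤ) := Int.toNat_of_nonneg (Int.emod_nonneg _ hqz.ne')
  have hbq : b < q := by
    have := Int.emod_lt_of_pos (-a) hqz
    rw [← hbz] at this; exact_mod_cast this
  obtain ⟨k, hk⟩ : ∃ k : ℤ, (b:ℤ) + a = k * q := by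
    refine ⟨-((-a) / q), ?_⟩
    have := Int.emod_add_mul_ediv (-a) q
    rw [← hbz] at this
    linarith
  have hbc : Nat.Coprime b q := by
    have h1 : IsCoprime (b:ℤ) (q:ℤ) := by
      have : (b:ℤ) = -a + q * k := by linarith
      rw [this]
      exact IsCoprime.add_mul_left_left hc.neg_left k
    exact Nat.isCoprime_iff_coprime.mp h1
  set x0 : ℕ × ℕ := (q, b) with hx0
  have hx0m : x0 ∈ fr Q := mem_fr.mpr ⟨hq, hqQ, hbq, hbc⟩
  set β := α - a / q with hβ
  have hth : α + th x0 = β + k := by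
    have : (b:ℝ) + a = k * q := by exact_mod_cast hk
    have e : (b:ℝ) = k * q - a := by linarith
    rw [th, hβ, hx0]; simp only
    rw [e]; field_simp; ring
  have hβX : |β| ≤ (Q:ℝ)^4 / X := by
    refine hα.trans ?_
    gcongr
    exact le_mul_of_one_le_right hX0.le hq1
  set ζ := ee (a / q) with hζ
  have hsplit : ∑ n ∈ Finset.Icc 1 N, ((ArithmeticFunction.vonMangoldt n : ℂ) - LQ Q n) * ee (n * α) =
      ∑ n ∈ Finset.Icc 1 N, ee (n * β) * ((ArithmeticFunction.vonMangoldt n : ℂ) * ζ ^ n - (ArithmeticFunction.moebius q : ℂ) / (q.totient : ℂ))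
      - ∑ n ∈ Finset.Icc 1 N, (∑ x ∈ (fr Q).erase x0, (cf x : ℂ) * ee (n * th x)) * ee (n * α) := by
    rw [← Finset.sum_sub_distrib]
    refine Finset.sum_congr rfl fun n _ => ?_
    have e1 : LQ Q n = (cf x0 : ℂ) * ee (n * th x0) + ∑ x ∈ (fr Q).erase x0, (cf x : ℂ) * ee (n * th x) := by
      rw [LQ]; exact (Finset.add_sum_erase _ (fun x => (cf x : ℂ) * ee (n * th x)) hx0m).symm
    have e2 : ee (n * α) = ee (n * β) * ζ ^ n := by
      rw [hζ, ← ee_nat_mul, ← ee_add, hβ]; congr 1; ring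
    have e3 : ee (n * th x0) * ee (n * α) = ee (n * β) := by
      rw [← ee_add]
      have : (n:ℝ) * th x0 + n * α = n * β + ((n * k : ℤ) : ℝ) := by push_cast; linear_combination (n:ℝ) * hth
      rw [this, ee_add, ee_int, mul_one]
    have e4 : (cf x0 : ℂ) = (ArithmeticFunction.moebius q : ℂ) / (q.totient : ℂ) := by
      rw [cf]; push_cast; rfl
    rw [e1, ← e4]
    linear_combination (ArithmeticFunction.vonMangoldt n : ℂ) * e2 - (cf x0 : ℂ) * e3
  rw [hsplit]
  refine (norm_sub_le _ _).trans (add_le_add ?_ ?_)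
  · rw [Icc_one_eq]
    refine (abel_bd (fun n => ee (n * β)) _ (Nat.zero_le N) (P := P) ?_).trans ?_
    · intro n _ hn
      have := hP ζ (ee_primitive hq hc) n (hn.trans hN)
      rwa [Icc_one_eq] at this
    · refine mul_le_mul_of_nonneg_left ?_ hP0
      rw [norm_ee]
      gcongr
      have : ∀ n ∈ Finset.Ico (0 + 1) N, ‖ee (n * β) - ee ((n + 1 : ℕ) * β)‖ ≤ 7 * ((Q:ℝ)^4 / X) := by
        intro n _
        refine (norm_ee_sub _ _).trans ?_
        have : (n:ℝ) * β - (n + 1 : ℕ) * β = -β := by push_cast; ring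
        rw [this, abs_neg]
        gcongr
      refine (Finset.sum_le_card_nsmul _ _ _ this).trans ?_
      rw [nsmul_eq_mul, Nat.card_Ico]
      have hcard : ((N - (0 + 1) : ℕ):ℝ) ≤ X := by exact_mod_cast (Nat.sub_le _ _).trans hN
      calc _ ≤ (X:ℝ) * (7 * ((Q:ℝ)^4 / X)) := by gcongr
        _ = _ := by field_simp
  · refine (LQ_sep (Q := Q) (δ := 1 / (2 * (Q:ℝ)^2)) (by positivity) _ (Finset.erase_subset _ _) ?_).trans ?_
    · intro x hx
      rw [Finset.mem_erase] at hx
      have h1 := fr_sep hx.2 hx0m hx.1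
      have h2 := nd_sub_le (th x - th x0) (th x + α - k)
      have h3 : th x - th x0 - (th x + α - k) = -β := by linarith
      rw [h3, abs_neg] at h2
      have h4 : nd (th x + α - k) = nd (α + th x) := by
        have : th x + α - k = (α + th x) + ((-k : ℤ):ℝ) := by push_cast; ring
        rw [this, nd_add_int]
      rw [h4] at h2
      have h5 : (Q:ℝ)^4 / X ≤ 1 / (2 * (Q:ℝ)^2) := by
        rw [div_le_div_iff₀ hX0 (by positivity)]
        nlinarith
      have h6 : 1 / (Q:ℝ)^2 = 2 * (1 / (2 * (Q:ℝ)^2)) := by field_simp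
      linarith
    · rw [one_div_one_div]; apply le_of_eq; ring

/-- uniform bound for all `α` -/
lemma all_bd {Q X : ℕ} {P : ℝ} (hQ : 0 < Q) (hX : 2 * Q ^ 6 ≤ X)
    (hP : ∀ q : ℕ, 0 < q → q ≤ Q → ∀ ζ : ℂ, IsPrimitiveRoot ζ q → ∀ n ≤ X,
      ‖∑ n ∈ Finset.Icc 1 n, ((ArithmeticFunction.vonMangoldt n : ℂ) * ζ ^ n - (ArithmeticFunction.moebius q : ℂ) / (q.totient : ℂ))‖ ≤ P)
    (N : ℕ) (hN : N ≤ X) (α : ℝ) :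
    ‖∑ n ∈ Finset.Icc 1 N, ((ArithmeticFunction.vonMangoldt n : ℂ) - LQ Q n) * ee (n * α)‖ ≤
      810 * (1 + Real.log X) ^ 3 * (X / √Q) + P * (1 + 7 * (Q:ℝ)^4) + 2 * (Q:ℝ)^4 := by
  have hQ0 : (0:ℝ) < Q := by exact_mod_cast hQ
  have hlogX := log_q_nonneg X
  have hP0 : 0 ≤ P := (norm_nonneg _).trans (hP 1 one_pos hQ 1 (IsPrimitiveRoot.one) 0 (Nat.zero_le _))
  have hX4 : Q ^ 4 ≤ X := by
    refine le_trans ?_ hX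
    calc Q ^ 4 ≤ Q ^ 6 := Nat.pow_le_pow_right hQ (by norm_num)
      _ ≤ _ := by omega
  have hX0 : (0:ℝ) < X := by exact_mod_cast lt_of_lt_of_le (pow_pos hQ 4) hX4
  have hn0 : 0 < X / Q ^ 4 := Nat.div_pos hX4 (pow_pos hQ 4)
  obtain ⟨r, hr1, hr2⟩ := Real.exists_rat_abs_sub_le_and_den_le α hn0
  have hq : 0 < r.den := r.den_pos
  have hq0 : (0:ℝ) < r.den := by exact_mod_cast hq
  have hc : IsCoprime r.num r.den := by
    rw [Int.isCoprime_iff_nat_coprime]; simpa using r.reduced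
  have hre : (r:ℝ) = (r.num:ℝ) / r.den := by exact_mod_cast (Rat.num_div_den r).symm
  have hqX : r.den * Q ^ 4 ≤ X := by
    rwa [Nat.le_div_iff_mul_le (pow_pos hQ 4)] at hr2
  have hα : |α - (r.num:ℝ) / r.den| ≤ (Q:ℝ)^4 / (X * r.den) := by
    rw [← hre]
    refine hr1.trans ?_
    rw [div_le_div_iff₀ (by positivity) (by positivity)]
    have : (X:ℝ) ≤ ((X / Q ^ 4 : ℕ) + 1) * (Q:ℝ)^4 := by
      have := (Nat.lt_div_mul_add (pow_pos hQ 4) (a := X)).le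
      have : X ≤ (X / Q^4 + 1) * Q ^ 4 := by rw [add_mul, one_mul]; exact this
      exact_mod_cast this
    nlinarith
  rcases Nat.lt_or_ge Q r.den with h | h
  · have := minor_bd hQ h hc hX hqX hα hN
    have : 0 ≤ P * (1 + 7 * (Q:ℝ)^4) + 2 * (Q:ℝ)^4 := by positivity
    linarith
  · have := major_bd hq h hc hX hα hN (hP _ hq h)
    have : 0 ≤ 810 * (1 + Real.log X) ^ 3 * (X / √Q) := by positivity
    linarith


/-- prime log weights -/
noncomputable def vp (n : ℕ) : ℝ := if n.Prime then Real.log n else 0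

lemma vp_le (n : ℕ) : vp n ≤ ArithmeticFunction.vonMangoldt n := by
  rw [vp]; split_ifs with h
  · rw [ArithmeticFunction.vonMangoldt_apply_prime h]
  · exact ArithmeticFunction.vonMangoldt_nonneg

lemma vp_nonneg (n : ℕ) : 0 ≤ vp n := by
  rw [vp]; split_ifs with h
  · exact log_q_nonneg n
  · exact le_rfl

lemma vp_diff {X N : ℕ} (hX : 1 ≤ X) (hN : N ≤ X) (α : ℝ) :
    ‖∑ n ∈ Finset.Icc 1 N, ((ArithmeticFunction.vonMangoldt n : ℂ) - (vp n : ℂ)) * ee (n * α)‖ ≤ 2 * √X * Real.log X := by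
  have hX1 : (1:ℝ) ≤ X := by exact_mod_cast hX
  have h := Chebyshev.abs_psi_sub_theta_le_sqrt_mul_log hX1
  refine le_trans ?_ ((le_abs_self _).trans h)
  rw [Chebyshev.psi, Chebyshev.theta, Nat.floor_natCast, Finset.sum_filter, ← Finset.sum_sub_distrib]
  rw [Icc_one_eq]
  calc _ ≤ ∑ n ∈ Finset.Ioc 0 N, (ArithmeticFunction.vonMangoldt n - vp n) := by
        refine (norm_sum_le _ _).trans (Finset.sum_le_sum fun n _ => ?_)
        rw [norm_mul, norm_ee, mul_one, ← Complex.ofReal_sub, Complex.norm_real, Real.norm_eq_abs,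
          abs_of_nonneg (sub_nonneg.mpr (vp_le n))]
    _ ≤ _ := by
        refine Finset.sum_le_sum_of_subset_of_nonneg (Finset.Ioc_subset_Ioc_right hN) ?_
        intro n _ _
        exact sub_nonneg.mpr (vp_le n)

lemma ev_log (k : ℕ) (c : ℝ) : ∀ᶠ X : ℕ in atTop, c * Real.log X ^ k ≤ X := by
  have h := (Real.isLittleO_pow_log_id_atTop (n := k)).def (c := 1 / (|c| + 1)) (by positivity)
  have h2 := tendsto_natCast_atTop_atTop (R := ℝ) |>.eventually h
  filter_upwards [h2] with X hX
  simp only [id, Real.norm_eq_abs, Nat.abs_cast] at hX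
  have hl : 0 ≤ Real.log X ^ k := pow_nonneg (log_q_nonneg X) k
  rw [abs_of_nonneg hl] at hX
  have hp : 0 < |c| + 1 := by positivity
  rw [div_mul_eq_mul_div, one_mul, le_div_iff₀ hp] at hX
  have := le_abs_self c
  nlinarith

/-- the level -/
noncomputable def lev (m X : ℕ) : ℕ := ⌊Real.log X ^ m⌋₊

lemma lev_le (m X : ℕ) : (lev m X : ℝ) ≤ Real.log X ^ m :=
  Nat.floor_le (pow_nonneg (log_q_nonneg X) m)

lemma lev_pos (m : ℕ) {X : ℕ} (hX : 3 ≤ X) : 0 < lev m X := by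
  rw [lev, Nat.floor_pos]
  exact one_le_pow₀ (one_le_log hX)

lemma le_lev (m : ℕ) {X : ℕ} (hX : 3 ≤ X) : Real.log X ^ m ≤ 2 * lev m X := by
  have h1 := Nat.lt_floor_add_one (Real.log X ^ m)
  have h2 : (1:ℝ) ≤ lev m X := by exact_mod_cast lev_pos m hX
  have : (lev m X : ℝ) = (⌊Real.log X ^ m⌋₊ : ℝ) := rfl
  linarith

lemma ev_lev (m k c : ℕ) : ∀ᶠ X : ℕ in atTop, c * lev m X ^ k ≤ X := by
  filter_upwards [ev_log (m * k) c] with X hX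
  have : (c:ℝ) * (lev m X : ℝ) ^ k ≤ X := by
    refine le_trans ?_ hX
    rw [pow_mul]
    have := lev_le m X
    gcongr
  exact_mod_cast this

theorem supE (D : ℕ) : ∃ C : ℝ, 0 < C ∧ ∀ᶠ X : ℕ in atTop, ∀ N ≤ X, ∀ α : ℝ,
    ‖∑ n ∈ Finset.Icc 1 N, ((vp n : ℂ) - LQ (lev (2 * D + 8) X) n) * ee (n * α)‖ ≤ C * (X / Real.log X ^ D) := by
  set m := 2 * D + 8 with hm
  obtain ⟨C1, hC1, h1⟩ := expG m (4 * m + D)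
  obtain ⟨C2, hC2, h2⟩ := log_pow_le_sqrt' (D + 1)
  refine ⟨12960 + 8 * C1 + 2 * (Nat.factorial (4 * m + D) : ℝ) + 2 * C2, by positivity, ?_⟩
  filter_upwards [ev_lev m 6 2, eventually_ge_atTop 3] with X hX6 hX3 N hN α
  set Q := lev m X with hQd
  have hQ := lev_pos m hX3
  have hQle := lev_le m X
  have hleQ := le_lev m hX3
  rw [← hQd] at hQ hQle hleQ
  have hL1 := one_le_log hX3
  set L := Real.log X with hL
  have hL0 : 0 < L := by linarith
  have hX1 : (1:ℝ) ≤ X := by exact_mod_cast (by omega : 1 ≤ X)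
  have hX0 : (0:ℝ) < X := by linarith
  have hQ0 : (0:ℝ) < Q := by exact_mod_cast hQ
  have hQ1 : (1:ℝ) ≤ Q := by exact_mod_cast hQ
  have hQ4 : (Q:ℝ)^4 ≤ L ^ (4 * m) := by
    rw [mul_comm, pow_mul]; gcongr
  have hmain := all_bd (P := C1 * X / L ^ (4 * m + D)) hQ hX6 (by
    intro q hq hqQ ζ hζ n hn
    refine h1 X n q hX3 hn hq ?_ ζ hζ
    exact (show (q:ℝ) ≤ Q by exact_mod_cast hqQ).trans hQle) N hN α
  have hd := vp_diff (by omega : 1 ≤ X) hN α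
  have b1 : 810 * (1 + L) ^ 3 * (X / √Q) ≤ 12960 * (X / L ^ D) := by
    have hs : L ^ (D + 4) / 2 ≤ √(Q:ℝ) := by
      apply Real.le_sqrt_of_sq_le
      have : (L ^ (D + 4) / 2) ^ 2 = L ^ m / 4 := by
        rw [div_pow, ← pow_mul, hm]; norm_num; ring_nf
      rw [this]; linarith
    have hs0 : 0 < L ^ (D + 4) / 2 := by positivity
    calc 810 * (1 + L) ^ 3 * (X / √Q) ≤ 810 * (2 * L) ^ 3 * (X / (L ^ (D+4) / 2)) := by
          have : 1 + L ≤ 2 * L := by linarith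
          gcongr
      _ = 12960 * (X / L ^ D) / L := by
          rw [pow_add]; field_simp; ring
      _ ≤ 12960 * (X / L ^ D) := div_le_self (by positivity) hL1
  have b2 : C1 * X / L ^ (4 * m + D) * (1 + 7 * (Q:ℝ)^4) ≤ 8 * C1 * (X / L ^ D) := by
    have : 1 + 7 * (Q:ℝ)^4 ≤ 8 * L ^ (4 * m) := by
      have : 1 ≤ L ^ (4 * m) := one_le_pow₀ hL1
      linarith
    calc _ ≤ C1 * X / L ^ (4 * m + D) * (8 * L ^ (4 * m)) := by gcongr
      _ = _ := by rw [pow_add]; field_simp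
  have b3 : 2 * (Q:ℝ)^4 ≤ 2 * (Nat.factorial (4 * m + D) : ℝ) * (X / L ^ D) := by
    have h3 := log_pow_le hX1 (4 * m + D)
    rw [mul_div_assoc', le_div_iff₀ (by positivity)]
    calc 2 * (Q:ℝ)^4 * L ^ D ≤ 2 * L ^ (4 * m) * L ^ D := by gcongr
      _ = 2 * L ^ (4 * m + D) := by rw [pow_add]; ring
      _ ≤ _ := by rw [mul_assoc]; gcongr
  have b4 : 2 * √X * L ≤ 2 * C2 * (X / L ^ D) := by
    have h3 := h2 X hX1
    rw [mul_div_assoc', le_div_iff₀ (by positivity)]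
    calc 2 * √X * L * L ^ D = 2 * √X * L ^ (D + 1) := by rw [pow_succ]; ring
      _ ≤ 2 * √X * (C2 * √X) := by gcongr
      _ = 2 * C2 * (√X * √X) := by ring
      _ = _ := by rw [Real.mul_self_sqrt hX0.le]
  have e : ∑ n ∈ Finset.Icc 1 N, ((vp n : ℂ) - LQ Q n) * ee (n * α) =
      ∑ n ∈ Finset.Icc 1 N, ((ArithmeticFunction.vonMangoldt n : ℂ) - LQ Q n) * ee (n * α) -
      ∑ n ∈ Finset.Icc 1 N, ((ArithmeticFunction.vonMangoldt n : ℂ) - (vp n : ℂ)) * ee (n * α) := by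
    rw [← Finset.sum_sub_distrib]
    refine Finset.sum_congr rfl fun n _ => by ring
  rw [e]
  refine (norm_sub_le _ _).trans ?_
  linarith

end CM

end

section

open Complex Filter Topology MeasureTheory
namespace CM

lemma le_tot_mul_div (n : ℕ) : n ≤ n.totient * n.divisors.card := by
  induction n using Nat.recOnPosPrimePosCoprime with
  | zero => simp
  | one => simp
  | prime_pow p k hp hk =>
    obtain ⟨j, rfl⟩ : ∃ j, k = j + 1 := ⟨k - 1, by omega⟩
    rw [Nat.totient_prime_pow_succ hp, Nat.divisors_prime_pow hp, Finset.card_map, Finset.card_range, pow_succ, mul_assoc]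
    refine Nat.mul_le_mul_left _ ?_
    obtain ⟨t, rfl⟩ : ∃ t, p = t + 2 := ⟨p - 2, by have := hp.two_le; omega⟩
    have : t + 2 - 1 = t + 1 := by omega
    rw [this]
    nlinarith [Nat.zero_le (t*j)]
  | coprime a b ha hb hab iha ihb =>
    rw [Nat.totient_mul hab, hab.card_divisors_mul]
    calc a * b ≤ (a.totient * a.divisors.card) * (b.totient * b.divisors.card) := Nat.mul_le_mul iha ihb
      _ = _ := by ring

lemma card_div_le (n : ℕ) : n.divisors.card ≤ 2 * n.sqrt := by
  rcases Nat.eq_zero_or_pos n with rfl | hn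
  · simp
  have hsub : n.divisors ⊆ Finset.Icc 1 n.sqrt ∪ (Finset.Icc 1 n.sqrt).image (fun d => n / d) := by
    intro d hd
    have hdn := Nat.dvd_of_mem_divisors hd
    have hd0 := Nat.pos_of_dvd_of_pos hdn hn
    rw [Finset.mem_union, Finset.mem_Icc, Finset.mem_image]
    by_cases h : d ≤ n.sqrt
    · left; exact ⟨hd0, h⟩
    · right
      refine ⟨n / d, ?_, Nat.div_div_self hdn hn.ne'⟩
      rw [Finset.mem_Icc]
      refine ⟨Nat.div_pos (Nat.le_of_dvd hn hdn) hd0, ?_⟩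
      by_contra h2
      push Not at h h2
      have h3 : (n.sqrt + 1) * (n.sqrt + 1) ≤ d * (n / d) := Nat.mul_le_mul h h2
      rw [Nat.mul_div_cancel' hdn] at h3
      have := Nat.lt_succ_sqrt n
      simp only [Nat.succ_eq_add_one] at this
      omega
  calc _ ≤ _ := Finset.card_le_card hsub
    _ ≤ _ := Finset.card_union_le _ _
    _ ≤ (Finset.Icc 1 n.sqrt).card + (Finset.Icc 1 n.sqrt).card := Nat.add_le_add_left Finset.card_image_le _
    _ = _ := by rw [Nat.card_Icc]; omega

lemma tot_ge_sqrt {n : ℕ} (hn : 0 < n) : √(n:ℝ) / 2 ≤ n.totient := by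
  have h1 : (n:ℝ) ≤ n.totient * n.divisors.card := by exact_mod_cast le_tot_mul_div n
  have h2 : (n.divisors.card : ℝ) ≤ 2 * √(n:ℝ) := by
    have : (n.divisors.card : ℝ) ≤ 2 * (n.sqrt : ℝ) := by exact_mod_cast card_div_le n
    have h3 : (n.sqrt : ℝ) ≤ √(n:ℝ) := Real.nat_sqrt_le_real_sqrt
    linarith
  have hs : 0 < √(n:ℝ) := Real.sqrt_pos.mpr (by exact_mod_cast hn)
  have h3 : √(n:ℝ) * √(n:ℝ) ≤ n.totient * (2 * √(n:ℝ)) := by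
    rw [Real.mul_self_sqrt (by positivity)]
    exact h1.trans (mul_le_mul_of_nonneg_left h2 (by positivity))
  have h4 : √(n:ℝ) * √(n:ℝ) ≤ (n.totient * 2) * √(n:ℝ) := by linarith
  have := le_of_mul_le_mul_right h4 hs
  linarith

lemma sum_inv_tot (Q : ℕ) : ∑ q ∈ Finset.Icc 1 Q, (1:ℝ) / q.totient ≤ (1 + Real.log Q) ^ 2 := by
  calc ∑ q ∈ Finset.Icc 1 Q, (1:ℝ) / q.totient ≤ ∑ q ∈ Finset.Icc 1 Q, ∑ x ∈ q.divisorsAntidiagonal, (1:ℝ) / x.1 * (1 / x.2) := by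
        refine Finset.sum_le_sum fun q hq => ?_
        rw [Finset.mem_Icc] at hq
        have hq0 : (0:ℝ) < q := by exact_mod_cast hq.1
        have : ∀ x ∈ q.divisorsAntidiagonal, (1:ℝ) / x.1 * (1 / x.2) = 1 / q := by
          intro x hx
          rw [← (Nat.mem_divisorsAntidiagonal.mp hx).1]; push_cast
          rw [div_mul_div_comm, one_mul]
        have hcard : q.divisorsAntidiagonal.card = q.divisors.card := by
          have := Nat.sum_divisorsAntidiagonal (fun _ _ => 1) (n := q)
          simpa using this
        rw [Finset.sum_congr rfl this, Finset.sum_const, nsmul_eq_mul, hcard]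
        have ht : (0:ℝ) < q.totient := by exact_mod_cast Nat.totient_pos.mpr hq.1
        rw [mul_one_div, div_le_div_iff₀ ht hq0, one_mul]
        have : (q:ℝ) ≤ q.totient * q.divisors.card := by exact_mod_cast le_tot_mul_div q
        linarith
    _ = ∑ x ∈ (Finset.Icc 1 Q).sigma (fun q => q.divisorsAntidiagonal), (1:ℝ) / x.2.1 * (1 / x.2.2) := by
        rw [Finset.sum_sigma]
    _ = ∑ y ∈ ((Finset.Icc 1 Q).sigma (fun q => q.divisorsAntidiagonal)).image (fun x => x.2), (1:ℝ) / y.1 * (1 / y.2) := by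
        rw [Finset.sum_image]
        rintro ⟨q, x⟩ hx ⟨q', x'⟩ hx' h
        simp only [Finset.coe_sigma, Set.mem_sigma_iff, Finset.mem_coe, Nat.mem_divisorsAntidiagonal] at hx hx'
        simp only at h
        subst h
        have : q = q' := by rw [← hx.2.1, ← hx'.2.1]
        subst this; rfl
    _ ≤ ∑ y ∈ Finset.Icc 1 Q ×ˢ Finset.Icc 1 Q, (1:ℝ) / y.1 * (1 / y.2) := by
        refine Finset.sum_le_sum_of_subset_of_nonneg ?_ (fun _ _ _ => by positivity)
        intro y hy
        rw [Finset.mem_image] at hy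
        obtain ⟨⟨q, x⟩, hx, rfl⟩ := hy
        simp only [Finset.mem_sigma, Finset.mem_Icc, Nat.mem_divisorsAntidiagonal] at hx
        obtain ⟨⟨h1, h2⟩, h3, h4⟩ := hx
        simp only [Finset.mem_product, Finset.mem_Icc]
        have p1 : 0 < x.1 := Nat.pos_of_ne_zero (by rintro h; rw [h] at h3; omega)
        have p2 : 0 < x.2 := Nat.pos_of_ne_zero (by rintro h; rw [h] at h3; omega)
        have := Nat.le_mul_of_pos_right x.1 p2
        have := Nat.le_mul_of_pos_left x.2 p1
        omega
    _ = (∑ q ∈ Finset.Icc 1 Q, (1:ℝ) / q) ^ 2 := by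
        rw [Finset.sum_product, sq, Finset.sum_mul_sum]
    _ ≤ _ := by
        have := harm_le Q
        have : 0 ≤ ∑ q ∈ Finset.Icc 1 Q, (1:ℝ) / q := Finset.sum_nonneg fun _ _ => by positivity
        gcongr

lemma sum_fr (F : ℕ → ℝ) (Q : ℕ) : ∑ x ∈ fr Q, F x.1 = ∑ q ∈ Finset.Icc 1 Q, (q.totient : ℝ) * F q := by
  rw [fr, Finset.sum_filter, Finset.sum_product]
  refine Finset.sum_congr rfl fun q hq => ?_
  rw [Finset.mem_Icc] at hq
  simp only
  rw [← Finset.sum_filter, Finset.sum_const, nsmul_eq_mul]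
  congr 2
  rw [Nat.totient_eq_card_coprime]
  congr 1
  ext a
  simp only [Finset.mem_filter, Finset.mem_range]
  rw [Nat.coprime_comm]
  constructor
  · rintro ⟨_, h⟩; exact h
  · rintro ⟨h1, h2⟩; exact ⟨by omega, h1, h2⟩

/-- the partial singular series -/
noncomputable def SQ (Q : ℕ) : ℝ := ∑ q ∈ Finset.Icc 1 Q, (ArithmeticFunction.moebius q : ℝ) ^ 2 / (q.totient : ℝ) ^ 3

lemma sum_cf4 (Q : ℕ) : ∑ x ∈ fr Q, cf x ^ 4 = SQ Q := by
  have := sum_fr (fun q => ((ArithmeticFunction.moebius q : ℝ) / (q.totient : ℝ)) ^ 4) Q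
  simp only [cf]
  rw [this, SQ]
  refine Finset.sum_congr rfl fun q hq => ?_
  rw [Finset.mem_Icc] at hq
  have ht : (0:ℝ) < q.totient := by exact_mod_cast Nat.totient_pos.mpr hq.1
  have hm : (ArithmeticFunction.moebius q : ℝ) ^ 4 = (ArithmeticFunction.moebius q : ℝ) ^ 2 := by
    have := abs_moeb q
    rcases ArithmeticFunction.moebius_eq_or q with h | h | h <;> rw [h] <;> norm_num
  field_simp
  rw [hm]

lemma sum_cf2 (Q : ℕ) : ∑ x ∈ fr Q, cf x ^ 2 ≤ (1 + Real.log Q) ^ 2 := by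
  have := sum_fr (fun q => ((ArithmeticFunction.moebius q : ℝ) / (q.totient : ℝ)) ^ 2) Q
  simp only [cf]
  rw [this]
  refine le_trans (Finset.sum_le_sum fun q hq => ?_) (sum_inv_tot Q)
  rw [Finset.mem_Icc] at hq
  have ht : (0:ℝ) < q.totient := by exact_mod_cast Nat.totient_pos.mpr hq.1
  have hm : (ArithmeticFunction.moebius q : ℝ) ^ 2 ≤ 1 := by
    have := abs_moeb q
    rw [← sq_abs]; exact pow_le_one₀ (abs_nonneg _) this
  rw [div_pow, mul_div_assoc', div_le_div_iff₀ (by positivity) ht]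
  nlinarith


/-- expansion of an `L²` norm of a finite sum -/
lemma norm_sq_sum (s : Finset (ℕ × ℕ)) (n : ℕ) :
    ((‖∑ x ∈ s, (cf x : ℂ) * ee (n * th x)‖ ^ 2 : ℝ) : ℂ) =
      ∑ x ∈ s, ∑ y ∈ s, ((cf x : ℂ) * (cf y : ℂ)) * ee (n * (th x - th y)) := by
  rw [Complex.ofReal_pow, ← Complex.mul_conj', map_sum, Finset.sum_mul_sum]
  refine Finset.sum_congr rfl fun x _ => Finset.sum_congr rfl fun y _ => ?_
  rw [map_mul, Complex.conj_ofReal, ee_conj, mul_sub, sub_eq_add_neg, ee_add]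
  ring

lemma LQ_l2 (Q M N : ℕ) (hMN : M ≤ N) :
    ∑ n ∈ Finset.Ioc M N, ‖LQ Q n‖ ^ 2 ≤ N * (1 + Real.log Q) ^ 2 + (Q:ℝ) ^ 6 := by
  have h0 : 0 ≤ ∑ n ∈ Finset.Ioc M N, ‖LQ Q n‖ ^ 2 := Finset.sum_nonneg fun _ _ => by positivity
  have e : ((∑ n ∈ Finset.Ioc M N, ‖LQ Q n‖ ^ 2 : ℝ) : ℂ) =
      ∑ x ∈ fr Q, ∑ y ∈ fr Q, ((cf x : ℂ) * (cf y : ℂ)) * ∑ n ∈ Finset.Ioc M N, ee (n * (th x - th y)) := by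
    rw [Complex.ofReal_sum]
    simp_rw [LQ, norm_sq_sum, Finset.mul_sum]
    rw [Finset.sum_comm]
    refine Finset.sum_congr rfl fun x _ => ?_
    rw [Finset.sum_comm]
  rw [← abs_of_nonneg h0, ← Real.norm_eq_abs, ← Complex.norm_real, e]
  have hxy : ∀ x ∈ fr Q, ∀ y ∈ fr Q, ‖((cf x : ℂ) * (cf y : ℂ)) * ∑ n ∈ Finset.Ioc M N, ee (n * (th x - th y))‖ ≤
      (if x = y then (N:ℝ) * cf x ^ 2 else 0) + (Q:ℝ)^2 := by
    intro x hx y hy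
    rw [norm_mul, norm_mul, Complex.norm_real, Complex.norm_real, Real.norm_eq_abs, Real.norm_eq_abs]
    by_cases h : x = y
    · subst h
      rw [if_pos rfl]
      have : ‖∑ n ∈ Finset.Ioc M N, ee (n * (th x - th x))‖ ≤ N := by
        refine (norm_sum_le _ _).trans ?_
        simp only [norm_ee, Finset.sum_const, Nat.card_Ioc, nsmul_eq_mul, mul_one]
        exact_mod_cast Nat.sub_le _ _
      have h2 : |cf x| * |cf x| = cf x ^ 2 := by rw [abs_mul_abs_self, sq]
      rw [h2]
      have h3 : cf x ^ 2 * ‖∑ n ∈ Finset.Ioc M N, ee (n * (th x - th x))‖ ≤ cf x ^ 2 * N :=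
        mul_le_mul_of_nonneg_left this (sq_nonneg _)
      have : 0 ≤ (Q:ℝ)^2 := by positivity
      linarith
    · rw [if_neg h, zero_add]
      have hQ : (0:ℝ) < Q := by
        have := (mem_fr.mp hx); exact_mod_cast (by omega : 0 < Q)
      have := geom_nd (by positivity) (fr_sep hx hy h) M N
      rw [one_div_one_div] at this
      have h1 : |cf x| * |cf y| ≤ 1 := mul_le_one₀ (abs_cf x) (abs_nonneg _) (abs_cf y)
      calc _ ≤ 1 * (Q:ℝ)^2 := mul_le_mul h1 this (norm_nonneg _) zero_le_one
        _ = _ := one_mul _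
  calc _ ≤ ∑ x ∈ fr Q, ∑ y ∈ fr Q, ((if x = y then (N:ℝ) * cf x ^ 2 else 0) + (Q:ℝ)^2) := by
        refine (norm_sum_le _ _).trans (Finset.sum_le_sum fun x hx => ?_)
        exact (norm_sum_le _ _).trans (Finset.sum_le_sum fun y hy => hxy x hx y hy)
    _ = N * ∑ x ∈ fr Q, cf x ^ 2 + ((fr Q).card : ℝ) * ((fr Q).card * (Q:ℝ)^2) := by
        simp only [Finset.sum_add_distrib, Finset.sum_const, nsmul_eq_mul]
        congr 1
        rw [Finset.mul_sum]
        refine Finset.sum_congr rfl fun x hx => ?_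
        rw [Finset.sum_ite_eq, if_pos hx]
    _ ≤ N * (1 + Real.log Q) ^ 2 + (Q:ℝ)^2 * ((Q:ℝ)^2 * (Q:ℝ)^2) := by
        have h1 := sum_cf2 Q
        have h2 : ((fr Q).card : ℝ) ≤ (Q:ℝ)^2 := by exact_mod_cast card_fr Q
        gcongr
    _ = _ := by ring

/-- orthogonality -/
lemma orth {M : ℕ} (hM : 0 < M) (s : ℤ) (hs : |s| < M) :
    ∑ k ∈ Finset.range M, ee (s * ((k:ℝ) / M)) = if s = 0 then (M:ℂ) else 0 := by
  split_ifs with h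
  · subst h; simp [ee_zero]
  · have hM0 : (0:ℝ) < M := by exact_mod_cast hM
    have e : ∀ k : ℕ, ee (s * ((k:ℝ) / M)) = ee ((s:ℝ) / M) ^ k := by
      intro k; rw [← ee_nat_mul]; congr 1; ring
    simp_rw [e]
    have hne : ee ((s:ℝ) / M) ≠ 1 := by
      intro h1
      have h2 := ee_sub_one_ge ((s:ℝ) / M)
      have h3 := nd_rat (a := s) hM (fun hd => h (Int.eq_zero_of_abs_lt_dvd hd hs))
      rw [h1, sub_self, norm_zero] at h2
      have : 0 < 1 / (M:ℝ) := by positivity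
      linarith
    rw [geom_sum_eq hne, ← ee_nat_mul, mul_div_cancel₀ _ hM0.ne', ee_int]
    simp

/-- Fourier transform on a finite set -/
noncomputable def FT (I : Finset ℕ) (f : ℕ → ℂ) (b : ℤ) (α : ℝ) : ℂ := ∑ n ∈ I, f n * ee ((b * n : ℤ) * α)

lemma parseval {I : Finset ℕ} {X M : ℕ} (hI : ∀ n ∈ I, n ≤ X) (hXM : X < M) (f : ℕ → ℂ) {b : ℤ} (hb : b = 1 ∨ b = -1) :
    ∑ k ∈ Finset.range M, ‖FT I f b ((k:ℝ) / M)‖ ^ 2 = M * ∑ n ∈ I, ‖f n‖ ^ 2 := by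
  have hM : 0 < M := by omega
  have e : ((∑ k ∈ Finset.range M, ‖FT I f b ((k:ℝ) / M)‖ ^ 2 : ℝ) : ℂ) = ((M * ∑ n ∈ I, ‖f n‖ ^ 2 : ℝ) : ℂ) := by
    have h1 : ∀ k : ℕ, ((‖FT I f b ((k:ℝ) / M)‖ ^ 2 : ℝ) : ℂ) = ∑ n ∈ I, ∑ n' ∈ I,
        (f n * (starRingEnd ℂ) (f n')) * ee ((b * n - b * n' : ℤ) * ((k:ℝ) / M)) := by
      intro k
      rw [Complex.ofReal_pow, ← Complex.mul_conj', FT, map_sum, Finset.sum_mul_sum]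
      refine Finset.sum_congr rfl fun x _ => Finset.sum_congr rfl fun y _ => ?_
      rw [map_mul, ee_conj, Int.cast_sub, sub_mul, sub_eq_add_neg, ee_add]
      ring
    rw [Complex.ofReal_sum]
    simp_rw [h1]
    rw [Finset.sum_comm]
    have h2 : ∀ n ∈ I, ∑ k ∈ Finset.range M, ∑ n' ∈ I, (f n * (starRingEnd ℂ) (f n')) * ee ((b * n - b * n' : ℤ) * ((k:ℝ) / M)) =
        (M:ℂ) * ((‖f n‖ ^ 2 : ℝ) : ℂ) := by
      intro n hn
      rw [Finset.sum_comm]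
      have h3 : ∀ n' ∈ I, ∑ k ∈ Finset.range M, (f n * (starRingEnd ℂ) (f n')) * ee ((b * n - b * n' : ℤ) * ((k:ℝ) / M)) =
          if n = n' then (M:ℂ) * ((‖f n‖ ^ 2 : ℝ) : ℂ) else 0 := by
        intro n' hn'
        have a1 := hI n hn
        have a2 := hI n' hn'
        rw [← Finset.mul_sum, orth hM]
        · by_cases h : n = n'
          · subst h
            rw [if_pos (by ring), if_pos rfl, Complex.mul_conj', Complex.ofReal_pow]; ring
          · rw [if_neg h, if_neg, mul_zero]
            rcases hb with rfl | rfl <;> omega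
        · rw [abs_lt]
          rcases hb with rfl | rfl <;> constructor <;> omega
      rw [Finset.sum_congr rfl h3, Finset.sum_ite_eq, if_pos hn]
    rw [Finset.sum_congr rfl h2, ← Finset.mul_sum]
    push_cast; rfl
  exact_mod_cast e

lemma FT_l1 (I : Finset ℕ) (f : ℕ → ℂ) (b : ℤ) (α : ℝ) {P : ℝ} (h1 : (I.card : ℝ) ≤ P) (h2 : ∑ n ∈ I, ‖f n‖ ^ 2 ≤ P) :
    ‖FT I f b α‖ ≤ P := by
  calc _ ≤ ∑ n ∈ I, (1 + ‖f n‖ ^ 2) / 2 := by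
        refine (norm_sum_le _ _).trans (Finset.sum_le_sum fun n _ => ?_)
        rw [norm_mul, norm_ee, mul_one]
        nlinarith [sq_nonneg (‖f n‖ - 1)]
    _ = ((I.card : ℝ) + ∑ n ∈ I, ‖f n‖ ^ 2) / 2 := by
        rw [← Finset.sum_div, Finset.sum_add_distrib]; simp
    _ ≤ P := by linarith

lemma quad_bd {M : ℕ} {E P : ℝ} (hE : 0 ≤ E) (hP : 0 ≤ P) (a b c d : ℕ → ℂ)
    (ha : ∀ k, ‖a k‖ ≤ E) (hb : ∀ k, ‖b k‖ ≤ P)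
    (hc : ∑ k ∈ Finset.range M, ‖c k‖ ^ 2 ≤ M * P) (hd : ∑ k ∈ Finset.range M, ‖d k‖ ^ 2 ≤ M * P) :
    ‖∑ k ∈ Finset.range M, a k * b k * c k * d k‖ ≤ M * (E * P ^ 2) := by
  calc _ ≤ ∑ k ∈ Finset.range M, E * P * ((‖c k‖ ^ 2 + ‖d k‖ ^ 2) / 2) := by
        refine (norm_sum_le _ _).trans (Finset.sum_le_sum fun k _ => ?_)
        rw [norm_mul, norm_mul, norm_mul, mul_assoc]
        refine mul_le_mul ?_ ?_ (by positivity) (by positivity)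
        · exact mul_le_mul (ha k) (hb k) (norm_nonneg _) hE
        · nlinarith [sq_nonneg (‖c k‖ - ‖d k‖)]
    _ = E * P * ((∑ k ∈ Finset.range M, ‖c k‖ ^ 2 + ∑ k ∈ Finset.range M, ‖d k‖ ^ 2) / 2) := by
        rw [← Finset.mul_sum, ← Finset.sum_div, Finset.sum_add_distrib]
    _ ≤ E * P * (M * P) := by
        refine mul_le_mul_of_nonneg_left ?_ (by positivity)
        linarith
    _ = _ := by ring

lemma quad_diff {M : ℕ} {E P : ℝ} (hE : 0 ≤ E) (hP : 0 ≤ P) (F G : Fin 4 → ℕ → ℂ)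
    (hFG : ∀ j k, ‖F j k - G j k‖ ≤ E) (hF : ∀ j k, ‖F j k‖ ≤ P) (hG : ∀ j k, ‖G j k‖ ≤ P)
    (hF2 : ∀ j, ∑ k ∈ Finset.range M, ‖F j k‖ ^ 2 ≤ M * P) (hG2 : ∀ j, ∑ k ∈ Finset.range M, ‖G j k‖ ^ 2 ≤ M * P) :
    ‖∑ k ∈ Finset.range M, F 0 k * F 1 k * F 2 k * F 3 k - ∑ k ∈ Finset.range M, G 0 k * G 1 k * G 2 k * G 3 k‖ ≤
      M * (4 * E * P ^ 2) := by
  have e : ∑ k ∈ Finset.range M, F 0 k * F 1 k * F 2 k * F 3 k - ∑ k ∈ Finset.range M, G 0 k * G 1 k * G 2 k * G 3 k =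
      ∑ k ∈ Finset.range M, (F 0 k - G 0 k) * F 1 k * F 2 k * F 3 k
      + ∑ k ∈ Finset.range M, (F 1 k - G 1 k) * G 0 k * F 2 k * F 3 k
      + ∑ k ∈ Finset.range M, (F 2 k - G 2 k) * G 0 k * G 1 k * F 3 k
      + ∑ k ∈ Finset.range M, (F 3 k - G 3 k) * G 0 k * G 1 k * G 2 k := by
    simp only [← Finset.sum_sub_distrib, ← Finset.sum_add_distrib]
    refine Finset.sum_congr rfl fun k _ => by ring
  rw [e]
  have h1 := quad_bd hE hP (fun k => F 0 k - G 0 k) (F 1) (F 2) (F 3) (hFG 0) (hF 1) (hF2 2) (hF2 3)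
  have h2 := quad_bd hE hP (fun k => F 1 k - G 1 k) (G 0) (F 2) (F 3) (hFG 1) (hG 0) (hF2 2) (hF2 3)
  have h3 := quad_bd hE hP (fun k => F 2 k - G 2 k) (G 0) (G 1) (F 3) (hFG 2) (hG 0) (hG2 1) (hF2 3)
  have h4 := quad_bd hE hP (fun k => F 3 k - G 3 k) (G 0) (G 1) (G 2) (hFG 3) (hG 0) (hG2 1) (hG2 2)
  refine (norm_add_le _ _).trans ?_
  refine (add_le_add ((norm_add_le _ _).trans (add_le_add (norm_add_le _ _) le_rfl)) le_rfl).trans ?_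
  linarith

end CM

end

section

open Complex Filter Topology MeasureTheory
namespace CM

lemma ee_sum {ι : Type*} (s : Finset ι) (f : ι → ℝ) : ∏ i ∈ s, ee (f i) = ee (∑ i ∈ s, f i) := by
  classical
  induction s using Finset.induction_on with
  | empty => simp [ee_zero]
  | insert a s ha ih => rw [Finset.prod_insert ha, Finset.sum_insert ha, ee_add, ih]

/-- weighted count of solutions of the linear equation -/
noncomputable def T4 (I : Fin 4 → Finset ℕ) (b : Fin 4 → ℤ) (f : Fin 4 → ℕ → ℂ) : ℂ :=
  ∑ n ∈ Fintype.piFinset I, if ∑ j, b j * (n j : ℤ) = 0 then ∏ j, f j (n j) else 0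

lemma T4_eq {I : Fin 4 → Finset ℕ} {b : Fin 4 → ℤ} (f : Fin 4 → ℕ → ℂ) {X M : ℕ} (hI : ∀ j, ∀ n ∈ I j, n ≤ X)
    (hb : ∀ j, b j = 1 ∨ b j = -1) (hM : 4 * X < M) :
    ∑ k ∈ Finset.range M, FT (I 0) (f 0) (b 0) ((k:ℝ) / M) * FT (I 1) (f 1) (b 1) ((k:ℝ) / M) *
      FT (I 2) (f 2) (b 2) ((k:ℝ) / M) * FT (I 3) (f 3) (b 3) ((k:ℝ) / M) = M * T4 I b f := by
  have h1 : ∀ k : ℕ, FT (I 0) (f 0) (b 0) ((k:ℝ) / M) * FT (I 1) (f 1) (b 1) ((k:ℝ) / M) *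
      FT (I 2) (f 2) (b 2) ((k:ℝ) / M) * FT (I 3) (f 3) (b 3) ((k:ℝ) / M) =
      ∑ n ∈ Fintype.piFinset I, (∏ j, f j (n j)) * ee ((∑ j, b j * (n j : ℤ) : ℤ) * ((k:ℝ) / M)) := by
    intro k
    rw [← Fin.prod_univ_four (fun j => FT (I j) (f j) (b j) ((k:ℝ) / M))]
    unfold FT
    rw [Finset.prod_univ_sum]
    refine Finset.sum_congr rfl fun n _ => ?_
    rw [Finset.prod_mul_distrib, ee_sum, Int.cast_sum, Finset.sum_mul]
  simp_rw [h1]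
  rw [Finset.sum_comm, T4, Finset.mul_sum]
  refine Finset.sum_congr rfl fun n hn => ?_
  rw [← Finset.mul_sum, orth (by omega)]
  · split_ifs <;> ring
  · rw [Fintype.mem_piFinset] at hn
    have a0 := hI 0 _ (hn 0)
    have a1 := hI 1 _ (hn 1)
    have a2 := hI 2 _ (hn 2)
    have a3 := hI 3 _ (hn 3)
    rw [Fin.sum_univ_four, abs_lt]
    rcases hb 0 with h | h <;> rcases hb 1 with h' | h' <;> rcases hb 2 with h'' | h'' <;>
      rcases hb 3 with h''' | h''' <;> rw [h, h', h'', h'''] <;> constructor <;> omega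

lemma pair_bd {x y δ : ℝ} (hδ : 0 < δ) (h : δ ≤ nd (x - y)) {b1 b2 : ℤ} (h1 : b1 = 1 ∨ b1 = -1) (h2 : b2 = 1 ∨ b2 = -1)
    (a b c d : ℕ) (t : ℤ) :
    ‖∑ n ∈ Finset.Ioc a b, ∑ n' ∈ Finset.Ioc c d, if b1 * (n:ℤ) + b2 * (n':ℤ) + t = 0 then
      ee ((b1 * (n:ℤ) : ℤ) * x + (b2 * (n':ℤ) : ℤ) * y) else 0‖ ≤ 1 / δ := by
  obtain ⟨u, v, huv⟩ : ∃ u v : ℕ, ∀ n : ℕ, n ∈ Finset.Ioc u v ↔ n ∈ Finset.Ioc a b ∧ ∃ n' ∈ Finset.Ioc c d, b1 * (n:ℤ) + b2 * (n':ℤ) + t = 0 := by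
    by_cases hbb : b1 = b2
    · refine ⟨max a (-b2 * t - d - 1).toNat, min b (-b2 * t - c - 1).toNat, fun n => ?_⟩
      constructor
      · intro hn
        refine ⟨by rw [Finset.mem_Ioc] at *; omega, (-b2 * t - n).toNat, ?_⟩
        rw [Finset.mem_Ioc] at *
        subst hbb
        rcases h1 with rfl | rfl <;> omega
      · rintro ⟨hn, n', hn', e⟩
        rw [Finset.mem_Ioc] at *
        subst hbb
        rcases h1 with rfl | rfl <;> omega
    · refine ⟨max a (c + b2 * t).toNat, min b (d + b2 * t).toNat, fun n => ?_⟩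
      constructor
      · intro hn
        refine ⟨by rw [Finset.mem_Ioc] at *; omega, (n - b2 * t).toNat, ?_⟩
        rw [Finset.mem_Ioc] at *
        rcases h1 with rfl | rfl <;> rcases h2 with rfl | rfl <;> first | omega | exact absurd rfl hbb
      · rintro ⟨hn, n', hn', e⟩
        rw [Finset.mem_Ioc] at *
        rcases h1 with rfl | rfl <;> rcases h2 with rfl | rfl <;> first | omega | exact absurd rfl hbb
  have key : ∀ n ∈ Finset.Ioc a b, (∑ n' ∈ Finset.Ioc c d, if b1 * (n:ℤ) + b2 * (n':ℤ) + t = 0 then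
      ee ((b1 * (n:ℤ) : ℤ) * x + (b2 * (n':ℤ) : ℤ) * y) else 0) = if n ∈ Finset.Ioc u v then ee (n * (b1 * (x - y))) * ee (-t * y) else 0 := by
    intro n hn
    split_ifs with hm
    · obtain ⟨-, m, hm, e⟩ := (huv n).1 hm
      rw [Finset.sum_eq_single_of_mem m hm, if_pos e, ← ee_add]
      · congr 1
        have e' : (b1 * (n:ℤ) + b2 * (m:ℤ) + t : ℝ) = 0 := by exact_mod_cast e
        push_cast at e' ⊢
        linear_combination y * e'
      · intro m' hm' hne
        rw [if_neg]
        intro e'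
        apply hne
        rcases h2 with rfl | rfl <;> omega
    · refine Finset.sum_eq_zero fun m hm' => ?_
      rw [if_neg]
      exact fun e => hm ((huv n).2 ⟨hn, m, hm', e⟩)
  rw [Finset.sum_congr rfl key, ← Finset.sum_filter]
  have e : Finset.filter (fun n => n ∈ Finset.Ioc u v) (Finset.Ioc a b) = Finset.Ioc u v := by
    ext n
    rw [Finset.mem_filter]
    exact ⟨fun h => h.2, fun h => ⟨((huv n).1 h).1, h⟩⟩
  rw [e, ← Finset.sum_mul, norm_mul, norm_ee, mul_one]
  refine geom_nd hδ ?_ u v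
  rcases h1 with rfl | rfl
  · simpa using h
  · rw [← nd_neg]; simpa using h

lemma sum_pi4 (I : Fin 4 → Finset ℕ) (F : (Fin 4 → ℕ) → ℂ) :
    ∑ n ∈ Fintype.piFinset I, F n = ∑ n0 ∈ I 0, ∑ n1 ∈ I 1, ∑ n2 ∈ I 2, ∑ n3 ∈ I 3, F ![n0, n1, n2, n3] := by
  rw [← Finset.sum_product', ← Finset.sum_product', ← Finset.sum_product']
  refine Finset.sum_nbij' (fun n => (((n 0, n 1), n 2), n 3)) (fun p => ![p.1.1.1, p.1.1.2, p.1.2, p.2]) ?_ ?_ ?_ ?_ ?_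
  · intro n hn
    rw [Fintype.mem_piFinset] at hn
    simp [hn]
  · intro p hp
    simp only [Finset.mem_product] at hp
    rw [Fintype.mem_piFinset]
    intro j
    fin_cases j <;> simp [hp]
  · intro n _
    ext j
    fin_cases j <;> rfl
  · intro p _; rfl
  · intro n _
    congr 1
    ext j
    fin_cases j <;> rfl

lemma norm_sum_card {I : Finset ℕ} {X : ℕ} (hI : I.card ≤ X) (F : ℕ → ℂ) {P : ℝ} (hP : 0 ≤ P) (h : ∀ n ∈ I, ‖F n‖ ≤ P) :
    ‖∑ n ∈ I, F n‖ ≤ X * P := by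
  refine (norm_sum_le _ _).trans ((Finset.sum_le_card_nsmul _ _ _ h).trans ?_)
  rw [nsmul_eq_mul]
  exact mul_le_mul_of_nonneg_right (by exact_mod_cast hI) hP

/-- kernel for frequencies -/
noncomputable def KK (I : Fin 4 → Finset ℕ) (b : Fin 4 → ℤ) (x : Fin 4 → ℝ) : ℂ :=
  ∑ n ∈ Fintype.piFinset I, if ∑ j, b j * (n j : ℤ) = 0 then ee (∑ j, (b j * (n j : ℤ) : ℤ) * x j) else 0

lemma KK_bd01 {u v : Fin 4 → ℕ} {b : Fin 4 → ℤ} {x : Fin 4 → ℝ} {X : ℕ} {δ : ℝ} (hδ : 0 < δ)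
    (hI : ∀ j, (Finset.Ioc (u j) (v j)).card ≤ X) (hb : ∀ j, b j = 1 ∨ b j = -1) (h : δ ≤ nd (x 0 - x 1)) :
    ‖KK (fun j => Finset.Ioc (u j) (v j)) b x‖ ≤ X ^ 2 / δ := by
  rw [KK, sum_pi4]
  have e : ∀ n0 n1 n2 n3 : ℕ, (if ∑ j, b j * ((![n0, n1, n2, n3] j : ℕ) : ℤ) = 0 then
      ee (∑ j, (b j * ((![n0, n1, n2, n3] j : ℕ) : ℤ) : ℤ) * x j) else 0) =
      (if b 0 * (n0:ℤ) + b 1 * (n1:ℤ) + (b 2 * n2 + b 3 * n3) = 0 then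
      ee ((b 0 * (n0:ℤ) : ℤ) * x 0 + (b 1 * (n1:ℤ) : ℤ) * x 1) else 0) * ee ((b 2 * (n2:ℤ) : ℤ) * x 2 + (b 3 * (n3:ℤ) : ℤ) * x 3) := by
    intro n0 n1 n2 n3
    rw [Fin.sum_univ_four, Fin.sum_univ_four]
    simp only [Matrix.cons_val]
    rw [ite_mul, zero_mul, ← ee_add, ← add_assoc, ← add_assoc]
    congr
  simp only [e]
  have r : ∀ G : ℕ → ℕ → ℕ → ℕ → ℂ, ∑ n0 ∈ Finset.Ioc (u 0) (v 0), ∑ n1 ∈ Finset.Ioc (u 1) (v 1), ∑ n2 ∈ Finset.Ioc (u 2) (v 2), ∑ n3 ∈ Finset.Ioc (u 3) (v 3), G n0 n1 n2 n3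
      = ∑ n2 ∈ Finset.Ioc (u 2) (v 2), ∑ n3 ∈ Finset.Ioc (u 3) (v 3), ∑ n0 ∈ Finset.Ioc (u 0) (v 0), ∑ n1 ∈ Finset.Ioc (u 1) (v 1), G n0 n1 n2 n3 := by
    intro G
    rw [← Finset.sum_product' (f := fun n0 n1 => ∑ n2 ∈ Finset.Ioc (u 2) (v 2), ∑ n3 ∈ Finset.Ioc (u 3) (v 3), G n0 n1 n2 n3), Finset.sum_comm]
    refine Finset.sum_congr rfl fun n2 _ => ?_
    rw [Finset.sum_comm]
    refine Finset.sum_congr rfl fun n3 _ => ?_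
    rw [Finset.sum_product]
  rw [r]
  calc _ ≤ (X:ℝ) * (X * (1 / δ)) := by
        refine norm_sum_card (hI 2) _ (by positivity) fun n2 _ => norm_sum_card (hI 3) _ (by positivity) fun n3 _ => ?_
        simp only [← Finset.sum_mul]
        rw [norm_mul, norm_ee, mul_one]
        exact pair_bd hδ h (hb 0) (hb 1) _ _ _ _ _
    _ = _ := by ring

lemma KK_perm (I : Fin 4 → Finset ℕ) (b : Fin 4 → ℤ) (x : Fin 4 → ℝ) (σ : Equiv.Perm (Fin 4)) :
    KK (fun j => I (σ j)) (fun j => b (σ j)) (fun j => x (σ j)) = KK I b x := by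
  unfold KK
  refine Finset.sum_nbij' (fun n j => n (σ.symm j)) (fun n j => n (σ j)) ?_ ?_ ?_ ?_ ?_
  · intro n hn
    rw [Fintype.mem_piFinset] at *
    intro j
    simpa using hn (σ.symm j)
  · intro n hn
    rw [Fintype.mem_piFinset] at *
    intro j
    exact hn (σ j)
  · intro n _; ext j; simp
  · intro n _; ext j; simp
  · intro n _
    have e1 : ∑ j, b j * (n (σ.symm j) : ℤ) = ∑ j, b (σ j) * (n j : ℤ) := by
      rw [← Equiv.sum_comp σ]; simp
    have e2 : ∑ j, ((b j * (n (σ.symm j) : ℤ) : ℤ) : ℝ) * x j = ∑ j, ((b (σ j) * (n j : ℤ) : ℤ) : ℝ) * x (σ j) := by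
      rw [← Equiv.sum_comp σ]; simp
    rw [e1, e2]

lemma KK_bd {u v : Fin 4 → ℕ} {b : Fin 4 → ℤ} {x : Fin 4 → ℝ} {X : ℕ} {δ : ℝ} (hδ : 0 < δ)
    (hI : ∀ j, (Finset.Ioc (u j) (v j)).card ≤ X) (hb : ∀ j, b j = 1 ∨ b j = -1) {i j : Fin 4} (hij : i ≠ j) (h : δ ≤ nd (x i - x j)) :
    ‖KK (fun j => Finset.Ioc (u j) (v j)) b x‖ ≤ X ^ 2 / δ := by
  obtain ⟨σ, h0, h1⟩ : ∃ σ : Equiv.Perm (Fin 4), σ 0 = i ∧ σ 1 = j := by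
    clear h
    revert i j; decide
  rw [← KK_perm _ _ _ σ]
  exact KK_bd01 (u := fun j => u (σ j)) (v := fun j => v (σ j)) hδ (fun j => hI _) (fun j => hb _) (by simpa [h0, h1] using h)

/-- model coefficients with a sign -/
noncomputable def gq (Q : ℕ) (b : ℤ) (n : ℕ) : ℂ := ∑ x ∈ fr Q, (cf x : ℂ) * ee ((b * (n:ℤ) : ℤ) * th x)

lemma gq_one (Q n : ℕ) : gq Q 1 n = LQ Q n := by simp [gq, LQ]

lemma gq_neg (Q n : ℕ) : gq Q (-1) n = (starRingEnd ℂ) (LQ Q n) := by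
  rw [gq, LQ, map_sum]
  refine Finset.sum_congr rfl fun x _ => ?_
  rw [map_mul, Complex.conj_ofReal, ee_conj]
  congr 2; push_cast; ring

lemma norm_gq (Q n : ℕ) {b : ℤ} (hb : b = 1 ∨ b = -1) : ‖gq Q b n‖ = ‖LQ Q n‖ := by
  rcases hb with rfl | rfl
  · rw [gq_one]
  · rw [gq_neg, RCLike.norm_conj]

/-- number of solutions -/
def JN (I : Fin 4 → Finset ℕ) (b : Fin 4 → ℤ) : ℕ :=
  ((Fintype.piFinset I).filter (fun n => ∑ j, b j * (n j : ℤ) = 0)).card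

lemma T4_gq (I : Fin 4 → Finset ℕ) (b : Fin 4 → ℤ) (Q : ℕ) :
    T4 I b (fun j => gq Q (b j)) = ∑ x ∈ Fintype.piFinset (fun _ : Fin 4 => fr Q), (∏ j, (cf (x j) : ℂ)) * KK I b (fun j => th (x j)) := by
  unfold T4 KK
  simp_rw [Finset.mul_sum]
  rw [Finset.sum_comm]
  refine Finset.sum_congr rfl fun n _ => ?_
  split_ifs with h
  · unfold gq
    rw [Finset.prod_univ_sum]
    refine Finset.sum_congr rfl fun x _ => ?_
    rw [Finset.prod_mul_distrib, ee_sum]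
  · simp

lemma KK_const {I : Fin 4 → Finset ℕ} {b : Fin 4 → ℤ} (y : ℝ) : KK I b (fun _ => y) = JN I b := by
  unfold KK JN
  rw [Finset.card_filter]
  push_cast
  refine Finset.sum_congr rfl fun n _ => ?_
  split_ifs with h
  · have h' : (∑ i, (b i : ℝ) * (n i : ℝ)) = 0 := by exact_mod_cast h
    rw [← Finset.sum_mul, h', zero_mul, ee_zero]
  · rfl

lemma T4_gq_bd {u v : Fin 4 → ℕ} {b : Fin 4 → ℤ} {X Q : ℕ} (hQ : 0 < Q)
    (hI : ∀ j, (Finset.Ioc (u j) (v j)).card ≤ X) (hb : ∀ j, b j = 1 ∨ b j = -1) :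
    ‖T4 (fun j => Finset.Ioc (u j) (v j)) b (fun j => gq Q (b j)) - JN (fun j => Finset.Ioc (u j) (v j)) b * (SQ Q : ℂ)‖ ≤ (Q:ℝ) ^ 10 * X ^ 2 := by
  set I := fun j => Finset.Ioc (u j) (v j) with hIdef
  rw [T4_gq, ← Finset.sum_filter_add_sum_filter_not _ (fun x : Fin 4 → ℕ × ℕ => ∀ j, x j = x 0)]
  have e : ∑ x ∈ (Fintype.piFinset (fun _ : Fin 4 => fr Q)).filter (fun x : Fin 4 → ℕ × ℕ => ∀ j, x j = x 0),
      (∏ j, (cf (x j) : ℂ)) * KK I b (fun j => th (x j)) = JN I b * (SQ Q : ℂ) := by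
    rw [← sum_cf4, Complex.ofReal_sum, Finset.mul_sum]
    symm
    refine Finset.sum_nbij' (fun y _ => y) (fun x => x 0) ?_ ?_ ?_ ?_ ?_
    · intro y hy
      rw [Finset.mem_filter, Fintype.mem_piFinset]
      exact ⟨fun _ => hy, fun _ => rfl⟩
    · intro x hx
      rw [Finset.mem_filter, Fintype.mem_piFinset] at hx
      exact hx.1 0
    · intro y _; rfl
    · intro x hx
      rw [Finset.mem_filter] at hx
      ext1 j; exact (hx.2 j).symm
    · intro y _
      rw [KK_const]
      simp only [Finset.prod_const, Finset.card_univ, Fintype.card_fin, Complex.ofReal_pow]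
      ring
  rw [e, add_sub_cancel_left]
  have hQ0 : (0:ℝ) < Q := by exact_mod_cast hQ
  refine (norm_sum_le _ _).trans ((Finset.sum_le_card_nsmul _ _ ((X:ℝ) ^ 2 / (1 / (Q:ℝ) ^ 2)) ?_).trans ?_)
  · intro x hx
    rw [Finset.mem_filter, Fintype.mem_piFinset] at hx
    obtain ⟨hx, hne⟩ := hx
    push Not at hne
    obtain ⟨j, hj⟩ := hne
    have h1 : ‖∏ j, (cf (x j) : ℂ)‖ ≤ 1 := by
      rw [norm_prod]
      refine Finset.prod_le_one (fun _ _ => norm_nonneg _) fun i _ => ?_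
      rw [Complex.norm_real]; exact abs_cf _
    have h2 := KK_bd (u := u) (v := v) (b := b) (x := fun j => th (x j)) (X := X) (δ := 1 / (Q:ℝ) ^ 2) (by positivity) hI hb
      (i := j) (j := 0) (by rintro rfl; exact hj rfl) (fr_sep (hx j) (hx 0) hj)
    rw [norm_mul]
    calc _ ≤ 1 * ((X:ℝ) ^ 2 / (1 / (Q:ℝ) ^ 2)) := mul_le_mul h1 h2 (norm_nonneg _) zero_le_one
      _ = _ := one_mul _
  · have hc : ((Fintype.piFinset (fun _ : Fin 4 => fr Q)).filter (fun x : Fin 4 → ℕ × ℕ => ¬ ∀ j, x j = x 0)).card ≤ (Q ^ 2) ^ 4 := by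
      refine (Finset.card_filter_le _ _).trans ?_
      rw [Fintype.card_piFinset]
      simp only [Finset.prod_const, Finset.card_univ, Fintype.card_fin]
      exact Nat.pow_le_pow_left (card_fr Q) 4
    rw [nsmul_eq_mul]
    have hc' : (((Fintype.piFinset (fun _ : Fin 4 => fr Q)).filter (fun x : Fin 4 → ℕ × ℕ => ¬ ∀ j, x j = x 0)).card : ℝ) ≤ ((Q:ℝ) ^ 2) ^ 4 := by
      exact_mod_cast hc
    calc _ ≤ ((Q:ℝ) ^ 2) ^ 4 * ((X:ℝ) ^ 2 / (1 / (Q:ℝ) ^ 2)) := mul_le_mul_of_nonneg_right hc' (by positivity)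
      _ = _ := by field_simp

lemma FT_bd {X Q u v : ℕ} {E : ℝ} (huv : u ≤ v) (hv : v ≤ X) (hE : ∀ N ≤ X, ∀ α : ℝ, ‖∑ n ∈ Finset.Icc 1 N, ((vp n : ℂ) - LQ Q n) * ee (n * α)‖ ≤ E)
    {b : ℤ} (hb : b = 1 ∨ b = -1) (α : ℝ) :
    ‖FT (Finset.Ioc u v) (fun n => (vp n : ℂ)) b α - FT (Finset.Ioc u v) (gq Q b) b α‖ ≤ 2 * E := by
  have h1 : ‖∑ n ∈ Finset.Ioc u v, ((vp n : ℂ) - LQ Q n) * ee (n * α)‖ ≤ 2 * E := by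
    have a1 := hE v hv α
    have a2 := hE u (huv.trans hv) α
    rw [Icc_one_eq] at a1 a2
    have e : ∑ n ∈ Finset.Ioc u v, ((vp n : ℂ) - LQ Q n) * ee (n * α) =
      ∑ n ∈ Finset.Ioc 0 v, ((vp n : ℂ) - LQ Q n) * ee (n * α) - ∑ n ∈ Finset.Ioc 0 u, ((vp n : ℂ) - LQ Q n) * ee (n * α) := by
      rw [← Finset.sum_Ioc_consecutive _ (Nat.zero_le u) huv]; ring
    rw [e]
    exact (norm_sub_le _ _).trans (by linarith)
  refine le_trans (le_of_eq ?_) h1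
  unfold FT
  rw [← Finset.sum_sub_distrib]
  rcases hb with rfl | rfl
  · congr 1
    refine Finset.sum_congr rfl fun n _ => ?_
    rw [gq_one]; push_cast; rw [one_mul]; ring
  · rw [← RCLike.norm_conj (∑ n ∈ Finset.Ioc u v, ((vp n : ℂ) - LQ Q n) * ee (n * α)), map_sum]
    congr 1
    refine Finset.sum_congr rfl fun n _ => ?_
    rw [gq_neg, map_mul, map_sub, Complex.conj_ofReal, ee_conj]
    push_cast
    rw [show (-1 * (n:ℝ)) * α = -(n * α) by ring]; ring

theorem circ (D : ℕ) : ∃ C : ℝ, 0 < C ∧ ∀ᶠ X : ℕ in atTop, ∀ u v : Fin 4 → ℕ, (∀ j, u j ≤ v j) → (∀ j, v j ≤ X) →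
    ∀ b : Fin 4 → ℤ, (∀ j, b j = 1 ∨ b j = -1) →
    ‖T4 (fun j => Finset.Ioc (u j) (v j)) b (fun _ n => (vp n : ℂ)) - JN (fun j => Finset.Ioc (u j) (v j)) b * (SQ (lev (2 * D + 8) X) : ℂ)‖
      ≤ C * (X ^ 3 * Real.log X ^ 4 / Real.log X ^ D) := by
  obtain ⟨C, hC, h⟩ := supE D
  refine ⟨200 * C + 1, by positivity, ?_⟩
  filter_upwards [h, eventually_ge_atTop 3, ev_lev (2 * D + 8) 6 1, ev_log (10 * (2 * D + 8) + D) 1] with X hX hX3 hQ6 hl u v huv hv b hb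
  set Q := lev (2 * D + 8) X with hQdef
  set L := Real.log X with hL
  have hL1 : 1 ≤ L := one_le_log hX3
  have hX0 : (0:ℝ) < X := by exact_mod_cast (by omega : 0 < X)
  have hQ : 0 < Q := lev_pos _ hX3
  have hQL : (Q:ℝ) ≤ L ^ (2 * D + 8) := lev_le _ _
  have hQ1 : (1:ℝ) ≤ Q := by exact_mod_cast hQ
  have hQ6' : (Q:ℝ) ^ 6 ≤ X := by
    have : Q ^ 6 ≤ X := by simpa using hQ6
    exact_mod_cast this
  have hQX : (Q:ℝ) ≤ X := (le_self_pow₀ hQ1 (by norm_num)).trans hQ6'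
  have hlQ : Real.log Q ≤ L := Real.log_le_log (by linarith) hQX
  have hlQ0 := log_q_nonneg Q
  set P := 5 * X * L ^ 2 with hP
  set E := C * (X / L ^ D) with hE
  have hE0 : 0 ≤ E := by positivity
  have hP0 : 0 ≤ P := by positivity
  have hL2 : 1 ≤ L ^ 2 := one_le_pow₀ hL1
  have hXL : (X:ℝ) ≤ X * L ^ 2 := le_mul_of_one_le_right hX0.le hL2
  have hcard : ∀ j, (Finset.Ioc (u j) (v j)).card ≤ X := by
    intro j; rw [Nat.card_Ioc]; have := hv j; omega
  have hcardP : ∀ j, ((Finset.Ioc (u j) (v j)).card : ℝ) ≤ P := by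
    intro j
    have : ((Finset.Ioc (u j) (v j)).card : ℝ) ≤ X := by exact_mod_cast hcard j
    rw [hP]; nlinarith
  have hvp2 : ∀ j, ∑ n ∈ Finset.Ioc (u j) (v j), ‖(vp n : ℂ)‖ ^ 2 ≤ P := by
    intro j
    calc _ ≤ ∑ n ∈ Finset.Ioc (u j) (v j), L ^ 2 := by
          refine Finset.sum_le_sum fun n hn => ?_
          rw [Finset.mem_Ioc] at hn
          rw [Complex.norm_real, Real.norm_of_nonneg (vp_nonneg n)]
          refine pow_le_pow_left₀ (vp_nonneg n) ?_ 2
          unfold vp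
          split_ifs
          · refine Real.log_le_log (by exact_mod_cast (by omega : 0 < n)) ?_
            exact_mod_cast hn.2.trans (hv j)
          · linarith
      _ = ((Finset.Ioc (u j) (v j)).card : ℝ) * L ^ 2 := by rw [Finset.sum_const, nsmul_eq_mul]
      _ ≤ X * L ^ 2 := by
          refine mul_le_mul_of_nonneg_right ?_ (by positivity)
          exact_mod_cast hcard j
      _ ≤ P := by rw [hP]; nlinarith
  have hgq2 : ∀ j, ∑ n ∈ Finset.Ioc (u j) (v j), ‖gq Q (b j) n‖ ^ 2 ≤ P := by
    intro j
    simp_rw [norm_gq Q _ (hb j)]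
    refine (LQ_l2 Q (u j) (v j) (huv j)).trans ?_
    have a1 : (1 + Real.log Q) ^ 2 ≤ 4 * L ^ 2 := by nlinarith
    have a2 : (v j : ℝ) ≤ X := by exact_mod_cast hv j
    have a3 : (v j : ℝ) * (1 + Real.log Q) ^ 2 ≤ X * (4 * L ^ 2) := mul_le_mul a2 a1 (by positivity) hX0.le
    rw [hP]; linarith
  set M := 4 * X + 1 with hM
  have hM0 : (0:ℝ) < M := by rw [hM]; positivity
  have hmem : ∀ j, ∀ n ∈ Finset.Ioc (u j) (v j), n ≤ X := by
    intro j n hn; rw [Finset.mem_Ioc] at hn; exact hn.2.trans (hv j)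
  have key := quad_diff (M := M) (E := 2 * E) (P := P) (by positivity) hP0
    (fun j k => FT (Finset.Ioc (u j) (v j)) (fun n => (vp n : ℂ)) (b j) ((k:ℝ) / M))
    (fun j k => FT (Finset.Ioc (u j) (v j)) (gq Q (b j)) (b j) ((k:ℝ) / M))
    (fun j k => FT_bd (huv j) (hv j) hX (hb j) _)
    (fun j k => FT_l1 _ _ _ _ (hcardP j) (hvp2 j)) (fun j k => FT_l1 _ _ _ _ (hcardP j) (hgq2 j))
    (fun j => by
      rw [parseval (X := X) (hmem j) (by omega) _ (hb j)]
      exact mul_le_mul_of_nonneg_left (hvp2 j) hM0.le)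
    (fun j => by
      rw [parseval (X := X) (hmem j) (by omega) _ (hb j)]
      exact mul_le_mul_of_nonneg_left (hgq2 j) hM0.le)
  have k1 := T4_eq (I := fun j => Finset.Ioc (u j) (v j)) (b := b) (X := X) (M := M) (fun _ n => (vp n : ℂ)) hmem hb (by omega)
  have k2 := T4_eq (I := fun j => Finset.Ioc (u j) (v j)) (b := b) (X := X) (M := M) (fun j => gq Q (b j)) hmem hb (by omega)
  rw [k1, k2, ← mul_sub, norm_mul, Complex.norm_natCast] at key
  have key' := le_of_mul_le_mul_left key hM0
  have key2 := T4_gq_bd (u := u) (v := v) (b := b) hQ hcard hb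
  have hLD : 0 < L ^ D := by positivity
  have key3 : (Q:ℝ) ^ 10 * X ^ 2 ≤ X ^ 3 * L ^ 4 / L ^ D := by
    rw [le_div_iff₀ hLD]
    calc (Q:ℝ) ^ 10 * X ^ 2 * L ^ D ≤ (L ^ (2 * D + 8)) ^ 10 * X ^ 2 * L ^ D := by gcongr
      _ = X ^ 2 * (1 * L ^ (10 * (2 * D + 8) + D)) := by ring
      _ ≤ X ^ 2 * X := by gcongr
      _ = X ^ 3 * 1 := by ring
      _ ≤ X ^ 3 * L ^ 4 := by
        have : 1 ≤ L ^ 4 := one_le_pow₀ hL1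
        gcongr
  have key4 : 4 * (2 * E) * P ^ 2 = 200 * C * (X ^ 3 * L ^ 4 / L ^ D) := by
    rw [hE, hP]; field_simp; ring
  rw [key4] at key'
  calc _ ≤ _ := norm_sub_le_norm_sub_add_norm_sub _ (T4 (fun j => Finset.Ioc (u j) (v j)) b (fun j => gq Q (b j))) _
    _ ≤ 200 * C * (X ^ 3 * L ^ 4 / L ^ D) + X ^ 3 * L ^ 4 / L ^ D := add_le_add key' (key2.trans key3)
    _ = _ := by ring

end CM

end

section

open Complex Filter Topology MeasureTheory
namespace CM

/-- terms of the singular series -/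
noncomputable def sg (q : ℕ) : ℝ := (ArithmeticFunction.moebius q : ℝ) ^ 2 / (q.totient : ℝ) ^ 3

lemma sg_nonneg (q : ℕ) : 0 ≤ sg q := by unfold sg; positivity

lemma sg_zero : sg 0 = 0 := by simp [sg]

lemma sg_one : sg 1 = 1 := by simp [sg]

lemma sg_mul {m n : ℕ} (h : Nat.Coprime m n) : sg (m * n) = sg m * sg n := by
  unfold sg
  rw [ArithmeticFunction.isMultiplicative_moebius.map_mul_of_coprime h, Nat.totient_mul h]
  push_cast
  rw [mul_pow, mul_pow, mul_div_mul_comm]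

lemma sg_succ_le {q : ℕ} (hq : 0 < q) : sg (q + 1) ≤ 16 * (1 / √(q:ℝ) - 1 / √((q + 1 : ℕ) : ℝ)) := by
  have ht := tot_ge_sqrt (n := q + 1) (by omega)
  set a := √(q:ℝ) with ha
  set b := √((q + 1 : ℕ) : ℝ) with hb
  have ha0 : 0 < a := Real.sqrt_pos.2 (by exact_mod_cast hq)
  have hb0 : 0 < b := Real.sqrt_pos.2 (by positivity)
  have ha2 : a ^ 2 = q := Real.sq_sqrt (by positivity)
  have hb2 : b ^ 2 = a ^ 2 + 1 := by rw [ha2, hb, Real.sq_sqrt (by positivity)]; push_cast; ring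
  have hab : a < b := by nlinarith
  have h1 : sg (q + 1) ≤ 1 / (b / 2) ^ 3 := by
    unfold sg
    have hm : (ArithmeticFunction.moebius (q + 1) : ℝ) ^ 2 ≤ 1 := by
      rw [← sq_abs]; exact pow_le_one₀ (abs_nonneg _) (abs_moeb _)
    gcongr
  refine h1.trans ?_
  have e : 16 * (1 / a - 1 / b) = 16 * (b - a) / (a * b) := by field_simp
  have e2 : 1 / (b / 2) ^ 3 = 8 / b ^ 3 := by field_simp; norm_num
  rw [e, e2, div_le_div_iff₀ (by positivity) (by positivity)]
  have h3 : (b - a) * (b + a) = 1 := by linear_combination hb2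
  have h4 : a ≤ 2 * (b - a) * b ^ 2 := by
    calc a = (b - a) * ((b + a) * a) := by linear_combination -a * h3
      _ ≤ (b - a) * (2 * b ^ 2) := by
        refine mul_le_mul_of_nonneg_left ?_ (by linarith)
        nlinarith
      _ = _ := by ring
  nlinarith [mul_le_mul_of_nonneg_left h4 hb0.le]

lemma SQ_eq (Q : ℕ) : SQ Q = ∑ q ∈ Finset.range (Q + 1), sg q := by
  rw [Finset.sum_range_succ', sg_zero, add_zero, SQ, Finset.range_eq_Ico, Finset.sum_Ico_add' (fun q => sg q) 0 Q 1]
  rfl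

lemma SQ_succ (Q : ℕ) : SQ (Q + 1) = SQ Q + sg (Q + 1) := by
  rw [SQ_eq, SQ_eq, Finset.sum_range_succ]

lemma SQ_le {Q N : ℕ} (hQ : 0 < Q) (h : Q ≤ N) : SQ N ≤ SQ Q + 16 / √(Q:ℝ) - 16 / √(N:ℝ) := by
  induction N, h using Nat.le_induction with
  | base => linarith
  | succ N hN ih =>
    have := sg_succ_le (q := N) (by omega)
    rw [SQ_succ]
    have e : 16 * (1 / √(N:ℝ) - 1 / √((N + 1 : ℕ) : ℝ)) = 16 / √(N:ℝ) - 16 / √((N + 1 : ℕ) : ℝ) := by ring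
    rw [e] at this
    linarith

lemma SQ_mono {Q N : ℕ} (h : Q ≤ N) : SQ Q ≤ SQ N := by
  rw [SQ_eq, SQ_eq]
  exact Finset.sum_le_sum_of_subset_of_nonneg (by intro x; simp; omega) fun q _ _ => sg_nonneg q

lemma SQ_le' {Q N : ℕ} (hQ : 0 < Q) : SQ N ≤ SQ Q + 16 / √(Q:ℝ) := by
  have h1 : SQ N ≤ SQ (max Q N) := SQ_mono (le_max_right _ _)
  have h2 := SQ_le hQ (le_max_left Q N)
  have h3 : 0 ≤ 16 / √((max Q N : ℕ):ℝ) := by positivity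
  linarith

lemma sg_summable : Summable sg := by
  refine summable_of_sum_range_le (c := SQ 1 + 16 / √((1:ℕ):ℝ)) sg_nonneg fun n => ?_
  refine le_trans ?_ (SQ_le' (N := n) one_pos)
  rw [SQ_eq]
  exact Finset.sum_le_sum_of_subset_of_nonneg (by intro x; simp; omega) fun q _ _ => sg_nonneg q

lemma sg_prime {p : ℕ} (hp : p.Prime) : ∑' e, sg (p ^ e) = 1 + 1 / ((p:ℝ) - 1) ^ 3 := by
  rw [tsum_eq_sum (s := Finset.range 2)]
  · rw [Finset.sum_range_succ, Finset.sum_range_one, pow_zero, sg_one, pow_one, sg,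
      ArithmeticFunction.moebius_apply_prime hp, Nat.totient_prime hp, Nat.cast_sub hp.one_le]
    norm_num
  · intro e he
    rw [Finset.mem_range, not_lt] at he
    have : ArithmeticFunction.moebius (p ^ e) = 0 := by
      apply ArithmeticFunction.moebius_eq_zero_of_not_squarefree
      intro hs
      rw [Nat.squarefree_pow_iff hp.ne_one (by omega)] at hs
      omega
    simp [sg, this]

lemma sing_eq : ∏' p : Nat.Primes, (1 + 1 / (((p : ℕ) : ℝ) - 1) ^ 3) = ∑' n, sg n := by
  have h := EulerProduct.eulerProduct_hasProd (f := sg) sg_one (fun h => sg_mul h) sg_summable.norm sg_zero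
  rw [← h.tprod_eq]
  exact tprod_congr fun p => (sg_prime p.2).symm

lemma sing_tail {Q : ℕ} (hQ : 0 < Q) : |∏' p : Nat.Primes, (1 + 1 / (((p : ℕ) : ℝ) - 1) ^ 3) - SQ Q| ≤ 16 / √(Q:ℝ) := by
  rw [sing_eq]
  have h1 : SQ Q ≤ ∑' n, sg n := by
    rw [SQ_eq]; exact sg_summable.sum_le_tsum _ fun q _ => sg_nonneg q
  have h2 : ∑' n, sg n ≤ SQ Q + 16 / √(Q:ℝ) := by
    refine Real.tsum_le_of_sum_range_le sg_nonneg fun n => ?_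
    refine le_trans ?_ (SQ_le' (N := n) hQ)
    rw [SQ_eq]
    exact Finset.sum_le_sum_of_subset_of_nonneg (by intro x; simp; omega) fun q _ _ => sg_nonneg q
  rw [abs_le]
  constructor <;> linarith [Real.sqrt_nonneg (Q:ℝ), show 0 ≤ 16 / √(Q:ℝ) by positivity]

lemma JN_le {u v : Fin 4 → ℕ} {b : Fin 4 → ℤ} {X : ℕ} (hI : ∀ j, (Finset.Ioc (u j) (v j)).card ≤ X) (hb : ∀ j, b j = 1 ∨ b j = -1) :
    JN (fun j => Finset.Ioc (u j) (v j)) b ≤ X ^ 3 := by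
  unfold JN
  calc _ ≤ (Finset.Ioc (u 0) (v 0) ×ˢ (Finset.Ioc (u 1) (v 1) ×ˢ Finset.Ioc (u 2) (v 2))).card := by
        refine Finset.card_le_card_of_injOn (fun n => (n 0, n 1, n 2)) ?_ ?_
        · intro n hn
          rw [Finset.mem_coe, Finset.mem_filter, Fintype.mem_piFinset] at hn
          have := hn.1
          rw [Finset.mem_coe, Finset.mem_product, Finset.mem_product]
          exact ⟨this 0, this 1, this 2⟩
        · intro n hn n' hn' h
          rw [Finset.mem_coe, Finset.mem_filter, Fin.sum_univ_four] at hn hn'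
          have e1 := hn.2
          have e2 := hn'.2
          simp only [Prod.mk.injEq] at h
          obtain ⟨h0, h1, h2⟩ := h
          rw [h0, h1, h2] at e1
          have h3 : n 3 = n' 3 := by
            rcases hb 3 with h | h <;> rw [h] at e1 e2 <;> omega
          ext j
          fin_cases j <;> assumption
    _ = (Finset.Ioc (u 0) (v 0)).card * ((Finset.Ioc (u 1) (v 1)).card * (Finset.Ioc (u 2) (v 2)).card) := by
        rw [Finset.card_product, Finset.card_product]
    _ ≤ X * (X * X) := by
        gcongr
        · exact hI 0
        · exact hI 1
        · exact hI 2
    _ = X ^ 3 := by ring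

theorem circ2 (k : ℕ) : ∃ C : ℝ, 0 < C ∧ ∀ᶠ X : ℕ in atTop, ∀ u v : Fin 4 → ℕ, (∀ j, u j ≤ v j) → (∀ j, v j ≤ X) →
    ∀ b : Fin 4 → ℤ, (∀ j, b j = 1 ∨ b j = -1) →
    ‖T4 (fun j => Finset.Ioc (u j) (v j)) b (fun _ n => (vp n : ℂ)) - JN (fun j => Finset.Ioc (u j) (v j)) b *
      ((∏' p : Nat.Primes, (1 + 1 / (((p : ℕ) : ℝ) - 1) ^ 3) : ℝ) : ℂ)‖ ≤ C * (X ^ 3 / Real.log X ^ k) := by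
  obtain ⟨C, hC, h⟩ := circ (k + 4)
  refine ⟨C + 32, by positivity, ?_⟩
  filter_upwards [h, eventually_ge_atTop 3] with X hX hX3 u v huv hv b hb
  have hX := hX u v huv hv b hb
  set S : ℝ := ∏' p : Nat.Primes, (1 + 1 / (((p : ℕ) : ℝ) - 1) ^ 3) with hS
  set Q := lev (2 * (k + 4) + 8) X with hQdef
  set L := Real.log X with hL
  have hL1 : 1 ≤ L := one_le_log hX3
  have hL0 : 0 < L := by linarith
  have hQ : 0 < Q := lev_pos _ hX3
  have hQ0 : (0:ℝ) < Q := by exact_mod_cast hQ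
  have hQL : L ^ (2 * (k + 4) + 8) ≤ 2 * Q := le_lev _ hX3
  have e1 : C * (X ^ 3 * L ^ 4 / L ^ (k + 4)) = C * (X ^ 3 / L ^ k) := by
    rw [pow_add]; field_simp
  rw [e1] at hX
  have hcard : ∀ j, (Finset.Ioc (u j) (v j)).card ≤ X := by
    intro j; rw [Nat.card_Ioc]; have := hv j; omega
  have hJ : (JN (fun j => Finset.Ioc (u j) (v j)) b : ℝ) ≤ (X:ℝ) ^ 3 := by exact_mod_cast JN_le hcard hb
  have ht := sing_tail hQ
  rw [← hS] at ht
  have hs : L ^ k ≤ 2 * √(Q:ℝ) := by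
    have a1 : L ^ k ≤ L ^ (k + 8) := pow_le_pow_right₀ hL1 (by omega)
    have a2 : (L ^ (k + 8)) ^ 2 ≤ (2 * √(Q:ℝ)) ^ 2 := by
      rw [mul_pow, Real.sq_sqrt hQ0.le, ← pow_mul]
      calc _ = L ^ (2 * (k + 4) + 8) := by congr 1; ring
        _ ≤ _ := hQL
        _ ≤ _ := by linarith
    exact a1.trans (le_of_sq_le_sq a2 (by positivity))
  have hs2 : 16 / √(Q:ℝ) ≤ 32 / L ^ k := by
    rw [div_le_div_iff₀ (Real.sqrt_pos.2 hQ0) (by positivity)]; linarith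
  have h2 : ‖(JN (fun j => Finset.Ioc (u j) (v j)) b : ℂ) * (SQ Q : ℂ) - JN (fun j => Finset.Ioc (u j) (v j)) b * (S : ℂ)‖ ≤ 32 * (X ^ 3 / L ^ k) := by
    rw [← mul_sub, norm_mul, Complex.norm_natCast, ← Complex.ofReal_sub, Complex.norm_real, Real.norm_eq_abs, abs_sub_comm]
    calc _ ≤ (X:ℝ) ^ 3 * (32 / L ^ k) := mul_le_mul hJ (ht.trans hs2) (abs_nonneg _) (by positivity)
      _ = _ := by ring
  calc _ ≤ _ := norm_sub_le_norm_sub_add_norm_sub _ ((JN (fun j => Finset.Ioc (u j) (v j)) b : ℂ) * (SQ Q : ℂ)) _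
    _ ≤ C * (X ^ 3 / L ^ k) + 32 * (X ^ 3 / L ^ k) := add_le_add hX h2
    _ = _ := by ring

end CM

end

section

open Complex Filter Topology MeasureTheory
namespace CM

/-- left end -/
noncomputable def loB (η B : ℝ) : ℝ := η * B ^ ((1 : ℝ) / 3) - B ^ ((1 : ℝ) / 3) / Real.log B
/-- right end -/
noncomputable def hiB (η B : ℝ) : ℝ := η * B ^ ((1 : ℝ) / 3) + B ^ ((1 : ℝ) / 3) / Real.log B

lemma log_ge_one {B : ℝ} (hB : 3 ≤ B) : 1 ≤ Real.log B := by
  have := one_le_log (N := 3) le_rfl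
  refine this.trans (Real.log_le_log (by norm_num) (by exact_mod_cast hB))

lemma rt_ge_one {B : ℝ} (hB : 3 ≤ B) : 1 ≤ B ^ ((1 : ℝ) / 3) := Real.one_le_rpow (by linarith) (by norm_num)

lemma hi_nonneg {η B : ℝ} (hη : 0 < η) (hB : 3 ≤ B) : 0 ≤ hiB η B := by
  have := rt_ge_one hB
  have := log_ge_one hB
  unfold hiB; positivity

lemma hi_le {η B : ℝ} (hB : 3 ≤ B) : hiB η B ≤ (η + 1) * B ^ ((1 : ℝ) / 3) := by
  have h1 := rt_ge_one hB
  have h2 := log_ge_one hB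
  unfold hiB
  have : B ^ ((1 : ℝ) / 3) / Real.log B ≤ B ^ ((1 : ℝ) / 3) := div_le_self (by linarith) h2
  linarith

lemma loB_ge {η B : ℝ} (hη : 0 < η) (hB : 3 ≤ B) : -B ^ ((1 : ℝ) / 3) ≤ loB η B := by
  have h1 := rt_ge_one hB
  have h2 := log_ge_one hB
  unfold loB
  have : B ^ ((1 : ℝ) / 3) / Real.log B ≤ B ^ ((1 : ℝ) / 3) := div_le_self (by linarith) h2
  have : 0 ≤ η * B ^ ((1 : ℝ) / 3) := by positivity
  linarith

lemma mem_si {η B x : ℝ} : x ∈ shortInterval η B ↔ loB η B ≤ x ∧ x ≤ hiB η B := Iff.rfl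

/-- integers of the interval -/
noncomputable def NI (η B : ℝ) : Finset ℕ := Finset.Icc ⌈loB η B⌉₊ ⌊hiB η B⌋₊

lemma mem_NI {η B : ℝ} (hη : 0 < η) (hB : 3 ≤ B) (n : ℕ) : n ∈ NI η B ↔ (n:ℝ) ∈ shortInterval η B := by
  rw [mem_si, NI, Finset.mem_Icc, Nat.ceil_le, Nat.le_floor_iff (hi_nonneg hη hB)]

lemma RB_eq {β : Fin 4 → ℤ} {η : Fin 4 → ℝ} (hη : ∀ j, 0 < η j) {B : ℝ} (hB : 3 ≤ B) :
    RB β η B = ∑ n ∈ (Fintype.piFinset (fun j => NI (η j) B)).filter (fun n => ∑ j, β j * (n j : ℤ) = 0), ∏ j, vp (n j) := by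
  classical
  have hset : primeQuad β η B = ↑(((Fintype.piFinset (fun j => NI (η j) B)).filter (fun n => ∑ j, β j * (n j : ℤ) = 0)).filter (fun n => ∀ j, (n j).Prime)) := by
    ext n
    rw [Finset.mem_coe, Finset.mem_filter, Finset.mem_filter, Fintype.mem_piFinset, Fin.sum_univ_four]
    simp only [mem_NI (hη _) hB]
    unfold primeQuad
    rw [Set.mem_setOf_eq]
    constructor
    · rintro ⟨h1, h2⟩
      exact ⟨⟨fun j => (h1 j).2, h2⟩, fun j => (h1 j).1⟩
    · rintro ⟨⟨h1, h2⟩, h3⟩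
      exact ⟨fun j => ⟨h3 j, h1 j⟩, h2⟩
  rw [RB, hset, finsum_mem_coe_finset, Finset.sum_filter]
  refine Finset.sum_congr rfl fun n _ => ?_
  split_ifs with h
  · rw [Fin.prod_univ_four]
    simp only [vp, if_pos (h _)]
  · push Not at h
    obtain ⟨j, hj⟩ := h
    exact (Finset.prod_eq_zero (Finset.mem_univ j) (by rw [vp, if_neg hj])).symm

lemma RB_T4 {β : Fin 4 → ℤ} {η : Fin 4 → ℝ} (hη : ∀ j, 0 < η j) {B : ℝ} (hB : 3 ≤ B) :
    (RB β η B : ℂ) = T4 (fun j => NI (η j) B) β (fun _ n => (vp n : ℂ)) := by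
  rw [RB_eq hη hB, T4, ← Finset.sum_filter]
  push_cast; rfl

lemma JB_eq {β : Fin 4 → ℤ} {η : Fin 4 → ℝ} (hη : ∀ j, 0 < η j) {B : ℝ} (hB : 3 ≤ B) (hlo : ∀ j, 0 < loB (η j) B) :
    JB β η B = JN (fun j => NI (η j) B) β := by
  have hinj : Function.Injective (fun (n : Fin 4 → ℕ) (j : Fin 4) => (n j : ℤ)) := by
    intro n n' h
    ext j
    have := congrFun h j
    simpa using this
  rw [JB, JN, ← Set.ncard_coe_finset, ← Set.ncard_image_of_injective _ hinj]
  congr 1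
  ext m
  rw [Set.mem_setOf_eq, Set.mem_image]
  constructor
  · rintro ⟨h1, h2⟩
    have hm : ∀ j, ((m j).toNat : ℤ) = m j := by
      intro j
      rw [Int.toNat_of_nonneg]
      have h3 : (0:ℝ) < m j := (hlo j).trans_le (h1 j).1
      exact_mod_cast h3.le
    refine ⟨fun j => (m j).toNat, ?_, funext hm⟩
    rw [Finset.mem_coe, Finset.mem_filter, Fintype.mem_piFinset, Fin.sum_univ_four, hm, hm, hm, hm]
    refine ⟨fun j => ?_, h2⟩
    rw [mem_NI (hη j) hB]
    have : (((m j).toNat : ℕ) : ℝ) = m j := by exact_mod_cast congrArg (fun z : ℤ => (z:ℝ)) (hm j)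
    rw [this]
    exact h1 j
  · rintro ⟨n, hn, rfl⟩
    rw [Finset.mem_coe, Finset.mem_filter, Fintype.mem_piFinset, Fin.sum_univ_four] at hn
    refine ⟨fun j => ?_, hn.2⟩
    have := (mem_NI (hη j) hB _).1 (hn.1 j)
    simpa using this

lemma NI_Ioc {η B : ℝ} (hlo : 0 < loB η B) : NI η B = Finset.Ioc (⌈loB η B⌉₊ - 1) ⌊hiB η B⌋₊ := by
  have := Nat.ceil_pos.2 hlo
  ext n
  rw [NI, Finset.mem_Icc, Finset.mem_Ioc]
  omega

lemma NI_le {η B : ℝ} (hη : 0 < η) (hB : 3 ≤ B) : ⌈loB η B⌉₊ - 1 ≤ ⌊hiB η B⌋₊ := by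
  have h1 := rt_ge_one hB
  have h2 := log_ge_one hB
  have h : loB η B ≤ hiB η B := by
    have : 0 ≤ B ^ ((1 : ℝ) / 3) / Real.log B := by positivity
    unfold loB hiB; linarith
  have := Nat.ceil_mono h
  have := Nat.ceil_le_floor_add_one (hiB η B)
  omega

/-- bounded range of `B` -/
lemma small_B {β : Fin 4 → ℤ} {η : Fin 4 → ℝ} (hη : ∀ j, 0 < η j) (B0 : ℝ) :
    ∃ K : ℝ, 0 < K ∧ ∀ B : ℝ, 3 ≤ B → B ≤ B0 → |RB β η B - (JB β η B : ℝ) * singSeries| ≤ K := by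
  set c := 1 + ∑ j, η j with hc
  have hcj : ∀ j, η j + 1 ≤ c := by
    intro j
    have := Finset.single_le_sum (f := η) (fun i _ => (hη i).le) (Finset.mem_univ j)
    linarith
  have hc1 : 1 ≤ c := by linarith [hcj 0, hη 0]
  set N := ⌈c * B0 ^ ((1 : ℝ) / 3)⌉₊ with hN
  refine ⟨(N + 1) ^ 4 * N ^ 4 + (2 * N + 1) ^ 4 * |singSeries| + 1, by positivity, fun B hB hB0 => ?_⟩
  have h1 := rt_ge_one hB
  have hmono : B ^ ((1 : ℝ) / 3) ≤ B0 ^ ((1 : ℝ) / 3) := Real.rpow_le_rpow (by linarith) hB0 (by norm_num)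
  have hN' : c * B0 ^ ((1 : ℝ) / 3) ≤ N := Nat.le_ceil _
  have hhi : ∀ j, hiB (η j) B ≤ N := by
    intro j
    refine (hi_le hB).trans (le_trans ?_ hN')
    exact mul_le_mul (hcj j) hmono (by positivity) (by linarith)
  have hlo : ∀ j, -(N:ℝ) ≤ loB (η j) B := by
    intro j
    refine le_trans ?_ (loB_ge (hη j) hB)
    have : B0 ^ ((1 : ℝ) / 3) ≤ c * B0 ^ ((1 : ℝ) / 3) := le_mul_of_one_le_left (by linarith) hc1
    linarith
  have hR0 : 0 ≤ RB β η B := by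
    rw [RB_eq hη hB]
    exact Finset.sum_nonneg fun n _ => Finset.prod_nonneg fun j _ => vp_nonneg _
  have hR : RB β η B ≤ (N + 1) ^ 4 * N ^ 4 := by
    rw [RB_eq hη hB]
    have hsub : (Fintype.piFinset (fun j => NI (η j) B)).filter (fun n => ∑ j, β j * (n j : ℤ) = 0) ⊆ Fintype.piFinset (fun _ : Fin 4 => Finset.range (N + 1)) := by
      intro n hn
      rw [Finset.mem_filter, Fintype.mem_piFinset] at hn
      rw [Fintype.mem_piFinset]
      intro j
      have h2 := ((mem_NI (hη j) hB _).1 (hn.1 j)).2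
      have h3 : (n j : ℝ) ≤ N := h2.trans (hhi j)
      rw [Finset.mem_range, Nat.lt_succ_iff]
      exact_mod_cast h3
    refine (Finset.sum_le_sum_of_subset_of_nonneg hsub fun n _ _ => Finset.prod_nonneg fun j _ => vp_nonneg _).trans ?_
    refine (Finset.sum_le_card_nsmul _ _ ((N:ℝ) ^ 4) fun n hn => ?_).trans ?_
    · rw [Fintype.mem_piFinset] at hn
      calc ∏ j, vp (n j) ≤ ∏ _j : Fin 4, (N:ℝ) := by
            refine Finset.prod_le_prod (fun _ _ => vp_nonneg _) fun j _ => ?_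
            have h4 : (n j : ℝ) ≤ N := by
              have := hn j
              rw [Finset.mem_range, Nat.lt_succ_iff] at this
              exact_mod_cast this
            unfold vp
            split_ifs
            · exact (Real.log_le_self (by positivity)).trans h4
            · positivity
        _ = (N:ℝ) ^ 4 := by simp
    · rw [nsmul_eq_mul, Fintype.card_piFinset]
      simp
  have hJ : (JB β η B : ℝ) ≤ (2 * N + 1) ^ 4 := by
    have : JB β η B ≤ (2 * N + 1) ^ 4 := by
      unfold JB
      calc _ ≤ Set.ncard (↑(Fintype.piFinset (fun _ : Fin 4 => Finset.Icc (-(N:ℤ)) N)) : Set (Fin 4 → ℤ)) := by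
            refine Set.ncard_le_ncard ?_ (Finset.finite_toSet _)
            rintro m ⟨hm, -⟩
            rw [Finset.mem_coe, Fintype.mem_piFinset]
            intro j
            obtain ⟨a1, a2⟩ := hm j
            have b1 : -(N:ℝ) ≤ m j := (hlo j).trans a1
            have b2 : (m j : ℝ) ≤ N := le_trans a2 (hhi j)
            rw [Finset.mem_Icc]
            exact ⟨by exact_mod_cast b1, by exact_mod_cast b2⟩
        _ = (2 * N + 1) ^ 4 := by
            rw [Set.ncard_coe_finset, Fintype.card_piFinset]
            simp only [Finset.prod_const, Finset.card_univ, Fintype.card_fin, Int.card_Icc]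
            congr 1; omega
    exact_mod_cast this
  calc _ ≤ |RB β η B| + |(JB β η B : ℝ) * singSeries| := abs_sub _ _
    _ ≤ (N + 1) ^ 4 * N ^ 4 + (2 * N + 1) ^ 4 * |singSeries| := by
        rw [abs_of_nonneg hR0, abs_mul, abs_of_nonneg (Nat.cast_nonneg (JB β η B))]
        exact add_le_add hR (mul_le_mul_of_nonneg_right hJ (abs_nonneg _))
    _ ≤ _ := by linarith

lemma large_B {β : Fin 4 → ℤ} (hβ : ∀ j, β j = 1 ∨ β j = -1) {η : Fin 4 → ℝ} (hη : ∀ j, 0 < η j) (k : ℕ) :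
    ∃ K : ℝ, 0 < K ∧ ∀ᶠ B : ℝ in atTop, |RB β η B - (JB β η B : ℝ) * singSeries| ≤ K * (B / Real.log B ^ k) := by
  obtain ⟨C, hC, h⟩ := circ2 k
  set c := 1 + ∑ j, η j with hc
  have hcj : ∀ j, η j + 1 ≤ c := by
    intro j
    have := Finset.single_le_sum (f := η) (fun i _ => (hη i).le) (Finset.mem_univ j)
    linarith
  have hc1 : 1 ≤ c := by linarith [hcj 0, hη 0]
  have hc0 : 0 < c := by linarith
  have htend : Tendsto (fun B : ℝ => ⌈c * B ^ ((1 : ℝ) / 3)⌉₊) atTop atTop :=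
    tendsto_nat_ceil_atTop.comp ((tendsto_rpow_atTop (by norm_num)).const_mul_atTop hc0)
  refine ⟨C * ((c + 1) ^ 3 * 3 ^ k), by positivity, ?_⟩
  have hlog : ∀ᶠ B : ℝ in atTop, ∀ j, 1 / η j < Real.log B := by
    rw [eventually_all]
    intro j
    exact Real.tendsto_log_atTop.eventually (eventually_gt_atTop _)
  filter_upwards [htend.eventually h, eventually_ge_atTop 3, hlog] with B hX hB hlB
  set X := ⌈c * B ^ ((1 : ℝ) / 3)⌉₊ with hXdef
  have h1 := rt_ge_one hB
  have h2 := log_ge_one hB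
  have hlo : ∀ j, 0 < loB (η j) B := by
    intro j
    have a := hlB j
    rw [div_lt_iff₀ (hη j)] at a
    have : loB (η j) B = B ^ ((1 : ℝ) / 3) * (Real.log B * η j - 1) / Real.log B := by
      unfold loB; field_simp
    rw [this]
    have : 0 < Real.log B * η j - 1 := by linarith
    positivity
  have hcX : c * B ^ ((1 : ℝ) / 3) ≤ X := Nat.le_ceil _
  have hXle : (X:ℝ) ≤ (c + 1) * B ^ ((1 : ℝ) / 3) := by
    have := (Nat.ceil_lt_add_one (a := c * B ^ ((1 : ℝ) / 3)) (by positivity)).le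
    linarith
  have hvX : ∀ j, ⌊hiB (η j) B⌋₊ ≤ X := by
    intro j
    have b1 : (⌊hiB (η j) B⌋₊ : ℝ) ≤ X := by
      refine (Nat.floor_le (hi_nonneg (hη j) hB)).trans ((hi_le hB).trans (le_trans ?_ hcX))
      exact mul_le_mul_of_nonneg_right (hcj j) (by linarith)
    exact_mod_cast b1
  have key := hX (fun j => ⌈loB (η j) B⌉₊ - 1) (fun j => ⌊hiB (η j) B⌋₊) (fun j => NI_le (hη j) hB) hvX β hβ
  simp only [← NI_Ioc (hlo _)] at key
  rw [← RB_T4 hη hB, ← JB_eq hη hB hlo] at key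
  have e : (RB β η B : ℂ) - (JB β η B : ℂ) * ((∏' p : Nat.Primes, (1 + 1 / (((p : ℕ) : ℝ) - 1) ^ 3) : ℝ) : ℂ) =
      ((RB β η B - (JB β η B : ℝ) * singSeries : ℝ) : ℂ) := by
    rw [singSeries]; push_cast; rfl
  rw [e, Complex.norm_real, Real.norm_eq_abs] at key
  refine key.trans ?_
  have hB3 : (B ^ ((1 : ℝ) / 3)) ^ 3 = B := by
    rw [← Real.rpow_natCast, ← Real.rpow_mul (by linarith)]; norm_num
  have hX3 : (X:ℝ) ^ 3 ≤ (c + 1) ^ 3 * B := by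
    calc (X:ℝ) ^ 3 ≤ ((c + 1) * B ^ ((1 : ℝ) / 3)) ^ 3 := pow_le_pow_left₀ (by positivity) hXle 3
      _ = _ := by rw [mul_pow, hB3]
  have hL : Real.log B / 3 ≤ Real.log X := by
    have : Real.log (B ^ ((1 : ℝ) / 3)) = Real.log B / 3 := by rw [Real.log_rpow (by linarith)]; ring
    rw [← this]
    refine Real.log_le_log (by linarith) (le_trans ?_ hcX)
    exact le_mul_of_one_le_left (by linarith) hc1
  rw [mul_assoc]
  refine mul_le_mul_of_nonneg_left ?_ hC.le
  have hl3 : 0 < Real.log B / 3 := by linarith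
  calc (X:ℝ) ^ 3 / Real.log X ^ k ≤ ((c + 1) ^ 3 * B) / (Real.log B / 3) ^ k := by
        gcongr
    _ = _ := by rw [div_pow]; field_simp

end CM

end

/-- Lemma 2: the circle-method asymptotic `R(B) = J(B)𝔖 + O_A(B (log B)^{-A})`. -/
theorem circle_method_asymptotic
    (β : Fin 4 → ℤ) (hβ : ∀ j, β j = 1 ∨ β j = -1)
    (η : Fin 4 → ℝ) (hη : ∀ j, 0 < η j)
    (hrel : (β 0 : ℝ) * η 0 + (β 1 : ℝ) * η 1 + (β 2 : ℝ) * η 2 + (β 3 : ℝ) * η 3 = 0) :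
    ∀ A : ℝ, 0 < A → ∃ C : ℝ, 0 < C ∧ ∀ B : ℝ, 3 ≤ B →
      |RB β η B - (JB β η B : ℝ) * singSeries| ≤ C * B * Real.log B ^ (-A) := by
  intro A hA
  obtain ⟨K1, hK1, h1⟩ := CM.large_B hβ hη ⌈A⌉₊
  obtain ⟨B0, hB0⟩ := Filter.eventually_atTop.1 h1
  obtain ⟨K2, hK2, h2⟩ := CM.small_B (β := β) hη (max B0 3)
  have hl0 := CM.log_ge_one (le_max_right B0 3)
  have hl0' : 0 < Real.log (max B0 3) := by linarith
  refine ⟨K1 + K2 * Real.log (max B0 3) ^ A, by positivity, fun B hB => ?_⟩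
  have hl := CM.log_ge_one hB
  have hl' : 0 < Real.log B := by linarith
  have hB' : 0 < B := by linarith
  have hp : 0 < Real.log B ^ (-A) := Real.rpow_pos_of_pos hl' _
  rcases le_total B (max B0 3) with hc | hc
  · refine (h2 B hB hc).trans ?_
    have a1 : Real.log B ^ A ≤ Real.log (max B0 3) ^ A := Real.rpow_le_rpow hl'.le (Real.log_le_log hB' hc) hA.le
    have a2 : 1 ≤ Real.log (max B0 3) ^ A * Real.log B ^ (-A) := by
      rw [Real.rpow_neg hl'.le, ← div_eq_mul_inv, one_le_div (Real.rpow_pos_of_pos hl' _)]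
      exact a1
    calc K2 ≤ K2 * (Real.log (max B0 3) ^ A * Real.log B ^ (-A)) := le_mul_of_one_le_right hK2.le a2
      _ ≤ K2 * (Real.log (max B0 3) ^ A * Real.log B ^ (-A)) * B := le_mul_of_one_le_right (by positivity) (by linarith)
      _ ≤ K1 * B * Real.log B ^ (-A) + K2 * (Real.log (max B0 3) ^ A * Real.log B ^ (-A)) * B := le_add_of_nonneg_left (by positivity)
      _ = _ := by ring
  · refine (hB0 B ((le_max_left _ _).trans hc)).trans ?_
    have a1 : B / Real.log B ^ ⌈A⌉₊ ≤ B * Real.log B ^ (-A) := by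
      rw [Real.rpow_neg hl'.le, ← div_eq_mul_inv, ← Real.rpow_natCast]
      have a3 : Real.log B ^ A ≤ Real.log B ^ ((⌈A⌉₊ : ℕ) : ℝ) := Real.rpow_le_rpow_of_exponent_le hl (Nat.le_ceil _)
      have a4 : 0 < Real.log B ^ A := Real.rpow_pos_of_pos hl' _
      exact div_le_div_of_nonneg_left hB'.le a4 a3
    calc K1 * (B / Real.log B ^ ⌈A⌉₊) ≤ K1 * (B * Real.log B ^ (-A)) := mul_le_mul_of_nonneg_left a1 hK1.le
      _ ≤ K1 * (B * Real.log B ^ (-A)) + K2 * Real.log (max B0 3) ^ A * (B * Real.log B ^ (-A)) := le_add_of_nonneg_right (by positivity)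
      _ = _ := by ring
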